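/- Fix R>1, ε>0 and an integer p ≥ 1. There exists a density one subsequence S'⊆S and a constant C=C(p,R)>0 such that for every λ∈S', every flat, L²-normalized toral eigenfunction f with eigenvalue λ, and every ball B⊂𝕋² of radius r > λ^{−1/2+ε}: (1/vol(B)) ∫_B L(F_x)^p dx ≤ C, where F_x(y) = f(x + Ry/√λ) for y∈[−1/2,1/2]² and L(F_x) = H¹({y∈[−1/2,1/2]²: F_x(y)=0}). -/

import Mathlib

open MeasureTheory Filter Topology Complex
open scoped ENNReal NNReal RealInnerProductSpace

noncomputable section

/-- The Euclidean plane `ℝ²`; the torus `𝕋² = ℝ²/ℤ²` is modeled by `ℤ²`-periodic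
functions on `E2` (toral eigenfunctions are automatically periodic), the fundamental
domain `Tdom`, and Euclidean balls of radius at most `1/2`. -/
abbrev E2 := EuclideanSpace ℝ (Fin 2)

/-- The point `(a, b) ∈ ℝ²`. -/
def pt (a b : ℝ) : E2 := (WithLp.equiv 2 (Fin 2 → ℝ)).symm ![a, b]

/-- `S`: the set of positive integers expressible as a sum of two squares. -/
def sumTwoSq : Set ℕ := {n | 0 < n ∧ ∃ a b : ℤ, (n : ℤ) = a ^ 2 + b ^ 2}

/-- `S' ⊆ S` is a density one subsequence of `S`. -/
def DensityOne (S' : Set ℕ) : Prop :=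
  S' ⊆ sumTwoSq ∧
    Tendsto
      (fun X : ℕ =>
        (Nat.card {n : ℕ | n ∈ S' ∧ n ≤ X} : ℝ) /
          (Nat.card {n : ℕ | n ∈ sumTwoSq ∧ n ≤ X} : ℝ))
      atTop (𝓝 1)

/-- The lattice points `ξ ∈ ℤ²` with `|ξ|² = lam`. -/
def latticePts (lam : ℕ) : Finset (ℤ × ℤ) :=
  ((Finset.Icc (-(lam : ℤ)) lam) ×ˢ (Finset.Icc (-(lam : ℤ)) lam)).filter
    fun ξ => ξ.1 ^ 2 + ξ.2 ^ 2 = (lam : ℤ)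

/-- `f` is a real-valued `L²`-normalized toral eigenfunction with eigenvalue `lam` and
Fourier coefficients `a`: `f(x) = Σ_{|ξ|²=lam} a_ξ e(⟨ξ,x⟩)`, `a_{-ξ} = conj a_ξ`,
`Σ |a_ξ|² = 1`. -/
def IsEigenfunction (lam : ℕ) (a : ℤ × ℤ → ℂ) (f : E2 → ℝ) : Prop :=
  (∀ ξ : ℤ × ℤ, ξ ∉ latticePts lam → a ξ = 0) ∧
    (∀ ξ : ℤ × ℤ, a (-ξ) = starRingEnd ℂ (a ξ)) ∧
    (∑ ξ ∈ latticePts lam, ‖a ξ‖ ^ 2 = 1) ∧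
    ∀ x : E2, (f x : ℂ) =
      ∑ ξ ∈ latticePts lam,
        a ξ * Complex.exp (2 * (Real.pi : ℂ) * Complex.I *
          ((((ξ.1 : ℝ) * x 0 + (ξ.2 : ℝ) * x 1 : ℝ)) : ℂ))

/-- Flatness: `|a_ξ|² ≤ 100 N^{-1+ε}` for every `ε > 0`. -/
def IsFlat (lam : ℕ) (a : ℤ × ℤ → ℂ) : Prop :=
  ∀ ε : ℝ, 0 < ε → ∀ ξ ∈ latticePts lam,
    ‖a ξ‖ ^ 2 ≤ 100 * ((latticePts lam).card : ℝ) ^ (-1 + ε : ℝ)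

/-- A fundamental domain `[0,1]²` for the torus `𝕋²`. -/
def Tdom : Set E2 := {x | x 0 ∈ Set.Icc (0 : ℝ) 1 ∧ x 1 ∈ Set.Icc (0 : ℝ) 1}

/-- The square `[-1/2,1/2]²`. -/
def Qdom : Set E2 := {y | y 0 ∈ Set.Icc (-(1/2) : ℝ) (1/2) ∧ y 1 ∈ Set.Icc (-(1/2) : ℝ) (1/2)}

/-- `L(f, B)`: the `1`-dimensional Hausdorff measure of the nodal set of `f` in `B`. -/
def nodalLen (f : E2 → ℝ) (B : Set E2) : ℝ := (μH[1] ({x : E2 | f x = 0} ∩ B)).toReal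

/-- `L(F_x)` where `F_x(y) = f(x + R y / √lam)` for `y ∈ [-1/2,1/2]²`, as an
extended nonnegative real. -/
def LF (lam : ℕ) (R : ℝ) (f : E2 → ℝ) (x : E2) : ℝ≥0∞ :=
  μH[1] {y : E2 | y ∈ Qdom ∧ f (x + (R / Real.sqrt lam) • y) = 0}

/-- The pseudo-spectral measure `µ_f = Σ_ξ |a_ξ|² δ_{ξ/√lam}` on `S¹ ⊂ ℝ²`. -/
def specMeasure (lam : ℕ) (a : ℤ × ℤ → ℂ) : Measure E2 :=
  ∑ ξ ∈ latticePts lam,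
    (ENNReal.ofReal (‖a ξ‖ ^ 2)) •
      Measure.dirac (pt ((ξ.1 : ℝ) / Real.sqrt lam) ((ξ.2 : ℝ) / Real.sqrt lam))

/-- Weak-star convergence of the pseudo-spectral measures of the sequence `a` to `mu`,
along `λ → ∞`, `λ ∈ S'`. -/
def SpecTendsto (S' : Set ℕ) (a : ℕ → ℤ × ℤ → ℂ) (mu : Measure E2) : Prop :=
  ∀ g : BoundedContinuousFunction E2 ℝ,
    Tendsto (fun lam => ∫ z, g z ∂(specMeasure lam (a lam))) (atTop ⊓ 𝓟 S')
      (𝓝 (∫ z, g z ∂mu))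

/-- The support of `mu` is not contained in a line. -/
def NotOnLine (mu : Measure E2) : Prop :=
  ∀ A B c : ℝ, ¬(A = 0 ∧ B = 0) → mu {x : E2 | A * x 0 + B * x 1 = c} < 1

/-- `µ̂(2) = ∫_{S¹} z² dµ(z)`, identifying `S¹ ⊂ ℂ`. -/
def muhat2 (mu : Measure E2) : ℂ := ∫ x, ((x 0 : ℂ) + (x 1 : ℂ) * Complex.I) ^ 2 ∂mu

/-- The constant `c₁ = (1-µ̂(2)²)/(2^{5/2}π) ∫₀^{2π} (1-µ̂(2)cos 2θ)^{-3/2} dθ`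
(for `µ̂(2)` real). -/
def c1const (mu : Measure E2) : ℝ :=
  ((1 - (muhat2 mu).re ^ 2) / (2 ^ ((5:ℝ)/2) * Real.pi)) *
    ∫ θ in (0:ℝ)..(2 * Real.pi), ((1 - (muhat2 mu).re * Real.cos (2 * θ)) ^ (-(3/2) : ℝ))

open Finset in
theorem sum_Ioc_sum_divisors (F : ℕ → ℕ → ℝ) (N : ℕ) :
    ∑ n ∈ Ioc 0 N, ∑ d ∈ n.divisors, F d (n / d) =
      ∑ d ∈ Ioc 0 N, ∑ m ∈ Ioc 0 (N / d), F d m := by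
  rw [Finset.sum_sigma', Finset.sum_sigma']
  refine Finset.sum_bij' (fun x _ => ⟨x.2, x.1 / x.2⟩) (fun x _ => ⟨x.1 * x.2, x.1⟩) ?_ ?_ ?_ ?_ ?_
  · rintro ⟨n, d⟩ h
    simp only [mem_sigma, mem_Ioc, Nat.mem_divisors] at h ⊢
    obtain ⟨⟨h0, h1⟩, h2, h3⟩ := h
    have hd : 0 < d := Nat.pos_of_dvd_of_pos h2 h0
    exact ⟨⟨hd, (Nat.le_of_dvd h0 h2).trans h1⟩, Nat.div_pos (Nat.le_of_dvd h0 h2) hd,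
      Nat.div_le_div_right h1⟩
  · rintro ⟨d, m⟩ h
    simp only [mem_sigma, mem_Ioc, Nat.mem_divisors] at h ⊢
    obtain ⟨⟨h0, h1⟩, h2, h3⟩ := h
    refine ⟨⟨Nat.mul_pos h0 h2, ?_⟩, Dvd.intro _ rfl, (Nat.mul_pos h0 h2).ne'⟩
    rw [mul_comm]; exact (Nat.le_div_iff_mul_le h0).1 h3
  · rintro ⟨n, d⟩ h
    simp only [mem_sigma, mem_Ioc, Nat.mem_divisors] at h ⊢
    rw [Nat.mul_div_cancel' h.2.1]
  · rintro ⟨d, m⟩ h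
    simp only [mem_sigma, mem_Ioc] at h ⊢
    rw [Nat.mul_div_cancel_left _ h.1.1]
  · rintro ⟨n, d⟩ h
    rfl

open ArithmeticFunction in
theorem sum_vonMangoldt_le (N : ℕ) : ∑ d ∈ Finset.Ioc 0 N, vonMangoldt d ≤ 6 * N := by
  have h := Chebyshev.psi_le_const_mul_self (x := N) (Nat.cast_nonneg N)
  rw [Chebyshev.psi, Nat.floor_natCast] at h
  refine h.trans ?_
  gcongr
  have : Real.log 4 = 2 * Real.log 2 := by
    rw [show (4 : ℝ) = 2 ^ 2 by norm_num, Real.log_pow]; norm_num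
  have := Real.log_two_lt_d9
  linarith

theorem sum_log_le (N : ℕ) : ∑ n ∈ Finset.Ioc 0 N, Real.log n ≤ N * Real.log N := by
  have : ∀ n ∈ Finset.Ioc 0 N, Real.log n ≤ Real.log N := by
    intro n hn
    simp only [Finset.mem_Ioc] at hn
    exact Real.log_le_log (by exact_mod_cast hn.1) (by exact_mod_cast hn.2)
  refine (Finset.sum_le_sum this).trans ?_
  simp

theorem le_sum_log (N : ℕ) : N * Real.log N - N ≤ ∑ n ∈ Finset.Ioc 0 N, Real.log n := by
  induction N with
  | zero => simp
  | succ N ih =>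
    rw [Finset.sum_Ioc_succ_top (by omega)]
    rcases Nat.eq_zero_or_pos N with rfl | hN
    · simp
    have hN' : (0 : ℝ) < N := by exact_mod_cast hN
    have h1 : Real.log (N + 1) - Real.log N ≤ 1 / N := by
      rw [← Real.log_div (by positivity) (by positivity)]
      refine (Real.log_le_sub_one_of_pos (by positivity)).trans (le_of_eq ?_)
      field_simp; ring
    have h2 : N * (Real.log (N + 1) - Real.log N) ≤ 1 := by
      have := mul_le_mul_of_nonneg_left h1 hN'.le
      rwa [mul_one_div_cancel hN'.ne'] at this
    push_cast
    linarith

open ArithmeticFunction in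
theorem abs_sum_vonMangoldt_div_sub_log_le (N : ℕ) (hN : 1 ≤ N) :
    |∑ d ∈ Finset.Ioc 0 N, vonMangoldt d / d - Real.log N| ≤ 6 := by
  have hN0 : (0 : ℝ) < N := by exact_mod_cast hN
  have key : ∑ n ∈ Finset.Ioc 0 N, Real.log n =
      ∑ d ∈ Finset.Ioc 0 N, vonMangoldt d * ((N / d : ℕ) : ℝ) := by
    have := sum_Ioc_sum_divisors (fun d _ => vonMangoldt d) N
    simp only [vonMangoldt_sum] at this
    rw [this]
    refine Finset.sum_congr rfl fun d _ => ?_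
    simp [mul_comm]
  have e : (N : ℝ) * ∑ d ∈ Finset.Ioc 0 N, vonMangoldt d / d =
      ∑ d ∈ Finset.Ioc 0 N, vonMangoldt d * ((N : ℝ) / d) := by
    rw [Finset.mul_sum]; refine Finset.sum_congr rfl fun d _ => by ring
  have u : ∑ n ∈ Finset.Ioc 0 N, Real.log n ≤
      (N : ℝ) * ∑ d ∈ Finset.Ioc 0 N, vonMangoldt d / d := by
    rw [key, e]
    refine Finset.sum_le_sum fun d _ => mul_le_mul_of_nonneg_left Nat.cast_div_le
      vonMangoldt_nonneg
  have l : (N : ℝ) * ∑ d ∈ Finset.Ioc 0 N, vonMangoldt d / d ≤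
      ∑ n ∈ Finset.Ioc 0 N, Real.log n + 6 * N := by
    rw [key, e]
    refine le_trans ?_ (add_le_add_right (sum_vonMangoldt_le N) _)
    rw [← Finset.sum_add_distrib]
    refine Finset.sum_le_sum fun d hd => ?_
    have : (N : ℝ) / d ≤ (N / d : ℕ) + 1 := by
      have := Nat.lt_floor_add_one ((N : ℝ) / d)
      rw [Nat.floor_div_natCast, Nat.floor_natCast] at this
      exact this.le
    calc vonMangoldt d * ((N : ℝ) / d) ≤ vonMangoldt d * ((N / d : ℕ) + 1) :=
          mul_le_mul_of_nonneg_left this vonMangoldt_nonneg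
      _ = _ := by ring
  have h1 := sum_log_le N
  have h2 := le_sum_log N
  rw [abs_le]
  constructor
  · have : (N : ℝ) * (-6) ≤ N * (∑ d ∈ Finset.Ioc 0 N, vonMangoldt d / d - Real.log N) := by
      linarith
    exact le_of_mul_le_mul_left this hN0
  · have : (N : ℝ) * (∑ d ∈ Finset.Ioc 0 N, vonMangoldt d / d - Real.log N) ≤ N * 6 := by
      linarith
    exact le_of_mul_le_mul_left this hN0

/-- The nontrivial character modulo four, as a real-valued function on the naturals. -/
def chiFour (n : ℕ) : ℝ := ((ZMod.χ₄ (n : ZMod 4) : ℤ) : ℝ)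

theorem chiFour_mul (m n : ℕ) : chiFour (m * n) = chiFour m * chiFour n := by
  rw [chiFour, chiFour, chiFour, Nat.cast_mul, map_mul, Int.cast_mul]

theorem chiFour_eq (n : ℕ) :
    chiFour n = if n % 4 = 1 then 1 else if n % 4 = 3 then -1 else 0 := by
  rw [chiFour, ZMod.χ₄_nat_eq_if_mod_four]
  split_ifs <;> first | omega | simp

theorem abs_chiFour_le (n : ℕ) : |chiFour n| ≤ 1 := by
  rw [chiFour_eq]; split_ifs <;> simp

theorem sum_chiFour_mul (g : ℕ → ℝ) (N : ℕ) :
    ∑ n ∈ Finset.Ioc 0 N, chiFour n * g n =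
      ∑ i ∈ Finset.range ((N + 1) / 2), (-1 : ℝ) ^ i * g (2 * i + 1) := by
  induction N with
  | zero => simp
  | succ N ih =>
    rw [Finset.sum_Ioc_succ_top (by omega), ih, chiFour_eq]
    obtain ⟨k, hk⟩ : ∃ k, N + 1 = 4 * k ∨ N + 1 = 4 * k + 1 ∨ N + 1 = 4 * k + 2 ∨ N + 1 = 4 * k + 3 :=
      ⟨(N + 1) / 4, by omega⟩
    rcases hk with hk | hk | hk | hk
    · rw [hk, if_neg (by omega), if_neg (by omega), show (4 * k + 1) / 2 = 2 * k by omega,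
        show (4 * k) / 2 = 2 * k by omega]; simp
    · rw [hk, if_pos (by omega), show (4 * k + 1 + 1) / 2 = 2 * k + 1 by omega,
        show (4 * k + 1) / 2 = 2 * k by omega, Finset.sum_range_succ]
      simp [show 2 * (2 * k) + 1 = 4 * k + 1 by ring]
    · rw [hk, if_neg (by omega), if_neg (by omega), show (4 * k + 2 + 1) / 2 = 2 * k + 1 by omega,
        show (4 * k + 2) / 2 = 2 * k + 1 by omega]; simp
    · rw [hk, if_neg (by omega), if_pos (by omega),
        show (4 * k + 3 + 1) / 2 = 2 * k + 1 + 1 by omega,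
        show (4 * k + 3) / 2 = 2 * k + 1 by omega, Finset.sum_range_succ _ (2 * k + 1)]
      simp [show 2 * (2 * k + 1) + 1 = 4 * k + 3 by ring, pow_succ]

theorem abs_alternating_sum_le (f : ℕ → ℝ) (hf : Antitone f) (h0 : ∀ n, 0 ≤ f n) (k : ℕ) :
    |∑ i ∈ Finset.range k, (-1 : ℝ) ^ i * f i| ≤ f 0 := by
  induction k generalizing f with
  | zero => simpa using h0 0
  | succ k ih =>
    have := ih (fun n => f (n + 1)) (fun a b h => hf (by omega)) (fun n => h0 _)
    rw [Finset.sum_range_succ']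
    have e : ∑ i ∈ Finset.range k, (-1 : ℝ) ^ (i + 1) * f (i + 1) =
        -∑ i ∈ Finset.range k, (-1 : ℝ) ^ i * f (i + 1) := by
      rw [← Finset.sum_neg_distrib]; refine Finset.sum_congr rfl fun i _ => by ring
    rw [e]
    simp only [pow_zero, one_mul]
    have h1 : f 1 ≤ f 0 := hf (by omega)
    -- the alternating partial sums of the tail are nonnegative
    have hpos : ∀ (k : ℕ) (g : ℕ → ℝ), Antitone g → (∀ n, 0 ≤ g n) →
        0 ≤ ∑ i ∈ Finset.range k, (-1 : ℝ) ^ i * g i := by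
      intro k
      induction k using Nat.twoStepInduction with
      | zero => simp
      | one => intro g _ h; simpa using h 0
      | more k ih1 _ =>
        intro g hg h
        rw [Finset.sum_range_succ', Finset.sum_range_succ']
        have := ih1 (fun n => g (n + 2)) (fun a b h => hg (by omega)) (fun n => h _)
        have h3 : g 1 ≤ g 0 := hg (by omega)
        have e2 : ∑ i ∈ Finset.range k, (-1 : ℝ) ^ (i + 1 + 1) * g (i + 1 + 1) =
            ∑ i ∈ Finset.range k, (-1 : ℝ) ^ i * g (i + 2) := by
          refine Finset.sum_congr rfl fun i _ => by ring
        rw [e2]; simp; linarith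
    have hp := hpos k (fun n => f (n + 1)) (fun a b h => hf (by omega)) (fun n => h0 _)
    rw [abs_le] at this ⊢
    simp only [zero_add] at this
    constructor <;> linarith [h0 0]

theorem abs_sum_chiFour_div_sub_le (N : ℕ) :
    |∑ m ∈ Finset.Ioc 0 N, chiFour m / m - Real.pi / 4| ≤ 1 / (N + 1) := by
  have e := sum_chiFour_mul (fun n => 1 / (n : ℝ)) N
  simp only [mul_one_div] at e
  rw [e]
  have ht := Real.tendsto_sum_pi_div_four
  set k := (N + 1) / 2 with hk
  have hf : Antitone (fun i : ℕ => 1 / (2 * ((i + k : ℕ) : ℝ) + 1)) := by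
    intro a b h
    apply one_div_le_one_div_of_le (by positivity)
    have : (a : ℝ) ≤ b := by exact_mod_cast h
    push_cast; linarith
  have htl : Tendsto (fun n => ∑ i ∈ Finset.range (n + k), (-1 : ℝ) ^ i / (2 * i + 1))
      atTop (𝓝 (Real.pi / 4)) := ht.comp (tendsto_add_atTop_nat k)
  have hb : ∀ n, |∑ i ∈ Finset.range (n + k), (-1 : ℝ) ^ i / (2 * i + 1) -
      ∑ i ∈ Finset.range k, (-1 : ℝ) ^ i / (2 * i + 1)| ≤ 1 / (N + 1) := by
    intro n
    rw [add_comm n k, Finset.sum_range_add, add_sub_cancel_left]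
    have := abs_alternating_sum_le _ hf (fun _ => by positivity) n
    have e3 : ∑ i ∈ Finset.range n, (-1 : ℝ) ^ (k + i) / (2 * ((k + i : ℕ) : ℝ) + 1) =
        (-1) ^ k * ∑ i ∈ Finset.range n, (-1 : ℝ) ^ i * (1 / (2 * ((i + k : ℕ) : ℝ) + 1)) := by
      rw [Finset.mul_sum]; refine Finset.sum_congr rfl fun i _ => ?_
      rw [pow_add, add_comm k i]; ring
    rw [e3, abs_mul, abs_pow, abs_neg, abs_one, one_pow, one_mul]
    refine this.trans ?_
    apply one_div_le_one_div_of_le (by positivity)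
    have : N ≤ 2 * k := by omega
    have : (N : ℝ) ≤ 2 * k := by exact_mod_cast this
    simp; linarith
  have := le_of_tendsto' ((htl.sub_const _).abs) hb
  rw [abs_sub_comm]
  simpa using this

theorem abs_sum_chiFour_log_div_le (N : ℕ) :
    |∑ n ∈ Finset.Ioc 0 N, chiFour n * (Real.log n / n)| ≤ 1 := by
  rw [sum_chiFour_mul (fun n => Real.log n / (n : ℝ))]
  rcases Nat.eq_zero_or_pos ((N + 1) / 2) with h | h
  · simp [h]
  obtain ⟨k, hk⟩ : ∃ k, (N + 1) / 2 = k + 1 := ⟨(N + 1) / 2 - 1, by omega⟩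
  rw [hk, Finset.sum_range_succ']
  have e : ∑ i ∈ Finset.range k, (-1 : ℝ) ^ (i + 1) *
      (Real.log ((2 * (i + 1) + 1 : ℕ) : ℝ) / ((2 * (i + 1) + 1 : ℕ) : ℝ)) =
        -∑ i ∈ Finset.range k, (-1 : ℝ) ^ i *
      (Real.log ((2 * (i + 1) + 1 : ℕ) : ℝ) / ((2 * (i + 1) + 1 : ℕ) : ℝ)) := by
    rw [← Finset.sum_neg_distrib]; refine Finset.sum_congr rfl fun i _ => by ring
  rw [e]
  have ha : Antitone (fun i : ℕ =>
      Real.log ((2 * (i + 1) + 1 : ℕ) : ℝ) / ((2 * (i + 1) + 1 : ℕ) : ℝ)) := by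
    intro a b hab
    have h3 : ∀ c : ℕ, Real.exp 1 ≤ ((2 * (c + 1) + 1 : ℕ) : ℝ) := by
      intro c
      have := Real.exp_one_lt_d9
      have : (0 : ℝ) ≤ c := Nat.cast_nonneg c
      push_cast; linarith
    exact Real.log_div_self_antitoneOn (h3 a) (h3 b) (by norm_cast; omega)
  have := abs_alternating_sum_le _ ha (fun n => div_nonneg (Real.log_natCast_nonneg _)
    (Nat.cast_nonneg _)) k
  simp only [mul_zero, zero_add, Nat.cast_one, Real.log_one, zero_div, add_zero, abs_neg]
  refine this.trans ?_
  have h4 := Real.log_le_sub_one_of_pos (x := 3) (by norm_num)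
  norm_num
  linarith

open ArithmeticFunction in
theorem abs_sum_chiFour_vonMangoldt_div_le (N : ℕ) :
    |∑ d ∈ Finset.Ioc 0 N, chiFour d * (vonMangoldt d / d)| ≤ 10 := by
  rcases Nat.eq_zero_or_pos N with rfl | hN
  · simp
  have hN0 : (0 : ℝ) < N := by exact_mod_cast hN
  have key : ∑ n ∈ Finset.Ioc 0 N, chiFour n * (Real.log n / n) =
      ∑ d ∈ Finset.Ioc 0 N, chiFour d * (vonMangoldt d / d) *
        ∑ m ∈ Finset.Ioc 0 (N / d), chiFour m / m := by
    have := sum_Ioc_sum_divisors (fun d m => chiFour d * (vonMangoldt d / d) * (chiFour m / m)) N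
    simp only [← Finset.mul_sum] at this
    rw [← this]
    refine Finset.sum_congr rfl fun n hn => ?_
    rw [← vonMangoldt_sum, Finset.sum_div, Finset.mul_sum]
    refine Finset.sum_congr rfl fun d hd => ?_
    have hd := Nat.dvd_of_mem_divisors hd
    obtain ⟨m, rfl⟩ := hd
    simp only [Finset.mem_Ioc] at hn
    have h0 : d ≠ 0 := by rintro rfl; simp at hn
    have h1 : m ≠ 0 := by rintro rfl; simp at hn
    rw [Nat.mul_div_cancel_left _ (Nat.pos_of_ne_zero h0), chiFour_mul]
    push_cast
    have : (d : ℝ) ≠ 0 := by exact_mod_cast h0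
    have : (m : ℝ) ≠ 0 := by exact_mod_cast h1
    field_simp
  have h1 := abs_sum_chiFour_log_div_le N
  rw [key] at h1
  set A := ∑ d ∈ Finset.Ioc 0 N, chiFour d * (vonMangoldt d / d) with hA
  have h2 : |∑ d ∈ Finset.Ioc 0 N, chiFour d * (vonMangoldt d / d) *
        ∑ m ∈ Finset.Ioc 0 (N / d), chiFour m / m - A * (Real.pi / 4)| ≤ 6 := by
    rw [hA, Finset.sum_mul, ← Finset.sum_sub_distrib]
    refine (Finset.abs_sum_le_sum_abs _ _).trans ?_
    have : ∀ d ∈ Finset.Ioc 0 N, |chiFour d * (vonMangoldt d / d) *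
        ∑ m ∈ Finset.Ioc 0 (N / d), chiFour m / m - chiFour d * (vonMangoldt d / d) *
          (Real.pi / 4)| ≤ vonMangoldt d * (1 / N) := by
      intro d hd
      simp only [Finset.mem_Ioc] at hd
      have hd0 : (0 : ℝ) < d := by exact_mod_cast hd.1
      rw [← mul_sub, abs_mul, abs_mul, abs_of_nonneg (div_nonneg vonMangoldt_nonneg hd0.le)]
      have h3 := abs_sum_chiFour_div_sub_le (N / d)
      have h4 : 1 / (((N / d : ℕ) : ℝ) + 1) ≤ d / N := by
        have : (N : ℝ) / d ≤ (N / d : ℕ) + 1 := by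
          have := Nat.lt_floor_add_one ((N : ℝ) / d)
          rw [Nat.floor_div_natCast, Nat.floor_natCast] at this
          exact this.le
        rw [← one_div_div (N : ℝ) d]
        exact one_div_le_one_div_of_le (by positivity) this
      calc _ ≤ 1 * (vonMangoldt d / d) * (d / N) := by
            have := div_nonneg (vonMangoldt_nonneg (n := d)) hd0.le
            gcongr
            · exact abs_chiFour_le d
            · exact h3.trans h4
        _ = _ := by field_simp
    refine (Finset.sum_le_sum this).trans ?_
    rw [← Finset.sum_mul, mul_one_div, div_le_iff₀ hN0]
    exact sum_vonMangoldt_le N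
  have h5 : |A * (Real.pi / 4)| ≤ 7 := by
    rw [abs_le] at h1 h2 ⊢
    constructor <;> linarith
  rw [abs_mul, abs_of_pos (by positivity : 0 < Real.pi / 4)] at h5
  have := Real.pi_gt_three
  nlinarith [abs_nonneg A]

open ArithmeticFunction in
theorem exists_sum_nonprime_vonMangoldt_div_le :
    ∃ C : ℝ, 0 ≤ C ∧ ∀ N : ℕ,
      ∑ d ∈ (Finset.Ioc 0 N).filter (fun d => ¬ d.Prime), vonMangoldt d / d ≤ C := by
  have hs : Summable (fun n : ℕ => 4 * (n : ℝ) ^ (-(3 / 2) : ℝ)) :=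
    (Real.summable_nat_rpow.2 (by norm_num)).mul_left 4
  refine ⟨∑' n : ℕ, 4 * (n : ℝ) ^ (-(3 / 2) : ℝ), tsum_nonneg fun n => by positivity, fun N => ?_⟩
  have hsub : ∑ d ∈ (Finset.Ioc 0 N).filter (fun d => ¬ d.Prime), vonMangoldt d / d ≤
      ∑ x ∈ Finset.Icc 2 N ×ˢ Finset.Icc 2 N, Real.log x.1 / ((x.1 : ℝ) ^ x.2) := by
    have h1 : ∑ d ∈ (Finset.Ioc 0 N).filter (fun d => ¬ d.Prime), vonMangoldt d / d =
        ∑ d ∈ (Finset.Ioc 0 N).filter (fun d => ¬ d.Prime ∧ IsPrimePow d), vonMangoldt d / d := by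
      rw [← Finset.filter_filter]
      symm
      apply Finset.sum_filter_of_ne
      intro d _ hd
      by_contra h
      exact hd (by rw [vonMangoldt_eq_zero_iff.2 h, zero_div])
    rw [h1]
    have key : ∀ d ∈ (Finset.Ioc 0 N).filter (fun d => ¬ d.Prime ∧ IsPrimePow d),
        ∃ x ∈ Finset.Icc 2 N ×ˢ Finset.Icc 2 N, x.1 ^ x.2 = d ∧
          vonMangoldt d / d = Real.log x.1 / ((x.1 : ℝ) ^ x.2) := by
      intro d hd
      simp only [Finset.mem_filter, Finset.mem_Ioc] at hd
      obtain ⟨⟨h0, hN⟩, hnp, hpp⟩ := hd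
      obtain ⟨p, k, hp, hk, rfl⟩ := (isPrimePow_nat_iff _).1 hpp
      have hk2 : 2 ≤ k := by
        by_contra h
        have : k = 1 := by omega
        subst this
        exact hnp (by simpa using hp)
      have hkN : k ≤ N := (Nat.lt_pow_self hp.one_lt).le.trans hN
      have hpN : p ≤ N := (Nat.le_self_pow (by omega) p).trans hN
      refine ⟨(p, k), by simp [hk2, hkN, hpN, hp.two_le], rfl, ?_⟩
      rw [vonMangoldt_apply_pow (by omega), vonMangoldt_apply_prime hp]
      push_cast; rfl
    choose! g hg1 hg2 hg3 using key
    rw [Finset.sum_congr rfl hg3]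
    rw [← Finset.sum_image (s := (Finset.Ioc 0 N).filter (fun d => ¬ d.Prime ∧ IsPrimePow d))
      (g := g) (f := fun x => Real.log x.1 / ((x.1 : ℝ) ^ x.2))]
    · refine Finset.sum_le_sum_of_subset_of_nonneg ?_ ?_
      · intro x hx
        obtain ⟨d, hd, rfl⟩ := Finset.mem_image.1 hx
        exact hg1 d hd
      · intro x _ _
        exact div_nonneg (Real.log_natCast_nonneg _) (by positivity)
    · intro a ha b hb hab
      rw [← hg2 a ha, ← hg2 b hb, hab]
  refine hsub.trans ?_
  rw [Finset.sum_product]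
  have hrow : ∀ n ∈ Finset.Icc 2 N, ∑ j ∈ Finset.Icc 2 N, Real.log n / ((n : ℝ) ^ j) ≤
      4 * (n : ℝ) ^ (-(3 / 2) : ℝ) := by
    intro n hn
    have hn2 : (2 : ℝ) ≤ n := by exact_mod_cast (Finset.mem_Icc.1 hn).1
    have hgeo : ∀ M : ℕ, ∑ j ∈ Finset.Icc 2 M, 1 / ((n : ℝ) ^ j) ≤ 2 / (n : ℝ) ^ 2 := by
      intro M
      have hi : (1 : ℝ) / n ≤ 1 / 2 := one_div_le_one_div_of_le (by norm_num) hn2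
      have : ∀ M : ℕ, ∑ j ∈ Finset.Icc 2 M, 1 / ((n : ℝ) ^ j) ≤
          2 / (n : ℝ) ^ 2 - (if 2 ≤ M then 1 / (n : ℝ) ^ M else 0) := by
        intro M
        induction M with
        | zero => simp; positivity
        | succ M ih =>
          rcases Nat.lt_or_ge (M + 1) 2 with h | h
          · rw [Finset.Icc_eq_empty (by omega), if_neg (by omega)]; simp; positivity
          · rw [Finset.sum_Icc_succ_top h, if_pos h]
            have hh : 1 / (n : ℝ) ^ (M + 1) * 2 ≤ 1 / (n : ℝ) ^ M := by
              rw [pow_succ, ← one_div_mul_one_div]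
              have : 0 < 1 / (n : ℝ) ^ M := by positivity
              nlinarith
            rcases Nat.lt_or_ge M 2 with h' | h'
            · have : M = 1 := by omega
              subst this
              simp
              ring_nf; rfl
            · rw [if_pos h'] at ih; linarith
      refine (this M).trans ?_
      have : (0 : ℝ) ≤ if 2 ≤ M then 1 / (n : ℝ) ^ M else 0 := by split_ifs <;> positivity
      linarith
    have h2 : Real.log n ≤ 2 * (n : ℝ) ^ (1 / 2 : ℝ) := by
      have := Real.log_le_rpow_div (x := n) (by positivity) (ε := 1 / 2) (by norm_num)
      linarith
    calc ∑ j ∈ Finset.Icc 2 N, Real.log n / ((n : ℝ) ^ j)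
        = Real.log n * ∑ j ∈ Finset.Icc 2 N, 1 / ((n : ℝ) ^ j) := by
          rw [Finset.mul_sum]; refine Finset.sum_congr rfl fun j _ => by ring
      _ ≤ (2 * (n : ℝ) ^ (1 / 2 : ℝ)) * (2 / (n : ℝ) ^ 2) := by
          gcongr
          exact hgeo N
      _ = 4 * (n : ℝ) ^ (-(3 / 2) : ℝ) := by
          rw [show (-(3 / 2) : ℝ) = 1 / 2 - (2 : ℕ) by norm_num, Real.rpow_sub (by positivity),
            Real.rpow_natCast]
          ring
  refine (Finset.sum_le_sum hrow).trans ?_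
  exact hs.sum_le_tsum _ fun n _ => by positivity

open ArithmeticFunction in
theorem exists_sum_one_mod_four_vonMangoldt :
    ∃ C : ℝ, 0 ≤ C ∧ ∀ N : ℕ, 1 ≤ N →
      |∑ d ∈ (Finset.Ioc 0 N).filter (fun d => d % 4 = 1), vonMangoldt d / d -
        Real.log N / 2| ≤ C := by
  obtain ⟨C, hC, h⟩ := exists_sum_nonprime_vonMangoldt_div_le
  refine ⟨C + 20, by positivity, fun N hN => ?_⟩
  have h1 := abs_sum_vonMangoldt_div_sub_log_le N hN
  have h2 := abs_sum_chiFour_vonMangoldt_div_le N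
  have h3 : ∑ d ∈ (Finset.Ioc 0 N).filter (fun d => d % 4 = 1), vonMangoldt d / d =
      (∑ d ∈ Finset.Ioc 0 N, vonMangoldt d / d +
        ∑ d ∈ Finset.Ioc 0 N, chiFour d * (vonMangoldt d / d) -
        ∑ d ∈ (Finset.Ioc 0 N).filter (fun d => d % 2 = 0), vonMangoldt d / d) / 2 := by
    rw [Finset.sum_filter, Finset.sum_filter, ← Finset.sum_add_distrib, ← Finset.sum_sub_distrib,
      Finset.sum_div]
    refine Finset.sum_congr rfl fun d _ => ?_
    rw [chiFour_eq]
    split_ifs <;> first | omega | ring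
  have h4 : 0 ≤ ∑ d ∈ (Finset.Ioc 0 N).filter (fun d => d % 2 = 0), vonMangoldt d / d :=
    Finset.sum_nonneg fun d _ => div_nonneg vonMangoldt_nonneg (Nat.cast_nonneg _)
  have h5 : ∑ d ∈ (Finset.Ioc 0 N).filter (fun d => d % 2 = 0), vonMangoldt d / d ≤ C + 1 := by
    calc _ ≤ ∑ d ∈ insert 2 ((Finset.Ioc 0 N).filter (fun d => ¬ d.Prime)), vonMangoldt d / d := by
          refine Finset.sum_le_sum_of_subset_of_nonneg ?_ fun d _ _ =>
            div_nonneg vonMangoldt_nonneg (Nat.cast_nonneg _)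
          intro d hd
          simp only [Finset.mem_filter, Finset.mem_insert] at hd ⊢
          by_cases hp : d.Prime
          · left
            exact (Nat.prime_dvd_prime_iff_eq Nat.prime_two hp).1 (Nat.dvd_of_mod_eq_zero hd.2)
              |>.symm
          · right; exact ⟨hd.1, hp⟩
      _ ≤ vonMangoldt 2 / (2 : ℕ) + C := by
          rw [Finset.sum_insert (by simp [Nat.prime_two])]
          have := h N
          linarith
      _ ≤ _ := by
          rw [vonMangoldt_apply_prime Nat.prime_two]
          have := Real.log_two_lt_d9
          push_cast; linarith
  rw [h3]
  rw [abs_le] at *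
  constructor <;> linarith

/-- Primes congruent to one modulo four in the interval `(a, b]`. -/
def primesOne (a b : ℝ) : Finset ℕ :=
  (Finset.Ioc ⌊a⌋₊ ⌊b⌋₊).filter fun p => p.Prime ∧ p % 4 = 1

theorem mem_primesOne {a b : ℝ} (ha : 0 ≤ a) (hb : 0 ≤ b) {p : ℕ} :
    p ∈ primesOne a b ↔ a < p ∧ p ≤ b ∧ p.Prime ∧ p % 4 = 1 := by
  rw [primesOne, Finset.mem_filter, Finset.mem_Ioc, Nat.floor_lt ha, Nat.le_floor_iff hb]
  tauto

theorem prime_of_mem_primesOne {a b : ℝ} {p : ℕ} (h : p ∈ primesOne a b) :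
    p.Prime ∧ p % 4 = 1 := (Finset.mem_filter.1 h).2

open ArithmeticFunction in
theorem exists_sum_primesOne_log_div :
    ∃ C : ℝ, 0 ≤ C ∧ ∀ x : ℝ, 1 ≤ x →
      |∑ p ∈ primesOne 0 x, Real.log p / p - Real.log x / 2| ≤ C := by
  obtain ⟨C1, hC1, h1⟩ := exists_sum_nonprime_vonMangoldt_div_le
  obtain ⟨C2, hC2, h2⟩ := exists_sum_one_mod_four_vonMangoldt
  refine ⟨C1 + C2 + 1, by positivity, fun x hx => ?_⟩
  have hN : 1 ≤ ⌊x⌋₊ := (Nat.one_le_floor_iff x).2 hx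
  have a1 := h1 ⌊x⌋₊
  have a2 := h2 ⌊x⌋₊ hN
  have e : ∑ d ∈ (Finset.Ioc 0 ⌊x⌋₊).filter (fun d => d % 4 = 1), vonMangoldt d / d =
      ∑ p ∈ primesOne 0 x, Real.log p / p +
      ∑ d ∈ ((Finset.Ioc 0 ⌊x⌋₊).filter (fun d => d % 4 = 1)).filter (fun d => ¬ d.Prime),
        vonMangoldt d / d := by
    rw [← Finset.sum_filter_add_sum_filter_not _ (fun d => d.Prime)]
    congr 1
    rw [primesOne, Nat.floor_zero, Finset.filter_filter]
    refine Finset.sum_congr (by congr 1; ext; tauto) fun p hp => ?_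
    rw [vonMangoldt_apply_prime (Finset.mem_filter.1 hp).2.1]
  have b0 : 0 ≤ ∑ d ∈ ((Finset.Ioc 0 ⌊x⌋₊).filter (fun d => d % 4 = 1)).filter
      (fun d => ¬ d.Prime), vonMangoldt d / d :=
    Finset.sum_nonneg fun d _ => div_nonneg vonMangoldt_nonneg (Nat.cast_nonneg _)
  have b1 : ∑ d ∈ ((Finset.Ioc 0 ⌊x⌋₊).filter (fun d => d % 4 = 1)).filter
      (fun d => ¬ d.Prime), vonMangoldt d / d ≤ C1 := by
    refine le_trans ?_ a1
    refine Finset.sum_le_sum_of_subset_of_nonneg ?_ fun d _ _ =>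
      div_nonneg vonMangoldt_nonneg (Nat.cast_nonneg _)
    exact Finset.filter_subset_filter _ (Finset.filter_subset _ _)
  have l1 : Real.log ⌊x⌋₊ ≤ Real.log x :=
    Real.log_le_log (by exact_mod_cast hN) (Nat.floor_le (by linarith))
  have l2 : Real.log x ≤ Real.log ⌊x⌋₊ + 1 := by
    have : x ≤ ⌊x⌋₊ * 2 := by
      have := Nat.lt_floor_add_one x
      have : (1 : ℝ) ≤ ⌊x⌋₊ := by exact_mod_cast hN
      linarith
    have h3 := Real.log_le_log (by linarith) this
    rw [Real.log_mul (by positivity) (by norm_num)] at h3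
    have := Real.log_two_lt_d9
    linarith
  rw [e] at a2
  rw [abs_le] at *
  constructor <;> linarith

theorem sum_primesOne_add {a b c : ℝ} (ha : 0 ≤ a) (hab : a ≤ b) (hbc : b ≤ c) (f : ℕ → ℝ) :
    ∑ p ∈ primesOne a b, f p + ∑ p ∈ primesOne b c, f p = ∑ p ∈ primesOne a c, f p := by
  rw [← Finset.sum_union]
  · congr 1
    ext p
    simp only [Finset.mem_union, mem_primesOne ha (ha.trans hab),
      mem_primesOne (ha.trans hab) ((ha.trans hab).trans hbc),
      mem_primesOne ha ((ha.trans hab).trans hbc)]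
    constructor
    · rintro (h | h)
      · exact ⟨h.1, h.2.1.trans hbc, h.2.2⟩
      · exact ⟨hab.trans_lt h.1, h.2⟩
    · intro h
      rcases le_or_gt (p : ℝ) b with h1 | h1
      · exact Or.inl ⟨h.1, h1, h.2.2⟩
      · exact Or.inr ⟨h1, h.2⟩
  · rw [Finset.disjoint_left]
    intro p h1 h2
    rw [mem_primesOne ha (ha.trans hab)] at h1
    rw [mem_primesOne (ha.trans hab) ((ha.trans hab).trans hbc)] at h2
    linarith [h1.2.1, h2.1]

theorem exists_card_primesOne_ge :
    ∃ c : ℝ, 0 < c ∧ ∃ x₀ : ℝ, 1 < x₀ ∧ ∀ x : ℝ, x₀ ≤ x →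
      c * x / Real.log x ≤ ((primesOne 0 x).card : ℝ) := by
  obtain ⟨C, hC, h⟩ := exists_sum_primesOne_log_div
  set K := Real.exp (4 * C + 2) with hK
  have hK0 : 0 < K := Real.exp_pos _
  have hK1 : 1 < K := Real.one_lt_exp_iff.2 (by positivity)
  refine ⟨1 / K, by positivity, K, hK1, fun x hx => ?_⟩
  have hx1 : 1 < x := hK1.trans_le hx
  have hx0 : 0 < x := by linarith
  have hxK : 1 ≤ x / K := by rwa [le_div_iff₀ hK0, one_mul]
  have h1 := h x hx1.le
  have h2 := h (x / K) hxK
  rw [Real.log_div hx0.ne' hK0.ne', hK, Real.log_exp, ← hK] at h2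
  have h3 := sum_primesOne_add le_rfl (zero_le_one.trans hxK)
    (div_le_self hx0.le hK1.le) (fun p => Real.log p / p)
  have h4 : 1 ≤ ∑ p ∈ primesOne (x / K) x, Real.log p / p := by
    rw [abs_le] at h1 h2; linarith
  have h5 : ∑ p ∈ primesOne (x / K) x, Real.log p / p ≤
      ∑ p ∈ primesOne (x / K) x, Real.log x / (x / K) := by
    refine Finset.sum_le_sum fun p hp => ?_
    rw [mem_primesOne (by positivity) hx0.le] at hp
    have hp0 : (0 : ℝ) < p := by exact_mod_cast hp.2.2.1.pos
    gcongr
    · exact Real.log_nonneg hx1.le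
    · exact hp.2.1
    · exact hp.1.le
  have h6 : ((primesOne (x / K) x).card : ℝ) ≤ (primesOne 0 x).card := by
    have : primesOne (x / K) x ⊆ primesOne 0 x := by
      intro p hp
      rw [mem_primesOne (by positivity) hx0.le] at hp
      rw [mem_primesOne le_rfl hx0.le]
      exact ⟨by exact_mod_cast hp.2.2.1.pos, hp.2⟩
    exact_mod_cast Finset.card_le_card this
  rw [Finset.sum_const, nsmul_eq_mul] at h5
  have hlog := Real.log_pos hx1
  rw [div_le_iff₀ hlog]
  have h7 : 1 ≤ ((primesOne 0 x).card : ℝ) * (Real.log x / (x / K)) :=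
    (h4.trans h5).trans (mul_le_mul_of_nonneg_right h6 (by positivity))
  have e : ((primesOne 0 x).card : ℝ) * (Real.log x / (x / K)) =
      ((primesOne 0 x).card * Real.log x) / (1 / K * x) := by field_simp
  rw [e, le_div_iff₀ (by positivity)] at h7
  linarith

theorem exists_sum_primesOne_inv_ge :
    ∃ Y₀ : ℝ, 1 < Y₀ ∧ ∀ Y : ℝ, Y₀ ≤ Y → 1 / 4 ≤ ∑ p ∈ primesOne Y (Y ^ 3), (1 : ℝ) / p := by
  obtain ⟨C, hC, h⟩ := exists_sum_primesOne_log_div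
  refine ⟨Real.exp (8 * C + 1), Real.one_lt_exp_iff.2 (by positivity), fun Y hY => ?_⟩
  have hY1 : 1 < Y := (Real.one_lt_exp_iff.2 (by positivity)).trans_le hY
  have hlog : 8 * C + 1 ≤ Real.log Y := by
    rw [← Real.log_exp (8 * C + 1)]; exact Real.log_le_log (Real.exp_pos _) hY
  have hY3 : Y ≤ Y ^ 3 := le_self_pow₀ hY1.le (by norm_num)
  have h1 := h Y hY1.le
  have h2 := h (Y ^ 3) (hY1.le.trans hY3)
  rw [Real.log_pow] at h2
  have h3 := sum_primesOne_add le_rfl (by linarith) hY3 (fun p => Real.log p / p)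
  have h4 : Real.log Y - 2 * C ≤ ∑ p ∈ primesOne Y (Y ^ 3), Real.log p / p := by
    push_cast at h2
    rw [abs_le] at h1 h2; linarith
  have h5 : ∑ p ∈ primesOne Y (Y ^ 3), Real.log p / p ≤
      3 * Real.log Y * ∑ p ∈ primesOne Y (Y ^ 3), (1 : ℝ) / p := by
    rw [Finset.mul_sum]
    refine Finset.sum_le_sum fun p hp => ?_
    rw [mem_primesOne (by positivity) (by positivity)] at hp
    have hp0 : (0 : ℝ) < p := by exact_mod_cast hp.2.2.1.pos
    have := Real.log_le_log hp0 hp.2.1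
    rw [Real.log_pow] at this
    push_cast at this
    rw [mul_one_div]
    gcongr
  nlinarith

/-- Positive integers all of whose prime factors are congruent to one modulo four. -/
def onePrimes : Set ℕ := {n | n ≠ 0 ∧ ∀ p : ℕ, p.Prime → p ∣ n → p % 4 = 1}

theorem one_mem_onePrimes : 1 ∈ onePrimes :=
  ⟨one_ne_zero, fun _ hp h => absurd (Nat.dvd_one.1 h) hp.ne_one⟩

theorem onePrimes_of_dvd {m n : ℕ} (hn : n ∈ onePrimes) (h : m ∣ n) : m ∈ onePrimes :=
  ⟨ne_zero_of_dvd_ne_zero hn.1 h, fun p hp hpm => hn.2 p hp (hpm.trans h)⟩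

theorem onePrimes_mul {m n : ℕ} (hm : m ∈ onePrimes) (hn : n ∈ onePrimes) :
    m * n ∈ onePrimes :=
  ⟨mul_ne_zero hm.1 hn.1, fun p hp h => ((Nat.Prime.dvd_mul hp).1 h).elim (hm.2 p hp) (hn.2 p hp)⟩

theorem onePrimes_prime {p : ℕ} (hp : p.Prime) (h : p % 4 = 1) : p ∈ onePrimes :=
  ⟨hp.ne_zero, fun q hq hqp => by rwa [(Nat.prime_dvd_prime_iff_eq hq hp).1 hqp]⟩

theorem onePrimes_mod_four {n : ℕ} (hn : n ∈ onePrimes) : n % 4 = 1 := by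
  induction n using Nat.recOnMul with
  | zero => exact absurd rfl hn.1
  | one => rfl
  | prime p hp => exact hn.2 p hp dvd_rfl
  | mul a b ha hb =>
    have h1 := ha (onePrimes_of_dvd hn (dvd_mul_right a b))
    have h2 := hb (onePrimes_of_dvd hn (dvd_mul_left b a))
    rw [Nat.mul_mod, h1, h2]

open Classical in
/-- Elements of `D` in `[1, x]`. -/
def elemsUpTo (D : Set ℕ) (x : ℝ) : Finset ℕ := (Finset.Ioc 0 ⌊x⌋₊).filter (· ∈ D)

theorem mem_elemsUpTo {D : Set ℕ} {x : ℝ} (hx : 0 ≤ x) {n : ℕ} :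
    n ∈ elemsUpTo D x ↔ 0 < n ∧ (n : ℝ) ≤ x ∧ n ∈ D := by
  classical
  rw [elemsUpTo, Finset.mem_filter, Finset.mem_Ioc, Nat.le_floor_iff hx, and_assoc]

/-- The harmonic sum over elements of `D` up to `x`. -/
def harmUpTo (D : Set ℕ) (x : ℝ) : ℝ := ∑ n ∈ elemsUpTo D x, (1 : ℝ) / n

theorem harmUpTo_nonneg (D : Set ℕ) (x : ℝ) : 0 ≤ harmUpTo D x :=
  Finset.sum_nonneg fun _ _ => by positivity

theorem elemsUpTo_mono {D D' : Set ℕ} (hD : D ⊆ D') {x y : ℝ} (hxy : x ≤ y) :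
    elemsUpTo D x ⊆ elemsUpTo D' y := by
  classical
  intro n hn
  rw [elemsUpTo, Finset.mem_filter, Finset.mem_Ioc] at hn ⊢
  exact ⟨⟨hn.1.1, hn.1.2.trans (Nat.floor_le_floor hxy)⟩, hD hn.2⟩

theorem harmUpTo_mono {D D' : Set ℕ} (hD : D ⊆ D') {x y : ℝ} (hxy : x ≤ y) :
    harmUpTo D x ≤ harmUpTo D' y :=
  Finset.sum_le_sum_of_subset_of_nonneg (elemsUpTo_mono hD hxy) fun _ _ _ => by positivity

theorem one_le_harmUpTo {D : Set ℕ} (h1 : 1 ∈ D) {x : ℝ} (hx : 1 ≤ x) : 1 ≤ harmUpTo D x := by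
  have : (1 : ℕ) ∈ elemsUpTo D x := (mem_elemsUpTo (by linarith)).2 ⟨one_pos, by simpa using hx, h1⟩
  have h := Finset.single_le_sum (f := fun n : ℕ => (1 : ℝ) / n) (fun _ _ => by positivity) this
  simpa [harmUpTo] using h

open ArithmeticFunction in
theorem sum_log_mul_le {D : Set ℕ} (hD : ∀ n ∈ D, ∀ d, d ∣ n → d ∈ D) (x : ℝ)
    (w : ℕ → ℝ) (hw : ∀ n, 0 ≤ w n) (hmul : ∀ m n, w (m * n) = w m * w n) :
    ∑ n ∈ elemsUpTo D x, w n * Real.log n ≤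
      ∑ m ∈ elemsUpTo D x, w m * ∑ d ∈ elemsUpTo D ((⌊x⌋₊ / m : ℕ) : ℝ), w d * vonMangoldt d := by
  classical
  have h := sum_Ioc_sum_divisors (fun m d => if m * d ∈ D then w m * (w d * vonMangoldt d) else 0)
    ⌊x⌋₊
  have h1 : ∑ n ∈ elemsUpTo D x, w n * Real.log n = ∑ n ∈ Finset.Ioc 0 ⌊x⌋₊, ∑ d ∈ n.divisors,
      (if d * (n / d) ∈ D then w d * (w (n / d) * vonMangoldt (n / d)) else 0) := by
    rw [elemsUpTo, Finset.sum_filter]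
    refine Finset.sum_congr rfl fun n _ => ?_
    rw [← vonMangoldt_sum, ← Nat.sum_div_divisors, Finset.mul_sum]
    split_ifs with hn
    · refine Finset.sum_congr rfl fun d hd => ?_
      rw [Nat.mul_div_cancel' (Nat.dvd_of_mem_divisors hd), if_pos hn, ← mul_assoc, ← hmul,
        Nat.mul_div_cancel' (Nat.dvd_of_mem_divisors hd)]
    · symm
      refine Finset.sum_eq_zero fun d hd => ?_
      rw [Nat.mul_div_cancel' (Nat.dvd_of_mem_divisors hd), if_neg hn]
  rw [h1, h, elemsUpTo, Finset.sum_filter]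
  refine Finset.sum_le_sum fun m hm => ?_
  by_cases hmD : m ∈ D
  · rw [if_pos hmD, elemsUpTo, Finset.sum_filter, Nat.floor_natCast, Finset.mul_sum]
    refine Finset.sum_le_sum fun d _ => ?_
    have : 0 ≤ w m * (w d * vonMangoldt d) := mul_nonneg (hw _) (mul_nonneg (hw _) vonMangoldt_nonneg)
    by_cases hdD : d ∈ D
    · rw [if_pos hdD]; split_ifs
      · exact le_rfl
      · exact this
    · rw [if_neg hdD, if_neg (fun h => hdD (hD _ h _ (dvd_mul_left d m))), mul_zero]
  · rw [if_neg hmD]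
    refine (Finset.sum_eq_zero fun d _ => ?_).le
    rw [if_neg (fun h => hmD (hD _ h _ (dvd_mul_right m d)))]

theorem sum_log_le_harm {D : Set ℕ} (hD : ∀ n ∈ D, ∀ d, d ∣ n → d ∈ D) {x : ℝ} (hx : 0 ≤ x) :
    ∑ n ∈ elemsUpTo D x, Real.log n ≤ 6 * x * harmUpTo D x := by
  classical
  have h := sum_log_mul_le hD x (fun _ => 1) (fun _ => zero_le_one) (by simp)
  simp only [one_mul] at h
  refine h.trans ?_
  rw [harmUpTo, Finset.mul_sum]
  refine Finset.sum_le_sum fun m hm => ?_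
  rw [mem_elemsUpTo hx] at hm
  calc _ ≤ ∑ d ∈ Finset.Ioc 0 (⌊x⌋₊ / m), ArithmeticFunction.vonMangoldt d := by
        rw [elemsUpTo, Nat.floor_natCast]
        exact Finset.sum_le_sum_of_subset_of_nonneg (Finset.filter_subset _ _) fun _ _ _ =>
          ArithmeticFunction.vonMangoldt_nonneg
    _ ≤ 6 * ((⌊x⌋₊ / m : ℕ) : ℝ) := sum_vonMangoldt_le _
    _ ≤ 6 * x * (1 / m) := by
        have : ((⌊x⌋₊ / m : ℕ) : ℝ) ≤ x / m := by
          refine Nat.cast_div_le.trans ?_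
          gcongr
          exact Nat.floor_le hx
        rw [mul_one_div, mul_div_assoc]; linarith

theorem log_le_two_sqrt {x : ℝ} (hx : 0 ≤ x) : Real.log x ≤ 2 * Real.sqrt x := by
  have := Real.log_le_rpow_div (x := x) hx (ε := 1 / 2) (by norm_num)
  rw [Real.sqrt_eq_rpow]; linarith

theorem card_elemsUpTo_le_harm {D : Set ℕ} (hD : ∀ n ∈ D, ∀ d, d ∣ n → d ∈ D) (h1 : 1 ∈ D) {x : ℝ}
    (hx : 1 < x) : ((elemsUpTo D x).card : ℝ) ≤ 14 * x / Real.log x * harmUpTo D x := by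
  have hx0 : 0 < x := by linarith
  have hl : 0 < Real.log x := Real.log_pos hx
  have hH := one_le_harmUpTo h1 hx.le
  have a1 : ((elemsUpTo D x).card : ℝ) ≤
      ∑ n ∈ elemsUpTo D x, ((if (n : ℝ) ≤ Real.sqrt x then 1 else 0) +
        2 / Real.log x * Real.log n) := by
    rw [Finset.card_eq_sum_ones, Nat.cast_sum]
    refine Finset.sum_le_sum fun n hn => ?_
    rw [mem_elemsUpTo hx0.le] at hn
    have hn0 : (1 : ℝ) ≤ n := by exact_mod_cast hn.1
    have : 0 ≤ Real.log n := Real.log_nonneg hn0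
    split_ifs with h
    · push_cast
      have : 0 ≤ 2 / Real.log x * Real.log n := by positivity
      linarith
    · push Not at h
      have h2 : Real.log (Real.sqrt x) ≤ Real.log n := Real.log_le_log (Real.sqrt_pos.2 hx0) h.le
      rw [Real.log_sqrt hx0.le] at h2
      have : (1 : ℝ) ≤ 2 / Real.log x * Real.log n := by
        rw [div_mul_eq_mul_div, le_div_iff₀ hl]; linarith
      push_cast; linarith
  have a2 : ∑ n ∈ elemsUpTo D x, (if (n : ℝ) ≤ Real.sqrt x then (1 : ℝ) else 0) ≤ Real.sqrt x := by
    rw [← Finset.sum_filter, Finset.sum_const, nsmul_eq_mul, mul_one]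
    have : (elemsUpTo D x).filter (fun n : ℕ => (n : ℝ) ≤ Real.sqrt x) ⊆
        Finset.Ioc 0 ⌊Real.sqrt x⌋₊ := by
      intro n hn
      rw [Finset.mem_filter, mem_elemsUpTo hx0.le] at hn
      exact Finset.mem_Ioc.2 ⟨hn.1.1, Nat.le_floor hn.2⟩
    have := Finset.card_le_card this
    rw [Nat.card_Ioc, Nat.sub_zero] at this
    exact le_trans (by exact_mod_cast this) (Nat.floor_le (Real.sqrt_nonneg x))
  have a3 := sum_log_le_harm hD hx0.le
  rw [Finset.sum_add_distrib, ← Finset.mul_sum] at a1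
  have a4 : Real.sqrt x ≤ 2 * x / Real.log x := by
    rw [le_div_iff₀ hl]
    have := log_le_two_sqrt hx0.le
    have h3 := Real.mul_self_sqrt hx0.le
    nlinarith [Real.sqrt_nonneg x]
  have a5 : 2 / Real.log x * ∑ n ∈ elemsUpTo D x, Real.log n ≤
      12 * x / Real.log x * harmUpTo D x := by
    calc _ ≤ 2 / Real.log x * (6 * x * harmUpTo D x) := by gcongr
      _ = _ := by ring
  have a6 : 2 * x / Real.log x ≤ 2 * x / Real.log x * harmUpTo D x :=
    le_mul_of_one_le_right (by positivity) hH
  calc _ ≤ 2 * x / Real.log x * harmUpTo D x + 12 * x / Real.log x * harmUpTo D x := by linarith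
    _ = _ := by ring

open ArithmeticFunction in
theorem exists_harm_onePrimes_le_of_log_le_aux :
    ∃ Y₁ : ℝ, 1 < Y₁ ∧ ∀ Y Z : ℝ, Y₁ ≤ Y → 0 < Z → Real.log Z ≤ 3 / 2 * Real.log Y →
      harmUpTo onePrimes Z ≤ 8 * harmUpTo onePrimes Y := by
  classical
  obtain ⟨C, hC, hU⟩ := exists_sum_one_mod_four_vonMangoldt
  refine ⟨Real.exp (8 * C + 1), Real.one_lt_exp_iff.2 (by positivity), fun Y Z hY hZ hYZ => ?_⟩
  have hY1 : 1 < Y := (Real.one_lt_exp_iff.2 (by positivity)).trans_le hY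
  have hlog : 8 * C + 1 ≤ Real.log Y := by
    rw [← Real.log_exp (8 * C + 1)]; exact Real.log_le_log (Real.exp_pos _) hY
  rcases le_or_gt Z Y with hZY | hZY
  · have := harmUpTo_mono (D := onePrimes) le_rfl hZY
    linarith [harmUpTo_nonneg onePrimes Y]
  have hZ1 : 1 < Z := hY1.trans hZY
  have hlY : 0 < Real.log Y := by linarith
  have a1 : harmUpTo onePrimes Z ≤ harmUpTo onePrimes Y +
      ∑ n ∈ elemsUpTo onePrimes Z, 1 / Real.log Y * ((1 : ℝ) / n * Real.log n) := by
    have : harmUpTo onePrimes Y =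
        ∑ n ∈ elemsUpTo onePrimes Z, if (n : ℝ) ≤ Y then (1 : ℝ) / n else 0 := by
      rw [← Finset.sum_filter, harmUpTo]
      congr 1
      ext n
      rw [Finset.mem_filter, mem_elemsUpTo (by linarith), mem_elemsUpTo hZ.le]
      constructor
      · exact fun h => ⟨⟨h.1, h.2.1.trans hZY.le, h.2.2⟩, h.2.1⟩
      · exact fun h => ⟨h.1.1, h.2, h.1.2.2⟩
    rw [this, ← Finset.sum_add_distrib, harmUpTo]
    refine Finset.sum_le_sum fun n hn => ?_
    rw [mem_elemsUpTo hZ.le] at hn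
    have hn0 : (1 : ℝ) ≤ n := by exact_mod_cast hn.1
    have hln := Real.log_nonneg hn0
    split_ifs with h
    · have : 0 ≤ 1 / Real.log Y * ((1 : ℝ) / n * Real.log n) := by positivity
      linarith
    · push Not at h
      have h2 : Real.log Y ≤ Real.log n := Real.log_le_log (by linarith) h.le
      have : 1 ≤ 1 / Real.log Y * Real.log n := by
        rw [one_div_mul_eq_div, le_div_iff₀ hlY]; linarith
      calc (1 : ℝ) / n = 1 * (1 / n) := by ring
        _ ≤ (1 / Real.log Y * Real.log n) * (1 / n) := by gcongr
        _ = _ := by ring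
  have a2 := sum_log_mul_le (D := onePrimes) (fun n hn d hd => onePrimes_of_dvd hn hd) Z
    (fun n => (1 : ℝ) / n) (fun n => by positivity) (by intro m n; push_cast; field_simp)
  have a3 : ∑ m ∈ elemsUpTo onePrimes Z, (1 : ℝ) / m *
      ∑ d ∈ elemsUpTo onePrimes ((⌊Z⌋₊ / m : ℕ) : ℝ), 1 / (d : ℝ) * vonMangoldt d ≤
      harmUpTo onePrimes Z * (3 / 4 * Real.log Y + C) := by
    rw [harmUpTo, Finset.sum_mul]
    refine Finset.sum_le_sum fun m hm => ?_
    refine mul_le_mul_of_nonneg_left ?_ (by positivity)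
    rw [elemsUpTo, Finset.mem_filter, Finset.mem_Ioc] at hm
    have hN : 1 ≤ ⌊Z⌋₊ / m := Nat.div_pos hm.1.2 hm.1.1
    have h1 := (abs_le.1 (hU _ hN)).2
    have h2 : Real.log ((⌊Z⌋₊ / m : ℕ) : ℝ) ≤ Real.log Z := by
      apply Real.log_le_log (by exact_mod_cast hN)
      exact (Nat.cast_le.2 (Nat.div_le_self _ _)).trans (Nat.floor_le hZ.le)
    have h3 : ∑ d ∈ elemsUpTo onePrimes ((⌊Z⌋₊ / m : ℕ) : ℝ), 1 / (d : ℝ) * vonMangoldt d ≤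
        ∑ d ∈ (Finset.Ioc 0 (⌊Z⌋₊ / m)).filter (fun d => d % 4 = 1), vonMangoldt d / d := by
      have : ∀ d : ℕ, 1 / (d : ℝ) * vonMangoldt d = vonMangoldt d / d := fun d => by ring
      simp only [this]
      refine Finset.sum_le_sum_of_subset_of_nonneg ?_ fun d _ _ =>
        div_nonneg vonMangoldt_nonneg (Nat.cast_nonneg _)
      intro d hd
      rw [elemsUpTo, Finset.mem_filter, Nat.floor_natCast] at hd
      exact Finset.mem_filter.2 ⟨hd.1, onePrimes_mod_four hd.2⟩
    linarith
  rw [← Finset.mul_sum] at a1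
  have a4 := a2.trans a3
  have hH := harmUpTo_nonneg onePrimes Z
  have a5 : harmUpTo onePrimes Z * (3 / 4 * Real.log Y + C) ≤
      harmUpTo onePrimes Z * (7 / 8 * Real.log Y) := by gcongr; linarith
  have a6 : 1 / Real.log Y * ∑ n ∈ elemsUpTo onePrimes Z, (1 : ℝ) / n * Real.log n ≤
      7 / 8 * harmUpTo onePrimes Z := by
    rw [one_div_mul_eq_div, div_le_iff₀ hlY]
    linarith
  linarith

theorem exists_harm_onePrimes_le_of_log_le :
    ∃ C : ℝ, 0 < C ∧ ∃ Y₁ : ℝ, 1 < Y₁ ∧ ∀ Y Z : ℝ, Y₁ ≤ Y → 0 < Z →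
      Real.log Z ≤ 8 * Real.log Y → harmUpTo onePrimes Z ≤ C * harmUpTo onePrimes Y := by
  obtain ⟨Y₁, hY₁, h⟩ := exists_harm_onePrimes_le_of_log_le_aux
  refine ⟨8 ^ 6, by positivity, Y₁, hY₁, fun Y Z hY hZ hl => ?_⟩
  have hY1 : 1 < Y := hY₁.trans_le hY
  have hlY : 0 < Real.log Y := Real.log_pos hY1
  have key : ∀ j : ℕ, ∀ Z : ℝ, 0 < Z → Real.log Z ≤ (3 / 2) ^ j * Real.log Y →
      harmUpTo onePrimes Z ≤ 8 ^ j * harmUpTo onePrimes Y := by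
    intro j
    induction j with
    | zero =>
      intro Z hZ hZY
      simp only [pow_zero, one_mul] at hZY ⊢
      exact harmUpTo_mono le_rfl ((Real.log_le_log_iff hZ (by linarith)).1 hZY)
    | succ j ih =>
      intro Z hZ hZY
      have hW : Y₁ ≤ Real.exp ((3 / 2) ^ j * Real.log Y) := by
        refine hY.trans ?_
        rw [← Real.log_le_iff_le_exp (by linarith)]
        exact le_mul_of_one_le_left hlY.le (one_le_pow₀ (by norm_num))
      have h1 := h _ Z hW hZ (by rw [Real.log_exp]; refine hZY.trans (le_of_eq ?_); ring)
      have h2 := ih _ (Real.exp_pos ((3 / 2) ^ j * Real.log Y)) (by rw [Real.log_exp])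
      rw [pow_succ]; linarith
  refine key 6 Z hZ (hl.trans ?_)
  gcongr
  norm_num

theorem exists_harm_onePrimes_growth :
    ∃ Y₀ : ℝ, 1 < Y₀ ∧ ∀ Y : ℝ, Y₀ ≤ Y →
      5 / 4 * harmUpTo onePrimes Y ≤ harmUpTo onePrimes (Y ^ 4) := by
  obtain ⟨Y₀, hY₀, h⟩ := exists_sum_primesOne_inv_ge
  refine ⟨Y₀, hY₀, fun Y hY => ?_⟩
  have hY1 : 1 < Y := hY₀.trans_le hY
  have hY0 : 0 < Y := by linarith
  have h1 := h Y hY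
  set P := primesOne Y (Y ^ 3)
  have hP : ∀ p ∈ P, Y < p ∧ (p : ℝ) ≤ Y ^ 3 ∧ p.Prime ∧ p % 4 = 1 := fun p hp =>
    (mem_primesOne hY0.le (by positivity)).1 hp
  have hE : ∀ m ∈ elemsUpTo onePrimes Y, 0 < m ∧ (m : ℝ) ≤ Y ∧ m ∈ onePrimes := fun m hm =>
    (mem_elemsUpTo hY0.le).1 hm
  have hinj : Set.InjOn (fun x : ℕ × ℕ => x.1 * x.2) (elemsUpTo onePrimes Y ×ˢ P : Finset (ℕ × ℕ)) := by
    rintro ⟨m, p⟩ h ⟨m', p'⟩ h' heq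
    simp only [Finset.coe_product, Set.mem_prod, Finset.mem_coe] at h h' heq
    have a := hP p h.2
    have a' := hP p' h'.2
    have b' := hE m' h'.1
    have hpp : p = p' := by
      have : p ∣ m' * p' := heq ▸ dvd_mul_left p m
      rcases (Nat.Prime.dvd_mul a.2.2.1).1 this with hd | hd
      · have : (p : ℝ) ≤ m' := by exact_mod_cast Nat.le_of_dvd b'.1 hd
        linarith [a.1, b'.2.1]
      · exact (Nat.prime_dvd_prime_iff_eq a.2.2.1 a'.2.2.1).1 hd
    subst hpp
    simp [Nat.eq_of_mul_eq_mul_right a.2.2.1.pos heq]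
  have hdis : Disjoint (elemsUpTo onePrimes Y)
      ((elemsUpTo onePrimes Y ×ˢ P).image (fun x : ℕ × ℕ => x.1 * x.2)) := by
    rw [Finset.disjoint_left]
    intro n hn hn'
    obtain ⟨⟨m, p⟩, hmp, rfl⟩ := Finset.mem_image.1 hn'
    rw [Finset.mem_product] at hmp
    have a := hP p hmp.2
    have b := hE m hmp.1
    have c := (hE _ hn).2.1
    push_cast at c
    have : (1 : ℝ) ≤ m := by exact_mod_cast b.1
    nlinarith
  have hsub : (elemsUpTo onePrimes Y) ∪
      ((elemsUpTo onePrimes Y ×ˢ P).image (fun x : ℕ × ℕ => x.1 * x.2)) ⊆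
      elemsUpTo onePrimes (Y ^ 4) := by
    intro n hn
    rcases Finset.mem_union.1 hn with hn | hn
    · exact elemsUpTo_mono le_rfl (le_self_pow₀ hY1.le (by norm_num)) hn
    · obtain ⟨⟨m, p⟩, hmp, rfl⟩ := Finset.mem_image.1 hn
      rw [Finset.mem_product] at hmp
      have a := hP p hmp.2
      have b := hE m hmp.1
      rw [mem_elemsUpTo (by positivity)]
      refine ⟨Nat.mul_pos b.1 a.2.2.1.pos, ?_, onePrimes_mul b.2.2 (onePrimes_prime a.2.2.1 a.2.2.2)⟩
      push_cast
      calc (m : ℝ) * p ≤ Y * Y ^ 3 := by gcongr; exact b.2.1; exact a.2.1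
        _ = Y ^ 4 := by ring
  have h2 : ∑ n ∈ (elemsUpTo onePrimes Y) ∪
      ((elemsUpTo onePrimes Y ×ˢ P).image (fun x : ℕ × ℕ => x.1 * x.2)), (1 : ℝ) / n ≤
      harmUpTo onePrimes (Y ^ 4) :=
    Finset.sum_le_sum_of_subset_of_nonneg hsub fun _ _ _ => by positivity
  rw [Finset.sum_union hdis, Finset.sum_image hinj, Finset.sum_product] at h2
  have h3 : ∑ m ∈ elemsUpTo onePrimes Y, ∑ p ∈ P, (1 : ℝ) / ((m * p : ℕ) : ℝ) =
      harmUpTo onePrimes Y * ∑ p ∈ P, (1 : ℝ) / p := by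
    rw [harmUpTo, Finset.sum_mul_sum]
    refine Finset.sum_congr rfl fun m _ => Finset.sum_congr rfl fun p _ => ?_
    push_cast; rw [one_div_mul_one_div]
  have h4 := mul_le_mul_of_nonneg_left h1 (harmUpTo_nonneg onePrimes Y)
  rw [h3] at h2
  have h5 : harmUpTo onePrimes Y = ∑ n ∈ elemsUpTo onePrimes Y, (1 : ℝ) / n := rfl
  linarith

theorem exists_harm_onePrimes_ge :
    ∃ c : ℝ, 0 < c ∧ ∃ Y₂ : ℝ, 1 < Y₂ ∧ ∀ Y : ℝ, Y₂ ≤ Y →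
      c * Real.log Y ^ (4 / 25 : ℝ) ≤ harmUpTo onePrimes Y := by
  obtain ⟨Y₀, hY₀, h⟩ := exists_harm_onePrimes_growth
  have hl0 : 0 < Real.log Y₀ := Real.log_pos hY₀
  refine ⟨4 / 5 * (1 / Real.log Y₀) ^ (4 / 25 : ℝ), by positivity, Y₀, hY₀, fun Y hY => ?_⟩
  have hY1 : 1 < Y := hY₀.trans_le hY
  have hlY : 0 < Real.log Y := Real.log_pos hY1
  have key : ∀ j : ℕ, (5 / 4 : ℝ) ^ j ≤ harmUpTo onePrimes (Y₀ ^ (4 ^ j)) := by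
    intro j
    induction j with
    | zero => simpa using one_le_harmUpTo one_mem_onePrimes hY₀.le
    | succ j ih =>
      have := h (Y₀ ^ (4 ^ j)) (le_self_pow₀ hY₀.le (by positivity))
      rw [← pow_mul, ← pow_succ] at this
      rw [pow_succ]; linarith
  set s := Real.log Y / Real.log Y₀ with hs
  have hs1 : 1 ≤ s := by
    rw [hs, le_div_iff₀ hl0, one_mul]; exact Real.log_le_log (by linarith) hY
  set j := ⌊Real.logb 4 s⌋₊ with hj
  have hj1 : (j : ℝ) ≤ Real.logb 4 s := Nat.floor_le (Real.logb_nonneg (by norm_num) hs1)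
  have hj2 : Real.logb 4 s < j + 1 := Nat.lt_floor_add_one _
  have h1 : Y₀ ^ (4 ^ j) ≤ Y := by
    rw [← Real.log_le_log_iff (by positivity) (by linarith), Real.log_pow]
    have : (4 : ℝ) ^ (j : ℝ) ≤ s := by
      rw [← Real.rpow_logb (b := 4) (x := s) (by norm_num) (by norm_num) (by linarith)]
      exact Real.rpow_le_rpow_of_exponent_le (by norm_num) hj1
    rw [Real.rpow_natCast, hs, le_div_iff₀ hl0] at this
    push_cast; exact this
  have h2 := (key j).trans (harmUpTo_mono le_rfl h1)
  have h3 : s ^ (4 / 25 : ℝ) ≤ (5 / 4 : ℝ) ^ (j + 1) := by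
    have h4 : s ≤ (4 : ℝ) ^ (j + 1) := by
      rw [← Real.rpow_logb (b := 4) (x := s) (by norm_num) (by norm_num) (by linarith),
        ← Real.rpow_natCast]
      apply Real.rpow_le_rpow_of_exponent_le (by norm_num)
      push_cast; exact hj2.le
    have h5 : (4 : ℝ) ^ (4 / 25 : ℝ) ≤ 5 / 4 := by
      rw [show (4 / 25 : ℝ) = ((4 : ℕ) : ℝ) * (25 : ℝ)⁻¹ by norm_num, Real.rpow_mul (by norm_num),
        Real.rpow_natCast]
      rw [Real.rpow_inv_le_iff_of_pos (by norm_num) (by norm_num) (by norm_num)]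
      rw [show (25 : ℝ) = ((25 : ℕ) : ℝ) by norm_num, Real.rpow_natCast]
      norm_num
    calc s ^ (4 / 25 : ℝ) ≤ ((4 : ℝ) ^ (j + 1)) ^ (4 / 25 : ℝ) :=
          Real.rpow_le_rpow (by linarith) h4 (by norm_num)
      _ = ((4 : ℝ) ^ (4 / 25 : ℝ)) ^ (j + 1) := by
          rw [← Real.rpow_natCast, ← Real.rpow_mul (by norm_num), mul_comm, Real.rpow_mul (by norm_num),
            Real.rpow_natCast]
      _ ≤ _ := by gcongr
  have e : (1 / Real.log Y₀) ^ (4 / 25 : ℝ) * Real.log Y ^ (4 / 25 : ℝ) = s ^ (4 / 25 : ℝ) := by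
    rw [← Real.mul_rpow (by positivity) hlY.le, hs]; congr 1; ring
  rw [mul_assoc, e]
  rw [pow_succ] at h3
  linarith

theorem mem_sumTwoSq_iff {n : ℕ} : n ∈ sumTwoSq ↔ 0 < n ∧ ∃ x y : ℕ, n = x ^ 2 + y ^ 2 := by
  constructor
  · rintro ⟨h0, a, b, h⟩
    refine ⟨h0, a.natAbs, b.natAbs, ?_⟩
    zify; simpa using h
  · rintro ⟨h0, a, b, h⟩
    exact ⟨h0, a, b, by exact_mod_cast h⟩

theorem onePrimes_subset_sumTwoSq : onePrimes ⊆ sumTwoSq := by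
  intro n hn
  refine mem_sumTwoSq_iff.2 ⟨Nat.pos_of_ne_zero hn.1, Nat.eq_sq_add_sq_iff.2 ?_⟩
  intro q hq h3
  have := hn.2 q (Nat.prime_of_mem_primeFactors hq) (Nat.dvd_of_mem_primeFactors hq)
  omega

theorem sumTwoSq_eq_mul {n : ℕ} (hn : n ∈ sumTwoSq) :
    ∃ δ k u : ℕ, (δ = 1 ∨ δ = 2) ∧ 0 < k ∧ u ∈ onePrimes ∧ n = δ * k ^ 2 * u := by
  obtain ⟨h0, h⟩ := mem_sumTwoSq_iff.1 hn
  obtain ⟨a, b, hab, hb⟩ := Nat.eq_sq_add_sq_iff_eq_sq_mul.1 h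
  have ha0 : 0 < a := Nat.pos_of_ne_zero (by rintro rfl; simp at hab; omega)
  have hb0 : b ≠ 0 := by rintro rfl; simp at hab; omega
  have h3 : ∀ p : ℕ, p.Prime → p ∣ b → p % 4 ≠ 3 := fun p hp hd => by
    have h := ZMod.isSquare_neg_one_of_dvd hd hb
    have := Fact.mk hp
    exact ZMod.exists_sq_eq_neg_one_iff.1 h
  have h4 : ¬ 4 ∣ b := fun hd => by
    have := (ZMod.isSquare_neg_one_of_dvd hd hb)
    revert this; decide
  have hodd : ∀ p : ℕ, p.Prime → p % 4 ≠ 3 → p ≠ 2 → p % 4 = 1 := fun p hp h h2 => by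
    have := hp.eq_two_or_odd
    omega
  by_cases h2 : 2 ∣ b
  · obtain ⟨u, rfl⟩ := h2
    refine ⟨2, a, u, Or.inr rfl, ha0, ⟨by omega, fun p hp hd => ?_⟩, by rw [hab]; ring⟩
    refine hodd p hp (h3 p hp (hd.mul_left 2)) ?_
    rintro rfl
    exact h4 (by obtain ⟨v, rfl⟩ := hd; exact ⟨v, by ring⟩)
  · refine ⟨1, a, b, Or.inl rfl, ha0, ⟨hb0, fun p hp hd => ?_⟩, by rw [hab]; ring⟩
    refine hodd p hp (h3 p hp hd) ?_
    rintro rfl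
    exact h2 hd

theorem exists_card_sumTwoSq_ge_aux :
    ∃ c : ℝ, 0 < c ∧ ∀ᶠ X : ℝ in atTop,
      c * X / Real.log X * harmUpTo onePrimes (X ^ (1 / 4 : ℝ)) ≤
        ((elemsUpTo sumTwoSq X).card : ℝ) := by
  obtain ⟨c, hc, x₀, hx₀, h⟩ := exists_card_primesOne_ge
  refine ⟨c / 2, by positivity, ?_⟩
  have hev1 : ∀ᶠ X : ℝ in atTop, Real.log X ≤ c / 2 * X ^ (1 / 4 : ℝ) := by
    have := (isLittleO_log_rpow_atTop (r := 1 / 4) (by norm_num)).bound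
      (show (0 : ℝ) < c / 2 by positivity)
    filter_upwards [this, eventually_ge_atTop 1] with X hX h1
    rw [Real.norm_of_nonneg (Real.log_nonneg h1), Real.norm_of_nonneg (by positivity)] at hX
    exact hX
  filter_upwards [hev1, eventually_ge_atTop (x₀ ^ 2), eventually_gt_atTop 1] with X hX1 hX2 hX3
  have hX0 : 0 < X := by linarith
  have hL : 0 < Real.log X := Real.log_pos hX3
  have hq1 : 1 ≤ X ^ (1 / 4 : ℝ) := Real.one_le_rpow hX3.le (by norm_num)
  set q := X ^ (1 / 4 : ℝ) with hq
  have hq0 : 0 < q := by linarith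
  have hX4 : X = q ^ 4 := by
    rw [hq, ← Real.rpow_natCast, ← Real.rpow_mul hX0.le]; norm_num
  have hsq : Real.sqrt X = q ^ 2 := by
    rw [Real.sqrt_eq_iff_mul_self_eq hX0.le (by positivity), hX4]; ring
  have hx0q : x₀ ≤ q ^ 2 := by
    rw [hX4] at hX2
    have : x₀ ^ 2 ≤ (q ^ 2) ^ 2 := by linarith [show (q ^ 2) ^ 2 = q ^ 4 by ring]
    exact (pow_le_pow_iff_left₀ (by linarith) (by positivity) (by norm_num)).1 this
  have hE : ∀ m ∈ elemsUpTo onePrimes q, 0 < m ∧ (m : ℝ) ≤ q ∧ m ∈ onePrimes := fun m hm =>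
    (mem_elemsUpTo hq0.le).1 hm
  have hmX : ∀ m ∈ elemsUpTo onePrimes q, q ^ 3 ≤ X / m := fun m hm => by
    have := hE m hm
    have hm0 : (0 : ℝ) < m := by exact_mod_cast this.1
    rw [le_div_iff₀ hm0, hX4]
    calc q ^ 3 * m ≤ q ^ 3 * q := by gcongr; exact this.2.1
      _ = _ := by ring
  have hq23 : q ^ 2 ≤ q ^ 3 := pow_le_pow_right₀ hq1 (by norm_num)
  have hP : ∀ m ∈ elemsUpTo onePrimes q, ∀ p ∈ primesOne (q ^ 2) (X / m),
      q ^ 2 < p ∧ (p : ℝ) ≤ X / m ∧ p.Prime ∧ p % 4 = 1 := fun m hm p hp =>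
    (mem_primesOne (by positivity) (by positivity)).1 hp
  have hcard : ∀ m ∈ elemsUpTo onePrimes q,
      c / 2 * X / Real.log X * (1 / m) ≤ ((primesOne (q ^ 2) (X / m)).card : ℝ) := by
    intro m hm
    have hmE := hE m hm
    have hm1 : (1 : ℝ) ≤ m := by exact_mod_cast hmE.1
    have h1 := h (X / m) (hx0q.trans (hq23.trans (hmX m hm)))
    have h2 := sum_primesOne_add le_rfl (by positivity) (hq23.trans (hmX m hm)) (fun _ => (1 : ℝ))
    simp only [Finset.sum_const, nsmul_eq_mul, mul_one] at h2
    have h3 : ((primesOne 0 (q ^ 2)).card : ℝ) ≤ q ^ 2 := by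
      have : (primesOne 0 (q ^ 2)).card ≤ ⌊q ^ 2⌋₊ := by
        refine (Finset.card_filter_le _ _).trans ?_
        simp
      exact (Nat.cast_le.2 this).trans (Nat.floor_le (by positivity))
    have h4 : c * X / Real.log X * (1 / m) ≤ c * (X / m) / Real.log (X / m) := by
      have : Real.log (X / m) ≤ Real.log X := Real.log_le_log (by positivity)
        (div_le_self hX0.le hm1)
      have hlm : 0 < Real.log (X / m) := Real.log_pos
        (by linarith [hmX m hm, hx0q])
      calc c * X / Real.log X * (1 / m) = c * (X / m) / Real.log X := by ring
        _ ≤ _ := by gcongr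
    have h5 : q ^ 2 ≤ c / 2 * X / Real.log X * (1 / m) := by
      calc q ^ 2 ≤ c / 2 * q ^ 3 / Real.log X := by
            rw [le_div_iff₀ hL]
            calc q ^ 2 * Real.log X ≤ q ^ 2 * (c / 2 * q) := by gcongr
              _ = _ := by ring
        _ ≤ c / 2 * (X / m) / Real.log X := by gcongr; exact hmX m hm
        _ = _ := by ring
    have e : c * X / Real.log X * (1 / m) = c / 2 * X / Real.log X * (1 / m) +
      c / 2 * X / Real.log X * (1 / m) := by ring
    linarith
  have hinj : Set.InjOn (fun x : (_ : ℕ) × ℕ => x.1 * x.2)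
      ((elemsUpTo onePrimes q).sigma fun m => primesOne (q ^ 2) (X / m) :
        Finset ((_ : ℕ) × ℕ)) := by
    rintro ⟨m, p⟩ h ⟨m', p'⟩ h' heq
    simp only [Finset.coe_sigma, Set.mem_sigma_iff, Finset.mem_coe] at h h' heq
    have a := hP m h.1 p h.2
    have a' := hP m' h'.1 p' h'.2
    have b' := hE m' h'.1
    have hpp : p = p' := by
      have : p ∣ m' * p' := heq ▸ dvd_mul_left p m
      rcases (Nat.Prime.dvd_mul a.2.2.1).1 this with hd | hd
      · have : (p : ℝ) ≤ m' := by exact_mod_cast Nat.le_of_dvd b'.1 hd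
        nlinarith [a.1, b'.2.1]
      · exact (Nat.prime_dvd_prime_iff_eq a.2.2.1 a'.2.2.1).1 hd
    subst hpp
    have := Nat.eq_of_mul_eq_mul_right a.2.2.1.pos heq
    subst this
    rfl
  have hsub : ((elemsUpTo onePrimes q).sigma fun m => primesOne (q ^ 2) (X / m)).image
      (fun x : (_ : ℕ) × ℕ => x.1 * x.2) ⊆ elemsUpTo sumTwoSq X := by
    intro n hn
    obtain ⟨⟨m, p⟩, hmp, rfl⟩ := Finset.mem_image.1 hn
    rw [Finset.mem_sigma] at hmp
    have a := hP m hmp.1 p hmp.2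
    have b := hE m hmp.1
    have hm0 : (0 : ℝ) < m := by exact_mod_cast b.1
    rw [mem_elemsUpTo hX0.le]
    refine ⟨Nat.mul_pos b.1 a.2.2.1.pos, ?_, onePrimes_subset_sumTwoSq
      (onePrimes_mul b.2.2 (onePrimes_prime a.2.2.1 a.2.2.2))⟩
    have := a.2.1
    rw [le_div_iff₀ hm0] at this
    push_cast; linarith
  have h1 := Finset.card_le_card hsub
  rw [Finset.card_image_of_injOn hinj, Finset.card_sigma] at h1
  refine le_trans ?_ (Nat.cast_le.2 h1)
  rw [harmUpTo, Finset.mul_sum, Nat.cast_sum]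
  exact Finset.sum_le_sum hcard

theorem exists_card_sumTwoSq_ge :
    ∃ c : ℝ, 0 < c ∧ ∀ᶠ X : ℝ in atTop,
      c * X / Real.log X * harmUpTo onePrimes (X ^ 2) ≤ ((elemsUpTo sumTwoSq X).card : ℝ) := by
  obtain ⟨c, hc, h1⟩ := exists_card_sumTwoSq_ge_aux
  obtain ⟨C, hC, Y₁, hY₁, h2⟩ := exists_harm_onePrimes_le_of_log_le
  refine ⟨c / C, by positivity, ?_⟩
  have hev := (tendsto_rpow_atTop (show (0 : ℝ) < 1 / 4 by norm_num)).eventually_ge_atTop Y₁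
  filter_upwards [h1, hev, eventually_gt_atTop 1] with X a b hX
  have hX0 : 0 < X := by linarith
  refine le_trans ?_ a
  have := h2 _ (X ^ 2) b (by positivity) (by rw [Real.log_pow, Real.log_rpow hX0]; push_cast; linarith)
  have hL := Real.log_pos hX
  calc c / C * X / Real.log X * harmUpTo onePrimes (X ^ 2)
      ≤ c / C * X / Real.log X * (C * harmUpTo onePrimes (X ^ (1 / 4 : ℝ))) := by gcongr
    _ = _ := by field_simp

theorem exists_card_sumTwoSq_ge_rpow :
    ∃ c : ℝ, 0 < c ∧ ∀ᶠ X : ℝ in atTop,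
      c * X * Real.log X ^ (-(21 / 25) : ℝ) ≤ ((elemsUpTo sumTwoSq X).card : ℝ) := by
  obtain ⟨c, hc, h1⟩ := exists_card_sumTwoSq_ge
  obtain ⟨c', hc', Y₁, hY₁, h2⟩ := exists_harm_onePrimes_ge
  refine ⟨c * c', by positivity, ?_⟩
  filter_upwards [h1, eventually_ge_atTop Y₁] with X a hX
  have hX1 : 1 < X := by linarith
  refine le_trans ?_ a
  have hL := Real.log_pos hX1
  have := (h2 X hX).trans (harmUpTo_mono (D := onePrimes) le_rfl
    (le_self_pow₀ hX1.le (by norm_num : 2 ≠ 0)))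
  calc c * c' * X * Real.log X ^ (-(21 / 25) : ℝ)
      = c * X / Real.log X * (c' * Real.log X ^ (4 / 25 : ℝ)) := by
        rw [show (-(21 / 25) : ℝ) = 4 / 25 - 1 by norm_num, Real.rpow_sub_one hL.ne']; ring
    _ ≤ _ := by gcongr

theorem sum_inv_sq_ge_le {K : ℝ} (hK : 1 ≤ K) (s : Finset ℕ) (hs : ∀ k ∈ s, K ≤ (k : ℝ)) :
    ∑ k ∈ s, (1 : ℝ) / (k : ℝ) ^ 2 ≤ 2 / K := by
  obtain ⟨j, hj⟩ : ∃ j, ⌈K⌉₊ = j + 1 :=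
    ⟨⌈K⌉₊ - 1, by have := Nat.ceil_pos.2 (by linarith : 0 < K); omega⟩
  have h := sum_Ioo_inv_sq_le (α := ℝ) j (s.sup id + 1)
  have h2 : (2 : ℝ) / (j + 1) ≤ 2 / K := by
    have : K ≤ j + 1 := by
      have := Nat.le_ceil K
      rw [hj] at this; exact_mod_cast this
    gcongr
  refine le_trans ?_ (h.trans h2)
  simp only [one_div]
  refine Finset.sum_le_sum_of_subset_of_nonneg (fun k hk => ?_) fun _ _ _ => by positivity
  rw [Finset.mem_Ioo]
  have := Nat.ceil_le.2 (hs k hk)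
  have h3 := Finset.le_sup (f := id) hk
  simp only [id] at h3
  omega

/-- Transfer of counting bounds through the representation `n = δ k² u`. -/
theorem card_le_of_forall_eq_mul (A : Set ℕ) {X M K : ℝ} (hX : 16 ≤ X) (hM : 0 ≤ M) (hK : 1 ≤ K)
    (hA : ∀ Z : ℝ, Real.sqrt X ≤ Z → Z ≤ X → ((elemsUpTo A Z).card : ℝ) ≤ M * Z)
    (E : Finset ℕ)
    (hE : ∀ n ∈ E, 0 < n ∧ (n : ℝ) ≤ X ∧ ∃ δ k u : ℕ, (δ = 1 ∨ δ = 2) ∧ 0 < k ∧ K ≤ k ∧ u ∈ A ∧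
      n = δ * k ^ 2 * u) :
    (E.card : ℝ) ≤ 4 * M * X / K + 4 * X ^ (7 / 8 : ℝ) := by
  classical
  have hX0 : 0 < X := by linarith
  have hX1 : 1 ≤ X := by linarith
  set q := X ^ (1 / 8 : ℝ) with hq
  have hq1 : 1 ≤ q := Real.one_le_rpow hX1 (by norm_num)
  have hX8 : X = q ^ 8 := by
    rw [hq, ← Real.rpow_natCast, ← Real.rpow_mul hX0.le]; norm_num
  have hq7 : X ^ (7 / 8 : ℝ) = q ^ 7 := by
    rw [hq, ← Real.rpow_natCast, ← Real.rpow_mul hX0.le]; norm_num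
  have hsq : Real.sqrt X = q ^ 4 := by
    rw [Real.sqrt_eq_iff_mul_self_eq hX0.le (by positivity), hX8]; ring
  set T := ({1, 2} : Finset ℕ) ×ˢ ((Finset.Icc 1 ⌊X⌋₊).filter fun k : ℕ => K ≤ (k : ℝ)) with hT
  have hTm : ∀ t ∈ T, (t.1 = 1 ∨ t.1 = 2) ∧ 1 ≤ t.2 ∧ K ≤ (t.2 : ℝ) := by
    intro t ht
    simp only [hT, Finset.mem_product, Finset.mem_insert, Finset.mem_singleton, Finset.mem_filter,
      Finset.mem_Icc] at ht
    exact ⟨ht.1, ht.2.1.1, ht.2.2⟩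
  have hsub : E ⊆ T.biUnion fun t =>
      (elemsUpTo A (X / (t.1 * t.2 ^ 2 : ℕ))).image fun u => t.1 * t.2 ^ 2 * u := by
    intro n hn
    obtain ⟨h0, h1, δ, k, u, hδ, hk0, hkK, hu, rfl⟩ := hE n hn
    have hδ0 : 0 < δ := by omega
    have hu0 : 0 < u := Nat.pos_of_mul_pos_left h0
    rw [Finset.mem_biUnion]
    refine ⟨(δ, k), ?_, Finset.mem_image.2 ⟨u, ?_, rfl⟩⟩
    · simp only [hT, Finset.mem_product, Finset.mem_insert, Finset.mem_singleton,
        Finset.mem_filter, Finset.mem_Icc]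
      refine ⟨hδ, ⟨hk0, Nat.le_floor (le_trans ?_ h1)⟩, hkK⟩
      have : k ≤ δ * k ^ 2 * u := by
        calc k ≤ k ^ 2 := Nat.le_self_pow (by norm_num) k
          _ ≤ δ * k ^ 2 := Nat.le_mul_of_pos_left _ hδ0
          _ ≤ _ := Nat.le_mul_of_pos_right _ hu0
      exact_mod_cast this
    · rw [mem_elemsUpTo (by positivity)]
      refine ⟨hu0, ?_, hu⟩
      have : (0 : ℝ) < (δ * k ^ 2 : ℕ) := by exact_mod_cast Nat.mul_pos hδ0 (pow_pos hk0 2)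
      rw [le_div_iff₀ this]
      push_cast at h1 ⊢; linarith
  have h1 : (E.card : ℝ) ≤ ∑ t ∈ T, ((elemsUpTo A (X / (t.1 * t.2 ^ 2 : ℕ))).card : ℝ) := by
    have := (Finset.card_le_card hsub).trans Finset.card_biUnion_le
    refine le_trans (Nat.cast_le.2 this) ?_
    rw [Nat.cast_sum]
    exact Finset.sum_le_sum fun t _ => Nat.cast_le.2 Finset.card_image_le
  have h2 : ∀ t ∈ T, ((elemsUpTo A (X / (t.1 * t.2 ^ 2 : ℕ))).card : ℝ) ≤
      M * X * (1 / (t.2 : ℝ) ^ 2) + if q ≤ (t.2 : ℝ) then X * (1 / (t.2 : ℝ) ^ 2) else 0 := by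
    intro t ht
    obtain ⟨hδ, hk, -⟩ := hTm t ht
    have hk1 : (1 : ℝ) ≤ t.2 := by exact_mod_cast hk
    have hδ1 : (1 : ℝ) ≤ t.1 := by rcases hδ with h | h <;> rw [h] <;> norm_num
    have hδ2 : (t.1 : ℝ) ≤ 2 := by rcases hδ with h | h <;> rw [h] <;> norm_num
    have hw : X / (t.1 * t.2 ^ 2 : ℕ) ≤ X * (1 / (t.2 : ℝ) ^ 2) := by
      rw [mul_one_div]; push_cast
      gcongr
      exact le_mul_of_one_le_left (by positivity) hδ1
    split_ifs with hqk
    · have : ((elemsUpTo A (X / (t.1 * t.2 ^ 2 : ℕ))).card : ℝ) ≤ X / (t.1 * t.2 ^ 2 : ℕ) := by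
        have : (elemsUpTo A (X / (t.1 * t.2 ^ 2 : ℕ))).card ≤ ⌊X / (t.1 * t.2 ^ 2 : ℕ)⌋₊ := by
          refine (Finset.card_filter_le _ _).trans ?_
          simp
        exact (Nat.cast_le.2 this).trans (Nat.floor_le (by positivity))
      have : 0 ≤ M * X * (1 / (t.2 : ℝ) ^ 2) := by positivity
      linarith
    · push Not at hqk
      have hZ1 : Real.sqrt X ≤ X / (t.1 * t.2 ^ 2 : ℕ) := by
        have hw0 : (0 : ℝ) < (t.1 * t.2 ^ 2 : ℕ) := by push_cast; positivity
        rw [le_div_iff₀ hw0, hsq, hX8]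
        push_cast
        have hq2 : 2 ≤ q ^ 2 := by
          by_contra hlt
          push Not at hlt
          have : q ^ 8 < 16 := by
            calc q ^ 8 = (q ^ 2) ^ 4 := by ring
              _ < 2 ^ 4 := by gcongr
              _ = 16 := by norm_num
          linarith
        calc q ^ 4 * (t.1 * (t.2 : ℝ) ^ 2) ≤ q ^ 4 * (q ^ 2 * q ^ 2) := by
              gcongr
              linarith
          _ = q ^ 8 := by ring
      have hZ2 : X / (t.1 * t.2 ^ 2 : ℕ) ≤ X := by
        refine div_le_self hX0.le ?_
        push_cast
        nlinarith
      have := hA _ hZ1 hZ2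
      rw [add_zero, mul_assoc]
      exact this.trans (by gcongr)
  refine h1.trans ((Finset.sum_le_sum h2).trans ?_)
  rw [Finset.sum_add_distrib, hT, Finset.sum_product, Finset.sum_product]
  simp only [Finset.sum_const, Finset.card_pair (show (1 : ℕ) ≠ 2 by norm_num), nsmul_eq_mul]
  rw [← Finset.mul_sum, ← Finset.sum_filter, ← Finset.mul_sum]
  have b1 := sum_inv_sq_ge_le hK ((Finset.Icc 1 ⌊X⌋₊).filter fun k : ℕ => K ≤ (k : ℝ))
    (fun k hk => (Finset.mem_filter.1 hk).2)
  have b2 := sum_inv_sq_ge_le hq1 (((Finset.Icc 1 ⌊X⌋₊).filter fun k : ℕ => K ≤ (k : ℝ)).filter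
    fun k : ℕ => q ≤ (k : ℝ)) (fun k hk => (Finset.mem_filter.1 hk).2)
  have c1 := mul_le_mul_of_nonneg_left b1 (show 0 ≤ M * X by positivity)
  have c2 := mul_le_mul_of_nonneg_left b2 hX0.le
  have e1 : X * (2 / q) = 2 * q ^ 7 := by rw [hX8]; field_simp
  have e2 : M * X * (2 / K) = 2 * M * X / K := by ring
  have e3 : 4 * M * X / K = 2 * (2 * M * X / K) := by ring
  rw [hq7, e3]
  push_cast
  linarith

theorem sumTwoSq_eq_mul_squarefree {n : ℕ} (hn : n ∈ sumTwoSq) :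
    ∃ δ k u : ℕ, (δ = 1 ∨ δ = 2) ∧ 0 < k ∧ u ∈ onePrimes ∧ Squarefree u ∧ n = δ * k ^ 2 * u := by
  obtain ⟨δ, k, u, hδ, hk, hu, rfl⟩ := sumTwoSq_eq_mul hn
  obtain ⟨a, b, hab, ha⟩ := Nat.sq_mul_squarefree u
  have hb0 : b ≠ 0 := by rintro rfl; simp at hab; exact hu.1 hab.symm
  refine ⟨δ, k * b, a, hδ, by positivity, onePrimes_of_dvd hu ⟨b ^ 2, by rw [← hab]; ring⟩, ha, ?_⟩
  rw [← hab]; ring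

/-- Elements of `onePrimes` whose `y`-smooth part is large. -/
def smoothSet (y b : ℝ) : Set ℕ :=
  {u | u ∈ onePrimes ∧ b ≤ ∑ p ∈ (primesOne 0 y).filter (· ∣ u), Real.log p}

/-- Elements of `onePrimes` with fewer than `k` prime factors above `y`. -/
def fewSet (y : ℝ) (k : ℕ) : Set ℕ :=
  {u | u ∈ onePrimes ∧ (u.primeFactors.filter fun p : ℕ => y < p).card < k}

theorem one_lt_sqrt_of_one_lt {X : ℝ} (hX : 1 < X) : 1 < Real.sqrt X := by
  rw [Real.lt_sqrt (by norm_num)]; simpa using hX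

theorem card_elemsUpTo_onePrimes_le {X Z : ℝ} (hX : 1 < X) (h1 : Real.sqrt X ≤ Z) (h2 : Z ≤ X) :
    ((elemsUpTo onePrimes Z).card : ℝ) ≤ 28 / Real.log X * harmUpTo onePrimes X * Z := by
  have hl : 0 < Real.log X := Real.log_pos hX
  have hZ : 1 < Z := (one_lt_sqrt_of_one_lt hX).trans_le h1
  have hlZ : Real.log X / 2 ≤ Real.log Z := by
    rw [← Real.log_sqrt (by linarith)]
    exact Real.log_le_log (Real.sqrt_pos.2 (by linarith)) h1
  have h := card_elemsUpTo_le_harm (fun n hn d hd => onePrimes_of_dvd hn hd) one_mem_onePrimes hZ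
  refine h.trans ?_
  have a := harmUpTo_mono (le_refl onePrimes) h2
  have a0 := harmUpTo_nonneg onePrimes Z
  calc 14 * Z / Real.log Z * harmUpTo onePrimes Z
      ≤ 14 * Z / (Real.log X / 2) * harmUpTo onePrimes X := by gcongr
    _ = _ := by field_simp; ring

theorem exists_card_smoothSet_le :
    ∃ C : ℝ, 0 ≤ C ∧ ∀ X y b Z : ℝ, 1 < X → 1 ≤ y → y ^ 4 ≤ X → 0 < b → Real.sqrt X ≤ Z → Z ≤ X →
      ((elemsUpTo (smoothSet y b) Z).card : ℝ) ≤
        56 * (Real.log y + C) / (b * Real.log X) * harmUpTo onePrimes X * Z := by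
  classical
  obtain ⟨C, hC, hlog⟩ := exists_sum_primesOne_log_div
  refine ⟨C, hC, fun X y b Z hX hy hyX hb h1 h2 => ?_⟩
  have hl : 0 < Real.log X := Real.log_pos hX
  have hX0 : 0 < X := by linarith
  have hZ : 1 < Z := (one_lt_sqrt_of_one_lt hX).trans_le h1
  have hlZ : Real.log X / 2 ≤ Real.log Z := by
    rw [← Real.log_sqrt (by linarith)]
    exact Real.log_le_log (Real.sqrt_pos.2 (by linarith)) h1
  have hly : 4 * Real.log y ≤ Real.log X := by
    have := Real.log_le_log (by positivity) hyX
    rwa [Real.log_pow] at this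
  have hly0 := Real.log_nonneg hy
  set H := harmUpTo onePrimes X with hH
  have hH0 : 0 ≤ H := harmUpTo_nonneg _ _
  have s1 : b * ((elemsUpTo (smoothSet y b) Z).card : ℝ) ≤
      ∑ p ∈ primesOne 0 y, Real.log p * ((elemsUpTo onePrimes (Z / p)).card : ℝ) := by
    calc b * ((elemsUpTo (smoothSet y b) Z).card : ℝ)
        = ∑ u ∈ elemsUpTo (smoothSet y b) Z, b := by rw [Finset.sum_const, nsmul_eq_mul, mul_comm]
      _ ≤ ∑ u ∈ elemsUpTo (smoothSet y b) Z, ∑ p ∈ primesOne 0 y,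
            if p ∣ u then Real.log p else 0 := by
          refine Finset.sum_le_sum fun u hu => ?_
          rw [← Finset.sum_filter]
          exact ((mem_elemsUpTo (by linarith)).1 hu).2.2.2
      _ = ∑ p ∈ primesOne 0 y, ∑ u ∈ elemsUpTo (smoothSet y b) Z,
            if p ∣ u then Real.log p else 0 := Finset.sum_comm
      _ ≤ _ := by
          refine Finset.sum_le_sum fun p hp => ?_
          have hpp := (prime_of_mem_primesOne hp).1
          have hp0 : (0 : ℝ) < p := by exact_mod_cast hpp.pos
          rw [← Finset.sum_filter, Finset.sum_const, nsmul_eq_mul, mul_comm]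
          have hlp : 0 ≤ Real.log p := Real.log_nonneg (by exact_mod_cast hpp.one_le)
          refine mul_le_mul_of_nonneg_left ?_ hlp
          refine Nat.cast_le.2 (Finset.card_le_card_of_injOn (fun u => u / p) ?_ ?_)
          · intro u hu
            obtain ⟨hu1, v, rfl⟩ := Finset.mem_filter.1 hu
            obtain ⟨hu2, hu3, hu4⟩ := (mem_elemsUpTo (by linarith)).1 hu1
            rw [Finset.mem_coe, mem_elemsUpTo (by positivity)]
            simp only [Nat.mul_div_cancel_left _ hpp.pos]
            refine ⟨Nat.pos_of_mul_pos_left hu2, ?_, onePrimes_of_dvd hu4.1 ⟨p, mul_comm _ _⟩⟩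
            rw [le_div_iff₀ hp0]
            push_cast at hu3; linarith
          · intro u hu v hv huv
            obtain ⟨-, u', rfl⟩ := Finset.mem_filter.1 hu
            obtain ⟨-, v', rfl⟩ := Finset.mem_filter.1 hv
            simp only [Nat.mul_div_cancel_left _ hpp.pos] at huv
            rw [huv]
  have s2 : ∀ p ∈ primesOne 0 y, Real.log p * ((elemsUpTo onePrimes (Z / p)).card : ℝ) ≤
      56 * Z / Real.log X * H * (Real.log p / p) := by
    intro p hp
    obtain ⟨hp0, hpy, hpp, -⟩ := (mem_primesOne le_rfl (by linarith)).1 hp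
    have hp1 : (1 : ℝ) ≤ p := by exact_mod_cast hpp.one_le
    have hlp : Real.log p ≤ Real.log y := Real.log_le_log hp0 hpy
    have hlp0 : 0 ≤ Real.log p := Real.log_nonneg hp1
    have hlog : Real.log X / 4 ≤ Real.log (Z / p) := by
      rw [Real.log_div (by linarith) hp0.ne']; linarith
    have hZp : 1 < Z / p := by
      by_contra hlt
      have := Real.log_nonpos (by positivity) (not_lt.1 hlt)
      linarith
    have h := card_elemsUpTo_le_harm (fun n hn d hd => onePrimes_of_dvd hn hd) one_mem_onePrimes hZp
    have a : harmUpTo onePrimes (Z / p) ≤ H :=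
      harmUpTo_mono le_rfl ((div_le_self (by linarith) hp1).trans h2)
    have a0 := harmUpTo_nonneg onePrimes (Z / p)
    calc Real.log p * ((elemsUpTo onePrimes (Z / p)).card : ℝ)
        ≤ Real.log p * (14 * (Z / p) / (Real.log X / 4) * H) := by
          refine mul_le_mul_of_nonneg_left (h.trans ?_) hlp0
          gcongr
      _ = _ := by field_simp; ring
  have s3 : ∑ p ∈ primesOne 0 y, Real.log p / p ≤ Real.log y + C := by
    have := (abs_le.1 (hlog y hy)).2
    linarith
  have s4 := s1.trans (Finset.sum_le_sum s2)
  rw [← Finset.mul_sum] at s4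
  have s5 := s4.trans (mul_le_mul_of_nonneg_left s3 (by positivity))
  rw [← le_div_iff₀' hb] at s5
  refine s5.trans (le_of_eq ?_)
  field_simp

theorem div_four_le_sum_primesOne_inv :
    ∃ Y₀ : ℝ, 1 < Y₀ ∧ ∀ (y X : ℝ) (j : ℕ), Y₀ ≤ y → y ^ (3 ^ j) ≤ X →
      (j : ℝ) / 4 ≤ ∑ p ∈ primesOne y X, (1 : ℝ) / p := by
  obtain ⟨Y₀, hY₀, h⟩ := exists_sum_primesOne_inv_ge
  refine ⟨Y₀, hY₀, fun y X j hy hX => ?_⟩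
  have hy1 : 1 ≤ y := hY₀.le.trans hy
  induction j generalizing X with
  | zero => simp; exact Finset.sum_nonneg fun _ _ => by positivity
  | succ j ih =>
    have a := ih (y ^ 3 ^ j) le_rfl
    have b := h (y ^ 3 ^ j) (hy.trans (le_self_pow₀ hy1 (by positivity)))
    rw [← pow_mul, ← pow_succ] at b
    have hsub : primesOne y (y ^ 3 ^ j) ∪ primesOne (y ^ 3 ^ j) (y ^ 3 ^ (j + 1)) ⊆
        primesOne y X := by
      intro p hp
      have hyj : y ^ 3 ^ j ≤ y ^ 3 ^ (j + 1) := pow_le_pow_right₀ hy1 (by gcongr <;> norm_num)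
      have hyj' : y ≤ y ^ 3 ^ j := le_self_pow₀ hy1 (by positivity)
      rw [Finset.mem_union, mem_primesOne (by linarith) (by positivity),
        mem_primesOne (by positivity) (by positivity)] at hp
      rw [mem_primesOne (by linarith) (by linarith)]
      rcases hp with hp | hp
      · exact ⟨hp.1, by linarith, hp.2.2⟩
      · exact ⟨by linarith, by linarith, hp.2.2⟩
    have hdis : Disjoint (primesOne y (y ^ 3 ^ j)) (primesOne (y ^ 3 ^ j) (y ^ 3 ^ (j + 1))) := by
      rw [Finset.disjoint_left]
      intro p hp hq
      rw [mem_primesOne (by linarith) (by positivity)] at hp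
      rw [mem_primesOne (by positivity) (by positivity)] at hq
      linarith
    have := Finset.sum_le_sum_of_subset_of_nonneg (f := fun p : ℕ => (1 : ℝ) / p) hsub
      fun _ _ _ => by positivity
    rw [Finset.sum_union hdis] at this
    push_cast
    linarith

theorem fewSet_dvd {y : ℝ} {k : ℕ} {n d : ℕ} (hn : n ∈ fewSet y k) (hd : d ∣ n) : d ∈ fewSet y k :=
  ⟨onePrimes_of_dvd hn.1 hd, (Finset.card_le_card
    (Finset.filter_subset_filter _ (Nat.primeFactors_mono hd hn.1.1))).trans_lt hn.2⟩

theorem harm_fewSet_mul_le {y X : ℝ} {k : ℕ} (hy : 0 ≤ y) (hX : 1 ≤ X) :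
    harmUpTo (fewSet y k) X * ∑ p ∈ primesOne y X, (1 : ℝ) / p ≤
      k * harmUpTo onePrimes (X ^ 2) := by
  classical
  have hX0 : 0 ≤ X := by linarith
  rw [harmUpTo, Finset.sum_mul_sum, ← Finset.sum_product']
  set s := elemsUpTo (fewSet y k) X ×ˢ primesOne y X with hs
  have e : ∑ t ∈ s, (1 : ℝ) / t.1 * (1 / t.2) =
      ∑ t ∈ s, (fun n : ℕ => (1 : ℝ) / n) (t.1 * t.2) := by
    refine Finset.sum_congr rfl fun t _ => ?_
    push_cast; rw [one_div_mul_one_div]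
  have hm : ∀ t ∈ s, (t.1 ∈ fewSet y k ∧ 0 < t.1 ∧ (t.1 : ℝ) ≤ X) ∧
      (y < t.2 ∧ (t.2 : ℝ) ≤ X ∧ t.2.Prime ∧ t.2 % 4 = 1) := by
    intro t ht
    rw [hs, Finset.mem_product, mem_elemsUpTo hX0, mem_primesOne hy hX0] at ht
    tauto
  rw [e, Finset.sum_comp (fun n : ℕ => (1 : ℝ) / n) (fun t : ℕ × ℕ => t.1 * t.2)]
  have hsub : s.image (fun t : ℕ × ℕ => t.1 * t.2) ⊆ elemsUpTo onePrimes (X ^ 2) := by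
    intro n hn
    obtain ⟨t, ht, rfl⟩ := Finset.mem_image.1 hn
    obtain ⟨⟨a1, a2, a3⟩, b1, b2, b3, b4⟩ := hm t ht
    rw [mem_elemsUpTo (by positivity)]
    refine ⟨Nat.mul_pos a2 b3.pos, ?_, onePrimes_mul a1.1 (onePrimes_prime b3 b4)⟩
    push_cast
    rw [pow_two]
    gcongr
  have hcard : ∀ n ∈ s.image (fun t : ℕ × ℕ => t.1 * t.2),
      (s.filter fun t => t.1 * t.2 = n).card ≤ k := by
    intro n hn
    obtain ⟨t, ht, rfl⟩ := Finset.mem_image.1 hn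
    obtain ⟨⟨a1, a2, a3⟩, b1, b2, b3, b4⟩ := hm t ht
    have h1 : (s.filter fun t' => t'.1 * t'.2 = t.1 * t.2).card ≤
        ((t.1 * t.2).primeFactors.filter fun p : ℕ => y < p).card := by
      refine Finset.card_le_card_of_injOn Prod.snd ?_ ?_
      · intro t' ht'
        obtain ⟨ht1, ht2⟩ := Finset.mem_filter.1 ht'
        obtain ⟨⟨c1, c2, c3⟩, d1, d2, d3, d4⟩ := hm t' ht1
        rw [Finset.mem_coe, Finset.mem_filter, Nat.mem_primeFactors]
        exact ⟨⟨d3, ⟨t'.1, by rw [← ht2, mul_comm]⟩, (Nat.mul_pos a2 b3.pos).ne'⟩, d1⟩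
      · intro t1 h1 t2 h2 h12
        obtain ⟨h11, h13⟩ := Finset.mem_filter.1 h1
        obtain ⟨h21, h23⟩ := Finset.mem_filter.1 h2
        have := (hm t1 h11).2.2.2.1.pos
        refine Prod.ext ?_ h12
        rw [← h23, h12] at h13
        rw [h12] at this
        exact Nat.eq_of_mul_eq_mul_right this h13
    refine h1.trans ?_
    rw [Nat.primeFactors_mul a2.ne' b3.ne_zero, Finset.filter_union]
    refine (Finset.card_union_le _ _).trans ?_
    have h2 : (t.2.primeFactors.filter fun p : ℕ => y < p).card ≤ 1 := by
      refine (Finset.card_filter_le _ _).trans ?_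
      rw [b3.primeFactors]; simp
    have := a1.2
    omega
  calc ∑ n ∈ s.image (fun t : ℕ × ℕ => t.1 * t.2),
        (s.filter fun t => t.1 * t.2 = n).card • ((1 : ℝ) / n)
      ≤ ∑ n ∈ s.image (fun t : ℕ × ℕ => t.1 * t.2), (k : ℝ) * (1 / n) := by
        refine Finset.sum_le_sum fun n hn => ?_
        rw [nsmul_eq_mul]
        have : ((s.filter fun t => t.1 * t.2 = n).card : ℝ) ≤ k := by exact_mod_cast hcard n hn
        gcongr
    _ = k * ∑ n ∈ s.image (fun t : ℕ × ℕ => t.1 * t.2), (1 : ℝ) / n := by rw [Finset.mul_sum]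
    _ ≤ _ := by
        gcongr
        exact Finset.sum_le_sum_of_subset_of_nonneg hsub fun _ _ _ => by positivity

theorem exists_card_fewSet_le :
    ∃ Y₀ : ℝ, 1 < Y₀ ∧ ∀ (X y Z : ℝ) (k j : ℕ), 1 < X → Y₀ ≤ y → y ^ (3 ^ j) ≤ X → 0 < k → 0 < j →
      Real.sqrt X ≤ Z → Z ≤ X →
      ((elemsUpTo (fewSet y k) Z).card : ℝ) ≤
        112 * k / (j * Real.log X) * harmUpTo onePrimes (X ^ 2) * Z := by
  obtain ⟨Y₀, hY₀, h⟩ := div_four_le_sum_primesOne_inv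
  refine ⟨Y₀, hY₀, fun X y Z k j hX hy hyX hk hj h1 h2 => ?_⟩
  have hl : 0 < Real.log X := Real.log_pos hX
  have hZ : 1 < Z := (one_lt_sqrt_of_one_lt hX).trans_le h1
  have hlZ : Real.log X / 2 ≤ Real.log Z := by
    rw [← Real.log_sqrt (by linarith)]
    exact Real.log_le_log (Real.sqrt_pos.2 (by linarith)) h1
  have hmem : 1 ∈ fewSet y k := ⟨one_mem_onePrimes, by simpa using hk⟩
  have h3 := card_elemsUpTo_le_harm (fun n hn d hd => fewSet_dvd hn hd) hmem hZ
  have h4 := harm_fewSet_mul_le (k := k) (show 0 ≤ y by linarith) hX.le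
  have h5 := h y X j hy hyX
  have h6 := harmUpTo_nonneg (fewSet y k) X
  have hj0 : (0 : ℝ) < j := by exact_mod_cast hj
  have h7 : harmUpTo (fewSet y k) X ≤ 4 * k * harmUpTo onePrimes (X ^ 2) / j := by
    rw [le_div_iff₀ hj0]
    have := mul_le_mul_of_nonneg_left h5 h6
    linarith
  have h8 := (harmUpTo_mono (le_refl (fewSet y k)) h2).trans h7
  have h9 := harmUpTo_nonneg (fewSet y k) Z
  have h10 := harmUpTo_nonneg onePrimes (X ^ 2)
  calc _ ≤ _ := h3
    _ ≤ 14 * Z / (Real.log X / 2) * (4 * k * harmUpTo onePrimes (X ^ 2) / j) := by gcongr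
    _ = _ := by field_simp; ring

/-- Splitting off the large primes: `n = m ∏ p` over a set `K` of at least `k` primes congruent to
one modulo four and larger than `y`, none dividing `m`, with `m ≤ W`. -/
def LargePrimes (y W : ℝ) (k n : ℕ) : Prop :=
  ∃ (m : ℕ) (K : Finset ℕ), n = m * ∏ p ∈ K, p ∧ 0 < m ∧ (m : ℝ) ≤ W ∧ k ≤ K.card ∧
    ∀ p ∈ K, p.Prime ∧ p % 4 = 1 ∧ y < p ∧ ¬ p ∣ m

/-- A family of sets of integers negligible with respect to the sums of two squares. -/
def Negligible (E : ℝ → Set ℕ) : Prop :=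
  ∀ η : ℝ, 0 < η → ∀ᶠ X : ℝ in atTop,
    ((elemsUpTo (E X) X).card : ℝ) ≤ η * ((elemsUpTo sumTwoSq X).card : ℝ)

theorem card_elemsUpTo_union_le (E F : Set ℕ) {X : ℝ} (hX : 0 ≤ X) :
    (elemsUpTo (E ∪ F) X).card ≤ (elemsUpTo E X).card + (elemsUpTo F X).card := by
  classical
  refine (Finset.card_le_card fun n hn => ?_).trans (Finset.card_union_le _ _)
  rw [mem_elemsUpTo hX] at hn
  rw [Finset.mem_union, mem_elemsUpTo hX, mem_elemsUpTo hX]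
  rcases hn with ⟨h1, h2, h3 | h3⟩
  · exact Or.inl ⟨h1, h2, h3⟩
  · exact Or.inr ⟨h1, h2, h3⟩

theorem Negligible.union {E F : ℝ → Set ℕ} (hE : Negligible E) (hF : Negligible F) :
    Negligible fun X => E X ∪ F X := by
  intro η hη
  filter_upwards [hE (η / 2) (by positivity), hF (η / 2) (by positivity),
    eventually_ge_atTop 0] with X h1 h2 hX
  have : ((elemsUpTo (E X ∪ F X) X).card : ℝ) ≤
      (elemsUpTo (E X) X).card + (elemsUpTo (F X) X).card := by
    exact_mod_cast card_elemsUpTo_union_le _ _ hX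
  linarith

theorem negligible_of_le_harm {E : ℝ → Set ℕ} {g : ℝ → ℝ} (hg : Tendsto g atTop (𝓝 0))
    (h : ∀ᶠ X : ℝ in atTop,
      ((elemsUpTo (E X) X).card : ℝ) ≤ g X * (X / Real.log X * harmUpTo onePrimes (X ^ 2))) : Negligible E := by
  intro η hη
  obtain ⟨c, hc, hS⟩ := exists_card_sumTwoSq_ge
  filter_upwards [h, hS, hg.eventually_le_const (show (0 : ℝ) < η * c by positivity),
    eventually_gt_atTop 1] with X h1 h2 h3 hX
  have hl := Real.log_pos hX
  have hH := harmUpTo_nonneg onePrimes (X ^ 2)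
  refine h1.trans ((mul_le_mul_of_nonneg_right h3 (by positivity)).trans ?_)
  calc η * c * (X / Real.log X * harmUpTo onePrimes (X ^ 2))
      = η * (c * X / Real.log X * harmUpTo onePrimes (X ^ 2)) := by ring
    _ ≤ _ := by gcongr

theorem negligible_of_le_rpow {E : ℝ → Set ℕ} {g : ℝ → ℝ} (hg : Tendsto g atTop (𝓝 0))
    (h : ∀ᶠ X : ℝ in atTop,
      ((elemsUpTo (E X) X).card : ℝ) ≤ g X * (X * Real.log X ^ (-(21 / 25) : ℝ))) : Negligible E := by
  intro η hη
  obtain ⟨c, hc, hS⟩ := exists_card_sumTwoSq_ge_rpow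
  filter_upwards [h, hS, hg.eventually_le_const (show (0 : ℝ) < η * c by positivity),
    eventually_gt_atTop 1] with X h1 h2 h3 hX
  have hl := Real.log_pos hX
  refine h1.trans ((mul_le_mul_of_nonneg_right h3 (by positivity)).trans ?_)
  calc η * c * (X * Real.log X ^ (-(21 / 25) : ℝ))
      = η * (c * X * Real.log X ^ (-(21 / 25) : ℝ)) := by ring
    _ ≤ _ := by gcongr

theorem sumTwoSq_cases {n : ℕ} (hn : n ∈ sumTwoSq) {y b : ℝ} (hy : 1 ≤ y) (k₀ : ℕ) :
    (∃ δ k u : ℕ, (δ = 1 ∨ δ = 2) ∧ 0 < k ∧ y ≤ k ∧ u ∈ onePrimes ∧ n = δ * k ^ 2 * u) ∨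
    (∃ δ k u : ℕ, (δ = 1 ∨ δ = 2) ∧ 0 < k ∧ u ∈ smoothSet y b ∧ n = δ * k ^ 2 * u) ∨
    (∃ δ k u : ℕ, (δ = 1 ∨ δ = 2) ∧ 0 < k ∧ u ∈ fewSet y k₀ ∧ n = δ * k ^ 2 * u) ∨
    LargePrimes y (2 * y ^ 2 * Real.exp b) k₀ n := by
  classical
  obtain ⟨δ, k, u, hδ, hk, hu, husq, rfl⟩ := sumTwoSq_eq_mul_squarefree hn
  by_cases h1 : y ≤ k
  · exact Or.inl ⟨δ, k, u, hδ, hk, h1, hu, rfl⟩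
  by_cases h2 : u ∈ smoothSet y b
  · exact Or.inr (Or.inl ⟨δ, k, u, hδ, hk, h2, rfl⟩)
  by_cases h3 : u ∈ fewSet y k₀
  · exact Or.inr (Or.inr (Or.inl ⟨δ, k, u, hδ, hk, h3, rfl⟩))
  refine Or.inr (Or.inr (Or.inr ?_))
  push Not at h1
  set s := ∏ p ∈ u.primeFactors.filter (fun p : ℕ => ¬ y < p), p with hs
  have hδ0 : 0 < δ := by omega
  have hs0 : 0 < s := Finset.prod_pos fun p hp =>
    (Nat.prime_of_mem_primeFactors (Finset.mem_filter.1 hp).1).pos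
  refine ⟨δ * k ^ 2 * s, u.primeFactors.filter fun p : ℕ => y < p, ?_, by positivity, ?_, ?_, ?_⟩
  · have := Finset.prod_filter_mul_prod_filter_not u.primeFactors (fun p : ℕ => y < p) (fun p => p)
    rw [Nat.prod_primeFactors_of_squarefree husq] at this
    rw [mul_assoc _ s, mul_comm s, this]
  · have hsm : (s : ℝ) ≤ Real.exp b := by
      rw [← Real.log_le_iff_le_exp (by exact_mod_cast hs0), hs, Nat.cast_prod, Real.log_prod]
      · have : ¬ (b ≤ ∑ p ∈ (primesOne 0 y).filter (· ∣ u), Real.log p) := fun h => h2 ⟨hu, h⟩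
        refine le_of_lt (lt_of_eq_of_lt ?_ (not_le.1 this))
        refine Finset.sum_congr ?_ fun _ _ => rfl
        ext p
        rw [Finset.mem_filter, Finset.mem_filter, mem_primesOne le_rfl (by linarith),
          Nat.mem_primeFactors, not_lt]
        constructor
        · rintro ⟨⟨a1, a2, a3⟩, a4⟩
          exact ⟨⟨by exact_mod_cast a1.pos, a4, a1, hu.2 p a1 a2⟩, a2⟩
        · rintro ⟨⟨a1, a2, a3, a4⟩, a5⟩
          exact ⟨⟨a3, a5, hu.1⟩, a2⟩
      · intro p hp
        have := (Nat.prime_of_mem_primeFactors (Finset.mem_filter.1 hp).1).ne_zero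
        exact_mod_cast this
    have hδ2 : (δ : ℝ) ≤ 2 := by rcases hδ with h | h <;> rw [h] <;> norm_num
    push_cast
    gcongr
  · by_contra hlt
    exact h3 ⟨hu, not_le.1 hlt⟩
  · intro p hp
    obtain ⟨hp1, hp2⟩ := Finset.mem_filter.1 hp
    have hpp := Nat.prime_of_mem_primeFactors hp1
    have hp4 := hu.2 p hpp (Nat.dvd_of_mem_primeFactors hp1)
    refine ⟨hpp, hp4, hp2, fun hd => ?_⟩
    rcases (Nat.Prime.dvd_mul hpp).1 hd with hd | hd
    · rcases (Nat.Prime.dvd_mul hpp).1 hd with hd | hd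
      · have := Nat.le_of_dvd hδ0 hd
        have := hpp.two_le
        omega
      · have := Nat.le_of_dvd hk (hpp.dvd_of_dvd_pow hd)
        have : (p : ℝ) ≤ k := by exact_mod_cast this
        linarith
    · obtain ⟨q, hq, hpq⟩ := (Prime.dvd_finsetProd_iff hpp.prime _).1 hd
      obtain ⟨hq1, hq2⟩ := Finset.mem_filter.1 hq
      rw [(Nat.prime_dvd_prime_iff_eq hpp (Nat.prime_of_mem_primeFactors hq1)).1 hpq] at hp2
      exact hq2 hp2

theorem exists_card_not_largePrimes_le :
    ∃ C : ℝ, 0 ≤ C ∧ ∃ Y₀ : ℝ, 1 < Y₀ ∧ ∀ (X y b : ℝ) (k₀ j : ℕ), 16 ≤ X → Y₀ ≤ y → y ^ 4 ≤ X →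
      y ^ 3 ^ j ≤ X → 0 < b → 0 < k₀ → 0 < j →
      ((elemsUpTo {n | n ∈ sumTwoSq ∧ ¬ LargePrimes y (2 * y ^ 2 * Real.exp b) k₀ n} X).card : ℝ) ≤
        (112 / y + 224 * (Real.log y + C) / b + 448 * k₀ / j +
          12 * Real.log X / X ^ (1 / 8 : ℝ)) * (X / Real.log X * harmUpTo onePrimes (X ^ 2)) := by
  classical
  obtain ⟨C, hC, hsm⟩ := exists_card_smoothSet_le
  obtain ⟨Y₀, hY₀, hfew⟩ := exists_card_fewSet_le
  refine ⟨C, hC, Y₀, hY₀, fun X y b k₀ j hX hY hy4 hyj hb hk0 hj0 => ?_⟩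
  have hX1 : 1 < X := by linarith
  have hl := Real.log_pos hX1
  have hy1 : 1 ≤ y := hY₀.le.trans hY
  set H := harmUpTo onePrimes (X ^ 2) with hH
  have hHX : harmUpTo onePrimes X ≤ H := harmUpTo_mono le_rfl (by nlinarith)
  have hH1 : 1 ≤ H := one_le_harmUpTo one_mem_onePrimes (by nlinarith)
  have hHX0 := harmUpTo_nonneg onePrimes X
  have hly := Real.log_nonneg hy1
  set S := elemsUpTo sumTwoSq X with hS
  have hmS : ∀ n ∈ S, 0 < n ∧ (n : ℝ) ≤ X ∧ n ∈ sumTwoSq := fun n hn =>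
    (mem_elemsUpTo (by linarith)).1 hn
  have b1 := card_le_of_forall_eq_mul onePrimes hX (M := 28 / Real.log X * H) (K := y)
    (by positivity) hy1 (fun Z h1 h2 => (card_elemsUpTo_onePrimes_le hX1 h1 h2).trans (by
      have : 0 ≤ Z := (Real.sqrt_nonneg X).trans h1
      gcongr))
    (S.filter fun n => ∃ δ k u : ℕ, (δ = 1 ∨ δ = 2) ∧ 0 < k ∧ y ≤ k ∧ u ∈ onePrimes ∧
      n = δ * k ^ 2 * u)
    (fun n hn => ⟨(hmS n (Finset.mem_filter.1 hn).1).1, (hmS n (Finset.mem_filter.1 hn).1).2.1,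
      (Finset.mem_filter.1 hn).2⟩)
  have b2 := card_le_of_forall_eq_mul (smoothSet y (b)) hX
    (M := 56 * (Real.log y + C) / (b * Real.log X) * H) (K := 1)
    (by positivity) le_rfl
    (fun Z h1 h2 => (hsm X y _ Z hX1 hy1 hy4 (by positivity) h1 h2).trans (by
      have : 0 ≤ Z := (Real.sqrt_nonneg X).trans h1
      gcongr))
    (S.filter fun n => ∃ δ k u : ℕ, (δ = 1 ∨ δ = 2) ∧ 0 < k ∧ u ∈ smoothSet y (b) ∧
      n = δ * k ^ 2 * u)
    (fun n hn => by
      obtain ⟨h1, δ, k, u, h2, h3, h4, h5⟩ := Finset.mem_filter.1 hn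
      exact ⟨(hmS n h1).1, (hmS n h1).2.1, δ, k, u, h2, h3, by exact_mod_cast h3, h4, h5⟩)
  have b3 := card_le_of_forall_eq_mul (fewSet y (k₀)) hX
    (M := 112 * k₀ / (j * Real.log X) * H) (K := 1)
    (by positivity) le_rfl
    (fun Z h1 h2 => hfew X y Z (k₀) (j) hX1 hY hyj hk0 hj0 h1 h2)
    (S.filter fun n => ∃ δ k u : ℕ, (δ = 1 ∨ δ = 2) ∧ 0 < k ∧ u ∈ fewSet y (k₀) ∧
      n = δ * k ^ 2 * u)
    (fun n hn => by
      obtain ⟨h1, δ, k, u, h2, h3, h4, h5⟩ := Finset.mem_filter.1 hn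
      exact ⟨(hmS n h1).1, (hmS n h1).2.1, δ, k, u, h2, h3, by exact_mod_cast h3, h4, h5⟩)
  have hsub : elemsUpTo {n | n ∈ sumTwoSq ∧ ¬ LargePrimes y (2 * y ^ 2 * Real.exp b) k₀ n} X ⊆
      (S.filter fun n => ∃ δ k u : ℕ, (δ = 1 ∨ δ = 2) ∧ 0 < k ∧ y ≤ k ∧ u ∈ onePrimes ∧
        n = δ * k ^ 2 * u) ∪ ((S.filter fun n => ∃ δ k u : ℕ, (δ = 1 ∨ δ = 2) ∧ 0 < k ∧
        u ∈ smoothSet y b ∧ n = δ * k ^ 2 * u) ∪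
      (S.filter fun n => ∃ δ k u : ℕ, (δ = 1 ∨ δ = 2) ∧ 0 < k ∧ u ∈ fewSet y k₀ ∧
        n = δ * k ^ 2 * u)) := by
    intro n hn
    obtain ⟨hn1, hn2, hn3, hn4⟩ := (mem_elemsUpTo (by linarith)).1 hn
    have hnS : n ∈ S := (mem_elemsUpTo (by linarith)).2 ⟨hn1, hn2, hn3⟩
    rw [Finset.mem_union, Finset.mem_union, Finset.mem_filter, Finset.mem_filter,
      Finset.mem_filter]
    rcases sumTwoSq_cases hn3 (b := b) hy1 k₀ with h | h | h | h
    · exact Or.inl ⟨hnS, h⟩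
    · exact Or.inr (Or.inl ⟨hnS, h⟩)
    · exact Or.inr (Or.inr ⟨hnS, h⟩)
    · exact absurd h hn4
  have hc := (Finset.card_le_card hsub).trans ((Finset.card_union_le _ _).trans
    (Nat.add_le_add_left (Finset.card_union_le _ _) _))
  have hc' := Nat.cast_le (α := ℝ).2 hc
  push_cast at hc'
  have h78 : X ^ (7 / 8 : ℝ) ≤ Real.log X / X ^ (1 / 8 : ℝ) * (X / Real.log X * H) := by
    have e : X ^ (7 / 8 : ℝ) = X / X ^ (1 / 8 : ℝ) := by
      rw [eq_div_iff (by positivity), ← Real.rpow_add (by linarith)]; norm_num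
    rw [e]
    have : Real.log X / X ^ (1 / 8 : ℝ) * (X / Real.log X * H) = X / X ^ (1 / 8 : ℝ) * H := by
      field_simp
    rw [this]
    exact le_mul_of_one_le_right (by positivity) hH1
  have hy0 : 0 < y := by linarith
  have hjr : (0 : ℝ) < j := by exact_mod_cast hj0
  have f1 : 4 * (28 / Real.log X * H) * X / y = 112 / y * (X / Real.log X * H) := by
    field_simp; norm_num
  have f2 : 4 * (56 * (Real.log y + C) / (b * Real.log X) * H) * X / 1 =
      224 * (Real.log y + C) / (b) * (X / Real.log X * H) := by
    field_simp; ring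
  have f3 : 4 * (112 * k₀ / (j * Real.log X) * H) * X / 1 =
      448 * k₀ / j * (X / Real.log X * H) := by
    field_simp; norm_num
  rw [f1] at b1
  rw [f2] at b2
  rw [f3] at b3
  have f4 : (112 / y + 224 * (Real.log y + C) / b + 448 * k₀ / j +
      12 * Real.log X / X ^ (1 / 8 : ℝ)) * (X / Real.log X * H) =
      112 / y * (X / Real.log X * H) + 224 * (Real.log y + C) / b * (X / Real.log X * H) +
      448 * k₀ / j * (X / Real.log X * H) +
      12 * (Real.log X / X ^ (1 / 8 : ℝ) * (X / Real.log X * H)) := by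
    ring
  rw [f4]
  linarith

/-- The threshold `exp ((log X)^(19/20))`. -/
def yPar (X : ℝ) : ℝ := Real.exp (Real.log X ^ (19 / 20 : ℝ))

/-- The number of large primes we insist on. -/
def kPar (X : ℝ) : ℕ := ⌈Real.sqrt (Real.log (Real.log X))⌉₊

theorem tendsto_log_log : Tendsto (fun X : ℝ => Real.log (Real.log X)) atTop atTop :=
  Real.tendsto_log_atTop.comp Real.tendsto_log_atTop

theorem tendsto_yPar : Tendsto yPar atTop atTop :=
  Real.tendsto_exp_atTop.comp
    ((tendsto_rpow_atTop (by norm_num)).comp Real.tendsto_log_atTop)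

theorem yPar_pos (X : ℝ) : 0 < yPar X := Real.exp_pos _

theorem log_yPar (X : ℝ) : Real.log (yPar X) = Real.log X ^ (19 / 20 : ℝ) := Real.log_exp _

theorem tendsto_log_yPar_div : Tendsto (fun X => Real.log (yPar X) / Real.log X) atTop (𝓝 0) := by
  have h : Tendsto (fun L : ℝ => L ^ (-(1 / 20) : ℝ)) atTop (𝓝 0) :=
    tendsto_rpow_neg_atTop (by norm_num)
  refine (h.comp Real.tendsto_log_atTop).congr' ?_
  filter_upwards [eventually_gt_atTop 1] with X hX
  have hl := Real.log_pos hX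
  rw [log_yPar, Function.comp, eq_div_iff hl.ne']
  nth_rewrite 2 [← Real.rpow_one (Real.log X)]
  rw [← Real.rpow_add hl]
  norm_num

theorem negligible_not_largePrimes {ε : ℝ} (hε : 0 < ε) :
    Negligible fun X => {n | n ∈ sumTwoSq ∧
      ¬ LargePrimes (yPar X) (2 * yPar X ^ 2 * Real.exp (ε * Real.log X)) (kPar X) n} := by
  obtain ⟨C, hC, Y₀, hY₀, hcard⟩ := exists_card_not_largePrimes_le
  set jP : ℝ → ℕ := fun X => ⌊Real.log (Real.log X) / 40⌋₊ with hjP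
  set g : ℝ → ℝ := fun X => 112 / yPar X + 224 * (Real.log (yPar X) + C) / (ε * Real.log X) +
    448 * kPar X / jP X + 12 * Real.log X / X ^ (1 / 8 : ℝ) with hg
  have hll := tendsto_log_log
  have hgl : Tendsto g atTop (𝓝 0) := by
    have t1 : Tendsto (fun X => 112 / yPar X) atTop (𝓝 0) := tendsto_yPar.const_div_atTop 112
    have t2 : Tendsto (fun X => 224 * (Real.log (yPar X) + C) / (ε * Real.log X)) atTop (𝓝 0) := by
      have := (tendsto_log_yPar_div.add (Real.tendsto_log_atTop.const_div_atTop C)).const_mul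
        (224 / ε)
      simp only [add_zero, mul_zero] at this
      refine this.congr fun X => ?_
      rw [← add_div]; ring
    have t3 : Tendsto (fun X => 448 * (kPar X : ℝ) / jP X) atTop (𝓝 0) := by
      have hk : Tendsto (fun t : ℝ => (448 * 160) / Real.sqrt t) atTop (𝓝 0) :=
        Real.tendsto_sqrt_atTop.const_div_atTop _
      refine squeeze_zero' (Eventually.of_forall fun X => by positivity) ?_ (hk.comp hll)
      filter_upwards [hll.eventually_ge_atTop 80] with X hX
      set t := Real.log (Real.log X) with ht
      have hst : 1 ≤ Real.sqrt t := by rw [Real.le_sqrt' one_pos]; linarith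
      have hsq : Real.sqrt t * Real.sqrt t = t := Real.mul_self_sqrt (by linarith)
      have a1 : (kPar X : ℝ) ≤ 2 * Real.sqrt t := by
        have := Nat.ceil_lt_add_one (Real.sqrt_nonneg t)
        rw [kPar]; linarith
      have a2 : t / 80 ≤ (jP X : ℝ) := by
        have := Nat.lt_floor_add_one (t / 40)
        simp only [hjP]; linarith
      calc 448 * (kPar X : ℝ) / jP X ≤ 448 * (2 * Real.sqrt t) / (t / 80) := by gcongr
        _ = 448 * 160 / Real.sqrt t := by
            have h0 : Real.sqrt t ≠ 0 := by positivity
            have h1 : t ≠ 0 := by linarith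
            rw [div_eq_div_iff (by positivity) h0]
            linear_combination 448 * 2 * hsq
    have t4 : Tendsto (fun X : ℝ => 12 * Real.log X / X ^ (1 / 8 : ℝ)) atTop (𝓝 0) := by
      have := ((isLittleO_log_rpow_atTop (r := 1 / 8) (by norm_num)).tendsto_div_nhds_zero).const_mul
        12
      simp only [mul_zero] at this
      exact this.congr fun X => by ring
    have := ((t1.add t2).add t3).add t4
    simp only [add_zero] at this
    exact this
  refine negligible_of_le_harm hgl ?_
  have e1 : ∀ᶠ X in atTop, yPar X ^ 4 ≤ X := by
    filter_upwards [tendsto_log_yPar_div.eventually_le_const (show (0 : ℝ) < 1 / 4 by norm_num),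
      eventually_gt_atTop 1] with X h hX
    rw [div_le_iff₀ (Real.log_pos hX)] at h
    rw [← Real.log_le_log_iff (pow_pos (yPar_pos X) _) (by linarith), Real.log_pow]
    push_cast; linarith
  have e2 : ∀ᶠ X in atTop, yPar X ^ 3 ^ jP X ≤ X := by
    filter_upwards [hll.eventually_ge_atTop 1, eventually_gt_atTop 1] with X h hX
    have hl := Real.log_pos hX
    rw [← Real.log_le_log_iff (pow_pos (yPar_pos X) _) (by linarith), Real.log_pow, log_yPar]
    have a1 : ((3 ^ jP X : ℕ) : ℝ) ≤ Real.log X ^ (1 / 20 : ℝ) := by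
      have h3 : (3 : ℝ) ≤ Real.exp 2 := by
        have := Real.add_one_le_exp (2 : ℝ)
        linarith
      push_cast
      calc (3 : ℝ) ^ jP X ≤ Real.exp 2 ^ jP X := by gcongr
        _ = Real.exp (jP X * 2) := by rw [← Real.exp_nat_mul]
        _ ≤ Real.exp (Real.log (Real.log X) * (1 / 20)) := by
            apply Real.exp_le_exp.2
            have := Nat.floor_le (show 0 ≤ Real.log (Real.log X) / 40 by linarith)
            simp only [hjP]; linarith
        _ = _ := by rw [Real.rpow_def_of_pos hl]
    calc ((3 ^ jP X : ℕ) : ℝ) * Real.log X ^ (19 / 20 : ℝ)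
        ≤ Real.log X ^ (1 / 20 : ℝ) * Real.log X ^ (19 / 20 : ℝ) := by gcongr
      _ = Real.log X := by rw [← Real.rpow_add hl]; norm_num
  filter_upwards [e1, e2, eventually_ge_atTop 16, tendsto_yPar.eventually_ge_atTop Y₀,
    hll.eventually_ge_atTop 40] with X hy4 hyj hX hY hL
  have hl : 0 < Real.log X := Real.log_pos (by linarith)
  exact hcard X _ _ _ _ hX hY hy4 hyj (mul_pos hε hl)
    (Nat.ceil_pos.2 (Real.sqrt_pos.2 (by linarith))) (Nat.floor_pos.2 (by linarith))

theorem mem_latticePts {n : ℕ} {ξ : ℤ × ℤ} : ξ ∈ latticePts n ↔ ξ.1 ^ 2 + ξ.2 ^ 2 = (n : ℤ) := by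
  rw [latticePts, Finset.mem_filter, Finset.mem_product, Finset.mem_Icc, Finset.mem_Icc]
  refine ⟨fun h => h.2, fun h => ⟨⟨⟨?_, ?_⟩, ?_, ?_⟩, h⟩⟩ <;> nlinarith

/-- The complex number attached to a lattice point. -/
def toC (ξ : ℤ × ℤ) : ℂ := ⟨ξ.1, ξ.2⟩

theorem toC_add (ξ η : ℤ × ℤ) : toC (ξ + η) = toC ξ + toC η := by
  apply Complex.ext <;> simp [toC]

theorem toC_zsmul (n : ℤ) (ξ : ℤ × ℤ) : toC (n • ξ) = n * toC ξ := by
  apply Complex.ext <;> simp [toC]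

theorem toC_zero : toC 0 = 0 := by
  apply Complex.ext <;> simp [toC]

theorem toC_eq_zero {ξ : ℤ × ℤ} : toC ξ = 0 ↔ ξ = 0 := by
  refine ⟨fun h => ?_, fun h => by rw [h, toC_zero]⟩
  have h1 := congrArg Complex.re h
  have h2 := congrArg Complex.im h
  simp only [toC, Complex.zero_re, Complex.zero_im, Int.cast_eq_zero] at h1 h2
  exact Prod.ext h1 h2

theorem norm_toC_sq (ξ : ℤ × ℤ) : ‖toC ξ‖ ^ 2 = ((ξ.1 ^ 2 + ξ.2 ^ 2 : ℤ) : ℝ) := by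
  rw [← Complex.normSq_eq_norm_sq, Complex.normSq_apply]
  push_cast [toC]; ring

theorem card_filter_abs_add_le (s : Finset ℤ) (c T : ℝ) (hT : 0 ≤ T)
    (hs : ∀ u ∈ s, |(u : ℝ) + c| ≤ T) : (s.card : ℝ) ≤ 2 * T + 1 := by
  have hsub : s ⊆ Finset.Icc ⌈-c - T⌉ ⌊-c + T⌋ := fun u hu => by
    have := abs_le.1 (hs u hu)
    rw [Finset.mem_Icc, Int.ceil_le, Int.le_floor]
    constructor <;> linarith
  have h := Finset.card_le_card hsub
  rw [Int.card_Icc] at h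
  have h2 : ((⌊-c + T⌋ + 1 - ⌈-c - T⌉).toNat : ℝ) ≤ 2 * T + 1 := by
    rcases le_total 0 (⌊-c + T⌋ + 1 - ⌈-c - T⌉) with h0 | h0
    · have e : ((⌊-c + T⌋ + 1 - ⌈-c - T⌉).toNat : ℝ) =
          ((⌊-c + T⌋ + 1 - ⌈-c - T⌉ : ℤ) : ℝ) := by
        exact_mod_cast Int.toNat_of_nonneg h0
      rw [e]
      push_cast
      have a := Int.floor_le (-c + T)
      have b := Int.le_ceil (-c - T)
      linarith
    · rw [Int.toNat_of_nonpos h0]; push_cast; linarith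
  exact le_trans (by exact_mod_cast h) h2

theorem card_strip_le (s : Finset (ℤ × ℤ)) (c R T : ℝ) (hR : 0 ≤ R) (hT : 0 ≤ T)
    (h1 : ∀ z ∈ s, |(z.2 : ℝ)| ≤ R) (h2 : ∀ z ∈ s, |(z.1 : ℝ) + c * z.2| ≤ T) :
    (s.card : ℝ) ≤ (2 * R + 1) * (2 * T + 1) := by
  classical
  rw [Finset.card_eq_sum_card_image Prod.snd s]
  have a : ∀ v ∈ s.image Prod.snd, ((s.filter fun z => z.2 = v).card : ℝ) ≤ 2 * T + 1 := by
    intro v _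
    have e : (s.filter fun z => z.2 = v).card =
        ((s.filter fun z => z.2 = v).image Prod.fst).card := by
      rw [Finset.card_image_of_injOn]
      intro x hx y hy hxy
      have hx2 := (Finset.mem_filter.1 hx).2
      have hy2 := (Finset.mem_filter.1 hy).2
      exact Prod.ext hxy (hx2.trans hy2.symm)
    rw [e]
    refine card_filter_abs_add_le _ (c * v) T hT fun u hu => ?_
    obtain ⟨z, hz, rfl⟩ := Finset.mem_image.1 hu
    obtain ⟨hz1, rfl⟩ := Finset.mem_filter.1 hz
    exact h2 z hz1
  have b : ((s.image Prod.snd).card : ℝ) ≤ 2 * R + 1 := by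
    refine card_filter_abs_add_le _ 0 R hR fun v hv => ?_
    obtain ⟨z, hz, rfl⟩ := Finset.mem_image.1 hv
    simpa using h1 z hz
  push_cast
  refine (Finset.sum_le_sum a).trans ?_
  rw [Finset.sum_const, nsmul_eq_mul]
  gcongr

theorem card_strip_swap_le (s : Finset (ℤ × ℤ)) (c R T : ℝ) (hR : 0 ≤ R) (hT : 0 ≤ T)
    (h1 : ∀ z ∈ s, |(z.1 : ℝ)| ≤ R) (h2 : ∀ z ∈ s, |(z.2 : ℝ) + c * z.1| ≤ T) :
    (s.card : ℝ) ≤ (2 * R + 1) * (2 * T + 1) := by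
  classical
  rw [← Finset.card_image_of_injective s Prod.swap_injective]
  refine card_strip_le _ c R T hR hT ?_ ?_ <;>
  · intro z hz
    obtain ⟨w, hw, rfl⟩ := Finset.mem_image.1 hz
    first | exact h1 w hw | exact h2 w hw

theorem card_near_relation_le {A B : ℂ} (hAB : ¬ (A = 0 ∧ B = 0)) {θ Y : ℝ} (hY : 1 ≤ Y)
    (hθ : 1 ≤ θ * Real.sqrt Y) (s : Finset (ℤ × ℤ))
    (h1 : ∀ z ∈ s, ‖toC z‖ ^ 2 ≤ Y)
    (h2 : ∀ z ∈ s, ‖A * toC z + B * starRingEnd ℂ (toC z)‖ ≤ θ * ‖toC z‖ * max ‖A‖ ‖B‖) :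
    (s.card : ℝ) ≤ 9 * θ * Y := by
  have hY1 : 1 ≤ Real.sqrt Y := Real.one_le_sqrt.2 hY
  have hsq : Real.sqrt Y * Real.sqrt Y = Y := Real.mul_self_sqrt (by linarith)
  have hθ0 : 0 ≤ θ := by
    by_contra h
    push Not at h
    nlinarith
  have hfin : (2 * Real.sqrt Y + 1) * (2 * (θ * Real.sqrt Y) + 1) ≤ 9 * θ * Y := by
    calc (2 * Real.sqrt Y + 1) * (2 * (θ * Real.sqrt Y) + 1)
        ≤ (3 * Real.sqrt Y) * (3 * (θ * Real.sqrt Y)) := by gcongr <;> linarith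
      _ = 9 * θ * (Real.sqrt Y * Real.sqrt Y) := by ring
      _ = _ := by rw [hsq]
  refine le_trans ?_ hfin
  set M := max ‖A‖ ‖B‖ with hM
  have hM0 : 0 < M := by
    by_contra h
    push Not at h
    have ha : ‖A‖ ≤ 0 := (le_max_left _ _).trans h
    have hb : ‖B‖ ≤ 0 := (le_max_right _ _).trans h
    exact hAB ⟨norm_le_zero_iff.1 ha, norm_le_zero_iff.1 hb⟩
  have hz : ∀ z ∈ s, ‖toC z‖ ≤ Real.sqrt Y := fun z hz => Real.le_sqrt_of_sq_le (h1 z hz)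
  have hre : ∀ z ∈ s, |(z.1 : ℝ)| ≤ Real.sqrt Y := fun z hzs =>
    (Complex.abs_re_le_norm (toC z)).trans (hz z hzs)
  have him : ∀ z ∈ s, |(z.2 : ℝ)| ≤ Real.sqrt Y := fun z hzs =>
    (Complex.abs_im_le_norm (toC z)).trans (hz z hzs)
  have hdec : ∀ z : ℤ × ℤ, A * toC z + B * starRingEnd ℂ (toC z) =
      (A + B) * ((z.1 : ℝ) : ℂ) + ((A - B) * Complex.I) * ((z.2 : ℝ) : ℂ) := by
    intro z
    have e1 : toC z = ((z.1 : ℝ) : ℂ) + ((z.2 : ℝ) : ℂ) * Complex.I := by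
      apply Complex.ext <;> simp [toC]
    rw [e1]
    simp only [map_add, map_mul, Complex.conj_ofReal, Complex.conj_I]
    ring
  have key : ∀ P W : ℂ, M ≤ ‖P‖ → ∀ a b : ℝ, ‖P * (a : ℂ) + W * (b : ℂ)‖ ≤ θ * Real.sqrt Y * M →
      |a + (W / P).re * b| ≤ θ * Real.sqrt Y := by
    intro P W hP a b hab
    have hP0 : 0 < ‖P‖ := hM0.trans_le hP
    have hPne : P ≠ 0 := norm_pos_iff.1 hP0
    have e : a + (W / P).re * b = (((a : ℂ) + W / P * (b : ℂ))).re := by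
      simp
    rw [e]
    refine (Complex.abs_re_le_norm _).trans ?_
    have e2 : (a : ℂ) + W / P * (b : ℂ) = (P * (a : ℂ) + W * (b : ℂ)) / P := by
      field_simp
    rw [e2, norm_div, div_le_iff₀ hP0]
    refine hab.trans ?_
    gcongr
  have hbd : ∀ z ∈ s, ‖(A + B) * ((z.1 : ℝ) : ℂ) + ((A - B) * Complex.I) * ((z.2 : ℝ) : ℂ)‖ ≤
      θ * Real.sqrt Y * M := by
    intro z hzs
    rw [← hdec]
    refine (h2 z hzs).trans ?_
    have := hz z hzs
    gcongr
  have hor : M ≤ ‖A + B‖ ∨ M ≤ ‖(A - B) * Complex.I‖ := by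
    rw [norm_mul, Complex.norm_I, mul_one]
    by_contra h
    push Not at h
    have ha : ‖A‖ < M := by
      have : 2 * ‖A‖ ≤ ‖A + B‖ + ‖A - B‖ := by
        have := norm_add_le (A + B) (A - B)
        rwa [show A + B + (A - B) = 2 * A by ring, norm_mul, Complex.norm_ofNat] at this
      linarith
    have hb : ‖B‖ < M := by
      have : 2 * ‖B‖ ≤ ‖A + B‖ + ‖A - B‖ := by
        have := norm_sub_le (A + B) (A - B)
        rwa [show A + B - (A - B) = 2 * B by ring, norm_mul, Complex.norm_ofNat] at this
      linarith
    exact absurd (max_lt ha hb) (lt_irrefl _)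
  rcases hor with h | h
  · exact card_strip_le s _ _ _ (by positivity) (by positivity) him
      fun z hzs => key _ _ h _ _ (hbd z hzs)
  · refine card_strip_swap_le s _ _ _ (by positivity) (by positivity) hre
      fun z hzs => key ((A - B) * Complex.I) (A + B) h _ _ ?_
    rw [add_comm]; exact hbd z hzs

/-- All integer combinations of the lattice points on a circle with coefficients bounded by `Q`. -/
def coefSums (μ Q : ℕ) : Finset (ℤ × ℤ) :=
  ((latticePts μ).pi fun _ => Finset.Icc (-(Q : ℤ)) Q).image
    fun n => ∑ α ∈ (latticePts μ).attach, n α.1 α.2 • α.1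

theorem sum_mem_coefSums {μ Q : ℕ} (n : ℤ × ℤ → ℤ) (hn : ∀ α ∈ latticePts μ, |n α| ≤ Q) :
    ∑ α ∈ latticePts μ, n α • α ∈ coefSums μ Q := by
  refine Finset.mem_image.2 ⟨fun α _ => n α, ?_, ?_⟩
  · rw [Finset.mem_pi]
    intro α hα
    rw [Finset.mem_Icc]
    exact abs_le.1 (hn α hα)
  · exact Finset.sum_attach (latticePts μ) fun α => n α • α

theorem card_coefSums_le (μ Q : ℕ) :
    (coefSums μ Q).card ≤ (2 * Q + 1) ^ (latticePts μ).card := by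
  refine Finset.card_image_le.trans ?_
  rw [Finset.card_pi, Finset.prod_const, Int.card_Icc]
  gcongr
  omega

/-- Integers admitting an exceptionally good near relation among their lattice points. -/
def nearSet (y θ : ℝ) (N₀ Q : ℕ) : Set ℕ :=
  {n | ∃ (ρ μ : ℕ) (z A B : ℤ × ℤ), (n : ℝ) = ρ * μ * ‖toC z‖ ^ 2 ∧ 0 < ρ ∧ 0 < μ ∧
    y < ‖toC z‖ ^ 2 ∧ (latticePts μ).card ≤ N₀ ∧ A ∈ coefSums μ Q ∧ B ∈ coefSums μ Q ∧
    ¬ (A = 0 ∧ B = 0) ∧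
    ‖toC A * toC z + toC B * starRingEnd ℂ (toC z)‖ ≤ θ * ‖toC z‖ * max ‖toC A‖ ‖toC B‖}

theorem sum_inv_le_one_add_log {X : ℝ} (hX : 1 ≤ X) :
    ∑ n ∈ Finset.Icc 1 ⌊X⌋₊, (1 : ℝ) / n ≤ 1 + Real.log X := by
  have h := harmonic_le_one_add_log ⌊X⌋₊
  rw [harmonic_eq_sum_Icc] at h
  push_cast at h
  simp only [one_div]
  refine h.trans ?_
  gcongr
  · exact_mod_cast Nat.floor_pos.2 hX
  · exact Nat.floor_le (by linarith)

theorem card_nearSet_le {X y θ : ℝ} (hX : 1 ≤ X) (hy : 1 ≤ y) (hθ0 : 0 ≤ θ)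
    (hθ : 1 ≤ θ * Real.sqrt y) (N₀ Q : ℕ) :
    ((elemsUpTo (nearSet y θ N₀ Q) X).card : ℝ) ≤
      9 * θ * X * (1 + Real.log X) ^ 2 * ((2 * Q + 1 : ℕ) : ℝ) ^ (2 * N₀) := by
  classical
  have hX0 : 0 ≤ X := by linarith
  set I := Finset.Icc 1 ⌊X⌋₊ with hI
  set m : ℕ := ⌊X⌋₊ with hm
  set box : Finset (ℤ × ℤ) := Finset.Icc (-(m : ℤ)) m ×ˢ Finset.Icc (-(m : ℤ)) m with hbox
  set P : Finset (ℕ × ℕ) := (I ×ˢ I).filter fun t => (latticePts t.2).card ≤ N₀ with hP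
  set zs : ℕ × ℕ → (ℤ × ℤ) × (ℤ × ℤ) → Finset (ℤ × ℤ) := fun t AB => box.filter fun z =>
    ((t.1 : ℝ) * t.2 * ‖toC z‖ ^ 2 ≤ X ∧ y < ‖toC z‖ ^ 2) ∧ ¬ (AB.1 = 0 ∧ AB.2 = 0) ∧
    ‖toC AB.1 * toC z + toC AB.2 * starRingEnd ℂ (toC z)‖ ≤
      θ * ‖toC z‖ * max ‖toC AB.1‖ ‖toC AB.2‖ with hzs
  have hsub : elemsUpTo (nearSet y θ N₀ Q) X ⊆ P.biUnion fun t =>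
      (coefSums t.2 Q ×ˢ coefSums t.2 Q).biUnion fun AB =>
        (zs t AB).image fun z => t.1 * t.2 * (z.1 ^ 2 + z.2 ^ 2).natAbs := by
    intro n hn
    obtain ⟨hn0, hnX, ρ, μ, z, A, B, hn, hρ, hμ, hyz, hN, hA, hB, hAB, hrel⟩ :=
      (mem_elemsUpTo hX0).1 hn
    have hz1 : 1 ≤ ‖toC z‖ ^ 2 := by linarith
    have hnsq : (((z.1 ^ 2 + z.2 ^ 2).natAbs : ℕ) : ℝ) = ‖toC z‖ ^ 2 := by
      rw [norm_toC_sq, Nat.cast_natAbs, abs_of_nonneg (by positivity)]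
    have hρ1 : (1 : ℝ) ≤ ρ := by exact_mod_cast hρ
    have hμ1 : (1 : ℝ) ≤ μ := by exact_mod_cast hμ
    have hρX : (ρ : ℝ) ≤ X := by
      refine le_trans ?_ (hn ▸ hnX)
      rw [mul_assoc]
      exact le_mul_of_one_le_right (by linarith) (one_le_mul_of_one_le_of_one_le hμ1 hz1)
    have hμX : (μ : ℝ) ≤ X := by
      refine le_trans ?_ (hn ▸ hnX)
      rw [mul_assoc, mul_left_comm]
      exact le_mul_of_one_le_right (by linarith) (one_le_mul_of_one_le_of_one_le hρ1 hz1)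
    have hzX : ‖toC z‖ ^ 2 ≤ X := by
      refine le_trans ?_ (hn ▸ hnX)
      exact le_mul_of_one_le_left (by positivity) (one_le_mul_of_one_le_of_one_le hρ1 hμ1)
    have hzm : z.1 ^ 2 + z.2 ^ 2 ≤ (m : ℤ) := by
      rw [← hnsq] at hzX
      have := Nat.le_floor hzX
      have h2 : (((z.1 ^ 2 + z.2 ^ 2).natAbs : ℕ) : ℤ) ≤ m := by exact_mod_cast this
      rwa [Nat.cast_natAbs, abs_of_nonneg (by positivity)] at h2
    rw [Finset.mem_biUnion]
    refine ⟨(ρ, μ), ?_, Finset.mem_biUnion.2 ⟨(A, B), Finset.mem_product.2 ⟨hA, hB⟩,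
      Finset.mem_image.2 ⟨z, ?_, ?_⟩⟩⟩
    · simp only [hP, hI, Finset.mem_filter, Finset.mem_product, Finset.mem_Icc]
      exact ⟨⟨⟨hρ, Nat.le_floor hρX⟩, hμ, Nat.le_floor hμX⟩, hN⟩
    · simp only [hzs, hbox, Finset.mem_filter, Finset.mem_product, Finset.mem_Icc]
      refine ⟨⟨⟨?_, ?_⟩, ?_, ?_⟩, ⟨hn ▸ hnX, hyz⟩, hAB, hrel⟩ <;> nlinarith
    · have : ((ρ * μ * (z.1 ^ 2 + z.2 ^ 2).natAbs : ℕ) : ℝ) = n := by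
        rw [hn]; push_cast [hnsq]; rfl
      exact_mod_cast this
  have hz : ∀ t ∈ P, ∀ AB, ((zs t AB).card : ℝ) ≤ 9 * θ * X * (1 / t.1 * (1 / t.2)) := by
    intro t ht AB
    simp only [hP, hI, Finset.mem_filter, Finset.mem_product, Finset.mem_Icc] at ht
    have ht1 : (0 : ℝ) < t.1 := by exact_mod_cast ht.1.1.1
    have ht2 : (0 : ℝ) < t.2 := by exact_mod_cast ht.1.2.1
    rcases (zs t AB).eq_empty_or_nonempty with h0 | ⟨w, hw⟩
    · rw [h0]; simp; positivity
    have hmem : ∀ z ∈ zs t AB, ((t.1 : ℝ) * t.2 * ‖toC z‖ ^ 2 ≤ X ∧ y < ‖toC z‖ ^ 2) ∧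
        ¬ (AB.1 = 0 ∧ AB.2 = 0) ∧ ‖toC AB.1 * toC z + toC AB.2 * starRingEnd ℂ (toC z)‖ ≤
          θ * ‖toC z‖ * max ‖toC AB.1‖ ‖toC AB.2‖ := fun z hz => (Finset.mem_filter.1 hz).2
    have hY : ∀ z ∈ zs t AB, ‖toC z‖ ^ 2 ≤ X / (t.1 * t.2) := fun z hz => by
      rw [le_div_iff₀ (by positivity), mul_comm]; exact (hmem z hz).1.1
    have hyY : y ≤ X / (t.1 * t.2) := (hmem w hw).1.2.le.trans (hY w hw)
    have := card_near_relation_le (A := toC AB.1) (B := toC AB.2) (θ := θ) (Y := X / (t.1 * t.2))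
      (by rw [toC_eq_zero, toC_eq_zero]; exact (hmem w hw).2.1) (hy.trans hyY)
      (hθ.trans (by gcongr)) (zs t AB) hY fun z hz => (hmem z hz).2.2
    refine this.trans (le_of_eq ?_)
    field_simp
  have hc : ((elemsUpTo (nearSet y θ N₀ Q) X).card : ℝ) ≤
      ∑ t ∈ P, ∑ AB ∈ coefSums t.2 Q ×ˢ coefSums t.2 Q, ((zs t AB).card : ℝ) := by
    have := (Finset.card_le_card hsub).trans (Finset.card_biUnion_le.trans
      (Finset.sum_le_sum fun t _ => Finset.card_biUnion_le.trans
        (Finset.sum_le_sum fun AB _ => Finset.card_image_le)))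
    exact_mod_cast this
  have hQ1 : (1 : ℝ) ≤ ((2 * Q + 1 : ℕ) : ℝ) := by push_cast; linarith [Nat.cast_nonneg (α := ℝ) Q]
  have hcoef : ∀ t ∈ P, ((coefSums t.2 Q ×ˢ coefSums t.2 Q).card : ℝ) ≤
      ((2 * Q + 1 : ℕ) : ℝ) ^ (2 * N₀) := by
    intro t ht
    have h1 : ((coefSums t.2 Q).card : ℝ) ≤ ((2 * Q + 1 : ℕ) : ℝ) ^ N₀ := by
      have h2 : ((coefSums t.2 Q).card : ℝ) ≤ ((2 * Q + 1 : ℕ) : ℝ) ^ (latticePts t.2).card := by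
        exact_mod_cast card_coefSums_le t.2 Q
      exact h2.trans (pow_le_pow_right₀ hQ1 (Finset.mem_filter.1 ht).2)
    rw [Finset.card_product, pow_mul', sq, Nat.cast_mul]
    exact mul_le_mul h1 h1 (Nat.cast_nonneg _) (by positivity)
  calc _ ≤ _ := hc
    _ ≤ ∑ t ∈ P, ∑ AB ∈ coefSums t.2 Q ×ˢ coefSums t.2 Q, 9 * θ * X * (1 / t.1 * (1 / t.2)) :=
        Finset.sum_le_sum fun t ht => Finset.sum_le_sum fun AB _ => hz t ht AB
    _ ≤ ∑ t ∈ P, ((2 * Q + 1 : ℕ) : ℝ) ^ (2 * N₀) * (9 * θ * X * (1 / t.1 * (1 / t.2))) := by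
        refine Finset.sum_le_sum fun t ht => ?_
        rw [Finset.sum_const, nsmul_eq_mul]
        exact mul_le_mul_of_nonneg_right (hcoef t ht) (by positivity)
    _ = ((2 * Q + 1 : ℕ) : ℝ) ^ (2 * N₀) * (9 * θ * X) * ∑ t ∈ P, (1 / (t.1 : ℝ) * (1 / t.2)) := by
        rw [Finset.mul_sum]
        exact Finset.sum_congr rfl fun t _ => by ring
    _ ≤ ((2 * Q + 1 : ℕ) : ℝ) ^ (2 * N₀) * (9 * θ * X) * ((1 + Real.log X) * (1 + Real.log X)) := by
        refine mul_le_mul_of_nonneg_left ?_ (by positivity)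
        have h1 : ∑ t ∈ P, (1 / (t.1 : ℝ) * (1 / t.2)) ≤ ∑ t ∈ I ×ˢ I, (1 / (t.1 : ℝ) * (1 / t.2)) :=
          Finset.sum_le_sum_of_subset_of_nonneg (Finset.filter_subset _ _)
            fun _ _ _ => by positivity
        rw [Finset.sum_product] at h1
        refine h1.trans ?_
        simp only
        rw [← Finset.sum_mul_sum]
        have h2 := sum_inv_le_one_add_log hX
        have h3 : 0 ≤ ∑ n ∈ I, (1 : ℝ) / n := Finset.sum_nonneg fun _ _ => by positivity
        exact mul_le_mul h2 h2 h3 (by linarith)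
    _ = _ := by ring

theorem card_many_latticePts_le {X T : ℝ} (hX : 1 ≤ X) (hT : 0 < T) :
    ((elemsUpTo {n | T < ((latticePts n).card : ℝ)} X).card : ℝ) ≤ 9 * X / T := by
  classical
  have hX0 : 0 ≤ X := by linarith
  have hs1 : 1 ≤ Real.sqrt X := Real.one_le_sqrt.2 hX
  set E := elemsUpTo {n | T < ((latticePts n).card : ℝ)} X with hE
  rw [le_div_iff₀ hT]
  have h1 : (E.card : ℝ) * T ≤ ∑ n ∈ E, ((latticePts n).card : ℝ) := by
    rw [← nsmul_eq_mul, ← Finset.sum_const]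
    exact Finset.sum_le_sum fun n hn => ((mem_elemsUpTo hX0).1 hn).2.2.le
  have h2 : ∑ n ∈ E, (latticePts n).card = (E.biUnion latticePts).card := by
    rw [Finset.card_biUnion]
    intro a _ b _ hab
    rw [Function.onFun, Finset.disjoint_left]
    intro ξ h3 h4
    rw [mem_latticePts] at h3 h4
    exact hab (by exact_mod_cast h3.symm.trans h4)
  have h3 : ((E.biUnion latticePts).card : ℝ) ≤
      (2 * Real.sqrt X + 1) * (2 * Real.sqrt X + 1) := by
    have hmem : ∀ ξ ∈ E.biUnion latticePts, ‖toC ξ‖ ≤ Real.sqrt X := by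
      intro ξ hξ
      obtain ⟨n, hn, hξ⟩ := Finset.mem_biUnion.1 hξ
      refine Real.le_sqrt_of_sq_le ?_
      rw [norm_toC_sq, mem_latticePts.1 hξ]
      exact_mod_cast ((mem_elemsUpTo hX0).1 hn).2.1
    refine card_strip_le _ 0 _ _ (by positivity) (by positivity)
      (fun ξ hξ => (Complex.abs_im_le_norm (toC ξ)).trans (hmem ξ hξ)) (fun ξ hξ => ?_)
    rw [zero_mul, add_zero]
    exact (Complex.abs_re_le_norm (toC ξ)).trans (hmem ξ hξ)
  have hsq : Real.sqrt X * Real.sqrt X = X := Real.mul_self_sqrt hX0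
  have h4 : (E.card : ℝ) * T ≤ (2 * Real.sqrt X + 1) * (2 * Real.sqrt X + 1) := by
    refine h1.trans (le_trans (le_of_eq ?_) h3)
    rw [← h2]; push_cast; rfl
  nlinarith

/-- Multiplication of Gaussian integers. -/
def gmul (z α : ℤ × ℤ) : ℤ × ℤ := (z.1 * α.1 - z.2 * α.2, z.1 * α.2 + z.2 * α.1)

/-- Conjugation of Gaussian integers. -/
def gconj (z : ℤ × ℤ) : ℤ × ℤ := (z.1, -z.2)

theorem toC_gmul (z α : ℤ × ℤ) : toC (gmul z α) = toC z * toC α := by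
  apply Complex.ext <;> simp [toC, gmul]

theorem toC_gconj (z : ℤ × ℤ) : toC (gconj z) = starRingEnd ℂ (toC z) := by
  apply Complex.ext <;> simp [toC, gconj]

theorem gmul_neg (z α : ℤ × ℤ) : gmul z (-α) = -gmul z α := by
  ext <;> simp [gmul] <;> ring

theorem gmul_zero (z : ℤ × ℤ) : gmul z 0 = 0 := by
  ext <;> simp [gmul]

theorem gmul_add (z α β : ℤ × ℤ) : gmul z (α + β) = gmul z α + gmul z β := by
  ext <;> simp [gmul] <;> ring

theorem gmul_zsmul (z α : ℤ × ℤ) (n : ℤ) : gmul z (n • α) = n • gmul z α := by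
  ext <;> simp [gmul] <;> ring

theorem gmul_sum {ι : Type*} (z : ℤ × ℤ) (s : Finset ι) (g : ι → ℤ × ℤ) :
    gmul z (∑ i ∈ s, g i) = ∑ i ∈ s, gmul z (g i) := by
  classical
  induction s using Finset.induction_on with
  | empty => simp [gmul_zero]
  | insert a s ha ih => rw [Finset.sum_insert ha, Finset.sum_insert ha, gmul_add, ih]

/-- Exact quotient of Gaussian integers. -/
def gquot (z ξ : ℤ × ℤ) : ℤ × ℤ :=
  ((z.1 * ξ.1 + z.2 * ξ.2) / (z.1 ^ 2 + z.2 ^ 2), (z.1 * ξ.2 - z.2 * ξ.1) / (z.1 ^ 2 + z.2 ^ 2))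

theorem gquot_gmul {z : ℤ × ℤ} (hz : z.1 ^ 2 + z.2 ^ 2 ≠ 0) (α : ℤ × ℤ) :
    gquot z (gmul z α) = α := by
  ext
  · simp only [gquot, gmul]
    rw [show z.1 * (z.1 * α.1 - z.2 * α.2) + z.2 * (z.1 * α.2 + z.2 * α.1) =
      (z.1 ^ 2 + z.2 ^ 2) * α.1 by ring, Int.mul_ediv_cancel_left _ hz]
  · simp only [gquot, gmul]
    rw [show z.1 * (z.1 * α.2 + z.2 * α.1) - z.2 * (z.1 * α.1 - z.2 * α.2) =
      (z.1 ^ 2 + z.2 ^ 2) * α.2 by ring, Int.mul_ediv_cancel_left _ hz]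

theorem gmul_injective {z : ℤ × ℤ} (hz : z.1 ^ 2 + z.2 ^ 2 ≠ 0) :
    Function.Injective (gmul z) := fun α β h => by
  rw [← gquot_gmul hz α, h, gquot_gmul hz]

theorem gmul_mem_latticePts {z α : ℤ × ℤ} {q μ : ℕ} (hz : z.1 ^ 2 + z.2 ^ 2 = (q : ℤ))
    (hα : α ∈ latticePts μ) : gmul z α ∈ latticePts (μ * q) := by
  rw [mem_latticePts] at hα ⊢
  push_cast
  rw [← hz, ← hα]
  simp only [gmul]
  ring

theorem exists_gmul_eq {z ξ : ℤ × ℤ} {q μ : ℕ} (hq : q.Prime) (hz : z.1 ^ 2 + z.2 ^ 2 = (q : ℤ))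
    (hξ : ξ ∈ latticePts (μ * q)) (hd : (q : ℤ) ∣ z.1 * ξ.1 + z.2 * ξ.2) :
    ∃ α ∈ latticePts μ, gmul z α = ξ := by
  have hq' : Prime (q : ℤ) := Nat.prime_iff_prime_int.1 hq
  have hq0 : (q : ℤ) ≠ 0 := hq'.ne_zero
  rw [mem_latticePts] at hξ
  push_cast at hξ
  obtain ⟨u, hu⟩ := hd
  have h1 : (q : ℤ) ∣ (z.1 * ξ.2 - z.2 * ξ.1) ^ 2 := by
    refine ⟨μ * q - q * u ^ 2, ?_⟩
    have : (z.1 * ξ.1 + z.2 * ξ.2) ^ 2 + (z.1 * ξ.2 - z.2 * ξ.1) ^ 2 =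
      (z.1 ^ 2 + z.2 ^ 2) * (ξ.1 ^ 2 + ξ.2 ^ 2) := by ring
    rw [hu, hz, hξ] at this
    linear_combination this
  obtain ⟨v, hv⟩ := hq'.dvd_of_dvd_pow h1
  have e1 : gmul z (u, v) = ξ := by
    ext
    · apply mul_left_cancel₀ hq0
      simp only [gmul]
      linear_combination z.2 * hv - z.1 * hu + ξ.1 * hz
    · apply mul_left_cancel₀ hq0
      simp only [gmul]
      linear_combination -z.1 * hv - z.2 * hu + ξ.2 * hz
  refine ⟨(u, v), ?_, e1⟩
  rw [mem_latticePts]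
  apply mul_left_cancel₀ hq0
  rw [← e1] at hξ
  simp only [gmul] at hξ ⊢
  rw [mul_comm (q : ℤ) (μ : ℤ), ← hξ, ← hz]
  ring

theorem latticePts_mul_prime {z : ℤ × ℤ} {q μ : ℕ} (hq : q.Prime)
    (hz : z.1 ^ 2 + z.2 ^ 2 = (q : ℤ)) :
    latticePts (μ * q) = (latticePts μ).image (gmul z) ∪ (latticePts μ).image (gmul (gconj z)) := by
  have hq' : Prime (q : ℤ) := Nat.prime_iff_prime_int.1 hq
  have hz' : (gconj z).1 ^ 2 + (gconj z).2 ^ 2 = (q : ℤ) := by simpa [gconj] using hz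
  ext ξ
  rw [Finset.mem_union, Finset.mem_image, Finset.mem_image]
  constructor
  · intro hξ
    have h0 := mem_latticePts.1 hξ
    push_cast at h0
    have h1 : (q : ℤ) ∣ (z.1 * ξ.1 + z.2 * ξ.2) * (z.1 * ξ.1 - z.2 * ξ.2) := by
      refine ⟨z.1 ^ 2 * μ - ξ.2 ^ 2, ?_⟩
      linear_combination z.1 ^ 2 * h0 - ξ.2 ^ 2 * hz
    rcases hq'.dvd_or_dvd h1 with h | h
    · exact Or.inl (exists_gmul_eq hq hz hξ h)
    · refine Or.inr (exists_gmul_eq hq hz' hξ ?_)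
      simpa [gconj, sub_eq_add_neg] using h
  · rintro (⟨α, hα, rfl⟩ | ⟨α, hα, rfl⟩)
    · exact gmul_mem_latticePts hz hα
    · exact gmul_mem_latticePts hz' hα

theorem gmul_ne_gmul_gconj {z α β : ℤ × ℤ} {q μ : ℕ} (hq : q.Prime) (hq2 : q ≠ 2) (hqμ : ¬ q ∣ μ)
    (hz : z.1 ^ 2 + z.2 ^ 2 = (q : ℤ)) (hα : α ∈ latticePts μ) :
    gmul z α ≠ gmul (gconj z) β := by
  intro h
  have hq' : Prime (q : ℤ) := Nat.prime_iff_prime_int.1 hq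
  rw [mem_latticePts] at hα
  have e1 := congrArg Prod.fst h
  have e2 := congrArg Prod.snd h
  simp only [gmul, gconj] at e1 e2
  have hz2 : ¬ (q : ℤ) ∣ z.2 := by
    rintro ⟨u, hu⟩
    have h1 : (q : ℤ) ∣ z.1 ^ 2 := ⟨1 - q * u ^ 2, by rw [hu] at hz; linear_combination hz⟩
    obtain ⟨v, hv⟩ := hq'.dvd_of_dvd_pow h1
    have h2 : (q : ℤ) * (v ^ 2 + u ^ 2) = 1 := by
      apply mul_left_cancel₀ hq'.ne_zero
      rw [hv, hu] at hz
      linear_combination hz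
    exact hq'.not_dvd_one ⟨_, h2.symm⟩
  have h2 : ¬ (q : ℤ) ∣ 2 := fun h => by
    have h' : q ∣ 2 := by exact_mod_cast h
    exact hq2 ((Nat.prime_dvd_prime_iff_eq hq Nat.prime_two).1 h')
  have h3 : (q : ℤ) ∣ (2 * z.2) * (z.1 * α.2 + z.2 * α.1) := by
    refine ⟨α.1 - β.1, ?_⟩
    linear_combination (α.1 - β.1) * hz - z.1 * e1 + z.2 * e2
  have h4 : (q : ℤ) ∣ z.1 * α.2 + z.2 * α.1 := by
    rcases hq'.dvd_or_dvd h3 with h | h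
    · rcases hq'.dvd_or_dvd h with h | h
      · exact absurd h h2
      · exact absurd h hz2
    · exact h
  obtain ⟨u, hu⟩ := h4
  have h5 : (z.1 * α.1 - z.2 * α.2) ^ 2 + (z.1 * α.2 + z.2 * α.1) ^ 2 = q * μ := by
    rw [← hz, ← hα]; ring
  have h6 : (q : ℤ) ∣ (z.1 * α.1 - z.2 * α.2) ^ 2 := ⟨μ - q * u ^ 2, by
    rw [hu] at h5; linear_combination h5⟩
  obtain ⟨v, hv⟩ := hq'.dvd_of_dvd_pow h6
  apply hqμ
  have : (q : ℤ) ∣ μ := by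
    refine ⟨v ^ 2 + u ^ 2, ?_⟩
    apply mul_left_cancel₀ hq'.ne_zero
    rw [hu, hv] at h5
    linear_combination -h5
  exact_mod_cast this

theorem sum_latticePts_mul_prime {M : Type*} [AddCommMonoid M] {z : ℤ × ℤ} {q μ : ℕ}
    (hq : q.Prime) (hq2 : q ≠ 2) (hqμ : ¬ q ∣ μ) (hz : z.1 ^ 2 + z.2 ^ 2 = (q : ℤ))
    (g : ℤ × ℤ → M) :
    ∑ ξ ∈ latticePts (μ * q), g ξ =
      ∑ α ∈ latticePts μ, g (gmul z α) + ∑ α ∈ latticePts μ, g (gmul (gconj z) α) := by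
  have hq0 : (q : ℤ) ≠ 0 := by exact_mod_cast hq.ne_zero
  have hz0 : z.1 ^ 2 + z.2 ^ 2 ≠ 0 := hz ▸ hq0
  have hz' : (gconj z).1 ^ 2 + (gconj z).2 ^ 2 ≠ 0 := by simpa [gconj] using hz0
  rw [latticePts_mul_prime hq hz, Finset.sum_union,
    Finset.sum_image fun _ _ _ _ h => gmul_injective hz0 h,
    Finset.sum_image fun _ _ _ _ h => gmul_injective hz' h]
  rw [Finset.disjoint_left]
  intro ξ h1 h2
  obtain ⟨α, hα, rfl⟩ := Finset.mem_image.1 h1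
  obtain ⟨β, _, hβ⟩ := Finset.mem_image.1 h2
  exact gmul_ne_gmul_gconj hq hq2 hqμ hz hα hβ.symm

/-- The lattice points on the circle of radius `√n` split into `G` symmetric classes of equal size
such that integer combinations of norm below `D` vanish in every class. -/
def Separated (n Q G : ℕ) (D : ℝ) : Prop :=
  ∃ cls : ℤ × ℤ → ℕ, (∀ ξ ∈ latticePts n, cls (-ξ) = cls ξ) ∧ (∀ ξ ∈ latticePts n, cls ξ < G) ∧
    (∀ i < G, G * ((latticePts n).filter fun ξ => cls ξ = i).card = (latticePts n).card) ∧
    ∀ w : ℤ × ℤ → ℤ, (∀ ξ ∈ latticePts n, |w ξ| ≤ Q) →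
      ‖toC (∑ ξ ∈ latticePts n, w ξ • ξ)‖ < D →
      ∀ i, ∑ ξ ∈ (latticePts n).filter (fun ξ => cls ξ = i), w ξ • ξ = 0

theorem neg_mem_latticePts {n : ℕ} {ξ : ℤ × ℤ} : -ξ ∈ latticePts n ↔ ξ ∈ latticePts n := by
  simp [mem_latticePts]

theorem eq_zero_of_norm_toC_lt_one {ξ : ℤ × ℤ} (h : ‖toC ξ‖ < 1) : ξ = 0 := by
  have h1 : ‖toC ξ‖ ^ 2 < 1 := by nlinarith [norm_nonneg (toC ξ)]
  rw [norm_toC_sq] at h1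
  have h2 : ξ.1 ^ 2 + ξ.2 ^ 2 < 1 := by exact_mod_cast h1
  ext <;> simp <;> nlinarith [sq_nonneg ξ.1, sq_nonneg ξ.2]

theorem separated_one (n Q : ℕ) : Separated n Q 1 1 := by
  refine ⟨fun _ => 0, fun _ _ => rfl, fun _ _ => one_pos, fun i hi => ?_, fun w _ h i => ?_⟩
  · obtain rfl : i = 0 := by omega
    simp
  · rcases eq_or_ne i 0 with rfl | hi
    · simpa using eq_zero_of_norm_toC_lt_one h
    · rw [Finset.filter_false_of_mem fun _ _ => hi.symm, Finset.sum_empty]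

theorem Separated.mul_prime {μ Q G q : ℕ} {D s : ℝ} (h : Separated μ Q G D) {z : ℤ × ℤ}
    (hq : q.Prime) (hq2 : q ≠ 2) (hqμ : ¬ q ∣ μ) (hz : z.1 ^ 2 + z.2 ^ 2 = (q : ℤ)) (hs : 0 < s)
    (hD : 0 < D)
    (hnear : ∀ A ∈ coefSums μ Q, ∀ B ∈ coefSums μ Q, ¬ (A = 0 ∧ B = 0) →
      s * max ‖toC A‖ ‖toC B‖ < ‖toC A * toC z + toC B * starRingEnd ℂ (toC z)‖) :
    Separated (μ * q) Q (2 * G) (D * s) := by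
  classical
  obtain ⟨cls, hsym, hran, hcard, hsep⟩ := h
  have hq0 : (q : ℤ) ≠ 0 := by exact_mod_cast hq.ne_zero
  have hz0 : z.1 ^ 2 + z.2 ^ 2 ≠ 0 := hz ▸ hq0
  have hzc : (gconj z).1 ^ 2 + (gconj z).2 ^ 2 = (q : ℤ) := by simpa [gconj] using hz
  have hz0' : (gconj z).1 ^ 2 + (gconj z).2 ^ 2 ≠ 0 := hzc ▸ hq0
  set cls' : ℤ × ℤ → ℕ := fun ξ =>
    if ξ ∈ (latticePts μ).image (gmul z) then 2 * cls (gquot z ξ)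
    else 2 * cls (gquot (gconj z) ξ) + 1 with hcls'
  have c1 : ∀ α ∈ latticePts μ, cls' (gmul z α) = 2 * cls α := fun α hα => by
    simp only [hcls']
    rw [if_pos (Finset.mem_image_of_mem _ hα), gquot_gmul hz0]
  have c2 : ∀ α ∈ latticePts μ, cls' (gmul (gconj z) α) = 2 * cls α + 1 := fun α hα => by
    simp only [hcls']
    rw [if_neg, gquot_gmul hz0']
    intro h
    obtain ⟨β, hβ, h⟩ := Finset.mem_image.1 h
    exact gmul_ne_gmul_gconj hq hq2 hqμ hz hβ h
  have hcases : ∀ ξ ∈ latticePts (μ * q), (∃ α ∈ latticePts μ, gmul z α = ξ) ∨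
      ∃ α ∈ latticePts μ, gmul (gconj z) α = ξ := fun ξ hξ => by
    rw [latticePts_mul_prime hq hz, Finset.mem_union, Finset.mem_image, Finset.mem_image] at hξ
    exact hξ
  refine ⟨cls', fun ξ hξ => ?_, fun ξ hξ => ?_, fun i hi => ?_, fun w hw hlt i => ?_⟩
  · rcases hcases ξ hξ with ⟨α, hα, rfl⟩ | ⟨α, hα, rfl⟩
    · rw [← gmul_neg, c1 _ (neg_mem_latticePts.2 hα), c1 _ hα, hsym α hα]
    · rw [← gmul_neg, c2 _ (neg_mem_latticePts.2 hα), c2 _ hα, hsym α hα]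
  · rcases hcases ξ hξ with ⟨α, hα, rfl⟩ | ⟨α, hα, rfl⟩
    · rw [c1 _ hα]; have := hran α hα; omega
    · rw [c2 _ hα]; have := hran α hα; omega
  · have hN : (latticePts (μ * q)).card = 2 * (latticePts μ).card := by
      rw [Finset.card_eq_sum_ones, sum_latticePts_mul_prime hq hq2 hqμ hz,
        ← Finset.card_eq_sum_ones]
      ring
    rw [hN, ← hcard (i / 2) (by omega), Finset.card_filter, Finset.card_filter,
      sum_latticePts_mul_prime hq hq2 hqμ hz, Finset.sum_congr rfl fun α hα => by rw [c1 α hα],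
      Finset.sum_congr (s₁ := latticePts μ) (f := fun α => if cls' (gmul (gconj z) α) = i then 1
        else 0) rfl fun α hα => by rw [c2 α hα], ← Finset.sum_add_distrib, mul_assoc]
    congr 2
    refine Finset.sum_congr rfl fun α _ => ?_
    split_ifs <;> omega
  · set A := ∑ α ∈ latticePts μ, w (gmul z α) • α with hA
    set B := ∑ α ∈ latticePts μ, w (gmul (gconj z) α) • α with hB
    have hwA : ∀ α ∈ latticePts μ, |w (gmul z α)| ≤ Q := fun α hα =>
      hw _ (gmul_mem_latticePts hz hα)
    have hwB : ∀ α ∈ latticePts μ, |w (gmul (gconj z) α)| ≤ Q := fun α hα =>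
      hw _ (gmul_mem_latticePts hzc hα)
    have hsum : ∑ ξ ∈ latticePts (μ * q), w ξ • ξ = gmul z A + gmul (gconj z) B := by
      rw [sum_latticePts_mul_prime hq hq2 hqμ hz, hA, hB, gmul_sum, gmul_sum]
      simp only [gmul_zsmul]
    have hmax : max ‖toC A‖ ‖toC B‖ < D := by
      by_cases h0 : A = 0 ∧ B = 0
      · rw [h0.1, h0.2, toC_zero]; simpa using hD
      · have h1 := hnear A (sum_mem_coefSums (fun α => w (gmul z α)) hwA) B
          (sum_mem_coefSums (fun α => w (gmul (gconj z) α)) hwB) h0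
        rw [hsum, toC_add, toC_gmul, toC_gmul, toC_gconj, mul_comm (toC z),
          mul_comm (starRingEnd ℂ (toC z))] at hlt
        have h2 := h1.trans hlt
        rw [mul_comm D] at h2
        exact lt_of_mul_lt_mul_left h2 hs.le
    have hA0 := hsep _ hwA (lt_of_le_of_lt (le_max_left _ _) hmax) (i / 2)
    have hB0 := hsep _ hwB (lt_of_le_of_lt (le_max_right _ _) hmax) (i / 2)
    rw [Finset.sum_filter] at hA0 hB0 ⊢
    rw [sum_latticePts_mul_prime hq hq2 hqμ hz]
    rcases Nat.even_or_odd' i with ⟨j, rfl | rfl⟩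
    · have e1 : ∑ α ∈ latticePts μ, (if cls' (gmul z α) = 2 * j then w (gmul z α) • gmul z α
          else 0) = gmul z (∑ α ∈ latticePts μ, if cls α = 2 * j / 2 then w (gmul z α) • α
          else 0) := by
        rw [gmul_sum]
        refine Finset.sum_congr rfl fun α hα => ?_
        rw [c1 α hα, apply_ite (gmul z), gmul_zsmul, gmul_zero]
        refine if_congr ?_ rfl rfl
        omega
      rw [e1, hA0, gmul_zero, zero_add]
      refine Finset.sum_eq_zero fun α hα => ?_
      rw [c2 α hα, if_neg (by omega)]
    · have e1 : ∑ α ∈ latticePts μ, (if cls' (gmul (gconj z) α) = 2 * j + 1 then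
          w (gmul (gconj z) α) • gmul (gconj z) α else 0) =
          gmul (gconj z) (∑ α ∈ latticePts μ, if cls α = (2 * j + 1) / 2 then
            w (gmul (gconj z) α) • α else 0) := by
        rw [gmul_sum]
        refine Finset.sum_congr rfl fun α hα => ?_
        rw [c2 α hα, apply_ite (gmul (gconj z)), gmul_zsmul, gmul_zero]
        refine if_congr ?_ rfl rfl
        omega
      rw [e1, hB0, gmul_zero, add_zero]
      refine Finset.sum_eq_zero fun α hα => ?_
      rw [c1 α hα, if_neg (by omega)]

theorem exists_sq_add_sq_int {q : ℕ} (hq : q.Prime) (h4 : q % 4 = 1) :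
    ∃ z : ℤ × ℤ, z.1 ^ 2 + z.2 ^ 2 = (q : ℤ) := by
  have : Fact q.Prime := ⟨hq⟩
  obtain ⟨a, b, h⟩ := Nat.Prime.sq_add_sq (p := q) (by omega)
  exact ⟨((a : ℤ), (b : ℤ)), by dsimp only; exact_mod_cast h⟩

theorem not_dvd_mul_prod {m q : ℕ} {T : Finset ℕ} (hq : q.Prime) (hT : ∀ x ∈ T, x.Prime)
    (hqT : q ∉ T) (hm : ¬ q ∣ m) : ¬ q ∣ m * ∏ x ∈ T, x := by
  intro h
  rcases hq.dvd_mul.1 h with h | h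
  · exact hm h
  · obtain ⟨x, hx, hd⟩ := (hq.prime.dvd_finsetProd_iff _).1 h
    exact hqT ((Nat.prime_dvd_prime_iff_eq hq (hT x hx)).1 hd ▸ hx)

theorem card_latticePts_mul_prod {m : ℕ} (T : Finset ℕ)
    (hT : ∀ x ∈ T, x.Prime ∧ x % 4 = 1 ∧ ¬ x ∣ m) :
    (latticePts (m * ∏ x ∈ T, x)).card = 2 ^ T.card * (latticePts m).card := by
  classical
  induction T using Finset.induction_on with
  | empty => simp
  | insert q T hq ih =>
    have hq' := hT q (Finset.mem_insert_self _ _)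
    have hT' := fun x hx => hT x (Finset.mem_insert_of_mem hx)
    obtain ⟨z, hz⟩ := exists_sq_add_sq_int hq'.1 hq'.2.1
    have hnd := not_dvd_mul_prod hq'.1 (fun x hx => (hT' x hx).1) hq hq'.2.2
    have hq2 : q ≠ 2 := fun h => by have := hq'.2.1; omega
    have h1 := sum_latticePts_mul_prime hq'.1 hq2 hnd hz (fun _ => 1)
    rw [← Finset.card_eq_sum_ones, ← Finset.card_eq_sum_ones, ih hT'] at h1
    rw [Finset.prod_insert hq, Finset.card_insert_of_notMem hq, mul_comm q, ← mul_assoc, h1]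
    ring

theorem separated_mul_prod {n m N₀ Q : ℕ} {y : ℝ} (hy : 1 ≤ y) (hm : 0 < m) (K : Finset ℕ)
    (hK : ∀ x ∈ K, x.Prime ∧ x % 4 = 1 ∧ y < x ∧ ¬ x ∣ m) (hn : n = m * ∏ x ∈ K, x)
    (hN : (latticePts n).card ≤ N₀) (hnear : n ∉ nearSet y (1 / Real.sqrt y) N₀ Q)
    (T : Finset ℕ) (hTK : T ⊆ K) :
    Separated (m * ∏ x ∈ T, x) Q (2 ^ T.card) (∏ x ∈ T, (1 / Real.sqrt y * Real.sqrt x)) := by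
  classical
  have hsy : 0 < Real.sqrt y := Real.sqrt_pos.2 (by linarith)
  have hpos : ∀ x ∈ K, 0 < 1 / Real.sqrt y * Real.sqrt x := fun x hx => by
    have : (0 : ℝ) < x := by linarith [(hK x hx).2.2.1]
    positivity
  induction T using Finset.induction_on with
  | empty => simpa using separated_one m Q
  | insert q T hq ih =>
    have hT' : T ⊆ K := (Finset.subset_insert _ _).trans hTK
    have hqK : q ∈ K := hTK (Finset.mem_insert_self _ _)
    have hq' := hK q hqK
    obtain ⟨z, hz⟩ := exists_sq_add_sq_int hq'.1 hq'.2.1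
    have hnd := not_dvd_mul_prod hq'.1 (fun x hx => (hK x (hT' hx)).1) hq hq'.2.2.2
    have hq2 : q ≠ 2 := fun h => by have := hq'.2.1; omega
    have hzn : ‖toC z‖ ^ 2 = q := by rw [norm_toC_sq, hz]; simp
    have hzn' : ‖toC z‖ = Real.sqrt q := by rw [← hzn, Real.sqrt_sq (norm_nonneg _)]
    have hprod : n = (∏ x ∈ K \ insert q T, x) * (m * ∏ x ∈ T, x) * q := by
      rw [hn, ← Finset.prod_sdiff hTK, Finset.prod_insert hq]
      ring
    have h := (ih hT').mul_prime hq'.1 hq2 hnd hz (hpos q hqK)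
      (Finset.prod_pos fun x hx => hpos x (hT' hx)) (by
        intro A hA B hB hAB
        by_contra hcon
        push Not at hcon
        apply hnear
        refine ⟨∏ x ∈ K \ insert q T, x, m * ∏ x ∈ T, x, z, A, B, ?_, ?_, ?_, ?_, ?_, hA, hB, hAB, ?_⟩
        · rw [hzn]; exact_mod_cast hprod
        · exact Finset.prod_pos fun x hx => (hK x (Finset.sdiff_subset hx)).1.pos
        · exact Nat.mul_pos hm (Finset.prod_pos fun x hx => (hK x (hT' hx)).1.pos)
        · rw [hzn]; exact hq'.2.2.1
        · refine le_trans ?_ hN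
          rw [hn, card_latticePts_mul_prod T fun x hx => ⟨(hK x (hT' hx)).1, (hK x (hT' hx)).2.1,
            (hK x (hT' hx)).2.2.2⟩, card_latticePts_mul_prod K fun x hx => ⟨(hK x hx).1,
            (hK x hx).2.1, (hK x hx).2.2.2⟩]
          exact Nat.mul_le_mul_right _ (Nat.pow_le_pow_right two_pos (Finset.card_le_card hT'))
        · rw [hzn']; exact hcon)
    rw [Finset.prod_insert hq, Finset.card_insert_of_notMem hq, Finset.prod_insert hq, mul_comm q,
      ← mul_assoc, pow_succ', mul_comm (1 / Real.sqrt y * Real.sqrt q)]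
    exact h

/-- The typical bound for the number of lattice points. -/
def nPar (X : ℝ) : ℕ := ⌊Real.log X ^ (9 / 10 : ℝ)⌋₊

theorem nPar_le {X : ℝ} (hX : 1 ≤ X) : (nPar X : ℝ) ≤ Real.log X ^ (9 / 10 : ℝ) :=
  Nat.floor_le (Real.rpow_nonneg (Real.log_nonneg hX) _)

theorem eventually_log_le_rpow {s : ℝ} (hs : 0 < s) : ∀ᶠ L : ℝ in atTop, Real.log L ≤ L ^ s := by
  filter_upwards [(isLittleO_log_rpow_atTop hs).bound one_pos, eventually_ge_atTop 1] with L h hL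
  rw [one_mul, Real.norm_of_nonneg (Real.log_nonneg hL),
    Real.norm_of_nonneg (Real.rpow_nonneg (by linarith) _)] at h
  exact h

theorem eventually_rpow_le_mul_rpow {s t c : ℝ} (hst : s < t) (hc : 0 < c) :
    ∀ᶠ L : ℝ in atTop, L ^ s ≤ c * L ^ t := by
  have h : Tendsto (fun L : ℝ => L ^ (-(t - s))) atTop (𝓝 0) :=
    tendsto_rpow_neg_atTop (by linarith)
  filter_upwards [h.eventually_le_const hc, eventually_gt_atTop 0] with L h1 hL
  calc L ^ s = L ^ (-(t - s)) * L ^ t := by rw [← Real.rpow_add hL]; congr 1; ring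
    _ ≤ c * L ^ t := by gcongr

theorem negligible_many : Negligible fun X => {n | n ∈ sumTwoSq ∧ nPar X < (latticePts n).card} := by
  refine negligible_of_le_rpow (g := fun X => 9 * Real.log X ^ (-(3 / 50) : ℝ)) ?_ ?_
  · have h : Tendsto (fun L : ℝ => L ^ (-(3 / 50) : ℝ)) atTop (𝓝 0) :=
      tendsto_rpow_neg_atTop (by norm_num)
    simpa using (h.comp Real.tendsto_log_atTop).const_mul 9
  · filter_upwards [eventually_gt_atTop 1] with X hX
    have hl := Real.log_pos hX
    have hT : 0 < Real.log X ^ (9 / 10 : ℝ) := by positivity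
    have hX0 : 0 ≤ X := by linarith
    calc _ ≤ ((elemsUpTo {n | Real.log X ^ (9 / 10 : ℝ) < ((latticePts n).card : ℝ)} X).card : ℝ) := by
          refine Nat.cast_le.2 (Finset.card_le_card fun n hn => ?_)
          rw [mem_elemsUpTo hX0] at hn ⊢
          exact ⟨hn.1, hn.2.1, (Nat.floor_lt hT.le).1 hn.2.2.2⟩
      _ ≤ 9 * X / Real.log X ^ (9 / 10 : ℝ) := card_many_latticePts_le hX.le hT
      _ = _ := by
          rw [div_eq_mul_inv, ← Real.rpow_neg hl.le]
          rw [show (-(9 / 10) : ℝ) = -(3 / 50) + -(21 / 25) by norm_num, Real.rpow_add hl]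
          ring

theorem negligible_nearSet (p : ℕ) : Negligible fun X =>
    nearSet (yPar X) (1 / Real.sqrt (yPar X)) (nPar X) (8 * nPar X ^ (p + 1)) := by
  refine negligible_of_le_rpow (g := fun X => 36 * Real.exp (-(Real.log X ^ (23 / 25 : ℝ)))) ?_ ?_
  · have h : Tendsto (fun L : ℝ => Real.exp (-(L ^ (23 / 25 : ℝ)))) atTop (𝓝 0) :=
      Real.tendsto_exp_neg_atTop_nhds_zero.comp (tendsto_rpow_atTop (by norm_num))
    simpa using (h.comp Real.tendsto_log_atTop).const_mul 36
  · have hL := Real.tendsto_log_atTop.eventually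
      ((eventually_log_le_rpow (show (0 : ℝ) < 1 / 50 by norm_num)).and
        (eventually_rpow_le_mul_rpow (show (23 / 25 : ℝ) < 19 / 20 by norm_num)
          (show (0 : ℝ) < 1 / (2 * (2 * (p + 2) + 4)) by positivity)))
    filter_upwards [hL, Real.tendsto_log_atTop.eventually_ge_atTop 17, eventually_gt_atTop 1]
      with X hL hL17 hX
    set L := Real.log X with hLdef
    set y := yPar X with hy
    have hL0 : 0 < L := by linarith
    have hL1 : 1 ≤ L := by linarith
    have hlogL : 0 ≤ Real.log L := Real.log_nonneg hL1
    have hy1 : 1 ≤ y := by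
      rw [hy, yPar]; exact Real.one_le_exp (by positivity)
    have hsy : 0 < Real.sqrt y := Real.sqrt_pos.2 (by linarith)
    have h1 := card_nearSet_le hX.le hy1 (θ := 1 / Real.sqrt y) (by positivity)
      (by rw [one_div_mul_cancel hsy.ne']) (nPar X) (8 * nPar X ^ (p + 1))
    refine h1.trans ?_
    have hn := nPar_le hX.le
    rw [← hLdef] at hn
    have hnL : (nPar X : ℝ) ≤ L := hn.trans
      ((Real.rpow_le_rpow_of_exponent_le hL1 (by norm_num)).trans_eq (Real.rpow_one L))
    have hbase : ((2 * (8 * nPar X ^ (p + 1)) + 1 : ℕ) : ℝ) ≤ Real.exp ((p + 2) * Real.log L) := by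
      push_cast
      have e1 : (nPar X : ℝ) ^ (p + 1) ≤ L ^ (p + 1) := by gcongr
      have e2 : (1 : ℝ) ≤ L ^ (p + 1) := one_le_pow₀ hL1
      have e3 : Real.exp ((p + 2) * Real.log L) = L * L ^ (p + 1) := by
        rw [← pow_succ', show ((p : ℝ) + 2) = ((p + 1 + 1 : ℕ) : ℝ) by push_cast; ring,
          mul_comm, ← Real.rpow_natCast, Real.rpow_def_of_pos hL0]
      rw [e3]
      nlinarith
    have hpow : ((2 * (8 * nPar X ^ (p + 1)) + 1 : ℕ) : ℝ) ^ (2 * nPar X) ≤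
        Real.exp (2 * (p + 2) * L ^ (23 / 25 : ℝ)) := by
      calc _ ≤ Real.exp ((p + 2) * Real.log L) ^ (2 * nPar X) := by gcongr
        _ = Real.exp (((2 * nPar X : ℕ) : ℝ) * ((p + 2) * Real.log L)) := (Real.exp_nat_mul _ _).symm
        _ ≤ _ := by
          refine Real.exp_le_exp.2 ?_
          push_cast
          calc 2 * (nPar X : ℝ) * ((p + 2) * Real.log L)
              ≤ 2 * L ^ (9 / 10 : ℝ) * ((p + 2) * L ^ (1 / 50 : ℝ)) := by
                have := hL.1
                gcongr
            _ = 2 * (p + 2) * (L ^ (9 / 10 : ℝ) * L ^ (1 / 50 : ℝ)) := by ring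
            _ = _ := by rw [← Real.rpow_add hL0]; norm_num
    have hs : 1 / Real.sqrt y = Real.exp (-(L ^ (19 / 20 : ℝ) / 2)) := by
      rw [hy, yPar, Real.sqrt_eq_rpow, ← Real.exp_mul, one_div, ← Real.exp_neg]
      congr 1; ring
    have hle : L ≤ Real.exp (L ^ (23 / 25 : ℝ)) := by
      rw [← Real.log_le_iff_le_exp hL0]
      exact hL.1.trans (Real.rpow_le_rpow_of_exponent_le hL1 (by norm_num))
    have hsq : (1 + L) ^ 2 ≤ 4 * Real.exp (2 * L ^ (23 / 25 : ℝ)) := by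
      have : Real.exp (2 * L ^ (23 / 25 : ℝ)) = Real.exp (L ^ (23 / 25 : ℝ)) ^ 2 := by
        rw [← Real.exp_nat_mul]; norm_num
      rw [this]
      nlinarith
    have hlr : 1 ≤ Real.exp (L ^ (23 / 25 : ℝ)) * L ^ (-(21 / 25) : ℝ) := by
      have e1 : L ^ (21 / 25 : ℝ) ≤ Real.exp (L ^ (23 / 25 : ℝ)) :=
        ((Real.rpow_le_rpow_of_exponent_le hL1 (by norm_num)).trans_eq (Real.rpow_one L)).trans hle
      rw [Real.rpow_neg hL0.le, ← div_eq_mul_inv, one_le_div (by positivity)]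
      exact e1
    have hexp : -(L ^ (19 / 20 : ℝ) / 2) ≤ -((2 * (p + 2) + 4) * L ^ (23 / 25 : ℝ)) := by
      have h2 := hL.2
      rw [one_div_mul_eq_div, le_div_iff₀ (by positivity)] at h2
      linarith
    calc 9 * (1 / Real.sqrt y) * X * (1 + L) ^ 2 *
          ((2 * (8 * nPar X ^ (p + 1)) + 1 : ℕ) : ℝ) ^ (2 * nPar X)
        ≤ 9 * Real.exp (-((2 * (p + 2) + 4) * L ^ (23 / 25 : ℝ))) * X *
          (4 * Real.exp (2 * L ^ (23 / 25 : ℝ))) * Real.exp (2 * (p + 2) * L ^ (23 / 25 : ℝ)) := by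
          rw [hs]
          have := Real.exp_le_exp.2 hexp
          gcongr
      _ = 36 * X * (Real.exp (-((2 * (p + 2) + 4) * L ^ (23 / 25 : ℝ))) *
          Real.exp (2 * L ^ (23 / 25 : ℝ)) * Real.exp (2 * (p + 2) * L ^ (23 / 25 : ℝ))) := by ring
      _ = 36 * X * Real.exp (-(L ^ (23 / 25 : ℝ)) + -(L ^ (23 / 25 : ℝ))) := by
          rw [← Real.exp_add, ← Real.exp_add]
          congr 2; ring
      _ ≤ 36 * X * Real.exp (-(L ^ (23 / 25 : ℝ)) + -(L ^ (23 / 25 : ℝ))) *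
          (Real.exp (L ^ (23 / 25 : ℝ)) * L ^ (-(21 / 25) : ℝ)) :=
          le_mul_of_one_le_right (by positivity) hlr
      _ = 36 * X * (Real.exp (-(L ^ (23 / 25 : ℝ)) + -(L ^ (23 / 25 : ℝ))) *
          Real.exp (L ^ (23 / 25 : ℝ))) * L ^ (-(21 / 25) : ℝ) := by ring
      _ = _ := by
          rw [← Real.exp_add, show -(L ^ (23 / 25 : ℝ)) + -(L ^ (23 / 25 : ℝ)) + L ^ (23 / 25 : ℝ) =
            -(L ^ (23 / 25 : ℝ)) by ring]
          ring

theorem negligible_le_sqrt : Negligible fun X => {n | (n : ℝ) < Real.sqrt X} := by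
  refine negligible_of_le_rpow (g := fun X => X ^ (-(1 / 4) : ℝ)) ?_ ?_
  · exact tendsto_rpow_neg_atTop (by norm_num)
  · filter_upwards [Real.tendsto_log_atTop.eventually_gt_atTop 0, eventually_gt_atTop 1,
      eventually_log_le_rpow (show (0 : ℝ) < 1 / 4 by norm_num)] with X hl hX hlog
    have hX0 : 0 < X := by linarith
    have h1 : ((elemsUpTo {n : ℕ | (n : ℝ) < Real.sqrt X} X).card : ℝ) ≤ Real.sqrt X := by
      calc _ ≤ ((Finset.Icc 1 ⌊Real.sqrt X⌋₊).card : ℝ) := by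
            refine Nat.cast_le.2 (Finset.card_le_card fun n hn => ?_)
            rw [mem_elemsUpTo hX0.le] at hn
            exact Finset.mem_Icc.2 ⟨hn.1, Nat.le_floor hn.2.2.le⟩
        _ ≤ _ := by rw [Nat.card_Icc]; exact Nat.floor_le (Real.sqrt_nonneg _)
    refine h1.trans ?_
    have h2 : X ^ (-(1 / 4) : ℝ) ≤ Real.log X ^ (-(21 / 25) : ℝ) := by
      rcases le_total (Real.log X) 1 with h | h
      · exact (Real.rpow_le_one_of_one_le_of_nonpos hX.le (by norm_num)).trans
          (Real.one_le_rpow_of_pos_of_le_one_of_nonpos hl h (by norm_num))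
      · calc X ^ (-(1 / 4) : ℝ) = (X ^ (1 / 4 : ℝ))⁻¹ := Real.rpow_neg hX0.le _
          _ ≤ (Real.log X)⁻¹ := by gcongr
          _ = Real.log X ^ (-1 : ℝ) := (Real.rpow_neg_one _).symm
          _ ≤ _ := Real.rpow_le_rpow_of_exponent_le h (by norm_num)
    calc Real.sqrt X = X ^ (-(1 / 4) : ℝ) * (X * X ^ (-(1 / 4) : ℝ)) := by
          rw [Real.sqrt_eq_rpow]
          nth_rewrite 3 [← Real.rpow_one X]
          rw [← Real.rpow_add hX0, ← Real.rpow_add hX0]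
          norm_num
      _ ≤ _ := by gcongr

/-- The arithmetic property of `lam` which makes every flat eigenfunction behave like a sum of many
independent variables. -/
def Structured (ε : ℝ) (p lam : ℕ) : Prop :=
  lam ∈ sumTwoSq ∧ 2 * ((latticePts lam).card : ℝ) ^ (p + 1) ≤ (lam : ℝ) ^ ε ∧
    ∃ G : ℕ, 3000 * p * Real.log (latticePts lam).card ≤ G ∧
      Separated lam (8 * (latticePts lam).card ^ (p + 1)) G ((lam : ℝ) ^ (1 / 2 - ε / 2))

theorem Separated.mono {n Q Q' G : ℕ} {D D' : ℝ} (h : Separated n Q G D) (hQ : Q' ≤ Q)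
    (hD : D' ≤ D) : Separated n Q' G D' := by
  obtain ⟨cls, h1, h2, h3, h4⟩ := h
  exact ⟨cls, h1, h2, h3, fun w hw hlt => h4 w
    (fun ξ hξ => (hw ξ hξ).trans (by exact_mod_cast hQ)) (hlt.trans_le hD)⟩

theorem card_latticePts_pos {n : ℕ} (hn : n ∈ sumTwoSq) : 0 < (latticePts n).card := by
  obtain ⟨_, a, b, h⟩ := hn
  exact Finset.card_pos.2 ⟨(a, b), mem_latticePts.2 h.symm⟩

theorem eventually_mul_log_le_two_pow (c : ℝ) :
    ∀ᶠ L : ℝ in atTop, c * Real.log L ≤ 2 ^ ⌈Real.sqrt (Real.log L)⌉₊ := by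
  have h : Tendsto (fun v : ℝ => v ^ (2 : ℝ) * Real.exp (-Real.log 2 * v)) atTop (𝓝 0) :=
    tendsto_rpow_mul_exp_neg_mul_atTop_nhds_zero 2 _ (Real.log_pos one_lt_two)
  have h2 := (h.const_mul c).eventually_le_const (show c * 0 < 1 by simp)
  have h3 : Tendsto (fun L => Real.sqrt (Real.log L)) atTop atTop :=
    Real.tendsto_sqrt_atTop.comp Real.tendsto_log_atTop
  filter_upwards [h3.eventually h2, eventually_ge_atTop 1] with L hL hL1
  have hlog := Real.log_nonneg hL1
  set v := Real.sqrt (Real.log L)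
  have hv : v ^ (2 : ℝ) = Real.log L := by rw [Real.rpow_two, Real.sq_sqrt hlog]
  rw [hv, neg_mul, Real.exp_neg, ← mul_assoc, ← div_eq_mul_inv, div_le_one (Real.exp_pos _)] at hL
  refine hL.trans ?_
  calc Real.exp (Real.log 2 * v) = 2 ^ v := (Real.rpow_def_of_pos two_pos v).symm
    _ ≤ 2 ^ ((⌈v⌉₊ : ℕ) : ℝ) := Real.rpow_le_rpow_of_exponent_le one_le_two (Nat.le_ceil v)
    _ = _ := Real.rpow_natCast _ _

theorem eventually_structured {ε : ℝ} (hε : 0 < ε) (p : ℕ) : ∀ᶠ X : ℝ in atTop, ∀ n ∈ sumTwoSq,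
    (n : ℝ) ≤ X → Real.sqrt X ≤ n → (latticePts n).card ≤ nPar X →
    LargePrimes (yPar X) (2 * yPar X ^ 2 * Real.exp (ε / 4 * Real.log X)) (kPar X) n →
    n ∉ nearSet (yPar X) (1 / Real.sqrt (yPar X)) (nPar X) (8 * nPar X ^ (p + 1)) →
    Structured ε p n := by
  have hexp : ∀ᶠ L : ℝ in atTop, 2 * L ^ (p + 1) ≤ Real.exp (ε / 2 * L) := by
    have h : Tendsto (fun L : ℝ => L ^ ((p + 1 : ℕ) : ℝ) * Real.exp (-(ε / 2) * L)) atTop (𝓝 0) :=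
      tendsto_rpow_mul_exp_neg_mul_atTop_nhds_zero _ _ (by positivity)
    filter_upwards [(h.const_mul 2).eventually_le_const (show (2 : ℝ) * 0 < 1 by simp)] with L hL
    rwa [Real.rpow_natCast, neg_mul, Real.exp_neg, ← mul_assoc, ← div_eq_mul_inv,
      div_le_one (Real.exp_pos _)] at hL
  have hpow := eventually_rpow_le_mul_rpow (show (24 / 25 : ℝ) < 1 by norm_num)
    (show (0 : ℝ) < ε / 4 / 5 by positivity)
  filter_upwards [Real.tendsto_log_atTop.eventually (hexp.and (hpow.and
      ((eventually_log_le_rpow (show (0 : ℝ) < 1 / 100 by norm_num)).and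
        (eventually_mul_log_le_two_pow (3000 * p))))), Real.tendsto_log_atTop.eventually_ge_atTop 1,
    eventually_gt_atTop 1] with X hL hL1 hX n hn hnX hXn hcard hLP hnear
  obtain ⟨hL2, hL3, hL4, hL5⟩ := hL
  set L := Real.log X with hLdef
  have hX0 : 0 < X := by linarith
  have hL0 : 0 < L := by linarith
  have hlogL := Real.log_nonneg hL1
  have hN1 := card_latticePts_pos hn
  set N := (latticePts n).card with hN
  have hNL : (N : ℝ) ≤ L := by
    have h1 : (N : ℝ) ≤ nPar X := by exact_mod_cast hcard
    exact h1.trans ((nPar_le hX.le).trans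
      ((Real.rpow_le_rpow_of_exponent_le hL1 (by norm_num)).trans_eq (Real.rpow_one L)))
  have hNpos : (0 : ℝ) < N := by exact_mod_cast hN1
  have hlogN : Real.log N ≤ Real.log L := Real.log_le_log hNpos hNL
  have hn0 : (0 : ℝ) < n := by exact_mod_cast hn.1
  have hne : Real.exp (ε / 2 * L) ≤ (n : ℝ) ^ ε := by
    calc Real.exp (ε / 2 * L) = Real.sqrt X ^ ε := by
          rw [Real.sqrt_eq_rpow, ← Real.rpow_mul hX0.le, Real.rpow_def_of_pos hX0, hLdef]
          congr 1; ring
      _ ≤ _ := Real.rpow_le_rpow (Real.sqrt_nonneg _) hXn hε.le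
  obtain ⟨m, K, hmK, hm0, hmW, hkK, hK⟩ := hLP
  have hy1 : 1 ≤ yPar X := by rw [yPar]; exact Real.one_le_exp (by positivity)
  have hK' : ∀ x ∈ K, x.Prime ∧ x % 4 = 1 ∧ yPar X < x ∧ ¬ x ∣ m := hK
  have hNK : N = 2 ^ K.card * (latticePts m).card := by
    rw [hN, hmK]
    exact card_latticePts_mul_prod K fun x hx => ⟨(hK' x hx).1, (hK' x hx).2.1, (hK' x hx).2.2.2⟩
  have hKN : 2 ^ K.card ≤ N := by
    rw [hNK]
    refine Nat.le_mul_of_pos_right _ (Nat.pos_of_ne_zero fun h0 => ?_)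
    rw [h0, mul_zero] at hNK
    omega
  have hKlog : (K.card : ℝ) ≤ 2 * Real.log L := by
    have h1 : ((2 : ℝ) ^ K.card) ≤ N := by exact_mod_cast hKN
    have h2 := Real.log_le_log (by positivity) h1
    rw [Real.log_pow] at h2
    have h3 := Real.log_two_gt_d9
    nlinarith [Nat.cast_nonneg (α := ℝ) K.card]
  refine ⟨hn, ?_, 2 ^ K.card, ?_, ?_⟩
  · calc 2 * (N : ℝ) ^ (p + 1) ≤ 2 * L ^ (p + 1) := by gcongr
      _ ≤ _ := hL2.trans hne
  · calc 3000 * p * Real.log N ≤ 3000 * p * Real.log L := by gcongr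
      _ ≤ 2 ^ kPar X := hL5
      _ ≤ 2 ^ K.card := pow_le_pow_right₀ one_le_two hkK
      _ = _ := by push_cast; rfl
  · have hsep := separated_mul_prod hy1 hm0 K hK' hmK hcard hnear K subset_rfl
    rw [← hmK] at hsep
    refine hsep.mono ?_ ?_
    · gcongr
    · have hyp := yPar_pos X
      have hs : ∏ x ∈ K, (1 / Real.sqrt (yPar X) * Real.sqrt x) =
          Real.sqrt (n / (m * yPar X ^ K.card)) := by
        have hm0' : (m : ℝ) ≠ 0 := by exact_mod_cast hm0.ne'
        have e1 : (n : ℝ) / (m * yPar X ^ K.card) = ∏ x ∈ K, ((x : ℝ) / yPar X) := by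
          rw [Finset.prod_div_distrib, Finset.prod_const, hmK]
          push_cast
          field_simp
        rw [e1, Real.sqrt_eq_rpow (∏ x ∈ K, (x : ℝ) / yPar X),
          ← Real.finsetProd_rpow _ _ fun x _ => by positivity]
        refine Finset.prod_congr rfl fun x _ => ?_
        rw [← Real.sqrt_eq_rpow, Real.sqrt_div (Nat.cast_nonneg _)]
        ring
      rw [hs]
      apply Real.le_sqrt_of_sq_le
      rw [le_div_iff₀ (by positivity), ← Real.rpow_natCast, ← Real.rpow_mul hn0.le]
      have hkey : (m : ℝ) * yPar X ^ K.card ≤ (n : ℝ) ^ ε := by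
        refine le_trans ?_ hne
        have e2 : yPar X ^ K.card = Real.exp (K.card * L ^ (19 / 20 : ℝ)) := by
          rw [yPar, ← Real.exp_nat_mul, hLdef]
        have e3 : yPar X ^ 2 = Real.exp (2 * L ^ (19 / 20 : ℝ)) := by
          rw [yPar, ← Real.exp_nat_mul, hLdef]; norm_num
        have e4 : (2 : ℝ) ≤ Real.exp 1 := by linarith [Real.add_one_le_exp (1 : ℝ)]
        calc (m : ℝ) * yPar X ^ K.card
            ≤ (Real.exp 1 * Real.exp (2 * L ^ (19 / 20 : ℝ)) * Real.exp (ε / 4 * L)) *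
              Real.exp (K.card * L ^ (19 / 20 : ℝ)) := by
              rw [← e2, ← e3]
              refine mul_le_mul_of_nonneg_right (hmW.trans ?_) (by positivity)
              gcongr
          _ = Real.exp (1 + 2 * L ^ (19 / 20 : ℝ) + ε / 4 * L + K.card * L ^ (19 / 20 : ℝ)) := by
              simp only [Real.exp_add]
          _ ≤ _ := by
              refine Real.exp_le_exp.2 ?_
              have f1 : L ^ (19 / 20 : ℝ) ≤ L ^ (24 / 25 : ℝ) :=
                Real.rpow_le_rpow_of_exponent_le hL1 (by norm_num)
              have f2 : (1 : ℝ) ≤ L ^ (24 / 25 : ℝ) := Real.one_le_rpow hL1 (by norm_num)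
              have f3 : K.card * L ^ (19 / 20 : ℝ) ≤ 2 * L ^ (24 / 25 : ℝ) := by
                calc K.card * L ^ (19 / 20 : ℝ) ≤ (2 * L ^ (1 / 100 : ℝ)) * L ^ (19 / 20 : ℝ) := by
                      gcongr; linarith
                  _ = 2 * (L ^ (1 / 100 : ℝ) * L ^ (19 / 20 : ℝ)) := by ring
                  _ = 2 * L ^ (24 / 25 : ℝ) := by rw [← Real.rpow_add hL0]; norm_num
              rw [Real.rpow_one] at hL3
              linarith
      calc (n : ℝ) ^ ((1 / 2 - ε / 2) * ((2 : ℕ) : ℝ)) * (m * yPar X ^ K.card)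
          ≤ (n : ℝ) ^ ((1 / 2 - ε / 2) * ((2 : ℕ) : ℝ)) * (n : ℝ) ^ ε := by gcongr
        _ = n := by
            rw [← Real.rpow_add hn0]
            push_cast
            rw [show (1 / 2 - ε / 2) * 2 + ε = (1 : ℝ) by ring, Real.rpow_one]

theorem negligible_not_structured {ε : ℝ} (hε : 0 < ε) (p : ℕ) :
    Negligible fun _ => {n | n ∈ sumTwoSq ∧ ¬ Structured ε p n} := by
  have h := ((negligible_le_sqrt.union negligible_many).union
    (negligible_not_largePrimes (show 0 < ε / 4 by positivity))).union (negligible_nearSet p)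
  intro η hη
  filter_upwards [h η hη, eventually_structured hε p, eventually_ge_atTop 0] with X hX hS hX0
  refine le_trans (Nat.cast_le.2 (Finset.card_le_card fun n hn => ?_)) hX
  rw [mem_elemsUpTo hX0] at hn ⊢
  refine ⟨hn.1, hn.2.1, ?_⟩
  by_contra hcon
  simp only [Set.mem_union, Set.mem_ofPred_eq, not_or, not_lt, not_and, not_not] at hcon
  obtain ⟨⟨⟨h1, h2⟩, h3⟩, h4⟩ := hcon
  exact hn.2.2.2 (hS n hn.2.2.1 hn.2.1 h1 (h2 hn.2.2.1) (h3 hn.2.2.1) h4)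

theorem natCard_eq_card_elemsUpTo {D : Set ℕ} (hD : ∀ n ∈ D, 0 < n) (X : ℕ) :
    Nat.card {n : ℕ | n ∈ D ∧ n ≤ X} = (elemsUpTo D X).card := by
  have : {n : ℕ | n ∈ D ∧ n ≤ X} = ↑(elemsUpTo D (X : ℝ)) := by
    ext n
    rw [Finset.mem_coe, mem_elemsUpTo (Nat.cast_nonneg _)]
    simp only [Set.mem_ofPred_eq, Nat.cast_le]
    exact ⟨fun h => ⟨hD n h.1, h.2, h.1⟩, fun h => ⟨h.2.2, h.2.1⟩⟩
  rw [this]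
  exact Nat.card_eq_card_toFinset _ |>.trans (by simp)

theorem densityOne_structured {ε : ℝ} (hε : 0 < ε) (p : ℕ) :
    DensityOne {lam | Structured ε p lam} := by
  classical
  refine ⟨fun n hn => hn.1, ?_⟩
  have hneg := negligible_not_structured hε p
  obtain ⟨c, hc, hS⟩ := exists_card_sumTwoSq_ge_rpow
  rw [Metric.tendsto_nhds]
  intro η hη
  filter_upwards [tendsto_natCast_atTop_atTop.eventually (hneg (η / 2) (by positivity)),
    tendsto_natCast_atTop_atTop.eventually hS, eventually_gt_atTop 1] with X h1 h2 hX
  rw [natCard_eq_card_elemsUpTo (D := sumTwoSq) fun n hn => hn.1,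
    show Nat.card {n : ℕ | Structured ε p n ∧ n ≤ X} =
      (elemsUpTo {lam | Structured ε p lam} X).card from natCard_eq_card_elemsUpTo
        (D := {lam | Structured ε p lam}) (fun n (hn : Structured ε p n) => hn.1.1) X]
  have hX' : (1 : ℝ) < X := by exact_mod_cast hX
  have hpos : (0 : ℝ) < (elemsUpTo sumTwoSq X).card := by
    have := Real.log_pos hX'
    exact lt_of_lt_of_le (by positivity) h2
  have hle : ((elemsUpTo sumTwoSq X).card : ℝ) ≤ (elemsUpTo {lam | Structured ε p lam} X).card +
      (elemsUpTo {n | n ∈ sumTwoSq ∧ ¬ Structured ε p n} X).card := by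
    refine le_trans (Nat.cast_le.2 (Finset.card_le_card fun n hn => ?_))
      (Nat.cast_le.2 (card_elemsUpTo_union_le _ _ (Nat.cast_nonneg X)) |>.trans_eq (Nat.cast_add _ _))
    rw [mem_elemsUpTo (Nat.cast_nonneg _)] at hn ⊢
    refine ⟨hn.1, hn.2.1, ?_⟩
    by_cases h : Structured ε p n
    · exact Or.inl h
    · exact Or.inr ⟨hn.2.2, h⟩
  have hge : ((elemsUpTo {lam | Structured ε p lam} X).card : ℝ) ≤ (elemsUpTo sumTwoSq X).card := by
    refine Nat.cast_le.2 (Finset.card_le_card fun n hn => ?_)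
    rw [mem_elemsUpTo (Nat.cast_nonneg _)] at hn ⊢
    exact ⟨hn.1, hn.2.1, hn.2.2.1⟩
  rw [Real.dist_eq, div_sub_one hpos.ne', abs_div, abs_of_pos hpos, div_lt_iff₀ hpos,
    abs_of_nonpos (by linarith)]
  nlinarith

theorem integral_sum_pow {ι Ω : Type*} [MeasurableSpace Ω] (P : Measure Ω)
    [IsProbabilityMeasure P] (s : Finset ι) (a : ι → ℂ) (X : ι → Ω → ℂ)
    (hm : ∀ i, Measurable (X i)) (hb : ∀ i ω, ‖X i ω‖ ≤ 1) (q : ℕ) :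
    ∫ ω, (∑ i ∈ s, a i * X i ω) ^ q ∂P =
      ∑ v ∈ Fintype.piFinset (fun _ : Fin q => s), (∏ j, a (v j)) * ∫ ω, ∏ j, X (v j) ω ∂P := by
  classical
  have e : ∀ ω, (∑ i ∈ s, a i * X i ω) ^ q =
      ∑ v ∈ Fintype.piFinset (fun _ : Fin q => s), (∏ j, a (v j)) * ∏ j, X (v j) ω := by
    intro ω
    rw [← Fin.prod_const, Finset.prod_univ_sum]
    simp only [Finset.prod_mul_distrib]
  simp only [e]
  rw [integral_finsetSum]
  · simp only [integral_const_mul]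
  · intro v _
    refine Integrable.const_mul ?_ _
    refine Integrable.of_bound (C := 1) ?_ (Eventually.of_forall fun ω => ?_)
    · exact (Finset.measurable_prod _ fun j _ => hm (v j)).aestronglyMeasurable
    · rw [norm_prod]
      exact Finset.prod_le_one (fun _ _ => norm_nonneg _) fun j _ => hb _ _

theorem norm_sum_mul_le {ι : Type*} (s : Finset ι) (a x : ι → ℂ) (hx : ∀ i, ‖x i‖ ≤ 1) :
    ‖∑ i ∈ s, a i * x i‖ ≤ ∑ i ∈ s, ‖a i‖ := by
  refine (norm_sum_le _ _).trans (Finset.sum_le_sum fun i _ => ?_)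
  rw [norm_mul]
  exact mul_le_of_le_one_right (norm_nonneg _) (hx i)

theorem norm_integral_pow_sub_le {ι Ω₁ Ω₂ : Type*} [MeasurableSpace Ω₁] [MeasurableSpace Ω₂]
    (P₁ : Measure Ω₁) (P₂ : Measure Ω₂) [IsProbabilityMeasure P₁] [IsProbabilityMeasure P₂]
    (s : Finset ι) (a : ι → ℂ) (X₁ : ι → Ω₁ → ℂ) (X₂ : ι → Ω₂ → ℂ)
    (hm₁ : ∀ i, Measurable (X₁ i)) (hm₂ : ∀ i, Measurable (X₂ i))
    (hb₁ : ∀ i ω, ‖X₁ i ω‖ ≤ 1) (hb₂ : ∀ i ω, ‖X₂ i ω‖ ≤ 1) {q : ℕ} {η : ℝ}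
    (h : ∀ v : Fin q → ι, (∀ j, v j ∈ s) →
      ‖∫ ω, ∏ j, X₁ (v j) ω ∂P₁ - ∫ ω, ∏ j, X₂ (v j) ω ∂P₂‖ ≤ η) :
    ‖∫ ω, (∑ i ∈ s, a i * X₁ i ω) ^ q ∂P₁ - ∫ ω, (∑ i ∈ s, a i * X₂ i ω) ^ q ∂P₂‖ ≤
      (∑ i ∈ s, ‖a i‖) ^ q * η := by
  classical
  rw [integral_sum_pow P₁ s a X₁ hm₁ hb₁, integral_sum_pow P₂ s a X₂ hm₂ hb₂, ← Finset.sum_sub_distrib]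
  calc _ ≤ ∑ v ∈ Fintype.piFinset (fun _ : Fin q => s), (∏ j, ‖a (v j)‖) * η := by
        refine (norm_sum_le _ _).trans (Finset.sum_le_sum fun v hv => ?_)
        rw [← mul_sub, norm_mul, norm_prod]
        exact mul_le_mul_of_nonneg_left (h v fun j => Fintype.mem_piFinset.1 hv j)
          (Finset.prod_nonneg fun _ _ => norm_nonneg _)
    _ = _ := by
        rw [← Finset.sum_mul, ← Fin.prod_const, Finset.prod_univ_sum]

theorem norm_integral_exp_sub_sum_le {Ω : Type*} [MeasurableSpace Ω]
    (P : Measure Ω) [IsProbabilityMeasure P] (g : Ω → ℂ) (hg : Measurable g) {A t : ℝ}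
    (hA : ∀ ω, ‖g ω‖ ≤ A) (ht : 0 ≤ t) {Q : ℕ} (hQ : 2 * (t * A) ≤ Q) :
    ‖∫ ω, cexp (t * I * g ω) ∂P - ∑ q ∈ Finset.range Q, (t * I) ^ q / q.factorial * ∫ ω, g ω ^ q ∂P‖ ≤
      2 * (t * A) ^ Q / Q.factorial := by
  have hInt : ∀ q : ℕ, Integrable (fun ω => g ω ^ q) P := fun q =>
    Integrable.of_bound (C := A ^ q) (hg.pow_const q).aestronglyMeasurable
      (Eventually.of_forall fun ω => by rw [norm_pow]; gcongr; exact hA ω)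
  have hle : ∀ ω, ‖(t : ℂ) * I * g ω‖ ≤ t * A := fun ω => by
    rw [norm_mul, norm_mul, Complex.norm_I, mul_one, Complex.norm_real, Real.norm_of_nonneg ht]
    exact mul_le_mul_of_nonneg_left (hA ω) ht
  have hie : Integrable (fun ω => cexp (t * I * g ω)) P := by
    refine Integrable.of_bound (C := Real.exp (t * A)) ?_ (Eventually.of_forall fun ω => ?_)
    · exact (Complex.measurable_exp.comp (hg.const_mul _)).aestronglyMeasurable
    · rw [Complex.norm_exp]
      exact Real.exp_le_exp.2 ((Complex.re_le_norm _).trans (hle ω))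
  have e1 : ∑ q ∈ Finset.range Q, (t * I) ^ q / q.factorial * ∫ ω, g ω ^ q ∂P =
      ∫ ω, ∑ q ∈ Finset.range Q, (t * I * g ω) ^ q / q.factorial ∂P := by
    rw [integral_finsetSum]
    · refine Finset.sum_congr rfl fun q _ => ?_
      rw [← integral_const_mul]
      congr 1
      ext ω
      rw [mul_pow]; ring
    · intro q _
      have := (hInt q).const_mul ((t * I) ^ q / q.factorial)
      refine this.congr (Eventually.of_forall fun ω => ?_)
      simp only
      rw [mul_pow (t * I : ℂ) (g ω)]; ring
  rw [e1, ← integral_sub hie]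
  · refine (norm_integral_le_of_norm_le_const (C := 2 * (t * A) ^ Q / Q.factorial)
      (Eventually.of_forall fun ω => ?_)).trans ?_
    · have h1 : ‖(t : ℂ) * I * g ω‖ / Q.succ ≤ 1 / 2 := by
        rw [div_le_iff₀ (by positivity)]
        push_cast
        linarith [hle ω]
      refine (Complex.exp_bound' h1).trans ?_
      have := pow_le_pow_left₀ (norm_nonneg _) (hle ω) Q
      rw [div_mul_eq_mul_div, mul_comm]
      gcongr
    · simp
  · refine integrable_finsetSum _ fun q _ => ?_
    have := (hInt q).const_mul ((t * I) ^ q / q.factorial)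
    refine this.congr (Eventually.of_forall fun ω => ?_)
    simp only
    rw [mul_pow (t * I : ℂ) (g ω)]; ring

theorem norm_integral_exp_sub_le {ι Ω₁ Ω₂ : Type*} [MeasurableSpace Ω₁] [MeasurableSpace Ω₂]
    (P₁ : Measure Ω₁) (P₂ : Measure Ω₂) [IsProbabilityMeasure P₁] [IsProbabilityMeasure P₂]
    (s : Finset ι) (a : ι → ℂ) (X₁ : ι → Ω₁ → ℂ) (X₂ : ι → Ω₂ → ℂ)
    (hm₁ : ∀ i, Measurable (X₁ i)) (hm₂ : ∀ i, Measurable (X₂ i))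
    (hb₁ : ∀ i ω, ‖X₁ i ω‖ ≤ 1) (hb₂ : ∀ i ω, ‖X₂ i ω‖ ≤ 1) {Q : ℕ} {η t A : ℝ} (hη : 0 ≤ η)
    (ht : 0 ≤ t) (hA : ∑ i ∈ s, ‖a i‖ ≤ A) (hQ : 2 * (t * A) ≤ Q)
    (h : ∀ q < Q, ∀ v : Fin q → ι, (∀ j, v j ∈ s) →
      ‖∫ ω, ∏ j, X₁ (v j) ω ∂P₁ - ∫ ω, ∏ j, X₂ (v j) ω ∂P₂‖ ≤ η) :
    ‖∫ ω, cexp (t * I * ∑ i ∈ s, a i * X₁ i ω) ∂P₁ -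
        ∫ ω, cexp (t * I * ∑ i ∈ s, a i * X₂ i ω) ∂P₂‖ ≤
      4 * (t * A) ^ Q / Q.factorial + Real.exp (t * A) * η := by
  have hA0 : 0 ≤ A := (Finset.sum_nonneg fun _ _ => norm_nonneg _).trans hA
  have h1 := norm_integral_exp_sub_sum_le P₁ (fun ω => ∑ i ∈ s, a i * X₁ i ω)
    (Finset.measurable_sum _ fun i _ => (hm₁ i).const_mul _) (fun ω => (norm_sum_mul_le s a _ fun i => hb₁ i ω).trans hA) ht hQ
  have h2 := norm_integral_exp_sub_sum_le P₂ (fun ω => ∑ i ∈ s, a i * X₂ i ω)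
    (Finset.measurable_sum _ fun i _ => (hm₂ i).const_mul _) (fun ω => (norm_sum_mul_le s a _ fun i => hb₂ i ω).trans hA) ht hQ
  set S₁ := ∑ q ∈ Finset.range Q, (t * I) ^ q / q.factorial * ∫ ω, (∑ i ∈ s, a i * X₁ i ω) ^ q ∂P₁
  set S₂ := ∑ q ∈ Finset.range Q, (t * I) ^ q / q.factorial * ∫ ω, (∑ i ∈ s, a i * X₂ i ω) ^ q ∂P₂
  have h3 : ‖S₁ - S₂‖ ≤ Real.exp (t * A) * η := by
    rw [← Finset.sum_sub_distrib]
    calc _ ≤ ∑ q ∈ Finset.range Q, (t * A) ^ q / q.factorial * η := by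
          refine (norm_sum_le _ _).trans (Finset.sum_le_sum fun q hq => ?_)
          rw [← mul_sub, norm_mul, norm_div, norm_pow, norm_mul, Complex.norm_I, mul_one,
            Complex.norm_real, Real.norm_of_nonneg ht, Complex.norm_natCast, mul_pow]
          have h4 := norm_integral_pow_sub_le P₁ P₂ s a X₁ X₂ hm₁ hm₂ hb₁ hb₂
            (h q (Finset.mem_range.1 hq))
          have h5 : (∑ i ∈ s, ‖a i‖) ^ q ≤ A ^ q :=
            pow_le_pow_left₀ (Finset.sum_nonneg fun _ _ => norm_nonneg _) hA q
          calc _ ≤ t ^ q / q.factorial * (A ^ q * η) := by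
                gcongr
                exact h4.trans (mul_le_mul_of_nonneg_right h5 hη)
            _ = _ := by ring
      _ ≤ _ := by
          rw [← Finset.sum_mul]
          exact mul_le_mul_of_nonneg_right (Real.sum_le_exp_of_nonneg (by positivity) Q) hη
  rw [norm_sub_rev] at h2
  calc _ = ‖(∫ ω, cexp (t * I * ∑ i ∈ s, a i * X₁ i ω) ∂P₁ - S₁) + (S₁ - S₂) +
        (S₂ - ∫ ω, cexp (t * I * ∑ i ∈ s, a i * X₂ i ω) ∂P₂)‖ := by congr 1; ring
    _ ≤ 2 * (t * A) ^ Q / Q.factorial + Real.exp (t * A) * η + 2 * (t * A) ^ Q / Q.factorial :=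
        (norm_add₃_le).trans (add_le_add (add_le_add h1 h3) h2)
    _ = _ := by ring

/-- The character `e(⟨ξ, w⟩)`. -/
def chr (ξ : ℤ × ℤ) (w : ℝ × ℝ) : ℂ :=
  cexp (2 * (Real.pi : ℂ) * I * ((ξ.1 * w.1 + ξ.2 * w.2 : ℝ) : ℂ))

theorem chr_zero (w : ℝ × ℝ) : chr 0 w = 1 := by simp [chr]

theorem chr_add (ξ η : ℤ × ℤ) (w : ℝ × ℝ) : chr (ξ + η) w = chr ξ w * chr η w := by
  rw [chr, chr, chr, ← Complex.exp_add]
  congr 1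
  push_cast [Prod.fst_add, Prod.snd_add]
  ring

theorem chr_sum {ι : Type*} (s : Finset ι) (g : ι → ℤ × ℤ) (w : ℝ × ℝ) :
    chr (∑ i ∈ s, g i) w = ∏ i ∈ s, chr (g i) w := by
  classical
  induction s using Finset.induction_on with
  | empty => simp [chr_zero]
  | insert i s hi ih => rw [Finset.sum_insert hi, Finset.prod_insert hi, chr_add, ih]

theorem norm_chr (ξ : ℤ × ℤ) (w : ℝ × ℝ) : ‖chr ξ w‖ = 1 := by
  rw [chr, show 2 * (Real.pi : ℂ) * I * ((ξ.1 * w.1 + ξ.2 * w.2 : ℝ) : ℂ) =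
    ((2 * Real.pi * (ξ.1 * w.1 + ξ.2 * w.2) : ℝ) : ℂ) * I by push_cast; ring,
    Complex.norm_exp_ofReal_mul_I]

theorem chr_neg (ξ : ℤ × ℤ) (w : ℝ × ℝ) : chr (-ξ) w = starRingEnd ℂ (chr ξ w) := by
  rw [chr, chr, ← Complex.exp_conj]
  congr 1
  simp only [map_mul, Complex.conj_ofReal, Complex.conj_I, map_ofNat]
  push_cast [Prod.fst_neg, Prod.snd_neg]
  ring

theorem continuous_chr (ξ : ℤ × ℤ) : Continuous (chr ξ) := by
  unfold chr
  fun_prop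

/-- The uniform measure on the unit square. -/
def torusMeasure : Measure (ℝ × ℝ) :=
  (volume.restrict (Set.Ioc 0 1)).prod (volume.restrict (Set.Ioc 0 1))

instance : IsProbabilityMeasure ((volume : Measure ℝ).restrict (Set.Ioc 0 1)) :=
  ⟨by simp⟩

instance : IsProbabilityMeasure torusMeasure := by
  unfold torusMeasure; infer_instance

theorem integral_exp_int (k : ℤ) :
    ∫ u, cexp (2 * (Real.pi : ℂ) * I * ((k * u : ℝ) : ℂ)) ∂((volume : Measure ℝ).restrict (Set.Ioc 0 1)) =
      if k = 0 then 1 else 0 := by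
  rw [← intervalIntegral.integral_of_le zero_le_one]
  split_ifs with hk
  · simp [hk]
  · have hc : (2 * (Real.pi : ℂ) * I * k) ≠ 0 := by
      simp [Real.pi_ne_zero, hk]
    have e : ∀ u : ℝ, cexp (2 * (Real.pi : ℂ) * I * ((k * u : ℝ) : ℂ)) =
        cexp ((2 * (Real.pi : ℂ) * I * k) * u) := fun u => by push_cast; ring_nf
    simp only [e]
    rw [integral_exp_mul_complex hc]
    have : cexp (2 * (Real.pi : ℂ) * I * k * (1 : ℝ)) = 1 := by
      rw [Complex.exp_eq_one_iff]
      exact ⟨k, by push_cast; ring⟩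
    rw [this]
    simp

theorem integral_chr (ξ : ℤ × ℤ) : ∫ w, chr ξ w ∂torusMeasure = if ξ = 0 then 1 else 0 := by
  have e : ∀ w : ℝ × ℝ, chr ξ w = cexp (2 * (Real.pi : ℂ) * I * ((ξ.1 * w.1 : ℝ) : ℂ)) *
      cexp (2 * (Real.pi : ℂ) * I * ((ξ.2 * w.2 : ℝ) : ℂ)) := fun w => by
    rw [chr, ← Complex.exp_add]; congr 1; push_cast; ring
  simp only [e]
  rw [torusMeasure, integral_prod_mul (fun u : ℝ => cexp (2 * (Real.pi : ℂ) * I * ((ξ.1 * u : ℝ) : ℂ)))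
    (fun u : ℝ => cexp (2 * (Real.pi : ℂ) * I * ((ξ.2 * u : ℝ) : ℂ))), integral_exp_int,
    integral_exp_int]
  simp only [Prod.ext_iff, Prod.fst_zero, Prod.snd_zero]
  split_ifs <;> simp_all

theorem integral_model_prod {G q : ℕ} (c : ℤ × ℤ → Fin G) (v : Fin q → ℤ × ℤ) :
    ∫ ω, ∏ j, chr (v j) (ω (c (v j))) ∂(Measure.pi fun _ : Fin G => torusMeasure) =
      if ∀ i, ∑ j with c (v j) = i, v j = 0 then 1 else 0 := by
  have e : ∀ ω : Fin G → ℝ × ℝ, ∏ j, chr (v j) (ω (c (v j))) =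
      ∏ i, chr (∑ j with c (v j) = i, v j) (ω i) := fun ω => by
    rw [← Finset.prod_fiberwise Finset.univ (fun j => c (v j))]
    refine Finset.prod_congr rfl fun i _ => ?_
    rw [chr_sum]
    exact Finset.prod_congr rfl fun j hj => by rw [(Finset.mem_filter.1 hj).2]
  simp only [e]
  rw [integral_fintype_prod_eq_prod (fun (i : Fin G) (w : ℝ × ℝ) =>
    chr (∑ j with c (v j) = i, v j) w)]
  simp only [integral_chr]
  split_ifs with h
  · exact Finset.prod_eq_one fun i _ => if_pos (h i)
  · push Not at h
    obtain ⟨i, hi⟩ := h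
    exact Finset.prod_eq_zero (Finset.mem_univ i) (if_neg hi)

theorem integral_model_exp {G : ℕ} (c : ℤ × ℤ → Fin G) (s : Finset (ℤ × ℤ)) (a : ℤ × ℤ → ℂ) (t : ℝ) :
    ∫ ω, cexp (t * I * ∑ ξ ∈ s, a ξ * chr ξ (ω (c ξ))) ∂(Measure.pi fun _ : Fin G => torusMeasure) =
      ∏ i, ∫ w, cexp (t * I * ∑ ξ ∈ s with c ξ = i, a ξ * chr ξ w) ∂torusMeasure := by
  rw [← integral_fintype_prod_eq_prod (fun (i : Fin G) (w : ℝ × ℝ) =>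
    cexp (t * I * ∑ ξ ∈ s with c ξ = i, a ξ * chr ξ w))]
  congr 1
  ext ω
  rw [← Complex.exp_sum, ← Finset.mul_sum, ← Finset.sum_fiberwise s c]
  congr 2
  refine Finset.sum_congr rfl fun i _ => Finset.sum_congr rfl fun ξ hξ => ?_
  rw [(Finset.mem_filter.1 hξ).2]

/-- The Gaussian probability measure centred at `x₀` at scale `r`. -/
def gaussAt (x₀ : E2) (r : ℝ) : Measure E2 :=
  volume.withDensity fun x => ENNReal.ofReal ((r ^ 2)⁻¹ * Real.exp (-(Real.pi / r ^ 2) * ‖x - x₀‖ ^ 2))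

/-- The character `e(⟨ξ, x⟩)` on the plane. -/
def chrE (ξ : ℤ × ℤ) (x : E2) : ℂ := chr ξ (x 0, x 1)

theorem continuous_chrE (ξ : ℤ × ℤ) : Continuous (chrE ξ) :=
  (continuous_chr ξ).comp (by fun_prop)

theorem inner_pt (a b : ℝ) (x : E2) : ⟪pt a b, x⟫ = a * x 0 + b * x 1 := by
  simp [pt, PiLp.inner_apply, Fin.sum_univ_two, mul_comm]

theorem norm_pt_sq (a b : ℝ) : ‖pt a b‖ ^ 2 = a ^ 2 + b ^ 2 := by
  simp [pt, EuclideanSpace.norm_sq_eq, Fin.sum_univ_two]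

theorem integral_gaussAt {x₀ : E2} {r : ℝ} (g : E2 → ℂ) :
    ∫ x, g x ∂gaussAt x₀ r =
      ∫ x, (((r ^ 2)⁻¹ * Real.exp (-(Real.pi / r ^ 2) * ‖x - x₀‖ ^ 2) : ℝ) : ℂ) * g x := by
  rw [gaussAt, integral_withDensity_eq_integral_toReal_smul₀]
  · refine integral_congr_ae (Eventually.of_forall fun x => ?_)
    simp only
    rw [ENNReal.toReal_ofReal (by positivity), Complex.real_smul]
  · fun_prop
  · exact Eventually.of_forall fun x => ENNReal.ofReal_lt_top

theorem integral_chrE_gaussAt (x₀ : E2) {r : ℝ} (hr : 0 < r) (ξ : ℤ × ℤ) :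
    ∫ x, chrE ξ x ∂gaussAt x₀ r =
      chrE ξ x₀ * Real.exp (-(Real.pi * r ^ 2 * ‖toC ξ‖ ^ 2)) := by
  rw [integral_gaussAt, ← integral_add_right_eq_self _ x₀]
  have hb : 0 < (((Real.pi / r ^ 2 : ℝ) : ℂ)).re := by
    rw [Complex.ofReal_re]; have := Real.pi_pos; positivity
  have h := GaussianFourier.integral_cexp_neg_mul_sq_norm_add hb (2 * (Real.pi : ℂ) * I)
    (pt ξ.1 ξ.2)
  have e : ∀ x : E2, (((r ^ 2)⁻¹ * Real.exp (-(Real.pi / r ^ 2) * ‖x + x₀ - x₀‖ ^ 2) : ℝ) : ℂ) *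
      chrE ξ (x + x₀) = ((r : ℂ) ^ 2)⁻¹ * chrE ξ x₀ * cexp (-((Real.pi / r ^ 2 : ℝ) : ℂ) *
        (‖x‖ : ℂ) ^ 2 + 2 * (Real.pi : ℂ) * I * (⟪pt ξ.1 ξ.2, x⟫ : ℝ)) := by
    intro x
    rw [add_sub_cancel_right, inner_pt, chrE, chrE, chr, chr, Complex.exp_add]
    push_cast
    rw [show 2 * (Real.pi : ℂ) * I * (ξ.1 * ((x + x₀ : E2) 0 : ℂ) + ξ.2 * ((x + x₀ : E2) 1 : ℂ)) =
      2 * (Real.pi : ℂ) * I * (ξ.1 * (x₀ 0 : ℂ) + ξ.2 * (x₀ 1 : ℂ)) +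
      2 * (Real.pi : ℂ) * I * (ξ.1 * (x 0 : ℂ) + ξ.2 * (x 1 : ℂ)) by
        simp only [PiLp.add_apply]; push_cast; ring, Complex.exp_add]
    ring
  simp only [e]
  rw [integral_const_mul]
  rw [h]
  have hrc : (r : ℂ) ≠ 0 := by exact_mod_cast hr.ne'
  have hpc : (Real.pi : ℂ) ≠ 0 := by exact_mod_cast Real.pi_ne_zero
  have hfin : ((Module.finrank ℝ E2 : ℂ) / 2) = 1 := by simp
  have hn : ((‖pt ξ.1 ξ.2‖ : ℂ)) ^ 2 = ((‖toC ξ‖ ^ 2 : ℝ) : ℂ) := by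
    rw [norm_toC_sq, ← Complex.ofReal_pow, norm_pt_sq]; push_cast; rfl
  rw [hfin, Complex.cpow_one, hn]
  push_cast
  rw [show (2 * (Real.pi : ℂ) * I) ^ 2 * (‖toC ξ‖ : ℂ) ^ 2 / (4 * (Real.pi / r ^ 2)) =
    -(Real.pi * r ^ 2 * ‖toC ξ‖ ^ 2) by
      rw [mul_pow, mul_pow, Complex.I_sq]; field_simp; ring]
  field_simp

theorem isProbabilityMeasure_gaussAt (x₀ : E2) {r : ℝ} (hr : 0 < r) :
    IsProbabilityMeasure (gaussAt x₀ r) := by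
  have h := integral_chrE_gaussAt x₀ hr 0
  have e : ∀ x, chrE 0 x = 1 := fun x => chr_zero _
  simp only [e, toC_zero] at h
  rw [integral_const] at h
  simp at h
  constructor
  have h2 : (gaussAt x₀ r).real Set.univ = 1 := by exact_mod_cast h
  rw [Measure.real, ENNReal.toReal_eq_one_iff] at h2
  exact h2

theorem norm_gauss_sub_model_le {lam Q G : ℕ} {D : ℝ} {cls : ℤ × ℤ → ℕ} (x₀ : E2) {r : ℝ}
    (hr : 0 < r) (hD : 0 ≤ D) (c : ℤ × ℤ → Fin G)
    (hc : ∀ ξ ∈ latticePts lam, (c ξ : ℕ) = cls ξ)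
    (hsep : ∀ w : ℤ × ℤ → ℤ, (∀ ξ ∈ latticePts lam, |w ξ| ≤ Q) →
      ‖toC (∑ ξ ∈ latticePts lam, w ξ • ξ)‖ < D →
      ∀ i, ∑ ξ ∈ (latticePts lam).filter (fun ξ => cls ξ = i), w ξ • ξ = 0)
    (a : ℤ × ℤ → ℂ) {t A : ℝ} (ht : 0 ≤ t) (hA : ∑ ξ ∈ latticePts lam, ‖a ξ‖ ≤ A)
    (hQ : 2 * (t * A) ≤ Q) :
    ‖∫ x, cexp (t * I * ∑ ξ ∈ latticePts lam, a ξ * chrE ξ x) ∂gaussAt x₀ r -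
      ∏ i, ∫ w, cexp (t * I * ∑ ξ ∈ latticePts lam with c ξ = i, a ξ * chr ξ w) ∂torusMeasure‖ ≤
      4 * (t * A) ^ Q / Q.factorial + Real.exp (t * A) * Real.exp (-(Real.pi * r ^ 2 * D ^ 2)) := by
  classical
  have := isProbabilityMeasure_gaussAt x₀ hr
  rw [← integral_model_exp]
  refine norm_integral_exp_sub_le (gaussAt x₀ r) (Measure.pi fun _ : Fin G => torusMeasure)
    (latticePts lam) a chrE (fun ξ ω => chr ξ (ω (c ξ))) (fun ξ => (continuous_chrE ξ).measurable)
    (fun ξ => (continuous_chr ξ).measurable.comp (measurable_pi_apply _))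
    (fun ξ x => (norm_chr _ _).le) (fun ξ x => (norm_chr _ _).le) (Real.exp_pos _).le ht hA hQ ?_
  intro q hq v hv
  rw [integral_model_prod]
  have e : ∀ x : E2, ∏ j, chrE (v j) x = chrE (∑ j, v j) x := fun x => (chr_sum _ _ _).symm
  simp only [e]
  rw [integral_chrE_gaussAt x₀ hr]
  have hcount : ∀ (P : ℤ × ℤ → Prop) [DecidablePred P], ∑ j with P (v j), v j =
      ∑ ξ ∈ latticePts lam with P ξ, ((Finset.univ.filter fun j => v j = ξ).card : ℤ) • ξ := by
    intro P _
    rw [← Finset.sum_fiberwise_of_maps_to (s := Finset.univ.filter fun j => P (v j))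
      (t := (latticePts lam).filter P) (g := v) (fun j hj => Finset.mem_filter.2
        ⟨hv j, (Finset.mem_filter.1 hj).2⟩)]
    refine Finset.sum_congr rfl fun ξ hξ => ?_
    rw [Finset.filter_filter, Finset.sum_congr rfl fun j hj => (Finset.mem_filter.1 hj).2.2,
      Finset.sum_const, natCast_zsmul]
    congr 2
    ext j
    simp only [Finset.mem_filter, Finset.mem_univ, true_and]
    exact ⟨fun h => h.2, fun h => ⟨h ▸ (Finset.mem_filter.1 hξ).2, h⟩⟩
  have hall : ∑ j, v j = ∑ ξ ∈ latticePts lam, ((Finset.univ.filter fun j => v j = ξ).card : ℤ) • ξ := by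
    simpa using hcount fun _ => True
  by_cases hcl : ∀ i, ∑ j with c (v j) = i, v j = 0
  · rw [if_pos hcl]
    have h0 : ∑ j, v j = 0 := by
      rw [← Finset.sum_fiberwise Finset.univ (fun j => c (v j))]
      exact Finset.sum_eq_zero fun i _ => hcl i
    rw [h0, toC_zero]
    simp [chrE, chr_zero, (Real.exp_pos _).le]
  · rw [if_neg hcl, sub_zero, norm_mul, chrE, norm_chr, one_mul, Complex.norm_real,
      Real.norm_of_nonneg (Real.exp_pos _).le]
    refine Real.exp_le_exp.2 (neg_le_neg ?_)
    have hDle : D ≤ ‖toC (∑ j, v j)‖ := by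
      by_contra hcon
      push Not at hcon
      apply hcl
      intro i
      rw [hall] at hcon
      rw [hcount fun ξ => c ξ = i]
      have h1 := hsep (fun ξ => ((Finset.univ.filter fun j => v j = ξ).card : ℤ)) (fun ξ _ => by
        rw [abs_of_nonneg (Int.natCast_nonneg _)]
        have : (Finset.univ.filter fun j => v j = ξ).card ≤ q :=
          (Finset.card_filter_le _ _).trans (by simp)
        exact_mod_cast this.trans hq.le) hcon i
      rw [← h1]
      refine Finset.sum_congr (Finset.filter_congr fun ξ hξ => ?_) fun _ _ => rfl
      rw [← hc ξ hξ, Fin.ext_iff]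
    have := Real.pi_pos
    gcongr

/-- The trigonometric polynomial with frequencies in `s` and coefficients `b`. -/
def trig (s : Finset (ℤ × ℤ)) (b : ℤ × ℤ → ℂ) (w : ℝ × ℝ) : ℂ := ∑ ξ ∈ s, b ξ * chr ξ w

theorem continuous_trig (s : Finset (ℤ × ℤ)) (b : ℤ × ℤ → ℂ) : Continuous (trig s b) :=
  continuous_finsetSum _ fun ξ _ => continuous_const.mul (continuous_chr ξ)

theorem norm_trig_le (s : Finset (ℤ × ℤ)) (b : ℤ × ℤ → ℂ) (w : ℝ × ℝ) :
    ‖trig s b w‖ ≤ ∑ ξ ∈ s, ‖b ξ‖ :=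
  norm_sum_mul_le s b _ fun _ => (norm_chr _ _).le

theorem norm_trig_pow_le (s : Finset (ℤ × ℤ)) (b : ℤ × ℤ → ℂ) (n : ℕ) (w : ℝ × ℝ) :
    ‖‖trig s b w‖ ^ n‖ ≤ (∑ ξ ∈ s, ‖b ξ‖) ^ n := by
  rw [norm_pow, norm_norm]
  exact pow_le_pow_left₀ (norm_nonneg _) (norm_trig_le s b w) n

theorem integrable_of_continuous_bounded {E : Type*} [NormedAddCommGroup E]
    [SecondCountableTopologyEither (ℝ × ℝ) E] {g : ℝ × ℝ → E}
    (hg : Continuous g) (C : ℝ) (hC : ∀ w, ‖g w‖ ≤ C) : Integrable g torusMeasure :=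
  Integrable.of_bound hg.aestronglyMeasurable C (Eventually.of_forall hC)

theorem integrable_norm_trig_pow (s : Finset (ℤ × ℤ)) (b : ℤ × ℤ → ℂ) (n : ℕ) :
    Integrable (fun w => ‖trig s b w‖ ^ n) torusMeasure :=
  integrable_of_continuous_bounded ((continuous_trig s b).norm.pow n) _ (norm_trig_pow_le s b n)

theorem integrable_chr (ξ : ℤ × ℤ) : Integrable (chr ξ) torusMeasure :=
  integrable_of_continuous_bounded (continuous_chr ξ) 1 fun _ => (norm_chr _ _).le

theorem integral_trig {s : Finset (ℤ × ℤ)} (b : ℤ × ℤ → ℂ) (hs : 0 ∉ s) :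
    ∫ w, trig s b w ∂torusMeasure = 0 := by
  unfold trig
  rw [integral_finsetSum _ fun ξ _ => (integrable_chr ξ).const_mul _]
  refine Finset.sum_eq_zero fun ξ hξ => ?_
  rw [integral_const_mul, integral_chr, if_neg (ne_of_mem_of_not_mem hξ hs), mul_zero]

theorem conj_trig (s : Finset (ℤ × ℤ)) (b : ℤ × ℤ → ℂ) (w : ℝ × ℝ) :
    starRingEnd ℂ (trig s b w) = ∑ ξ ∈ s, starRingEnd ℂ (b ξ) * chr (-ξ) w := by
  simp only [trig, map_sum, map_mul, chr_neg]

theorem integral_norm_sum_chr_sq {ι : Type*} (s : Finset ι) (B : ι → ℂ) (g : ι → ℤ × ℤ) :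
    ((∫ w, ‖∑ i ∈ s, B i * chr (g i) w‖ ^ 2 ∂torusMeasure : ℝ) : ℂ) =
      ∑ i ∈ s, ∑ j ∈ s, if g i = g j then B i * starRingEnd ℂ (B j) else 0 := by
  have e : ∀ w, ((‖∑ i ∈ s, B i * chr (g i) w‖ ^ 2 : ℝ) : ℂ) =
      ∑ i ∈ s, ∑ j ∈ s, B i * starRingEnd ℂ (B j) * chr (g i + -g j) w := by
    intro w
    rw [ofReal_pow, ← Complex.mul_conj', map_sum, Finset.sum_mul_sum]
    refine Finset.sum_congr rfl fun ξ _ => Finset.sum_congr rfl fun η _ => ?_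
    rw [chr_add, chr_neg, map_mul]; ring
  rw [← integral_complex_ofReal]
  simp only [e]
  rw [integral_finsetSum _ fun i _ => integrable_finsetSum _ fun j _ => (integrable_chr _).const_mul _]
  refine Finset.sum_congr rfl fun i _ => ?_
  rw [integral_finsetSum _ fun j _ => (integrable_chr _).const_mul _]
  refine Finset.sum_congr rfl fun j _ => ?_
  simp only [integral_const_mul, integral_chr, ← sub_eq_add_neg, sub_eq_zero]
  split_ifs <;> simp

theorem integral_norm_trig_sq (s : Finset (ℤ × ℤ)) (b : ℤ × ℤ → ℂ) :
    ∫ w, ‖trig s b w‖ ^ 2 ∂torusMeasure = ∑ ξ ∈ s, ‖b ξ‖ ^ 2 := by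
  classical
  apply Complex.ofReal_injective
  refine (integral_norm_sum_chr_sq s b id).trans ?_
  rw [ofReal_sum]
  refine Finset.sum_congr rfl fun ξ hξ => ?_
  simp [hξ, Complex.mul_conj']

theorem eq_or_eq_of_add_eq_add {n : ℕ} {ξ η ξ' η' : ℤ × ℤ} (h1 : ξ ∈ latticePts n)
    (h2 : η ∈ latticePts n) (h3 : ξ' ∈ latticePts n) (h4 : η' ∈ latticePts n) (h : ξ + η = ξ' + η') :
    (ξ' = ξ ∧ η' = η) ∨ (ξ' = η ∧ η' = ξ) ∨ (η = -ξ ∧ η' = -ξ') := by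
  have inj : ∀ {x y : ℤ × ℤ}, toC x = toC y → x = y := by
    intro x y hxy
    rw [← sub_eq_zero, ← toC_eq_zero, sub_eq_add_neg, toC_add, ← neg_one_zsmul, toC_zsmul, hxy]
    push_cast; ring
  have nrm : ∀ {x : ℤ × ℤ}, x ∈ latticePts n → toC x * starRingEnd ℂ (toC x) = n := by
    intro x hx
    rw [Complex.mul_conj', ← ofReal_pow, norm_toC_sq, mem_latticePts.1 hx]
    simp
  by_cases hs : ξ + η = 0
  · right; right
    exact ⟨eq_neg_of_add_eq_zero_right hs, eq_neg_of_add_eq_zero_right (h ▸ hs)⟩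
  have hC : toC ξ + toC η = toC ξ' + toC η' := by rw [← toC_add, h, toC_add]
  have hS : starRingEnd ℂ (toC ξ + toC η) ≠ 0 := by
    rw [Ne, map_eq_zero, ← toC_add, toC_eq_zero]; exact hs
  have key : toC ξ * toC η = toC ξ' * toC η' := by
    apply mul_left_cancel₀ hS
    have a1 : starRingEnd ℂ (toC ξ + toC η) * (toC ξ * toC η) = n * (toC ξ + toC η) := by
      rw [map_add]; linear_combination toC η * nrm h1 + toC ξ * nrm h2
    have a2 : starRingEnd ℂ (toC ξ' + toC η') * (toC ξ' * toC η') = n * (toC ξ' + toC η') := by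
      rw [map_add]; linear_combination toC η' * nrm h3 + toC ξ' * nrm h4
    rw [a1, hC, a2]
  have : (toC ξ' - toC ξ) * (toC ξ' - toC η) = 0 := by
    linear_combination key - toC ξ' * hC
  rcases mul_eq_zero.1 this with h5 | h5
  · left
    have := inj (sub_eq_zero.1 h5)
    subst this
    exact ⟨rfl, (add_left_cancel h).symm⟩
  · right; left
    have := inj (sub_eq_zero.1 h5)
    subst this
    refine ⟨rfl, ?_⟩
    rw [add_comm] at h
    exact (add_left_cancel h).symm

theorem integral_norm_trig_pow_four_le {n : ℕ} {s : Finset (ℤ × ℤ)}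
    (hs : s ⊆ latticePts n) (b : ℤ × ℤ → ℂ) (hb : ∀ ξ, ‖b (-ξ)‖ = ‖b ξ‖) :
    ∫ w, ‖trig s b w‖ ^ 4 ∂torusMeasure ≤ 3 * (∑ ξ ∈ s, ‖b ξ‖ ^ 2) ^ 2 := by
  classical
  set B : (ℤ × ℤ) × (ℤ × ℤ) → ℂ := fun q => b q.1 * b q.2 with hB
  set S := s ×ˢ s with hS
  have e : ∀ w, ‖trig s b w‖ ^ 4 = ‖∑ q ∈ S, B q * chr (q.1 + q.2) w‖ ^ 2 := by
    intro w
    have : ∑ q ∈ S, B q * chr (q.1 + q.2) w = trig s b w ^ 2 := by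
      rw [pow_two, trig, Finset.sum_mul_sum, hS, Finset.sum_product]
      refine Finset.sum_congr rfl fun ξ _ => Finset.sum_congr rfl fun η _ => ?_
      rw [chr_add, hB]; ring
    rw [this, norm_pow, ← pow_mul]
  simp only [e]
  have h1 := congrArg norm (integral_norm_sum_chr_sq S B fun q => q.1 + q.2)
  rw [Complex.norm_real] at h1
  refine (le_abs_self _).trans (h1.le.trans ((norm_sum_le _ _).trans
    ((Finset.sum_le_sum fun i _ => norm_sum_le _ _).trans ?_)))
  have hBn : ∀ q, ‖B q‖ = ‖b q.1‖ * ‖b q.2‖ := fun q => norm_mul _ _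
  set V := ∑ ξ ∈ s, ‖b ξ‖ ^ 2 with hV
  have hV2 : ∑ q ∈ S, ‖B q‖ ^ 2 = V ^ 2 := by
    rw [hS, Finset.sum_product, pow_two, hV, Finset.sum_mul_sum]
    simp only [hBn, mul_pow]
  have hanti : ∑ q ∈ S, (if q.2 = -q.1 then ‖B q‖ else 0) ≤ V := by
    rw [hS, Finset.sum_product]
    refine Finset.sum_le_sum fun ξ _ => ?_
    simp only [hBn]
    rw [Finset.sum_ite_eq' s (-ξ) fun η => ‖b ξ‖ * ‖b η‖, hb]
    split_ifs
    · rw [pow_two]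
    · positivity
  calc _ ≤ ∑ q ∈ S, ∑ q' ∈ S, ((if q' = q then ‖B q‖ * ‖B q'‖ else 0) +
        (if q' = q.swap then ‖B q‖ * ‖B q'‖ else 0) +
        (if q.2 = -q.1 then ‖B q‖ else 0) * (if q'.2 = -q'.1 then ‖B q'‖ else 0)) := by
        refine Finset.sum_le_sum fun q hq => Finset.sum_le_sum fun q' hq' => ?_
        have hq := Finset.mem_product.1 hq
        have hq' := Finset.mem_product.1 hq'
        have n1 : 0 ≤ (if q' = q then ‖B q‖ * ‖B q'‖ else 0) := by split_ifs <;> positivity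
        have n2 : 0 ≤ (if q' = q.swap then ‖B q‖ * ‖B q'‖ else 0) := by split_ifs <;> positivity
        have n3 : 0 ≤ (if q.2 = -q.1 then ‖B q‖ else 0) * (if q'.2 = -q'.1 then ‖B q'‖ else 0) := by
          split_ifs <;> positivity
        by_cases h : q.1 + q.2 = q'.1 + q'.2
        · rw [if_pos h, norm_mul, RCLike.norm_conj]
          rcases eq_or_eq_of_add_eq_add (hs hq.1) (hs hq.2) (hs hq'.1) (hs hq'.2) h with h' | h' | h'
          · have : q' = q := Prod.ext h'.1 h'.2
            rw [if_pos this] at n1 ⊢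
            linarith
          · have : q' = q.swap := Prod.ext h'.1 h'.2
            rw [if_pos this] at n2 ⊢
            linarith
          · rw [if_pos h'.1, if_pos h'.2]
            linarith
        · rw [if_neg h, norm_zero]
          linarith
    _ ≤ V ^ 2 + V ^ 2 + V * V := by
        simp only [Finset.sum_add_distrib]
        gcongr
        · rw [← hV2]
          refine Finset.sum_le_sum fun q hq => ?_
          rw [Finset.sum_ite_eq' S q fun q' => ‖B q‖ * ‖B q'‖, if_pos hq, pow_two]
        · rw [← hV2]
          refine Finset.sum_le_sum fun q hq => ?_
          rw [Finset.sum_ite_eq' S q.swap fun q' => ‖B q‖ * ‖B q'‖, if_pos]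
          · rw [hBn, hBn, Prod.fst_swap, Prod.snd_swap]
            exact le_of_eq (by ring)
          · have := Finset.mem_product.1 hq
            exact Finset.mem_product.2 ⟨this.2, this.1⟩
        · rw [← Finset.sum_mul_sum]
          refine mul_le_mul hanti hanti (Finset.sum_nonneg fun q _ => ?_)
            (Finset.sum_nonneg fun _ _ => sq_nonneg _)
          split_ifs <;> positivity
    _ = _ := by ring

theorem cos_le_quartic (x : ℝ) : Real.cos x ≤ 1 - x ^ 2 / 2 + x ^ 4 / 24 := by
  have main : ∀ y : ℝ, 0 ≤ y → y ^ 2 - y ^ 4 / 3 ≤ Real.sin y ^ 2 := by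
    intro y hy
    by_cases h : y ^ 2 ≤ 6
    · have h1 := Real.sin_ge_sub_cube hy
      have h2 : 0 ≤ y - y ^ 3 / 6 := by nlinarith
      have h3 := pow_le_pow_left₀ h2 h1 2
      nlinarith [sq_nonneg (y ^ 3)]
    · have : y ^ 2 - y ^ 4 / 3 ≤ 0 := by nlinarith
      exact this.trans (sq_nonneg _)
  have h := main (|x| / 2) (by positivity)
  have e1 : (|x| / 2) ^ 2 = x ^ 2 / 4 := by rw [div_pow, sq_abs]; ring
  have e2 : (|x| / 2) ^ 4 = x ^ 4 / 16 := by
    rw [div_pow, show |x| ^ 4 = (|x| ^ 2) ^ 2 by ring, sq_abs]; ring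
  have e3 : Real.cos x = 1 - 2 * Real.sin (|x| / 2) ^ 2 := by
    rw [← Real.cos_abs x]
    have := Real.cos_two_mul (|x| / 2)
    have h2 := Real.sin_sq_add_cos_sq (|x| / 2)
    rw [show 2 * (|x| / 2) = |x| by ring] at this
    linarith
  rw [e1, e2] at h
  linarith

theorem trig_eq_re {s : Finset (ℤ × ℤ)} {b : ℤ × ℤ → ℂ} (hs : ∀ ξ ∈ s, -ξ ∈ s)
    (hb : ∀ ξ, b (-ξ) = starRingEnd ℂ (b ξ)) (w : ℝ × ℝ) :
    trig s b w = ((trig s b w).re : ℂ) := by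
  symm
  rw [← Complex.conj_eq_iff_re, conj_trig, trig]
  refine Finset.sum_bij (fun ξ _ => -ξ) (fun ξ hξ => hs ξ hξ) (fun _ _ _ _ h => neg_injective h)
    (fun ξ hξ => ⟨-ξ, hs ξ hξ, neg_neg ξ⟩) (fun ξ _ => by rw [hb])

theorem norm_eq_of_conj {b : ℤ × ℤ → ℂ} (hb : ∀ ξ, b (-ξ) = starRingEnd ℂ (b ξ)) (ξ : ℤ × ℤ) :
    ‖b (-ξ)‖ = ‖b ξ‖ := by
  rw [hb, RCLike.norm_conj]

theorem zero_notMem_of_subset {n : ℕ} (hn : 0 < n) {s : Finset (ℤ × ℤ)} (hs : s ⊆ latticePts n) :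
    (0 : ℤ × ℤ) ∉ s := by
  intro h
  have := mem_latticePts.1 (hs h)
  simp at this
  omega

theorem norm_integral_exp_trig_le_of_small {n : ℕ} (hn : 0 < n) {s : Finset (ℤ × ℤ)}
    (hsub : s ⊆ latticePts n) {b : ℤ × ℤ → ℂ} (hs : ∀ ξ ∈ s, -ξ ∈ s)
    (hb : ∀ ξ, b (-ξ) = starRingEnd ℂ (b ξ)) (t : ℝ) (ht : t ^ 2 * ∑ ξ ∈ s, ‖b ξ‖ ^ 2 ≤ 1) :
    ‖∫ w, cexp (t * I * trig s b w) ∂torusMeasure‖ ≤ 1 - (t ^ 2 * ∑ ξ ∈ s, ‖b ξ‖ ^ 2) / 5 := by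
  set W := t ^ 2 * ∑ ξ ∈ s, ‖b ξ‖ ^ 2 with hW
  have hW0 : 0 ≤ W := by positivity
  set X : ℝ × ℝ → ℝ := fun w => t * (trig s b w).re with hX
  have hXc : Continuous X := continuous_const.mul (Complex.continuous_re.comp (continuous_trig s b))
  have hXn : ∀ w, |X w| = |t| * ‖trig s b w‖ := by
    intro w
    conv_rhs => rw [trig_eq_re hs hb w, Complex.norm_real]
    rw [hX, abs_mul]; rfl
  have hXb : ∀ w, |X w| ≤ |t| * ∑ ξ ∈ s, ‖b ξ‖ := fun w => by
    rw [hXn]; exact mul_le_mul_of_nonneg_left (norm_trig_le s b w) (abs_nonneg _)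
  set M := |t| * ∑ ξ ∈ s, ‖b ξ‖
  have hInt : ∀ k : ℕ, Integrable (fun w => X w ^ k) torusMeasure := fun k =>
    integrable_of_continuous_bounded (hXc.pow k) (M ^ k) fun w => by
      rw [norm_pow]; exact pow_le_pow_left₀ (abs_nonneg _) (hXb w) k
  have m1 : ∫ w, X w ∂torusMeasure = 0 := by
    have h := integral_trig b (zero_notMem_of_subset hn hsub)
    simp only [hX]
    rw [integral_const_mul]
    have h2 : ((∫ w, (trig s b w).re ∂torusMeasure : ℝ) : ℂ) = 0 := by
      rw [← integral_complex_ofReal, ← h]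
      exact integral_congr_ae (Eventually.of_forall fun w => (trig_eq_re hs hb w).symm)
    rw [Complex.ofReal_eq_zero.1 h2, mul_zero]
  have m2 : ∫ w, X w ^ 2 ∂torusMeasure = W := by
    rw [hW, ← integral_norm_trig_sq, ← integral_const_mul]
    refine integral_congr_ae (Eventually.of_forall fun w => ?_)
    simp only
    rw [← sq_abs, hXn, mul_pow, sq_abs]
  have m4 : ∫ w, X w ^ 4 ∂torusMeasure ≤ 3 * W ^ 2 := by
    have h := integral_norm_trig_pow_four_le hsub b (norm_eq_of_conj hb)
    have e : ∫ w, X w ^ 4 ∂torusMeasure = t ^ 4 * ∫ w, ‖trig s b w‖ ^ 4 ∂torusMeasure := by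
      rw [← integral_const_mul]
      refine integral_congr_ae (Eventually.of_forall fun w => ?_)
      simp only
      rw [show X w ^ 4 = (X w ^ 2) ^ 2 by ring, ← sq_abs (X w), hXn, mul_pow, sq_abs]; ring
    rw [e, hW]
    calc _ ≤ t ^ 4 * (3 * (∑ ξ ∈ s, ‖b ξ‖ ^ 2) ^ 2) := by gcongr
      _ = _ := by ring
  have ic : Integrable (fun w => Real.cos (X w)) torusMeasure :=
    integrable_of_continuous_bounded (Real.continuous_cos.comp hXc) 1 fun w => Real.abs_cos_le_one _
  have is : Integrable (fun w => Real.sin (X w)) torusMeasure :=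
    integrable_of_continuous_bounded (Real.continuous_sin.comp hXc) 1 fun w => Real.abs_sin_le_one _
  have hφ : ∫ w, cexp (t * I * trig s b w) ∂torusMeasure =
      ((∫ w, Real.cos (X w) ∂torusMeasure : ℝ) : ℂ) + ((∫ w, Real.sin (X w) ∂torusMeasure : ℝ) : ℂ) * I := by
    rw [← integral_complex_ofReal, ← integral_complex_ofReal, ← integral_mul_const, ← integral_add]
    · refine integral_congr_ae (Eventually.of_forall fun w => ?_)
      simp only
      rw [trig_eq_re hs hb w, ofReal_cos, ofReal_sin, ← Complex.exp_mul_I, hX]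
      push_cast
      congr 1; ring
    · exact ic.ofReal
    · exact is.ofReal.mul_const I
  have i24 : Integrable (fun w => 1 - (1 / 2) * X w ^ 2) torusMeasure :=
    (integrable_const _).sub ((hInt 2).const_mul _)
  have hc1 : ∫ w, Real.cos (X w) ∂torusMeasure ≤ 1 - 3 / 8 * W := by
    have h1 : ∫ w, Real.cos (X w) ∂torusMeasure ≤
        ∫ w, (1 - (1 / 2) * X w ^ 2 + (1 / 24) * X w ^ 4) ∂torusMeasure := by
      refine integral_mono ic (i24.add ((hInt 4).const_mul _)) fun w => ?_
      · have := cos_le_quartic (X w)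
        simp only
        linarith
    rw [integral_add i24 ((hInt 4).const_mul _),
      integral_sub (integrable_const _) ((hInt 2).const_mul _), integral_const_mul, integral_const_mul,
      m2] at h1
    simp only [integral_const, probReal_univ, smul_eq_mul, mul_one] at h1
    nlinarith
  have hc2 : 1 - W / 2 ≤ ∫ w, Real.cos (X w) ∂torusMeasure := by
    have h1 : ∫ w, (1 - (1 / 2) * X w ^ 2) ∂torusMeasure ≤ ∫ w, Real.cos (X w) ∂torusMeasure := by
      refine integral_mono ((integrable_const _).sub ((hInt 2).const_mul _)) ic fun w => ?_
      have := Real.one_sub_sq_div_two_le_cos (x := X w)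
      simp only
      linarith
    rw [integral_sub (integrable_const _) ((hInt 2).const_mul _), integral_const_mul, m2] at h1
    simp only [integral_const, probReal_univ, smul_eq_mul, mul_one] at h1
    linarith
  have hsn : |∫ w, Real.sin (X w) ∂torusMeasure| ≤ W / 3 := by
    have i1 : Integrable X torusMeasure := by simpa using hInt 1
    have e : ∫ w, Real.sin (X w) ∂torusMeasure = ∫ w, (Real.sin (X w) - X w) ∂torusMeasure := by
      rw [integral_sub is i1, m1, sub_zero]
    rw [e]
    have h1 : |∫ w, (Real.sin (X w) - X w) ∂torusMeasure| ≤
        ∫ w, ((1 / 12) * X w ^ 2 + (1 / 12) * X w ^ 4) ∂torusMeasure := by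
      refine (abs_integral_le_integral_abs).trans (integral_mono (is.sub i1).abs
        (((hInt 2).const_mul _).add ((hInt 4).const_mul _)) fun w => ?_)
      have h2 := Real.abs_sub_sin_le (X w)
      simp only
      rw [abs_sub_comm]
      refine h2.trans ?_
      have h3 : X w ^ 4 = (|X w| ^ 2) ^ 2 := by rw [sq_abs]; ring
      rw [h3, ← sq_abs (X w)]
      nlinarith [sq_nonneg (|X w| ^ 2 - |X w|)]
    rw [integral_add ((hInt 2).const_mul _) ((hInt 4).const_mul _), integral_const_mul,
      integral_const_mul, m2] at h1
    nlinarith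
  rw [hφ]
  set c := ∫ w, Real.cos (X w) ∂torusMeasure
  set d := ∫ w, Real.sin (X w) ∂torusMeasure
  have hsq : ‖(c : ℂ) + d * I‖ ^ 2 = c ^ 2 + d ^ 2 := by
    rw [← Complex.normSq_eq_norm_sq, Complex.normSq_add_mul_I]
  refine abs_le_of_sq_le_sq' ?_ (by linarith) |>.2
  rw [hsq]
  have hd : d ^ 2 ≤ (W / 3) ^ 2 := by
    rw [← sq_abs d]; exact pow_le_pow_left₀ (abs_nonneg _) hsn 2
  have hcc : c ^ 2 ≤ (1 - 3 / 8 * W) ^ 2 := pow_le_pow_left₀ (by linarith) hc1 2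
  nlinarith

/-- Coefficients of the derivative in the first variable. -/
def dcoef (b : ℤ × ℤ → ℂ) (ξ : ℤ × ℤ) : ℂ := 2 * Real.pi * I * ξ.1 * b ξ

theorem dcoef_neg {b : ℤ × ℤ → ℂ} (hb : ∀ ξ, b (-ξ) = starRingEnd ℂ (b ξ)) (ξ : ℤ × ℤ) :
    dcoef b (-ξ) = starRingEnd ℂ (dcoef b ξ) := by
  simp [dcoef, hb, Complex.conj_ofNat]

theorem norm_dcoef_sq (b : ℤ × ℤ → ℂ) (ξ : ℤ × ℤ) :
    ‖dcoef b ξ‖ ^ 2 = 4 * Real.pi ^ 2 * ((ξ.1 : ℝ) ^ 2 * ‖b ξ‖ ^ 2) := by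
  rw [dcoef]
  simp only [norm_mul, Complex.norm_I, Complex.norm_real, Complex.norm_intCast, mul_pow, RCLike.norm_ofNat,
    Real.norm_eq_abs, sq_abs]
  ring

theorem hasDerivAt_trig (s : Finset (ℤ × ℤ)) (b : ℤ × ℤ → ℂ) (x y : ℝ) :
    HasDerivAt (fun x : ℝ => trig s b (x, y)) (trig s (dcoef b) (x, y)) x := by
  unfold trig
  refine HasDerivAt.fun_sum fun ξ _ => ?_
  have h1 : HasDerivAt (fun x : ℝ => 2 * (Real.pi : ℂ) * I * (((ξ.1 : ℝ) * x + (ξ.2 : ℝ) * y : ℝ) : ℂ))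
      (2 * (Real.pi : ℂ) * I * ((ξ.1 : ℝ) : ℂ)) x := by
    refine HasDerivAt.const_mul _ (HasDerivAt.ofReal_comp ?_)
    simpa using ((hasDerivAt_id x).const_mul (ξ.1 : ℝ)).add_const ((ξ.2 : ℝ) * y)
  have h2 := (h1.cexp).const_mul (b ξ)
  refine h2.congr_deriv ?_
  simp only [dcoef, chr, ofReal_intCast]
  ring

theorem chr_one_eq (ξ : ℤ × ℤ) (y : ℝ) : chr ξ (1, y) = chr ξ (0, y) := by
  have h := Complex.exp_int_mul_two_pi_mul_I ξ.1
  simp only [chr]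
  have e : 2 * (Real.pi : ℂ) * I * (((ξ.1 : ℝ) * 1 + (ξ.2 : ℝ) * y : ℝ) : ℂ) =
      ξ.1 * (2 * Real.pi * I) + 2 * (Real.pi : ℂ) * I * (((ξ.1 : ℝ) * 0 + (ξ.2 : ℝ) * y : ℝ) : ℂ) := by
    push_cast; ring
  rw [e, Complex.exp_add, h, one_mul]

theorem trig_one_eq (s : Finset (ℤ × ℤ)) (b : ℤ × ℤ → ℂ) (y : ℝ) :
    trig s b (1, y) = trig s b (0, y) := by
  simp only [trig, chr_one_eq]

theorem norm_exp_trig {s : Finset (ℤ × ℤ)} {b : ℤ × ℤ → ℂ} (hs : ∀ ξ ∈ s, -ξ ∈ s)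
    (hb : ∀ ξ, b (-ξ) = starRingEnd ℂ (b ξ)) (t : ℝ) (w : ℝ × ℝ) :
    ‖cexp (t * I * trig s b w)‖ = 1 := by
  rw [trig_eq_re hs hb w, show (t : ℂ) * I * ((trig s b w).re : ℂ) = ((t * (trig s b w).re : ℝ) : ℂ) * I by
    push_cast; ring]
  exact Complex.norm_exp_ofReal_mul_I _

theorem integral_second_deriv_exp_trig {s : Finset (ℤ × ℤ)} {b : ℤ × ℤ → ℂ} (hs : ∀ ξ ∈ s, -ξ ∈ s)
    (hb : ∀ ξ, b (-ξ) = starRingEnd ℂ (b ξ)) (t : ℝ) :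
    ∫ w, (trig s (dcoef (dcoef b)) w + t * I * trig s (dcoef b) w ^ 2) * cexp (t * I * trig s b w)
      ∂torusMeasure = 0 := by
  have hc : Continuous fun w => (trig s (dcoef (dcoef b)) w + t * I * trig s (dcoef b) w ^ 2) *
      cexp (t * I * trig s b w) :=
    ((continuous_trig s _).add (continuous_const.mul ((continuous_trig s _).pow 2))).mul
      (Complex.continuous_exp.comp (continuous_const.mul (continuous_trig s _)))
  have hi : Integrable (fun w => (trig s (dcoef (dcoef b)) w + t * I * trig s (dcoef b) w ^ 2) *
      cexp (t * I * trig s b w)) torusMeasure := by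
    refine integrable_of_continuous_bounded hc
      (∑ ξ ∈ s, ‖dcoef (dcoef b) ξ‖ + |t| * (∑ ξ ∈ s, ‖dcoef b ξ‖) ^ 2) fun w => ?_
    rw [norm_mul, norm_exp_trig hs hb, mul_one]
    refine (norm_add_le _ _).trans (add_le_add (norm_trig_le _ _ _) ?_)
    rw [norm_mul, norm_mul, Complex.norm_I, mul_one, Complex.norm_real, norm_pow, Real.norm_eq_abs]
    gcongr
    exact norm_trig_le _ _ _
  unfold torusMeasure at hi ⊢
  rw [integral_prod_symm _ hi]
  refine integral_eq_zero_of_ae (Eventually.of_forall fun y => ?_)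
  simp only [Pi.zero_apply]
  rw [← intervalIntegral.integral_of_le zero_le_one]
  have hder : ∀ x ∈ Set.uIcc (0 : ℝ) 1, HasDerivAt
      (fun x : ℝ => trig s (dcoef b) (x, y) * cexp (t * I * trig s b (x, y)))
      ((trig s (dcoef (dcoef b)) (x, y) + t * I * trig s (dcoef b) (x, y) ^ 2) *
        cexp (t * I * trig s b (x, y))) x := by
    intro x _
    refine ((hasDerivAt_trig s (dcoef b) x y).mul
      ((hasDerivAt_trig s b x y).const_mul (t * I : ℂ)).cexp).congr_deriv ?_
    ring
  rw [intervalIntegral.integral_eq_sub_of_hasDerivAt hder]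
  · simp [trig_one_eq]
  · exact (hc.comp (Continuous.prodMk continuous_id continuous_const)).intervalIntegrable _ _

theorem norm_integral_exp_trig_le_of_large_of_dir {n : ℕ} (hn : 0 < n) {s : Finset (ℤ × ℤ)}
    (hsub : s ⊆ latticePts n) {b : ℤ × ℤ → ℂ} (hs : ∀ ξ ∈ s, -ξ ∈ s)
    (hb : ∀ ξ, b (-ξ) = starRingEnd ℂ (b ξ)) {t : ℝ} (ht0 : 0 ≤ t)
    (ht : 1 ≤ t ^ 2 * ∑ ξ ∈ s, ‖b ξ‖ ^ 2)
    (hdir : n * (∑ ξ ∈ s, ‖b ξ‖ ^ 2) ≤ 2 * ∑ ξ ∈ s, (ξ.1 : ℝ) ^ 2 * ‖b ξ‖ ^ 2) :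
    ‖∫ w, cexp (t * I * trig s b w) ∂torusMeasure‖ ≤ 1 - 1 / 30 := by
  set V := ∑ ξ ∈ s, ‖b ξ‖ ^ 2 with hV
  set φ := ∫ w, cexp (t * I * trig s b w) ∂torusMeasure with hφ
  by_cases hφ0 : φ = 0
  · rw [hφ0]; norm_num
  have hφn : 0 < ‖φ‖ := norm_pos_iff.2 hφ0
  have hec : Continuous fun w => cexp (t * I * trig s b w) :=
    Complex.continuous_exp.comp (continuous_const.mul (continuous_trig s _))
  have hei : Integrable (fun w => cexp (t * I * trig s b w)) torusMeasure :=
    integrable_of_continuous_bounded hec 1 fun w => (norm_exp_trig hs hb t w).le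
  set u : ℂ := φ / ‖φ‖ with hu
  have hun : ‖u‖ = 1 := by
    rw [hu, norm_div, Complex.norm_real, norm_norm, div_self hφn.ne']
  set h : ℝ × ℝ → ℂ := fun w => cexp (t * I * trig s b w) - u with hh
  have hhc : Continuous h := hec.sub continuous_const
  have hhb : ∀ w, ‖h w‖ ≤ 2 := fun w => by
    refine (norm_sub_le _ _).trans ?_
    rw [norm_exp_trig hs hb, hun]; norm_num
  have hhi : Integrable (fun w => ‖h w‖ ^ 2) torusMeasure :=
    integrable_of_continuous_bounded (hhc.norm.pow 2) 4 fun w => by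
      rw [norm_pow, norm_norm]; nlinarith [hhb w, norm_nonneg (h w)]
  have hD : ∫ w, ‖h w‖ ^ 2 ∂torusMeasure = 2 - 2 * ‖φ‖ := by
    have e : ∀ w, ‖h w‖ ^ 2 = 2 - 2 * (starRingEnd ℂ u * cexp (t * I * trig s b w)).re := by
      intro w
      rw [hh]
      simp only
      rw [← Complex.normSq_eq_norm_sq, Complex.normSq_sub, Complex.normSq_eq_norm_sq,
        Complex.normSq_eq_norm_sq, norm_exp_trig hs hb, hun, mul_comm (cexp _)]
      ring
    simp only [e]
    have hi2 : Integrable (fun w => starRingEnd ℂ u * cexp (t * I * trig s b w)) torusMeasure :=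
      hei.const_mul _
    have hi3 : Integrable (fun w => (starRingEnd ℂ u * cexp (t * I * trig s b w)).re) torusMeasure :=
      hi2.re
    rw [integral_sub (integrable_const _) (hi3.const_mul 2), integral_const_mul]
    have h3 : ∫ w, (starRingEnd ℂ u * cexp (t * I * trig s b w)).re ∂torusMeasure = ‖φ‖ := by
      have := integral_re hi2
      refine this.trans ?_
      rw [integral_const_mul, ← hφ, hu, map_div₀, Complex.conj_ofReal, div_mul_eq_mul_div, mul_comm,
        Complex.mul_conj', pow_two, mul_div_assoc, div_self (by exact_mod_cast hφn.ne'), mul_one]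
      simp
    rw [h3]
    simp
  set A := ∑ ξ ∈ s, ‖dcoef b ξ‖ ^ 2 with hA
  have hAe : A = 4 * Real.pi ^ 2 * ∑ ξ ∈ s, (ξ.1 : ℝ) ^ 2 * ‖b ξ‖ ^ 2 := by
    rw [hA, Finset.mul_sum]
    exact Finset.sum_congr rfl fun ξ _ => norm_dcoef_sq b ξ
  have hV0 : 0 < V := by
    by_contra hc
    have : t ^ 2 * V ≤ 0 := mul_nonpos_of_nonneg_of_nonpos (sq_nonneg _) (not_lt.1 hc)
    linarith
  have ht1 : 0 < t := by
    rcases ht0.lt_or_eq with h | h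
    · exact h
    · rw [← h] at ht; norm_num at ht
  have hn' : (0 : ℝ) < n := by exact_mod_cast hn
  have hpi : 0 < 4 * Real.pi ^ 2 := by positivity
  have hA1 : 4 * Real.pi ^ 2 * n * V ≤ 2 * A := by
    rw [hAe]; nlinarith
  have hA0 : 0 < A := by
    have : 0 < 4 * Real.pi ^ 2 * n * V := by positivity
    linarith
  set X1 := trig s (dcoef b) with hX1
  set X2 := trig s (dcoef (dcoef b)) with hX2
  have hX1r : ∀ w, X1 w ^ 2 = ((‖X1 w‖ ^ 2 : ℝ) : ℂ) := by
    intro w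
    rw [hX1, trig_eq_re hs (dcoef_neg hb) w, Complex.norm_real, Real.norm_eq_abs, sq_abs, ofReal_pow]
  have h0s := zero_notMem_of_subset hn hsub
  have m2 : ∫ w, ‖X1 w‖ ^ 2 ∂torusMeasure = A := integral_norm_trig_sq s _
  have m4 : ∫ w, ‖X1 w‖ ^ 4 ∂torusMeasure ≤ 3 * A ^ 2 :=
    integral_norm_trig_pow_four_le hsub _ (norm_eq_of_conj (dcoef_neg hb))
  have mm : ∫ w, ‖X2 w‖ ^ 2 ∂torusMeasure ≤ 4 * Real.pi ^ 2 * n * A := by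
    rw [hX2, integral_norm_trig_sq, hA, Finset.mul_sum]
    refine Finset.sum_le_sum fun ξ hξ => ?_
    rw [norm_dcoef_sq (dcoef b), mul_assoc (4 * Real.pi ^ 2)]
    have h1 : (ξ.1 : ℝ) ^ 2 ≤ n := by
      have := mem_latticePts.1 (hsub hξ)
      have h2 : (ξ.1 : ℝ) ^ 2 + (ξ.2 : ℝ) ^ 2 = n := by exact_mod_cast this
      nlinarith [sq_nonneg (ξ.2 : ℝ)]
    gcongr
  have i2 := integrable_norm_trig_pow s (dcoef (dcoef b)) 2
  have i4 := integrable_norm_trig_pow s (dcoef b) 4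
  have c1 : Continuous X1 := continuous_trig _ _
  have c2 : Continuous X2 := continuous_trig _ _
  have iX2 : Integrable X2 torusMeasure :=
    integrable_of_continuous_bounded c2 _ (norm_trig_le _ _)
  have iX1 : Integrable (fun w => X1 w ^ 2) torusMeasure :=
    integrable_of_continuous_bounded (c1.pow 2) ((∑ ξ ∈ s, ‖dcoef b ξ‖) ^ 2) fun w => by
      rw [norm_pow]; exact pow_le_pow_left₀ (norm_nonneg _) (norm_trig_le _ _ _) 2
  have key : ∫ w, (X2 w + t * I * X1 w ^ 2) * h w ∂torusMeasure = -(t * I * u * A) := by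
    have e : ∀ w, (X2 w + t * I * X1 w ^ 2) * h w =
        (X2 w + t * I * X1 w ^ 2) * cexp (t * I * trig s b w) - u * (X2 w + t * I * X1 w ^ 2) := by
      intro w; rw [hh]; ring
    have hi : Integrable (fun w => X2 w + t * I * X1 w ^ 2) torusMeasure :=
      iX2.add (iX1.const_mul _)
    have hi2 : Integrable (fun w => (X2 w + t * I * X1 w ^ 2) * cexp (t * I * trig s b w)) torusMeasure :=
      hi.mul_bdd (c := 1) hec.aestronglyMeasurable (Eventually.of_forall fun w => (norm_exp_trig hs hb t w).le)
    simp only [e]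
    rw [integral_sub hi2 (hi.const_mul u), integral_second_deriv_exp_trig hs hb, integral_const_mul,
      integral_add iX2 (iX1.const_mul _), integral_const_mul, integral_trig _ h0s]
    simp only [hX1r]
    rw [integral_complex_ofReal, m2]
    ring
  have hbd : t * A ≤ ∫ w, (t * (1 / (14 * A) * ‖X1 w‖ ^ 4 + 7 * A / 2 * ‖h w‖ ^ 2) +
      (1 / (10 * t * A) * ‖X2 w‖ ^ 2 + 5 * t * A / 2 * ‖h w‖ ^ 2)) ∂torusMeasure := by
    have e : ‖-((t : ℂ) * I * u * A)‖ = t * A := by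
      rw [norm_neg, norm_mul, norm_mul, norm_mul, hun, Complex.norm_I, Complex.norm_real,
        Complex.norm_real, Real.norm_of_nonneg ht0, Real.norm_of_nonneg hA0.le]
      ring
    rw [← e, ← key]
    refine norm_integral_le_of_norm_le (((i4.const_mul _).add (hhi.const_mul _)).const_mul t |>.add
      ((i2.const_mul _).add (hhi.const_mul _))) (Eventually.of_forall fun w => ?_)
    rw [norm_mul]
    have h1 : ‖X2 w + t * I * X1 w ^ 2‖ ≤ ‖X2 w‖ + t * ‖X1 w‖ ^ 2 := by
      refine (norm_add_le _ _).trans (le_of_eq ?_)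
      rw [norm_mul, norm_mul, norm_pow, Complex.norm_I, Complex.norm_real, Real.norm_of_nonneg ht0, mul_one]
    refine (mul_le_mul_of_nonneg_right h1 (norm_nonneg _)).trans ?_
    have h2 : ‖X1 w‖ ^ 2 * ‖h w‖ ≤ 1 / (14 * A) * ‖X1 w‖ ^ 4 + 7 * A / 2 * ‖h w‖ ^ 2 := by
      have : 1 / (14 * A) * ‖X1 w‖ ^ 4 + 7 * A / 2 * ‖h w‖ ^ 2 - ‖X1 w‖ ^ 2 * ‖h w‖ =
          (1 / (14 * A)) * (‖X1 w‖ ^ 2 - 7 * A * ‖h w‖) ^ 2 := by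
        field_simp; ring
      have h3 : 0 ≤ (1 / (14 * A)) * (‖X1 w‖ ^ 2 - 7 * A * ‖h w‖) ^ 2 := by positivity
      linarith
    have h4 : ‖X2 w‖ * ‖h w‖ ≤ 1 / (10 * t * A) * ‖X2 w‖ ^ 2 + 5 * t * A / 2 * ‖h w‖ ^ 2 := by
      have : 1 / (10 * t * A) * ‖X2 w‖ ^ 2 + 5 * t * A / 2 * ‖h w‖ ^ 2 - ‖X2 w‖ * ‖h w‖ =
          (1 / (10 * t * A)) * (‖X2 w‖ - 5 * t * A * ‖h w‖) ^ 2 := by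
        field_simp; ring
      have h3 : 0 ≤ (1 / (10 * t * A)) * (‖X2 w‖ - 5 * t * A * ‖h w‖) ^ 2 := by positivity
      linarith
    have h5 := mul_le_mul_of_nonneg_left h2 ht0
    nlinarith
  have j1 : Integrable (fun w => 1 / (14 * A) * ‖X1 w‖ ^ 4 + 7 * A / 2 * ‖h w‖ ^ 2) torusMeasure :=
    (i4.const_mul _).add (hhi.const_mul _)
  have j2 : Integrable (fun w => 1 / (10 * t * A) * ‖X2 w‖ ^ 2 + 5 * t * A / 2 * ‖h w‖ ^ 2) torusMeasure :=
    (i2.const_mul _).add (hhi.const_mul _)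
  rw [integral_add (j1.const_mul t) j2, integral_const_mul, integral_add (i4.const_mul _) (hhi.const_mul _),
    integral_add (i2.const_mul _) (hhi.const_mul _), integral_const_mul, integral_const_mul,
    integral_const_mul, integral_const_mul, hD] at hbd
  have k1 : 1 / (14 * A) * ∫ w, ‖X1 w‖ ^ 4 ∂torusMeasure ≤ 3 / 14 * A := by
    calc _ ≤ 1 / (14 * A) * (3 * A ^ 2) := by gcongr
      _ = _ := by field_simp
  have k2 : 1 / (10 * t * A) * ∫ w, ‖X2 w‖ ^ 2 ∂torusMeasure ≤ t * A / 5 := by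
    have h1 : 4 * Real.pi ^ 2 * n ≤ 2 * A * t ^ 2 := by
      have h2 : 4 * Real.pi ^ 2 * n * 1 ≤ 4 * Real.pi ^ 2 * n * (t ^ 2 * V) := by gcongr
      nlinarith [sq_nonneg t]
    calc _ ≤ 1 / (10 * t * A) * (4 * Real.pi ^ 2 * n * A) := by gcongr
      _ ≤ 1 / (10 * t * A) * (2 * A * t ^ 2 * A) := by gcongr
      _ = _ := by field_simp; ring
  have k3 := mul_le_mul_of_nonneg_left k1 ht0
  have htA : 0 < t * A := by positivity
  have : t * A * 1 ≤ t * A * (3 / 14 + 1 / 5 + 6 * (2 - 2 * ‖φ‖)) := by nlinarith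
  have := le_of_mul_le_mul_left this htA
  linarith

theorem norm_integral_exp_trig_le_of_large {n : ℕ} (hn : 0 < n) {s : Finset (ℤ × ℤ)}
    (hsub : s ⊆ latticePts n) {b : ℤ × ℤ → ℂ} (hs : ∀ ξ ∈ s, -ξ ∈ s)
    (hb : ∀ ξ, b (-ξ) = starRingEnd ℂ (b ξ)) {t : ℝ} (ht0 : 0 ≤ t)
    (ht : 1 ≤ t ^ 2 * ∑ ξ ∈ s, ‖b ξ‖ ^ 2) :
    ‖∫ w, cexp (t * I * trig s b w) ∂torusMeasure‖ ≤ 1 - 1 / 30 := by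
  have hsum : n * (∑ ξ ∈ s, ‖b ξ‖ ^ 2) =
      (∑ ξ ∈ s, (ξ.1 : ℝ) ^ 2 * ‖b ξ‖ ^ 2) + ∑ ξ ∈ s, (ξ.2 : ℝ) ^ 2 * ‖b ξ‖ ^ 2 := by
    rw [Finset.mul_sum, ← Finset.sum_add_distrib]
    refine Finset.sum_congr rfl fun ξ hξ => ?_
    have h2 : (ξ.1 : ℝ) ^ 2 + (ξ.2 : ℝ) ^ 2 = n := by exact_mod_cast mem_latticePts.1 (hsub hξ)
    rw [← h2]; ring
  rcases le_total (∑ ξ ∈ s, (ξ.2 : ℝ) ^ 2 * ‖b ξ‖ ^ 2) (∑ ξ ∈ s, (ξ.1 : ℝ) ^ 2 * ‖b ξ‖ ^ 2) with h | h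
  · exact norm_integral_exp_trig_le_of_large_of_dir hn hsub hs hb ht0 ht (by linarith)
  · set s' := s.map (Equiv.prodComm ℤ ℤ).toEmbedding with hs'
    have hmem : ∀ ξ : ℤ × ℤ, ξ ∈ s' ↔ ξ.swap ∈ s := by
      intro ξ
      rw [hs', Finset.mem_map_equiv]
      rfl
    have htr : ∀ w : ℝ × ℝ, trig s b w.swap = trig s' (fun ξ => b ξ.swap) w := by
      intro w
      rw [trig, trig, hs', Finset.sum_map]
      refine Finset.sum_congr rfl fun ξ _ => ?_
      simp only [chr, Equiv.coe_toEmbedding, Equiv.prodComm_apply, Prod.swap_swap, Prod.fst_swap,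
        Prod.snd_swap]
      rw [add_comm]
    have hsum' : ∀ g : ℤ × ℤ → ℝ, ∑ ξ ∈ s', g ξ = ∑ ξ ∈ s, g ξ.swap := by
      intro g
      rw [hs', Finset.sum_map]
      rfl
    have e : ∫ w, cexp (t * I * trig s b w) ∂torusMeasure =
        ∫ w, cexp (t * I * trig s' (fun ξ => b ξ.swap) w) ∂torusMeasure := by
      simp only [← htr]
      exact (integral_prod_swap (fun w => cexp (t * I * trig s b w))).symm
    rw [e]
    refine norm_integral_exp_trig_le_of_large_of_dir hn ?_ ?_ ?_ ht0 ?_ ?_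
    · intro ξ hξ
      have := mem_latticePts.1 (hsub ((hmem ξ).1 hξ))
      refine mem_latticePts.2 ?_
      simp only [Prod.fst_swap, Prod.snd_swap] at this
      omega
    · intro ξ hξ
      exact (hmem _).2 (hs _ ((hmem ξ).1 hξ))
    · intro ξ
      exact hb ξ.swap
    · rw [hsum']; simpa using ht
    · rw [hsum', hsum']
      simp only [Prod.swap_swap, Prod.fst_swap]
      linarith

theorem norm_integral_exp_trig_le {n : ℕ} (hn : 0 < n) {s : Finset (ℤ × ℤ)}
    (hsub : s ⊆ latticePts n) {b : ℤ × ℤ → ℂ} (hs : ∀ ξ ∈ s, -ξ ∈ s)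
    (hb : ∀ ξ, b (-ξ) = starRingEnd ℂ (b ξ)) {t : ℝ} (ht0 : 0 ≤ t) :
    ‖∫ w, cexp (t * I * trig s b w) ∂torusMeasure‖ ≤
      Real.exp (-(min (t ^ 2 * ∑ ξ ∈ s, ‖b ξ‖ ^ 2) 1 / 30)) := by
  have hexp : ∀ x : ℝ, 1 - x ≤ Real.exp (-x) := fun x => by
    have := Real.add_one_le_exp (-x); linarith
  have h0 : 0 ≤ t ^ 2 * ∑ ξ ∈ s, ‖b ξ‖ ^ 2 := by positivity
  rcases le_total (t ^ 2 * ∑ ξ ∈ s, ‖b ξ‖ ^ 2) 1 with h | h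
  · rw [min_eq_left h]
    refine (norm_integral_exp_trig_le_of_small hn hsub hs hb t h).trans (le_trans ?_ (hexp _))
    linarith
  · rw [min_eq_right h]
    exact (norm_integral_exp_trig_le_of_large hn hsub hs hb ht0 h).trans (hexp _)

/-- The product of the characteristic functions of the class sums decays like a Gaussian. -/
theorem prod_norm_integral_exp_trig_le {n G : ℕ} (hn : 0 < n) (hG : 0 < G) {c : ℤ × ℤ → Fin G}
    (hc : ∀ ξ ∈ latticePts n, c (-ξ) = c ξ)
    {a : ℤ × ℤ → ℂ} (ha : ∀ ξ, a (-ξ) = starRingEnd ℂ (a ξ)) (hnorm : ∑ ξ ∈ latticePts n, ‖a ξ‖ ^ 2 = 1)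
    (hV : ∀ i, ∑ ξ ∈ latticePts n with c ξ = i, ‖a ξ‖ ^ 2 ≤ 100 / G) {t : ℝ} (ht0 : 0 ≤ t) :
    ‖∏ i, ∫ w, cexp (t * I * ∑ ξ ∈ latticePts n with c ξ = i, a ξ * chr ξ w) ∂torusMeasure‖ ≤
      Real.exp (-(min (t ^ 2) (G / 100) / 30)) := by
  have h1 : ∀ i, ‖∫ w, cexp (t * I * ∑ ξ ∈ latticePts n with c ξ = i, a ξ * chr ξ w) ∂torusMeasure‖ ≤
      Real.exp (-(min (t ^ 2 * ∑ ξ ∈ latticePts n with c ξ = i, ‖a ξ‖ ^ 2) 1 / 30)) := by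
    intro i
    refine norm_integral_exp_trig_le hn (Finset.filter_subset _ _) ?_ ha ht0
    intro ξ hξ
    obtain ⟨h2, h3⟩ := Finset.mem_filter.1 hξ
    exact Finset.mem_filter.2 ⟨neg_mem_latticePts.2 h2, (hc ξ h2).trans h3⟩
  rw [norm_prod]
  refine (Finset.prod_le_prod (fun _ _ => norm_nonneg _) fun i _ => h1 i).trans ?_
  rw [← Real.exp_sum, Real.exp_le_exp, Finset.sum_neg_distrib, neg_le_neg_iff, ← Finset.sum_div]
  gcongr
  set V : Fin G → ℝ := fun i => ∑ ξ ∈ latticePts n with c ξ = i, ‖a ξ‖ ^ 2 with hVd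
  have hsumV : ∑ i, V i = 1 := by
    rw [← hnorm, hVd]
    exact Finset.sum_fiberwise _ _ _
  have hG' : (0 : ℝ) < G := by exact_mod_cast hG
  set m := min (t ^ 2) (G / 100 : ℝ)
  have hm : ∀ i, m * V i ≤ min (t ^ 2 * V i) 1 := by
    intro i
    have hVi : 0 ≤ V i := Finset.sum_nonneg fun _ _ => sq_nonneg _
    refine le_min (mul_le_mul_of_nonneg_right (min_le_left _ _) hVi) ?_
    calc m * V i ≤ (G / 100) * (100 / G) :=
          mul_le_mul (min_le_right _ _) (hV i) hVi (by positivity)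
      _ = 1 := by field_simp
  calc m = ∑ i, m * V i := by rw [← Finset.mul_sum, hsumV, mul_one]
    _ ≤ _ := Finset.sum_le_sum fun i _ => hm i

theorem integral_fejer (y : ℝ) (hy : y ≠ 0) :
    ∫ s in (0 : ℝ)..1, 2 * (1 - s) * Real.cos (s * y) = 2 * (1 - Real.cos y) / y ^ 2 := by
  have hder : ∀ s ∈ Set.uIcc (0 : ℝ) 1, HasDerivAt
      (fun s : ℝ => 2 * (1 - s) * Real.sin (s * y) / y - 2 * Real.cos (s * y) / y ^ 2)
      (2 * (1 - s) * Real.cos (s * y)) s := by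
    intro s _
    have h1 : HasDerivAt (fun s : ℝ => s * y) y s := by simpa using (hasDerivAt_id s).mul_const y
    have h2 : HasDerivAt (fun s : ℝ => 2 * (1 - s)) (-2) s := by
      simpa using ((hasDerivAt_id s).const_sub 1).const_mul 2
    refine (((h2.mul h1.sin).div_const y).sub ((h1.cos.const_mul 2).div_const (y ^ 2))).congr_deriv ?_
    field_simp
    ring
  rw [intervalIntegral.integral_eq_sub_of_hasDerivAt hder]
  · simp
    ring
  · exact (by fun_prop : Continuous fun s : ℝ => 2 * (1 - s) * Real.cos (s * y)).intervalIntegrable _ _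

theorem integral_fejer_nonneg (y : ℝ) :
    0 ≤ ∫ s in (0 : ℝ)..1, 2 * (1 - s) * Real.cos (s * y) := by
  by_cases hy : y = 0
  · subst hy
    refine intervalIntegral.integral_nonneg zero_le_one fun s hs => ?_
    rw [mul_zero, Real.cos_zero]
    nlinarith [hs.2]
  · rw [integral_fejer y hy]
    have := Real.cos_le_one y
    have : 0 ≤ 1 - Real.cos y := by linarith
    positivity

theorem half_le_integral_fejer {y : ℝ} (hy : |y| ≤ 1) :
    1 / 2 ≤ ∫ s in (0 : ℝ)..1, 2 * (1 - s) * Real.cos (s * y) := by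
  have h1 : ∫ s in (0 : ℝ)..1, (1 - s) = 1 / 2 := by
    rw [intervalIntegral.integral_sub] <;> norm_num
  rw [← h1]
  refine intervalIntegral.integral_mono_on zero_le_one ?_ ?_ fun s hs => ?_
  · exact (by fun_prop : Continuous fun s : ℝ => 1 - s).intervalIntegrable _ _
  · exact (by fun_prop : Continuous fun s : ℝ => 2 * (1 - s) * Real.cos (s * y)).intervalIntegrable _ _
  · have h2 := Real.one_sub_sq_div_two_le_cos (x := s * y)
    have h3 : (s * y) ^ 2 ≤ 1 := by
      rw [mul_pow, ← sq_abs y]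
      have h4 : s ^ 2 ≤ 1 := by nlinarith [hs.1, hs.2]
      have h5 : |y| ^ 2 ≤ 1 := by nlinarith [abs_nonneg y]
      nlinarith [sq_nonneg s, sq_nonneg |y|]
    nlinarith [hs.2]

/-- Esseen's concentration inequality. -/
theorem measureReal_abs_le_inv_le {Ω : Type*} [MeasurableSpace Ω] (P : Measure Ω)
    [IsProbabilityMeasure P] {f : Ω → ℝ} (hf : Measurable f) {τ : ℝ} (hτ : 0 < τ) {B : ℝ → ℝ}
    (hB : Continuous B)
    (h : ∀ s ∈ Set.Icc (0 : ℝ) 1, ‖∫ x, cexp ((s * τ : ℝ) * I * f x) ∂P‖ ≤ B s) :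
    P.real {x | |f x| ≤ 1 / τ} ≤ 4 * ∫ s in (0 : ℝ)..1, B s := by
  set μ := (volume : Measure ℝ).restrict (Set.Ioc 0 1)
  have hm : Measurable fun q : Ω × ℝ => 2 * (1 - q.2) * Real.cos (q.2 * (τ * f q.1)) := by
    fun_prop
  have hμ : ∀ᵐ s ∂μ, s ∈ Set.Ioc (0 : ℝ) 1 := ae_restrict_mem measurableSet_Ioc
  have hi : Integrable (fun q : Ω × ℝ => 2 * (1 - q.2) * Real.cos (q.2 * (τ * f q.1))) (P.prod μ) := by
    refine Integrable.of_bound (C := 2) hm.aestronglyMeasurable ?_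
    have : ∀ᵐ q ∂(P.prod μ), q.2 ∈ Set.Ioc (0 : ℝ) 1 :=
      Measure.quasiMeasurePreserving_snd.ae hμ
    filter_upwards [this] with q hq
    have h1 := Real.abs_cos_le_one (q.2 * (τ * f q.1))
    rw [norm_mul, Real.norm_eq_abs, Real.norm_eq_abs, abs_of_nonneg (by linarith [hq.2])]
    nlinarith [hq.1, hq.2, abs_nonneg (Real.cos (q.2 * (τ * f q.1)))]
  have hset : MeasurableSet {x | |f x| ≤ 1 / τ} := measurableSet_le hf.abs measurable_const
  have h1 : P.real {x | |f x| ≤ 1 / τ} ≤ ∫ x, 2 * ∫ s, 2 * (1 - s) * Real.cos (s * (τ * f x)) ∂μ ∂P := by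
    rw [← integral_indicator_one hset]
    refine integral_mono ((integrable_const (1 : ℝ)).indicator hset) (hi.integral_prod_left.const_mul 2)
      fun x => ?_
    have e : ∫ s, 2 * (1 - s) * Real.cos (s * (τ * f x)) ∂μ =
        ∫ s in (0 : ℝ)..1, 2 * (1 - s) * Real.cos (s * (τ * f x)) := by
      rw [intervalIntegral.integral_of_le zero_le_one]
    simp only
    rw [e]
    by_cases hx : x ∈ {x | |f x| ≤ 1 / τ}
    · rw [Set.indicator_of_mem hx]
      have h2 : |τ * f x| ≤ 1 := by
        rw [abs_mul, abs_of_pos hτ]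
        have := mul_le_mul_of_nonneg_left (show |f x| ≤ 1 / τ from hx) hτ.le
        rwa [mul_one_div_cancel hτ.ne'] at this
      have := half_le_integral_fejer h2
      simp only [Pi.one_apply]
      linarith
    · rw [Set.indicator_of_notMem hx]
      have := integral_fejer_nonneg (τ * f x)
      linarith
  refine h1.trans ?_
  rw [integral_const_mul, integral_integral_swap hi]
  have h2 : ∫ s, ∫ x, 2 * (1 - s) * Real.cos (s * (τ * f x)) ∂P ∂μ ≤ ∫ s, 2 * B s ∂μ := by
    refine integral_mono_ae hi.integral_prod_right ?_ ?_
    · exact ((continuous_const.mul hB).integrableOn_Icc (a := 0) (b := 1)).mono_set Set.Ioc_subset_Icc_self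
    · filter_upwards [hμ] with s hs
      rw [integral_const_mul]
      have h3 : ∫ x, Real.cos (s * (τ * f x)) ∂P ≤ B s := by
        have hie : Integrable (fun x => cexp ((s * τ : ℝ) * I * f x)) P := by
          refine Integrable.of_bound (C := 1) ?_ (Eventually.of_forall fun x => ?_)
          · exact (Complex.measurable_exp.comp
              (measurable_const.mul (Complex.measurable_ofReal.comp hf))).aestronglyMeasurable
          · rw [show ((s * τ : ℝ) : ℂ) * I * f x = ((s * τ * f x : ℝ) : ℂ) * I by push_cast; ring,
              Complex.norm_exp_ofReal_mul_I]
        have e : ∫ x, Real.cos (s * (τ * f x)) ∂P = (∫ x, cexp ((s * τ : ℝ) * I * f x) ∂P).re := by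
          refine Eq.trans ?_ (integral_re hie)
          refine integral_congr_ae (Eventually.of_forall fun x => ?_)
          simp only
          rw [show ((s * τ : ℝ) : ℂ) * I * f x = ((s * (τ * f x) : ℝ) : ℂ) * I by push_cast; ring]
          exact (Complex.exp_ofReal_mul_I_re _).symm
        rw [e]
        exact (Complex.re_le_norm _).trans (h s ⟨hs.1.le, hs.2⟩)
      have hB0 : 0 ≤ B s := (norm_nonneg _).trans (h s ⟨hs.1.le, hs.2⟩)
      nlinarith [hs.1, hs.2]
  rw [intervalIntegral.integral_of_le zero_le_one]
  rw [integral_const_mul] at h2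
  linarith

theorem integral_exp_neg_mul_le {τ : ℝ} (hτ : 0 < τ) :
    ∫ s in (0 : ℝ)..1, Real.exp (-(s * τ)) ≤ 1 / τ := by
  have hder : ∀ s ∈ Set.uIcc (0 : ℝ) 1, HasDerivAt (fun s : ℝ => -(Real.exp (-(s * τ)) / τ))
      (Real.exp (-(s * τ))) s := by
    intro s _
    have h1 : HasDerivAt (fun s : ℝ => -(s * τ)) (-τ) s := by
      simpa using ((hasDerivAt_id s).mul_const τ).fun_neg
    refine ((h1.exp.div_const τ).neg).congr_deriv ?_
    field_simp
  rw [intervalIntegral.integral_eq_sub_of_hasDerivAt hder]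
  · simp only [zero_mul, neg_zero, Real.exp_zero]
    have : 0 ≤ Real.exp (-(1 * τ)) / τ := by positivity
    linarith
  · exact (by fun_prop : Continuous fun s : ℝ => Real.exp (-(s * τ))).intervalIntegrable _ _

theorem IsFlat.sq_le {lam : ℕ} {a : ℤ × ℤ → ℂ} (h : IsFlat lam a) {ξ : ℤ × ℤ} (hξ : ξ ∈ latticePts lam) :
    ‖a ξ‖ ^ 2 ≤ 100 / (latticePts lam).card := by
  have hN : (0 : ℝ) < (latticePts lam).card := by exact_mod_cast Finset.card_pos.2 ⟨ξ, hξ⟩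
  have ht : Tendsto (fun δ : ℝ => 100 * ((latticePts lam).card : ℝ) ^ (-1 + δ)) (𝓝[>] 0)
      (𝓝 (100 * ((latticePts lam).card : ℝ) ^ (-1 + (0 : ℝ)))) := by
    refine Tendsto.mono_left (ContinuousAt.tendsto ?_) nhdsWithin_le_nhds
    exact continuousAt_const.mul (Real.continuousAt_const_rpow hN.ne' |>.comp
      (continuousAt_const.add continuousAt_id))
  have := ge_of_tendsto ht (eventually_nhdsWithin_of_forall fun δ hδ => h δ hδ ξ hξ)
  rwa [add_zero, Real.rpow_neg_one, ← div_eq_mul_inv] at this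

theorem IsEigenfunction.sum_norm_le {lam : ℕ} {a : ℤ × ℤ → ℂ} {f : E2 → ℝ} (h : IsEigenfunction lam a f) :
    ∑ ξ ∈ latticePts lam, ‖a ξ‖ ≤ (latticePts lam).card := by
  have h1 : ∀ ξ ∈ latticePts lam, ‖a ξ‖ ≤ 1 := by
    intro ξ hξ
    have := Finset.single_le_sum (f := fun ξ => ‖a ξ‖ ^ 2) (fun _ _ => sq_nonneg _) hξ
    rw [h.2.2.1] at this
    nlinarith [norm_nonneg (a ξ)]
  simpa using Finset.sum_le_sum h1

theorem IsEigenfunction.eq_sum {lam : ℕ} {a : ℤ × ℤ → ℂ} {f : E2 → ℝ} (h : IsEigenfunction lam a f) (x : E2) :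
    (f x : ℂ) = ∑ ξ ∈ latticePts lam, a ξ * chrE ξ x := h.2.2.2 x

theorem IsEigenfunction.continuous {lam : ℕ} {a : ℤ × ℤ → ℂ} {f : E2 → ℝ} (h : IsEigenfunction lam a f) :
    Continuous f := by
  have e : f = fun x => (∑ ξ ∈ latticePts lam, a ξ * chrE ξ x).re := by
    ext x
    rw [← h.eq_sum, Complex.ofReal_re]
  rw [e]
  exact Complex.continuous_re.comp
    (continuous_finsetSum _ fun ξ _ => continuous_const.mul (continuous_chrE ξ))

theorem pow_div_factorial_le_exp_neg (M : ℕ) :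
    (M : ℝ) ^ (8 * M) / (8 * M).factorial ≤ Real.exp (-M) := by
  have h1 := Real.pow_div_factorial_le_exp (x := 4 * (M : ℝ)) (by positivity) (8 * M)
  have h2 : Real.exp (5 * (M : ℝ)) ≤ 4 ^ (8 * M) := by
    rw [pow_mul, show (5 * (M : ℝ)) = (M : ℝ) * 5 by ring, Real.exp_nat_mul]
    refine pow_le_pow_left₀ (Real.exp_pos _).le ?_ M
    have h3 : Real.exp 5 = Real.exp 1 ^ 5 := by
      rw [← Real.exp_nat_mul]; norm_num
    rw [h3]
    have h4 : Real.exp 1 ≤ 3 := by linarith [Real.exp_one_lt_d9]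
    calc _ ≤ (3 : ℝ) ^ 5 := pow_le_pow_left₀ (Real.exp_pos _).le h4 5
      _ ≤ _ := by norm_num
  rw [mul_pow] at h1
  have h5 : (0 : ℝ) < 4 ^ (8 * M) := by positivity
  have h6 : (M : ℝ) ^ (8 * M) / (8 * M).factorial ≤ Real.exp (4 * M) / 4 ^ (8 * M) := by
    rw [le_div_iff₀ h5]
    calc _ = 4 ^ (8 * M) * (M : ℝ) ^ (8 * M) / (8 * M).factorial := by ring
      _ ≤ _ := h1
  refine h6.trans ?_
  rw [div_le_iff₀ h5]
  calc Real.exp (4 * M) = Real.exp (-M) * Real.exp (5 * M) := by rw [← Real.exp_add]; ring_nf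
    _ ≤ _ := by gcongr

theorem exp_neg_le_inv {M : ℝ} (hM : 0 < M) : Real.exp (-M) ≤ 1 / M := by
  rw [Real.exp_neg, ← one_div]
  exact one_div_le_one_div_of_le hM (by linarith [Real.add_one_le_exp M])

theorem le_radius_mul {lam : ℕ} (hlam : 0 < lam) {ε r : ℝ} (hr : (lam : ℝ) ^ (-(1/2 : ℝ) + ε) < r) :
    (lam : ℝ) ^ ε ≤ r ^ 2 * ((lam : ℝ) ^ (1/2 - ε/2)) ^ 2 := by
  have hl : (0 : ℝ) < lam := by exact_mod_cast hlam
  have h1 : (lam : ℝ) ^ (ε / 2) ≤ r * (lam : ℝ) ^ (1/2 - ε/2) := by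
    calc (lam : ℝ) ^ (ε / 2) = (lam : ℝ) ^ (-(1/2 : ℝ) + ε) * (lam : ℝ) ^ (1/2 - ε/2) := by
          rw [← Real.rpow_add hl]; ring_nf
      _ ≤ _ := by gcongr
  calc (lam : ℝ) ^ ε = ((lam : ℝ) ^ (ε / 2)) ^ 2 := by
        rw [← Real.rpow_natCast, ← Real.rpow_mul hl.le]; norm_num
    _ ≤ (r * (lam : ℝ) ^ (1/2 - ε/2)) ^ 2 := by gcongr
    _ = _ := by ring

theorem measureReal_abs_le_inv_le_div {ε : ℝ} {p lam : ℕ} (hS : Structured ε p lam)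
    {a : ℤ × ℤ → ℂ} {f : E2 → ℝ} (hf : IsEigenfunction lam a f) (hflat : IsFlat lam a)
    (x₀ : E2) {r : ℝ} (hr0 : 0 < r) (hr : (lam : ℝ) ^ (-(1/2 : ℝ) + ε) < r) {τ : ℝ} (hτ : 1 ≤ τ)
    (hτN : τ ≤ ((latticePts lam).card : ℝ) ^ p) :
    (gaussAt x₀ r).real {x | |f x| ≤ 1 / τ} ≤ (24 + 4 * Real.exp 8) / τ := by
  obtain ⟨hsum, hN, G, hG, cls, hc1, hc2, hc3, hsep⟩ := hS
  have := isProbabilityMeasure_gaussAt x₀ hr0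
  have hNpos := card_latticePts_pos hsum
  set N := (latticePts lam).card with hNdef
  have hN1 : (1 : ℝ) ≤ N := by exact_mod_cast hNpos
  have hlam : 0 < lam := hsum.1
  have hNp : (1 : ℝ) ≤ (N : ℝ) ^ p := one_le_pow₀ hN1
  have hG0 : 0 < G := by
    obtain ⟨ξ, hξ⟩ := Finset.card_pos.1 hNpos
    exact (Nat.zero_le _).trans_lt (hc2 ξ hξ)
  have : NeZero G := ⟨hG0.ne'⟩
  set c : ℤ × ℤ → Fin G := fun ξ => Fin.ofNat G (cls ξ) with hc
  have hcc : ∀ ξ ∈ latticePts lam, (c ξ : ℕ) = cls ξ := fun ξ hξ => by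
    simp only [hc, Fin.ofNat]
    exact Nat.mod_eq_of_lt (hc2 ξ hξ)
  set M : ℕ := N ^ (p + 1) with hM
  have hM1 : 0 < M := pow_pos hNpos _
  have hNM : (N : ℝ) ^ p ≤ M := by
    rw [hM]; push_cast
    exact pow_le_pow_right₀ hN1 (Nat.le_succ p)
  have hM0 : (0 : ℝ) < M := by exact_mod_cast hM1
  have hτ0 : 0 < τ := by linarith
  have hGτ : Real.exp (-(G / 3000 : ℝ)) ≤ 1 / τ := by
    have h1 : Real.log τ ≤ G / 3000 := by
      have h2 := Real.log_le_log hτ0 hτN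
      rw [Real.log_pow] at h2
      linarith
    calc Real.exp (-(G / 3000 : ℝ)) ≤ Real.exp (-Real.log τ) := by gcongr
      _ = _ := by rw [Real.exp_neg, Real.exp_log hτ0, one_div]
  have hMτ : Real.exp (-(M : ℝ)) ≤ 1 / τ :=
    (exp_neg_le_inv hM0).trans (one_div_le_one_div_of_le hτ0 (hτN.trans hNM))
  have hprod : ∀ t : ℝ, 0 ≤ t →
      ‖∏ i, ∫ w, cexp (t * I * ∑ ξ ∈ latticePts lam with c ξ = i, a ξ * chr ξ w) ∂torusMeasure‖ ≤
      Real.exp (-(min (t ^ 2) (G / 100) / 30)) := by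
    intro t ht
    refine prod_norm_integral_exp_trig_le hlam hG0 ?_ hf.2.1 hf.2.2.1 ?_ ht
    · intro ξ hξ
      apply Fin.ext
      rw [hcc _ hξ, hcc _ (neg_mem_latticePts.2 hξ), hc1 ξ hξ]
    · intro i
      have h1 : ∑ ξ ∈ latticePts lam with c ξ = i, ‖a ξ‖ ^ 2 ≤
          ((latticePts lam).filter fun ξ => c ξ = i).card • (100 / N : ℝ) :=
        Finset.sum_le_card_nsmul _ _ _ fun ξ hξ => hflat.sq_le (Finset.mem_filter.1 hξ).1
      have h2 : (G : ℝ) * ((latticePts lam).filter fun ξ => c ξ = i).card = N := by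
        have h3 := hc3 i i.2
        have h4 : ((latticePts lam).filter fun ξ => c ξ = i) =
            (latticePts lam).filter fun ξ => cls ξ = i := by
          refine Finset.filter_congr fun ξ hξ => ?_
          rw [← hcc ξ hξ]
          exact Fin.ext_iff
        rw [h4]
        exact_mod_cast h3
      refine h1.trans (le_of_eq ?_)
      rw [nsmul_eq_mul, ← h2]
      have hG' : (G : ℝ) ≠ 0 := by exact_mod_cast hG0.ne'
      have h5 : (((latticePts lam).filter fun ξ => c ξ = i).card : ℝ) ≠ 0 := by
        intro h0; rw [h0, mul_zero] at h2; linarith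
      field_simp
  have hchar : ∀ s ∈ Set.Icc (0 : ℝ) 1,
      ‖∫ x, cexp ((s * τ : ℝ) * I * f x) ∂(gaussAt x₀ r)‖ ≤ 6 / τ + Real.exp 8 * Real.exp (-(s * τ)) := by
    intro s hs
    have ht0 : 0 ≤ s * τ := mul_nonneg hs.1 hτ0.le
    have htN : s * τ ≤ (N : ℝ) ^ p := by
      have : s * τ ≤ 1 * τ := by gcongr; exact hs.2
      linarith
    have htA : s * τ * N ≤ M := by
      rw [hM, pow_succ]; push_cast; gcongr
    have h1 := norm_gauss_sub_model_le (Q := 8 * M) x₀ hr0 (D := (lam : ℝ) ^ (1/2 - ε/2)) (by positivity) c hcc hsep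
      a ht0 hf.sum_norm_le (by push_cast; linarith)
    simp only [← hf.eq_sum] at h1
    have h2 : 4 * (s * τ * N) ^ (8 * M) / (8 * M).factorial ≤ 4 / τ := by
      calc 4 * (s * τ * N) ^ (8 * M) / (8 * M).factorial ≤ 4 * ((M : ℝ) ^ (8 * M) / (8 * M).factorial) := by
            rw [mul_div_assoc]; gcongr
        _ ≤ 4 * (1 / τ) :=
            mul_le_mul_of_nonneg_left ((pow_div_factorial_le_exp_neg M).trans hMτ) (by norm_num)
        _ = _ := by ring
    have h3 : Real.exp (s * τ * N) * Real.exp (-(Real.pi * r ^ 2 * ((lam : ℝ) ^ (1/2 - ε/2)) ^ 2)) ≤ 1 / τ := by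
      rw [← Real.exp_add]
      refine le_trans (Real.exp_le_exp.2 ?_) hMτ
      have h4 := le_radius_mul hlam hr
      have h5 : 2 * (M : ℝ) ≤ r ^ 2 * ((lam : ℝ) ^ (1/2 - ε/2)) ^ 2 := by
        refine le_trans ?_ h4
        rw [hM]; push_cast; exact hN
      have h6 := Real.pi_gt_three
      rw [mul_assoc]
      nlinarith
    have h4 : Real.exp (-(min ((s * τ) ^ 2) (G / 100) / 30)) ≤ 1 / τ + Real.exp 8 * Real.exp (-(s * τ)) := by
      rcases le_total ((s * τ) ^ 2) (G / 100 : ℝ) with h | h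
      · rw [min_eq_left h, ← Real.exp_add]
        have : Real.exp (-((s * τ) ^ 2 / 30)) ≤ Real.exp (8 + -(s * τ)) := by
          apply Real.exp_le_exp.2
          nlinarith [sq_nonneg (s * τ - 15)]
        have : 0 ≤ 1 / τ := by positivity
        linarith
      · rw [min_eq_right h, show (G / 100 / 30 : ℝ) = G / 3000 by ring]
        have : 0 ≤ Real.exp 8 * Real.exp (-(s * τ)) := by positivity
        linarith
    have h5 := norm_le_norm_add_norm_sub' (∫ x, cexp ((s * τ : ℝ) * I * f x) ∂(gaussAt x₀ r))
      (∏ i, ∫ w, cexp ((s * τ : ℝ) * I * ∑ ξ ∈ latticePts lam with c ξ = i, a ξ * chr ξ w) ∂torusMeasure)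
    have h6 := hprod (s * τ) ht0
    have h7 : (6 : ℝ) / τ = 4 / τ + 1 / τ + 1 / τ := by ring
    linarith
  have hcont : Continuous fun s : ℝ => Real.exp 8 * Real.exp (-(s * τ)) := by fun_prop
  refine (measureReal_abs_le_inv_le (B := fun s => 6 / τ + Real.exp 8 * Real.exp (-(s * τ)))
    _ hf.continuous.measurable hτ0 (continuous_const.add hcont) hchar).trans ?_
  have h2 := integral_exp_neg_mul_le hτ0
  have h3 : ∫ s in (0 : ℝ)..1, (6 / τ + Real.exp 8 * Real.exp (-(s * τ))) =
      6 / τ + Real.exp 8 * ∫ s in (0 : ℝ)..1, Real.exp (-(s * τ)) := by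
    rw [intervalIntegral.integral_add (by simp) (hcont.intervalIntegrable _ _),
      intervalIntegral.integral_const_mul]
    simp
  rw [h3]
  have h4 : Real.exp 8 * ∫ s in (0 : ℝ)..1, Real.exp (-(s * τ)) ≤ Real.exp 8 * (1 / τ) := by gcongr
  calc _ ≤ 4 * (6 / τ + Real.exp 8 * (1 / τ)) := by gcongr
    _ = _ := by ring

/-- Jensen's inequality for integer powers over a probability measure. -/
theorem lintegral_pow_le_of_isProbabilityMeasure {α : Type*} [MeasurableSpace α] (μ : Measure α)
    [IsProbabilityMeasure μ] {g : α → ℝ≥0∞} (hg : AEMeasurable g μ) {p : ℕ} (hp : 1 ≤ p) :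
    (∫⁻ x, g x ∂μ) ^ p ≤ ∫⁻ x, g x ^ p ∂μ := by
  rcases eq_or_lt_of_le hp with rfl | h1
  · simp
  have hp1 : (1 : ℝ) < p := by exact_mod_cast h1
  have hpq := Real.HolderConjugate.conjExponent hp1
  have h := ENNReal.lintegral_mul_le_Lp_mul_Lq μ hpq hg (aemeasurable_const (b := (1 : ℝ≥0∞)))
  simp only [Pi.mul_apply, mul_one, ENNReal.one_rpow, lintegral_const, measure_univ] at h
  calc (∫⁻ x, g x ∂μ) ^ p ≤ ((∫⁻ x, g x ^ (p : ℝ) ∂μ) ^ (1 / (p : ℝ))) ^ p := by gcongr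
    _ = ∫⁻ x, g x ^ (p : ℝ) ∂μ := by
      rw [← ENNReal.rpow_natCast, ← ENNReal.rpow_mul, one_div_mul_cancel (by linarith),
        ENNReal.rpow_one]
    _ = _ := by simp only [ENNReal.rpow_natCast]

theorem Separated.le_norm_sub {n Q G : ℕ} {D : ℝ} (h : Separated n Q G D) (hn : 0 < n) (hQ : 1 ≤ Q)
    {ξ η : ℤ × ℤ} (hξ : ξ ∈ latticePts n) (hη : η ∈ latticePts n) (hne : ξ ≠ η) :
    D ≤ ‖toC (ξ - η)‖ := by
  classical
  obtain ⟨cls, -, -, -, hsep⟩ := h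
  by_contra! hlt
  have hw := hsep (fun ζ => (if ζ = ξ then 1 else 0) - (if ζ = η then 1 else 0)) (by
    intro ζ _
    have : (1 : ℤ) ≤ Q := by exact_mod_cast hQ
    split_ifs <;> simp <;> omega) (by
    simpa [sub_smul, Finset.sum_sub_distrib, ite_smul, hξ, hη] using hlt) (cls ξ)
  simp only [sub_smul, Finset.sum_sub_distrib, ite_smul, one_smul, zero_smul] at hw
  rw [Finset.sum_ite_eq', Finset.sum_ite_eq'] at hw
  simp only [Finset.mem_filter, hξ, hη, true_and, if_true] at hw
  split_ifs at hw with hc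
  · exact hne (sub_eq_zero.1 hw)
  · rw [sub_zero] at hw
    rw [mem_latticePts, hw] at hξ
    simp at hξ
    omega

theorem chrE_sub (ξ η : ℤ × ℤ) (x : E2) : chrE (ξ - η) x = chrE ξ x * (starRingEnd ℂ) (chrE η x) := by
  unfold chrE
  rw [sub_eq_add_neg, chr_add, chr_neg]

theorem integral_normSq_sum_chrE_le {n : ℕ} (x₀ : E2) {r : ℝ} (hr : 0 < r) (b : ℤ × ℤ → ℂ) {δ : ℝ}
    (hδ : ∀ ξ ∈ latticePts n, ∀ η ∈ latticePts n, ξ ≠ η →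
      Real.exp (-(Real.pi * r ^ 2 * ‖toC (ξ - η)‖ ^ 2)) ≤ δ) (hδ0 : 0 ≤ δ) :
    ∫ x, ‖∑ ξ ∈ latticePts n, b ξ * chrE ξ x‖ ^ 2 ∂(gaussAt x₀ r) ≤
      ∑ ξ ∈ latticePts n, ‖b ξ‖ ^ 2 + (∑ ξ ∈ latticePts n, ‖b ξ‖) ^ 2 * δ := by
  classical
  have := isProbabilityMeasure_gaussAt x₀ hr
  have hInt : ∀ ξ, Integrable (fun x => chrE ξ x) (gaussAt x₀ r) := by
    intro ξ
    refine Integrable.of_bound (continuous_chrE ξ).aestronglyMeasurable 1 (ae_of_all _ fun x => ?_)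
    exact (norm_chr _ _).le
  have e1 : ∀ x, ((‖∑ ξ ∈ latticePts n, b ξ * chrE ξ x‖ ^ 2 : ℝ) : ℂ) =
      ∑ ξ ∈ latticePts n, ∑ η ∈ latticePts n, b ξ * (starRingEnd ℂ) (b η) * chrE (ξ - η) x := by
    intro x
    rw [← Complex.normSq_eq_norm_sq, ← Complex.mul_conj, map_sum, Finset.sum_mul_sum]
    refine Finset.sum_congr rfl fun ξ _ => Finset.sum_congr rfl fun η _ => ?_
    rw [chrE_sub, map_mul]
    ring
  have e2 : ((∫ x, ‖∑ ξ ∈ latticePts n, b ξ * chrE ξ x‖ ^ 2 ∂(gaussAt x₀ r) : ℝ) : ℂ) =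
      ∑ ξ ∈ latticePts n, ∑ η ∈ latticePts n,
        b ξ * (starRingEnd ℂ) (b η) * ∫ x, chrE (ξ - η) x ∂(gaussAt x₀ r) := by
    rw [← integral_complex_ofReal]
    simp_rw [e1]
    rw [integral_finsetSum _ fun ξ _ => integrable_finsetSum _ fun η _ => (hInt _).const_mul _]
    refine Finset.sum_congr rfl fun ξ _ => ?_
    rw [integral_finsetSum _ fun η _ => (hInt _).const_mul _]
    refine Finset.sum_congr rfl fun η _ => ?_
    rw [integral_const_mul]
  have e3 : ∀ ξ ∈ latticePts n, ∀ η ∈ latticePts n,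
      ‖b ξ * (starRingEnd ℂ) (b η) * ∫ x, chrE (ξ - η) x ∂(gaussAt x₀ r)‖ ≤
        (if ξ = η then ‖b ξ‖ ^ 2 else 0) + ‖b ξ‖ * ‖b η‖ * δ := by
    intro ξ hξ η hη
    have hpos : 0 ≤ ‖b ξ‖ * ‖b η‖ * δ := by positivity
    rw [norm_mul, norm_mul, RCLike.norm_conj]
    split_ifs with h
    · subst h
      have : ‖∫ x, chrE (ξ - ξ) x ∂(gaussAt x₀ r)‖ ≤ 1 := by
        rw [integral_chrE_gaussAt x₀ hr, sub_self, toC_zero]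
        simp [chrE, chr_zero]
      have h2 : 0 ≤ ‖b ξ‖ * ‖b ξ‖ := by positivity
      nlinarith
    · rw [zero_add, integral_chrE_gaussAt x₀ hr, norm_mul]
      have h1 : ‖chrE (ξ - η) x₀‖ = 1 := norm_chr _ _
      rw [h1, one_mul]
      gcongr
      refine le_trans (le_of_eq ?_) (hδ ξ hξ η hη h)
      rw [Complex.norm_real, Real.norm_of_nonneg (Real.exp_pos _).le]
  have hnn : 0 ≤ ∫ x, ‖∑ ξ ∈ latticePts n, b ξ * chrE ξ x‖ ^ 2 ∂(gaussAt x₀ r) :=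
    integral_nonneg fun x => by positivity
  calc _ = ‖((∫ x, ‖∑ ξ ∈ latticePts n, b ξ * chrE ξ x‖ ^ 2 ∂(gaussAt x₀ r) : ℝ) : ℂ)‖ := by
        rw [Complex.norm_real, Real.norm_of_nonneg hnn]
    _ ≤ ∑ ξ ∈ latticePts n, ∑ η ∈ latticePts n,
          ((if ξ = η then ‖b ξ‖ ^ 2 else 0) + ‖b ξ‖ * ‖b η‖ * δ) := by
        rw [e2]
        exact (norm_sum_le _ _).trans (Finset.sum_le_sum fun ξ hξ =>
          (norm_sum_le _ _).trans (Finset.sum_le_sum fun η hη => e3 ξ hξ η hη))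
    _ = _ := by
        simp_rw [Finset.sum_add_distrib]
        congr 1
        · refine Finset.sum_congr rfl fun ξ hξ => ?_
          rw [Finset.sum_ite_eq, if_pos hξ]
        · rw [sq, Finset.sum_mul_sum, Finset.sum_mul]
          exact Finset.sum_congr rfl fun ξ _ => by rw [Finset.sum_mul]

/-- Second moments of sums with coefficients dominated by those of an eigenfunction. -/
theorem lintegral_enorm_sq_sum_chrE_le {ε : ℝ} {p lam : ℕ} (hp : 1 ≤ p) (hS : Structured ε p lam)
    {a : ℤ × ℤ → ℂ} {f : E2 → ℝ} (hf : IsEigenfunction lam a f)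
    (x₀ : E2) {r : ℝ} (hr0 : 0 < r) (hr : (lam : ℝ) ^ (-(1/2 : ℝ) + ε) < r) {K : ℝ} (hK : 0 ≤ K)
    {b : ℤ × ℤ → ℂ} (hb : ∀ ξ ∈ latticePts lam, ‖b ξ‖ ≤ K * ‖a ξ‖) :
    ∫⁻ x, ‖∑ ξ ∈ latticePts lam, b ξ * chrE ξ x‖ₑ ^ 2 ∂(gaussAt x₀ r) ≤ ENNReal.ofReal (2 * K ^ 2) := by
  obtain ⟨hsum, hN, G, hG, hsep⟩ := hS
  have := isProbabilityMeasure_gaussAt x₀ hr0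
  have hNpos := card_latticePts_pos hsum
  have hlam : 0 < lam := hsum.1
  set N := (latticePts lam).card with hNdef
  have hN1 : (1 : ℝ) ≤ N := by exact_mod_cast hNpos
  have hδ : ∀ ξ ∈ latticePts lam, ∀ η ∈ latticePts lam, ξ ≠ η →
      Real.exp (-(Real.pi * r ^ 2 * ‖toC (ξ - η)‖ ^ 2)) ≤ 1 / (N : ℝ) ^ 2 := by
    intro ξ hξ η hη hne
    have h1 := hsep.le_norm_sub hlam (by
      have := pow_pos hNpos (p + 1); omega) hξ hη hne
    have h2 := le_radius_mul hlam hr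
    have h3 : r ^ 2 * ((lam : ℝ) ^ (1/2 - ε/2)) ^ 2 ≤ r ^ 2 * ‖toC (ξ - η)‖ ^ 2 := by gcongr
    have h4 : (N : ℝ) ^ 2 ≤ (N : ℝ) ^ (p + 1) := pow_le_pow_right₀ hN1 (by omega)
    have h5 := Real.pi_gt_three
    have h6 : (N : ℝ) ^ 2 ≤ Real.pi * r ^ 2 * ‖toC (ξ - η)‖ ^ 2 := by nlinarith
    have h7 : (0 : ℝ) < (N : ℝ) ^ 2 := by positivity
    calc Real.exp (-(Real.pi * r ^ 2 * ‖toC (ξ - η)‖ ^ 2)) ≤ Real.exp (-(N : ℝ) ^ 2) := by gcongr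
      _ ≤ _ := by
        rw [Real.exp_neg, one_div]
        exact inv_anti₀ h7 (by linarith [Real.add_one_le_exp ((N : ℝ) ^ 2)])
  have h1 := integral_normSq_sum_chrE_le x₀ hr0 b hδ (by positivity)
  have h2 : ∑ ξ ∈ latticePts lam, ‖b ξ‖ ^ 2 ≤ K ^ 2 := by
    calc _ ≤ ∑ ξ ∈ latticePts lam, K ^ 2 * ‖a ξ‖ ^ 2 := Finset.sum_le_sum fun ξ hξ => by
          rw [← mul_pow]; exact pow_le_pow_left₀ (norm_nonneg _) (hb ξ hξ) 2
      _ = K ^ 2 := by rw [← Finset.mul_sum, hf.2.2.1, mul_one]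
  have h3 : ∑ ξ ∈ latticePts lam, ‖b ξ‖ ≤ K * N := by
    calc _ ≤ ∑ ξ ∈ latticePts lam, K * ‖a ξ‖ := Finset.sum_le_sum hb
      _ ≤ _ := by rw [← Finset.mul_sum]; gcongr; exact hf.sum_norm_le
  have h4 : (∑ ξ ∈ latticePts lam, ‖b ξ‖) ^ 2 * (1 / (N : ℝ) ^ 2) ≤ K ^ 2 := by
    calc _ ≤ (K * N) ^ 2 * (1 / (N : ℝ) ^ 2) := by gcongr
      _ = K ^ 2 := by field_simp
  have hc : Continuous fun x => ‖∑ ξ ∈ latticePts lam, b ξ * chrE ξ x‖ ^ 2 :=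
    (continuous_finsetSum _ fun ξ _ => continuous_const.mul (continuous_chrE ξ)).norm.pow 2
  have hi : Integrable (fun x => ‖∑ ξ ∈ latticePts lam, b ξ * chrE ξ x‖ ^ 2) (gaussAt x₀ r) := by
    refine Integrable.of_bound hc.aestronglyMeasurable ((∑ ξ ∈ latticePts lam, ‖b ξ‖) ^ 2)
      (ae_of_all _ fun x => ?_)
    rw [Real.norm_of_nonneg (by positivity)]
    gcongr
    refine (norm_sum_le _ _).trans (Finset.sum_le_sum fun ξ _ => ?_)
    rw [norm_mul, show ‖chrE ξ x‖ = 1 from norm_chr _ _, mul_one]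
  have e : ∀ x, ‖∑ ξ ∈ latticePts lam, b ξ * chrE ξ x‖ₑ ^ 2 =
      ENNReal.ofReal (‖∑ ξ ∈ latticePts lam, b ξ * chrE ξ x‖ ^ 2) := by
    intro x
    rw [ENNReal.ofReal_pow (norm_nonneg _), ofReal_norm]
  simp_rw [e]
  rw [← ofReal_integral_eq_lintegral_ofReal hi (ae_of_all _ fun x => by positivity)]
  exact ENNReal.ofReal_le_ofReal (by linarith)

theorem summable_succ_pow_mul_exp_neg (p : ℕ) :
    Summable fun k : ℕ => ((k : ℝ) + 1) ^ p * Real.exp (-k) := by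
  have h := (summable_nat_add_iff 1).2 (Real.summable_pow_mul_exp_neg_nat_mul p one_pos)
  refine (h.mul_left (Real.exp 1)).congr fun k => ?_
  push_cast
  rw [mul_left_comm, ← Real.exp_add]
  congr 2
  ring

/-- Truncated moments of the negative part of the logarithm. -/
theorem lintegral_log_pow_le {α : Type*} [MeasurableSpace α] (μ : Measure α) [IsProbabilityMeasure μ]
    {f : α → ℝ} (hf : Measurable f) {T K : ℝ} (hT : 0 < T) (hK : 0 ≤ K)
    (h : ∀ τ : ℝ, 1 ≤ τ → τ ≤ T → μ.real {x | |f x| ≤ 1 / τ} ≤ K / τ) {p : ℕ} (hp : 1 ≤ p) :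
    ∫⁻ x in {x | 1 / T ≤ |f x|}, ENNReal.ofReal ((max 0 (-Real.log |f x|)) ^ p) ∂μ ≤
      ENNReal.ofReal (K * ∑' k : ℕ, ((k : ℝ) + 1) ^ p * Real.exp (-k)) := by
  have hm : ∀ c : ℝ, MeasurableSet {x | |f x| ≤ c} := fun c =>
    measurableSet_le hf.abs measurable_const
  have hmT : MeasurableSet {x | 1 / T ≤ |f x|} := measurableSet_le measurable_const hf.abs
  set g : ℕ → α → ℝ≥0∞ := fun k =>
    ({x | |f x| ≤ Real.exp (-k)} ∩ {_x | Real.exp k ≤ T}).indicator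
      fun _ => ENNReal.ofReal (((k : ℝ) + 1) ^ p) with hg
  have h1 : ∀ x ∈ {x | 1 / T ≤ |f x|}, |f x| ≤ 1 →
      ENNReal.ofReal ((max 0 (-Real.log |f x|)) ^ p) ≤ ∑' k, g k x := by
    intro x hx hx1
    have hpos : 0 < |f x| := lt_of_lt_of_le (by positivity) hx
    have hlog : Real.log |f x| ≤ 0 := Real.log_nonpos hpos.le hx1
    set L := -Real.log |f x| with hL
    have hL0 : 0 ≤ L := by linarith
    rw [max_eq_right hL0]
    refine le_trans ?_ (ENNReal.le_tsum ⌊L⌋₊)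
    have hfl := Nat.floor_le hL0
    have hfl2 := Nat.lt_floor_add_one L
    have hexp : |f x| = Real.exp (-L) := by rw [hL, neg_neg, Real.exp_log hpos]
    rw [hg]
    dsimp only
    rw [Set.indicator_of_mem]
    · gcongr
    · refine ⟨?_, ?_⟩
      · change |f x| ≤ _
        rw [hexp]; gcongr
      · change Real.exp _ ≤ T
        have h2 : Real.exp L ≤ T := by
          have : 1 / T ≤ Real.exp (-L) := hexp ▸ hx
          rw [Real.exp_neg, one_div] at this
          exact (inv_le_inv₀ hT (Real.exp_pos _)).1 this
        exact (Real.exp_le_exp.2 hfl).trans h2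
  have hmg : ∀ k, Measurable (g k) := fun k =>
    measurable_const.indicator ((hm _).inter (MeasurableSet.const _))
  have hgi : ∀ k, ∫⁻ x, g k x ∂μ ≤ ENNReal.ofReal (K * (((k : ℝ) + 1) ^ p * Real.exp (-k))) := by
    intro k
    rw [hg]
    dsimp only
    rw [lintegral_indicator_const ((hm _).inter (MeasurableSet.const _))]
    by_cases hk : Real.exp k ≤ T
    · have h2 := h (Real.exp k) (Real.one_le_exp (by positivity)) hk
      rw [one_div, ← Real.exp_neg, div_eq_mul_inv, ← Real.exp_neg] at h2
      have h3 : {x | |f x| ≤ Real.exp (-k)} ∩ {_x : α | Real.exp k ≤ T} = {x | |f x| ≤ Real.exp (-k)} := by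
        ext x; simp [hk]
      rw [h3, ← ofReal_measureReal, ← ENNReal.ofReal_mul (by positivity)]
      apply ENNReal.ofReal_le_ofReal
      calc _ ≤ ((k : ℝ) + 1) ^ p * (K * Real.exp (-k)) := by gcongr
        _ = _ := by ring
    · have h3 : {x | |f x| ≤ Real.exp (-k)} ∩ {_x : α | Real.exp k ≤ T} = ∅ := by
        ext x; simp [hk]
      rw [h3]; simp
  calc _ ≤ ∫⁻ x in {x | 1 / T ≤ |f x|}, (∑' k, g k x) ∂μ := by
        refine setLIntegral_mono' hmT fun x hx => ?_
        rcases le_total |f x| 1 with h2 | h2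
        · exact h1 x hx h2
        · rw [max_eq_left (by linarith [Real.log_nonneg h2]), zero_pow (by omega)]
          simp
    _ ≤ ∫⁻ x, (∑' k, g k x) ∂μ := setLIntegral_le_lintegral _ _
    _ = ∑' k, ∫⁻ x, g k x ∂μ := lintegral_tsum fun k => (hmg k).aemeasurable
    _ ≤ ∑' k : ℕ, ENNReal.ofReal (K * (((k : ℝ) + 1) ^ p * Real.exp (-k))) := ENNReal.tsum_le_tsum hgi
    _ = _ := by
        rw [← ENNReal.ofReal_tsum_of_nonneg (fun k => by positivity)
          ((summable_succ_pow_mul_exp_neg p).mul_left K), tsum_mul_left]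

theorem setLIntegral_ball_le (x₀ : E2) {r : ℝ} (hr : 0 < r) (g : E2 → ℝ≥0∞) :
    ∫⁻ x in Metric.ball x₀ r, g x ≤
      ENNReal.ofReal (Real.exp Real.pi * r ^ 2) * ∫⁻ x, g x ∂(gaussAt x₀ r) := by
  have hm : Measurable fun x : E2 => ENNReal.ofReal ((r^2)⁻¹*Real.exp (-(Real.pi/r^2)*‖x-x₀‖^2)) := by
    fun_prop
  unfold gaussAt
  rw [lintegral_withDensity_eq_lintegral_mul_non_measurable₀ _ hm.aemeasurable (by simp),
    ← lintegral_const_mul' _ _ (by simp)]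
  rw [← lintegral_indicator measurableSet_ball]
  refine lintegral_mono fun x => ?_
  by_cases hx : x ∈ Metric.ball x₀ r
  · rw [Set.indicator_of_mem hx, Pi.mul_apply, ← mul_assoc, ← ENNReal.ofReal_mul (by positivity)]
    refine le_mul_of_one_le_left' ?_
    rw [← ENNReal.ofReal_one]
    apply ENNReal.ofReal_le_ofReal
    have h1 : ‖x - x₀‖ ≤ r := by rw [← dist_eq_norm]; exact (Metric.mem_ball.1 hx).le
    have h2 : Real.exp Real.pi * r ^ 2 * ((r ^ 2)⁻¹ * Real.exp (-(Real.pi / r ^ 2) * ‖x - x₀‖ ^ 2)) =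
        Real.exp (Real.pi + -(Real.pi / r ^ 2) * ‖x - x₀‖ ^ 2) := by
      rw [Real.exp_add]; field_simp
    rw [h2]
    apply Real.one_le_exp
    have h3 : Real.pi / r ^ 2 * ‖x - x₀‖ ^ 2 ≤ Real.pi / r ^ 2 * r ^ 2 := by
      have := Real.pi_pos; gcongr
    rw [div_mul_cancel₀ _ (by positivity)] at h3
    linarith
  · rw [Set.indicator_of_notMem hx]; exact zero_le

/-- Jensen's inequality for the number of zeros in the disc of radius `1/2`. -/
theorem card_zeros_mul_log_two_le {F : ℂ → ℂ} (hF : AnalyticOnNhd ℂ F Set.univ) (h0 : F 0 ≠ 0)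
    (s : Finset ℂ) (hs : ∀ u ∈ s, ‖u‖ ≤ 1 / 2 ∧ F u = 0) :
    s.card * Real.log 2 ≤ Real.circleAverage (fun z => Real.log ‖F z‖) 0 1 - Real.log ‖F 0‖ := by
  have hF1 : AnalyticOnNhd ℂ F (Metric.closedBall 0 |(1 : ℝ)|) := hF.mono (Set.subset_univ _)
  rw [hF1.circleAverage_log_norm one_ne_zero h0, add_sub_cancel_right]
  set D := MeromorphicOn.divisor F (Metric.closedBall (0 : ℂ) |(1 : ℝ)|) with hD
  have hnn : ∀ u, 0 ≤ D u := fun u => MeromorphicOn.AnalyticOnNhd.divisor_nonneg hF1 u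
  have hfin : D.support.Finite := D.finiteSupport (isCompact_closedBall _ _)
  have hterm : ∀ u, 0 ≤ (D u : ℝ) * Real.log (1 * ‖0 - u‖⁻¹) := by
    intro u
    by_cases hu : u ∈ Metric.closedBall (0 : ℂ) |(1 : ℝ)|
    · refine mul_nonneg (by exact_mod_cast hnn u) ?_
      rw [one_mul, zero_sub, norm_neg, Real.log_inv]
      have : ‖u‖ ≤ 1 := by simpa using hu
      have := Real.log_nonpos (norm_nonneg u) this
      linarith
    · rw [D.apply_eq_zero_of_notMem hu]; simp
  have hone : ∀ u ∈ s, 1 ≤ D u := by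
    intro u hu
    have hmem : u ∈ Metric.closedBall (0 : ℂ) |(1 : ℝ)| := by
      have := (hs u hu).1
      simp; linarith
    have h1 : D u = ((analyticOrderAt F u).map (↑)).untop₀ := MeromorphicOn.AnalyticOnNhd.divisor_apply hF1 hmem
    have h2 : analyticOrderAt F u ≠ ⊤ := by
      intro htop
      rw [analyticOrderAt_eq_top] at htop
      exact h0 (hF.eqOn_zero_of_preconnected_of_eventuallyEq_zero isPreconnected_univ
        (Set.mem_univ u) htop (Set.mem_univ 0))
    have h3 : analyticOrderAt F u ≠ 0 := by
      rw [Ne, (hF u (Set.mem_univ _)).analyticOrderAt_eq_zero]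
      simp [(hs u hu).2]
    obtain ⟨k, hk⟩ := ENat.ne_top_iff_exists.1 h2
    rw [← hk] at h1 h3
    have h4 : k ≠ 0 := by rintro rfl; exact h3 rfl
    have h5 : D u = (k : ℤ) := by rw [h1]; rfl
    rw [h5]; omega
  rw [finsum_eq_sum_of_support_subset (s := hfin.toFinset) _ (by
    intro u hu
    simp only [Function.mem_support] at hu
    simp only [Set.Finite.coe_toFinset, Function.mem_support]
    intro h; apply hu; rw [h]; simp)]
  have hsub : s ⊆ hfin.toFinset := by
    intro u hu
    have := hone u hu
    simp only [Set.Finite.mem_toFinset, Function.mem_support]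
    omega
  refine le_trans ?_ (Finset.sum_le_sum_of_subset_of_nonneg hsub fun u _ _ => hterm u)
  rw [← nsmul_eq_mul]
  refine Finset.card_nsmul_le_sum _ _ _ fun u hu => ?_
  have hu0 : u ≠ 0 := by rintro rfl; exact h0 (hs 0 hu).2
  have hpos : 0 < ‖u‖ := norm_pos_iff.2 hu0
  have h6 : Real.log 2 ≤ Real.log (1 * ‖0 - u‖⁻¹) := by
    apply Real.log_le_log two_pos
    rw [one_mul, zero_sub, norm_neg, le_inv_comm₀ two_pos hpos]
    linarith [(hs u hu).1]
  have h7 : (1 : ℝ) ≤ D u := by exact_mod_cast hone u hu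
  have h8 : 0 ≤ Real.log 2 := Real.log_nonneg one_le_two
  nlinarith

/-- The uniform probability measure on `(0, 2π]`. -/
def angleMeasure : Measure ℝ :=
  (ENNReal.ofReal (2 * Real.pi))⁻¹ • volume.restrict (Set.Ioc 0 (2 * Real.pi))

instance : IsProbabilityMeasure angleMeasure := by
  constructor
  have h : (0 : ℝ) < 2 * Real.pi := by positivity
  unfold angleMeasure
  rw [Measure.smul_apply, Measure.restrict_apply MeasurableSet.univ, Set.univ_inter, Real.volume_Ioc,
    sub_zero, smul_eq_mul, ENNReal.inv_mul_cancel (by simpa using h) ENNReal.ofReal_ne_top]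

theorem ofReal_circleAverage_eq_lintegral {g : ℂ → ℝ} (hg : CircleIntegrable g 0 1) (h0 : ∀ z, 0 ≤ g z) :
    ENNReal.ofReal (Real.circleAverage g 0 1) = ∫⁻ θ, ENNReal.ofReal (g (circleMap 0 1 θ)) ∂angleMeasure := by
  have h : (0 : ℝ) < 2 * Real.pi := by positivity
  unfold angleMeasure
  rw [lintegral_smul_measure, Real.circleAverage_def, intervalIntegral.integral_of_le h.le,
    smul_eq_mul, ENNReal.ofReal_mul (by positivity), ENNReal.ofReal_inv_of_pos h, smul_eq_mul,
    ofReal_integral_eq_lintegral_ofReal _ (ae_of_all _ fun θ => h0 _)]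
  exact (intervalIntegrable_iff_integrableOn_Ioc_of_le h.le).1 hg

theorem posLog_pow_le (p : ℕ) {t : ℝ} (ht : 0 ≤ t) : Real.posLog t ^ p ≤ p.factorial * (1 + t ^ 2) := by
  have h1 := Real.pow_div_factorial_le_exp (Real.posLog t) Real.posLog_nonneg p
  have hp : (0 : ℝ) < p.factorial := by positivity
  rw [div_le_iff₀ hp] at h1
  have h2 : Real.exp (Real.posLog t) ≤ 1 + t ^ 2 := by
    rcases le_total t 1 with h | h
    · rw [Real.posLog_eq_zero_iff t |>.2 (by rwa [abs_of_nonneg ht]), Real.exp_zero]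
      nlinarith
    · rw [Real.posLog_eq_log (by rwa [abs_of_nonneg ht]), Real.exp_log (by linarith)]
      nlinarith
  calc _ ≤ _ := h1
    _ ≤ (1 + t ^ 2) * p.factorial := by gcongr
    _ = _ := by ring

/-- Moments of the number of zeros, by Jensen's formula. -/
theorem card_zeros_pow_le {F : ℂ → ℂ} (hF : AnalyticOnNhd ℂ F Set.univ) (h0 : F 0 ≠ 0)
    (s : Finset ℂ) (hs : ∀ u ∈ s, ‖u‖ ≤ 1 / 2 ∧ F u = 0) {p : ℕ} (hp : 1 ≤ p) :
    (s.card : ℝ≥0∞) ^ p ≤ ENNReal.ofReal (4 ^ p * p.factorial) *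
      (1 + ∫⁻ θ, ‖F (circleMap 0 1 θ)‖ₑ ^ 2 ∂angleMeasure +
        ENNReal.ofReal (max 0 (-Real.log ‖F 0‖) ^ p)) := by
  have h1 := card_zeros_mul_log_two_le hF h0 s hs
  have hint1 : CircleIntegrable (fun z => Real.log ‖F z‖) 0 1 :=
    (hF.mono (Set.subset_univ _)).meromorphicOn.circleIntegrable_log_norm
  have hint2 : CircleIntegrable (fun z => Real.posLog ‖F z‖) 0 1 :=
    (hF.mono (Set.subset_univ _)).meromorphicOn.circleIntegrable_posLog_norm
  have h2 : Real.circleAverage (fun z => Real.log ‖F z‖) 0 1 ≤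
      Real.circleAverage (fun z => Real.posLog ‖F z‖) 0 1 :=
    Real.circleAverage_mono hint1 hint2 fun z _ => le_max_right _ _
  set A := Real.circleAverage (fun z => Real.posLog ‖F z‖) 0 1 with hA
  set L := max 0 (-Real.log ‖F 0‖) with hL
  have hA0 : 0 ≤ A := Real.circleAverage_nonneg_of_nonneg fun z _ => Real.posLog_nonneg
  have hL0 : 0 ≤ L := le_max_left _ _
  have h3 : (s.card : ℝ) ≤ 2 * (A + L) := by
    have h4 : -Real.log ‖F 0‖ ≤ L := le_max_right _ _
    have h5 : (1 : ℝ) / 2 ≤ Real.log 2 := by linarith [Real.log_two_gt_d9]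
    have h6 : (0 : ℝ) ≤ s.card := by positivity
    nlinarith
  have h4 : (s.card : ℝ) ^ p ≤ 4 ^ p * (A ^ p + L ^ p) := by
    calc (s.card : ℝ) ^ p ≤ (2 * (A + L)) ^ p := by gcongr
      _ = 2 ^ p * (A + L) ^ p := by rw [mul_pow]
      _ ≤ 2 ^ p * (2 ^ (p - 1) * (A ^ p + L ^ p)) := by
        gcongr; exact add_pow_le hA0 hL0 p
      _ ≤ 2 ^ p * (2 ^ p * (A ^ p + L ^ p)) := by gcongr <;> simp
      _ = _ := by rw [← mul_assoc, ← mul_pow]; norm_num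
  have hm : Measurable fun θ : ℝ => F (circleMap 0 1 θ) := by
    have : Continuous F := continuousOn_univ.1 hF.continuousOn
    exact (this.comp (continuous_circleMap 0 1)).measurable
  have hm2 : Measurable fun θ : ℝ => ENNReal.ofReal (Real.posLog ‖F (circleMap 0 1 θ)‖) :=
    (measurable_const.max (Real.measurable_log.comp hm.norm)).ennreal_ofReal
  have h5 : ENNReal.ofReal (A ^ p) ≤ ENNReal.ofReal p.factorial *
      (1 + ∫⁻ θ, ‖F (circleMap 0 1 θ)‖ₑ ^ 2 ∂angleMeasure) := by
    rw [ENNReal.ofReal_pow hA0, hA, ofReal_circleAverage_eq_lintegral hint2 fun z => Real.posLog_nonneg]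
    refine (lintegral_pow_le_of_isProbabilityMeasure _ hm2.aemeasurable hp).trans ?_
    have h6 : ∀ θ : ℝ, ENNReal.ofReal (Real.posLog ‖F (circleMap 0 1 θ)‖) ^ p ≤
        ENNReal.ofReal p.factorial * (1 + ‖F (circleMap 0 1 θ)‖ₑ ^ 2) := by
      intro θ
      rw [← ofReal_norm, ← ENNReal.ofReal_pow (norm_nonneg _), ← ENNReal.ofReal_one,
        ← ENNReal.ofReal_add zero_le_one (by positivity), ← ENNReal.ofReal_mul (by positivity),
        ← ENNReal.ofReal_pow Real.posLog_nonneg]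
      exact ENNReal.ofReal_le_ofReal (posLog_pow_le p (norm_nonneg _))
    refine (lintegral_mono h6).trans (le_of_eq ?_)
    rw [lintegral_const_mul' _ _ (by simp), lintegral_add_left measurable_const, lintegral_const,
      measure_univ, mul_one]
  have hfac : (1 : ℝ) ≤ p.factorial := by exact_mod_cast Nat.factorial_pos p
  calc (s.card : ℝ≥0∞) ^ p = ENNReal.ofReal ((s.card : ℝ) ^ p) := by
        rw [ENNReal.ofReal_pow (by positivity), ENNReal.ofReal_natCast]
    _ ≤ ENNReal.ofReal (4 ^ p * (A ^ p + L ^ p)) := ENNReal.ofReal_le_ofReal h4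
    _ = ENNReal.ofReal (4 ^ p) * (ENNReal.ofReal (A ^ p) + ENNReal.ofReal (L ^ p)) := by
        rw [ENNReal.ofReal_mul (by positivity), ENNReal.ofReal_add (by positivity) (by positivity)]
    _ ≤ ENNReal.ofReal (4 ^ p) * (ENNReal.ofReal p.factorial *
      (1 + ∫⁻ θ, ‖F (circleMap 0 1 θ)‖ₑ ^ 2 ∂angleMeasure) +
        ENNReal.ofReal p.factorial * ENNReal.ofReal (L ^ p)) := by
        gcongr
        refine le_mul_of_one_le_left' ?_
        rw [← ENNReal.ofReal_one]
        exact ENNReal.ofReal_le_ofReal hfac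
    _ = _ := by
        rw [← mul_add, ← mul_assoc, ← ENNReal.ofReal_mul (by positivity)]

/-- Rolle's theorem for a finite set of zeros. -/
theorem exists_finset_zeros_deriv {f f' : ℝ → ℝ} {I : Set ℝ} (hI : I.OrdConnected)
    (hf : ∀ x ∈ I, HasDerivAt f (f' x) x) (z : Finset ℝ) (hz : ∀ x ∈ z, x ∈ I ∧ f x = 0) :
    ∃ z' : Finset ℝ, (∀ x ∈ z', x ∈ I ∧ f' x = 0) ∧ z.card ≤ z'.card + 1 := by
  classical
  suffices h : ∃ z' : Finset ℝ, (∀ x ∈ z', x ∈ I ∧ f' x = 0) ∧ z.card ≤ z'.card + 1 ∧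
      ∀ w ∈ z', ∃ x ∈ z, w < x by
    obtain ⟨z', h1, h2, -⟩ := h
    exact ⟨z', h1, h2⟩
  induction z using Finset.induction_on_max with
  | empty => exact ⟨∅, by simp⟩
  | insert a s hs ih =>
    obtain ⟨z', h1, h2, h3⟩ := ih fun x hx => hz x (Finset.mem_insert_of_mem hx)
    have ha := hz a (Finset.mem_insert_self a s)
    have has : a ∉ s := fun h => lt_irrefl _ (hs a h)
    rcases s.eq_empty_or_nonempty with rfl | hne
    · exact ⟨∅, by simp⟩
    set m := s.max' hne with hm
    have hms : m ∈ s := s.max'_mem hne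
    have hma : m < a := hs m hms
    have hmz := hz m (Finset.mem_insert_of_mem hms)
    obtain ⟨c, hc, hc0⟩ := exists_hasDerivAt_eq_zero hma
      (fun x hx => (hf x (hI.out hmz.1 ha.1 hx)).continuousAt.continuousWithinAt)
      (hmz.2.trans ha.2.symm) fun x hx => hf x (hI.out hmz.1 ha.1 ⟨hx.1.le, hx.2.le⟩)
    have hcz : c ∉ z' := by
      intro h
      obtain ⟨x, hx, hcx⟩ := h3 c h
      exact absurd (hc.1.trans hcx) (not_lt.2 (s.le_max' x hx))
    refine ⟨insert c z', ?_, ?_, ?_⟩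
    · intro x hx
      rcases Finset.mem_insert.1 hx with rfl | hx
      · exact ⟨hI.out hmz.1 ha.1 ⟨hc.1.le, hc.2.le⟩, hc0⟩
      · exact h1 x hx
    · rw [Finset.card_insert_of_notMem has, Finset.card_insert_of_notMem hcz]
      omega
    · intro w hw
      rcases Finset.mem_insert.1 hw with rfl | hw
      · exact ⟨a, Finset.mem_insert_self _ _, hc.2⟩
      · obtain ⟨x, hx, h⟩ := h3 w hw
        exact ⟨x, Finset.mem_insert_of_mem hx, h⟩

theorem eq_of_hasDerivAt_eq_zero {q q' : ℝ → ℝ} {a b : ℝ} (hq : ∀ x ∈ Set.Icc a b, HasDerivAt q (q' x) x)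
    (h0 : ∀ x ∈ Set.Icc a b, q' x = 0) {x y : ℝ} (hx : x ∈ Set.Icc a b) (hy : y ∈ Set.Icc a b) : q x = q y := by
  have h := (convex_Icc a b).norm_image_sub_le_of_norm_hasDerivWithin_le (f := q) (f' := q') (C := 0)
    (fun x hx => (hq x hx).hasDerivWithinAt) (fun x hx => by rw [h0 x hx, norm_zero]) hy hx
  rw [zero_mul] at h
  exact sub_eq_zero.1 (norm_eq_zero.1 (le_antisymm h (norm_nonneg _)))

/-- Applying `D² + ω²` loses at most two zeros on a short interval. -/
theorem exists_finset_zeros_oscillator {f f' f'' : ℝ → ℝ} (hf : ∀ x, HasDerivAt f (f' x) x)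
    (hf' : ∀ x, HasDerivAt f' (f'' x) x) {ω t₀ l : ℝ} (hω : |ω| * l < Real.pi / 2) (z : Finset ℝ)
    (hz : ∀ x ∈ z, x ∈ Set.Icc (t₀ - l) (t₀ + l) ∧ f x = 0) :
    (∃ z' : Finset ℝ, (∀ x ∈ z', x ∈ Set.Icc (t₀ - l) (t₀ + l) ∧ f'' x + ω ^ 2 * f x = 0) ∧
      z.card ≤ z'.card + 2) ∧
    ((∀ x ∈ Set.Icc (t₀ - l) (t₀ + l), f'' x + ω ^ 2 * f x = 0) →
      z.card ≤ 1 ∨ ∀ x ∈ Set.Icc (t₀ - l) (t₀ + l), f x = 0) := by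
  set I := Set.Icc (t₀ - l) (t₀ + l) with hI
  have hIo : I.OrdConnected := Set.ordConnected_Icc
  set u : ℝ → ℝ := fun x => Real.cos (ω * (x - t₀)) with hu
  set u' : ℝ → ℝ := fun x => -(ω * Real.sin (ω * (x - t₀))) with hu'
  have hupos : ∀ x ∈ I, 0 < u x := by
    intro x hx
    apply Real.cos_pos_of_mem_Ioo
    have h1 : |x - t₀| ≤ l := by
      rw [abs_le]; constructor <;> linarith [hx.1, hx.2]
    have h2 : |ω * (x - t₀)| < Real.pi / 2 := by
      rw [abs_mul]
      exact (mul_le_mul_of_nonneg_left h1 (abs_nonneg _)).trans_lt hω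
    exact abs_lt.1 h2
  have hlin : ∀ x, HasDerivAt (fun x => ω * (x - t₀)) ω x := fun x => by
    simpa using ((hasDerivAt_id x).sub_const t₀).const_mul ω
  have hud : ∀ x, HasDerivAt u (u' x) x := fun x =>
    (hlin x).cos.congr_deriv (by simp only [hu']; ring)
  have hud' : ∀ x, HasDerivAt u' (-(ω ^ 2 * u x)) x := fun x =>
    ((hlin x).sin.const_mul ω).fun_neg.congr_deriv (by simp only [hu]; ring)
  have hq : ∀ x ∈ I, HasDerivAt (fun x => f x / u x) ((f' x * u x - f x * u' x) / u x ^ 2) x :=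
    fun x hx => (hf x).fun_div (hud x) (hupos x hx).ne'
  have hg : ∀ x ∈ I, HasDerivAt (fun x => f' x * u x - f x * u' x) (u x * (f'' x + ω ^ 2 * f x)) x :=
    fun x _ => (((hf' x).fun_mul (hud x)).fun_sub ((hf x).fun_mul (hud' x))).congr_deriv (by ring)
  obtain ⟨z₁, hz₁, hc₁⟩ := exists_finset_zeros_deriv hIo hq z fun x hx =>
    ⟨(hz x hx).1, by rw [(hz x hx).2, zero_div]⟩
  have hz₁' : ∀ x ∈ z₁, x ∈ I ∧ f' x * u x - f x * u' x = 0 := fun x hx =>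
    ⟨(hz₁ x hx).1, (div_eq_zero_iff.1 (hz₁ x hx).2).resolve_right
      (pow_ne_zero 2 (hupos x (hz₁ x hx).1).ne')⟩
  obtain ⟨z₂, hz₂, hc₂⟩ := exists_finset_zeros_deriv hIo hg z₁ hz₁'
  refine ⟨⟨z₂, fun x hx => ⟨(hz₂ x hx).1, (mul_eq_zero.1 (hz₂ x hx).2).resolve_left
    (hupos x (hz₂ x hx).1).ne'⟩, by omega⟩, fun h0 => ?_⟩
  by_cases hc : z.card ≤ 1
  · exact Or.inl hc
  refine Or.inr fun x hx => ?_
  obtain ⟨y, hy⟩ := Finset.card_pos.1 (show 0 < z₁.card by omega)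
  obtain ⟨w, hw⟩ := Finset.card_pos.1 (show 0 < z.card by omega)
  have h1 : ∀ x ∈ I, f' x * u x - f x * u' x = 0 := fun x hx => by
    rw [← (hz₁' y hy).2]
    exact eq_of_hasDerivAt_eq_zero hg (fun x hx => by rw [h0 x hx, mul_zero]) hx (hz₁' y hy).1
  have h2 : f x / u x = f w / u w :=
    eq_of_hasDerivAt_eq_zero hq (fun x hx => by rw [h1 x hx, zero_div]) hx (hz w hw).1
  rw [(hz w hw).2, zero_div, div_eq_zero_iff] at h2
  exact h2.resolve_right (ne_of_gt (hupos x hx))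

/-- A real exponential sum with few frequencies has few zeros on a short interval. -/
theorem card_zeros_le_of_short {ι : Type*} (s : Finset ι) (ω : ι → ℝ) {t₀ l : ℝ}
    (hω : ∀ j ∈ s, |ω j| * l < Real.pi / 2) (c : ι → ℂ) (z : Finset ℝ)
    (hz : ∀ x ∈ z, x ∈ Set.Icc (t₀ - l) (t₀ + l) ∧ (∑ j ∈ s, c j * cexp (I * (ω j * x : ℝ))).re = 0) :
    z.card ≤ 2 * s.card ∨
      ∀ x ∈ Set.Icc (t₀ - l) (t₀ + l), (∑ j ∈ s, c j * cexp (I * (ω j * x : ℝ))).re = 0 := by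
  classical
  induction s using Finset.induction_on generalizing c z with
  | empty => right; simp
  | insert k s hk ih =>
    have hE : ∀ (b : ι → ℂ) (x : ℝ), HasDerivAt
        (fun x : ℝ => (∑ j ∈ insert k s, b j * cexp (I * (ω j * x : ℝ))).re)
        ((∑ j ∈ insert k s, (b j * (I * ω j)) * cexp (I * (ω j * x : ℝ))).re) x := by
      intro b x
      have h1 : HasDerivAt (fun x : ℝ => ∑ j ∈ insert k s, b j * cexp (I * (ω j * x : ℝ)))
          (∑ j ∈ insert k s, (b j * (I * ω j)) * cexp (I * (ω j * x : ℝ))) x := by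
        refine HasDerivAt.fun_sum fun j _ => ?_
        have h2 : HasDerivAt (fun x : ℝ => I * ((ω j * x : ℝ) : ℂ)) (I * ω j) x := by
          have h3 : HasDerivAt (fun x : ℝ => ω j * x) (ω j) x := by
            simpa using (hasDerivAt_id x).const_mul (ω j)
          exact h3.ofReal_comp.const_mul I
        exact (h2.cexp.const_mul (b j)).congr_deriv (by ring)
      exact (Complex.reCLM.hasFDerivAt.comp_hasDerivAt x h1)
    obtain ⟨⟨z', hz', hcard⟩, hzero⟩ := exists_finset_zeros_oscillator (hE c) (hE _)
      (hω k (Finset.mem_insert_self _ _)) z hz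
    have hL : ∀ x : ℝ, (∑ j ∈ insert k s, (c j * (I * ω j) * (I * ω j)) * cexp (I * (ω j * x : ℝ))).re +
        ω k ^ 2 * (∑ j ∈ insert k s, c j * cexp (I * (ω j * x : ℝ))).re =
        (∑ j ∈ s, (c j * (ω k ^ 2 - ω j ^ 2 : ℝ)) * cexp (I * (ω j * x : ℝ))).re := by
      intro x
      rw [← Complex.re_ofReal_mul, ← Complex.add_re, Finset.mul_sum, ← Finset.sum_add_distrib,
        Finset.sum_insert hk]
      congr 1
      have e : ∀ j, c j * (I * ω j) * (I * ω j) * cexp (I * (ω j * x : ℝ)) +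
          ((ω k ^ 2 : ℝ) : ℂ) * (c j * cexp (I * (ω j * x : ℝ))) =
          (c j * (ω k ^ 2 - ω j ^ 2 : ℝ)) * cexp (I * (ω j * x : ℝ)) := by
        intro j
        have h : I * I = -1 := I_mul_I
        push_cast
        linear_combination (c j * ω j * ω j * cexp (I * (ω j * x))) * h
      simp_rw [e]
      simp
    simp only [hL] at hz' hzero
    have hcs : (insert k s).card = s.card + 1 := Finset.card_insert_of_notMem hk
    rcases ih (fun j hj => hω j (Finset.mem_insert_of_mem hj)) _ z' hz' with h | h
    · left; omega
    · rcases hzero h with h | h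
      · left; omega
      · exact Or.inr h

/-- The frequency of the character `ξ` in the direction `v`. -/
def dirFreq (v : E2) (ξ : ℤ × ℤ) : ℝ := ξ.1 * v 0 + ξ.2 * v 1

theorem abs_dirFreq_le {lam : ℕ} {v : E2} (hv : ‖v‖ ≤ 1) {ξ : ℤ × ℤ} (hξ : ξ ∈ latticePts lam) :
    |dirFreq v ξ| ≤ Real.sqrt lam := by
  have h1 : ((ξ.1 : ℝ) ^ 2 + (ξ.2 : ℝ) ^ 2) = lam := by exact_mod_cast mem_latticePts.1 hξ
  have h2 : v 0 ^ 2 + v 1 ^ 2 ≤ 1 := by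
    have := EuclideanSpace.norm_sq_eq v
    rw [Fin.sum_univ_two, Real.norm_eq_abs, Real.norm_eq_abs, sq_abs, sq_abs] at this
    nlinarith [norm_nonneg v]
  apply Real.abs_le_sqrt
  unfold dirFreq
  nlinarith [sq_nonneg ((ξ.1 : ℝ) * v 1 - ξ.2 * v 0)]

theorem chrE_add_smul (ξ : ℤ × ℤ) (c v : E2) (t : ℝ) :
    chrE ξ (c + t • v) = chrE ξ c * cexp (2 * Real.pi * I * (t * dirFreq v ξ : ℝ)) := by
  unfold chrE chr dirFreq
  rw [← Complex.exp_add]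
  congr 1
  simp
  ring

/-- The entire extension of `u ↦ f (c + h u v)`. -/
def lineExt (lam : ℕ) (a : ℤ × ℤ → ℂ) (h : ℝ) (v c : E2) (ζ : ℂ) : ℂ :=
  ∑ ξ ∈ latticePts lam, a ξ * cexp (2 * Real.pi * I * ζ * (h * dirFreq v ξ : ℝ)) * chrE ξ c

theorem analyticOnNhd_lineExt (lam : ℕ) (a : ℤ × ℤ → ℂ) (h : ℝ) (v c : E2) :
    AnalyticOnNhd ℂ (lineExt lam a h v c) Set.univ := by
  apply Complex.analyticOnNhd_univ_iff_differentiable.2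
  unfold lineExt
  fun_prop

theorem lineExt_ofReal {lam : ℕ} {a : ℤ × ℤ → ℂ} {f : E2 → ℝ} (hf : IsEigenfunction lam a f)
    (h : ℝ) (v c : E2) (u : ℝ) : lineExt lam a h v c u = f (c + (h * u) • v) := by
  rw [hf.eq_sum]
  refine Finset.sum_congr rfl fun ξ _ => ?_
  rw [chrE_add_smul, mul_assoc, mul_comm (cexp _)]
  congr 3
  push_cast
  ring

theorem lineExt_zero {lam : ℕ} {a : ℤ × ℤ → ℂ} {f : E2 → ℝ} (hf : IsEigenfunction lam a f)
    (h : ℝ) (v c : E2) : lineExt lam a h v c 0 = f c := by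
  have := lineExt_ofReal hf h v c 0
  simpa using this

theorem card_line_zeros_pow_le {lam : ℕ} {a : ℤ × ℤ → ℂ} {f : E2 → ℝ} (hf : IsEigenfunction lam a f)
    (h : ℝ) (v : E2) {c : E2} (hc : f c ≠ 0) (z : Finset ℝ)
    (hz : ∀ u ∈ z, |u| ≤ 1 / 2 ∧ f (c + (h * u) • v) = 0) {p : ℕ} (hp : 1 ≤ p) :
    (z.card : ℝ≥0∞) ^ p ≤ ENNReal.ofReal (4 ^ p * p.factorial) *
      (1 + ∫⁻ θ, ‖lineExt lam a h v c (circleMap 0 1 θ)‖ₑ ^ 2 ∂angleMeasure +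
        ENNReal.ofReal (max 0 (-Real.log |f c|) ^ p)) := by
  classical
  have h1 := card_zeros_pow_le (analyticOnNhd_lineExt lam a h v c)
    (by rw [lineExt_zero hf]; exact_mod_cast hc) (z.map ⟨_, Complex.ofReal_injective⟩) (by
      intro w hw
      obtain ⟨u, hu, rfl⟩ := Finset.mem_map.1 hw
      refine ⟨by simpa using (hz u hu).1, ?_⟩
      change lineExt lam a h v c (u : ℂ) = 0
      rw [lineExt_ofReal hf, (hz u hu).2, Complex.ofReal_zero]) hp
  rwa [Finset.card_map, lineExt_zero hf, Complex.norm_real, Real.norm_eq_abs] at h1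

theorem lineExt_ne_zero_frequently {lam : ℕ} {a : ℤ × ℤ → ℂ} {f : E2 → ℝ} (hf : IsEigenfunction lam a f)
    (h : ℝ) (v : E2) {c : E2} (hc : f c ≠ 0) {t₀ l : ℝ} (hl : 0 < l) :
    ¬ ∀ x ∈ Set.Icc (t₀ - l) (t₀ + l), f (c + (h * x) • v) = 0 := by
  intro h0
  have h1 : ∃ᶠ w in 𝓝[≠] (t₀ : ℂ), lineExt lam a h v c w = 0 := by
    have ht : Tendsto (fun x : ℝ => (x : ℂ)) (𝓝[>] t₀) (𝓝[≠] (t₀ : ℂ)) := by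
      refine tendsto_nhdsWithin_iff.2 ⟨(Complex.continuous_ofReal.tendsto t₀).mono_left
        nhdsWithin_le_nhds, ?_⟩
      filter_upwards [self_mem_nhdsWithin] with x hx
      simpa using (ne_of_gt hx)
    refine ht.frequently (Eventually.frequently ?_)
    filter_upwards [Ioc_mem_nhdsGT (show t₀ < t₀ + l by linarith)] with x hx
    rw [lineExt_ofReal hf, h0 x ⟨by linarith [hx.1], hx.2⟩, Complex.ofReal_zero]
  have h2 := (analyticOnNhd_lineExt lam a h v c).eqOn_zero_of_preconnected_of_frequently_eq_zero
    isPreconnected_univ (Set.mem_univ _) h1 (Set.mem_univ 0)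
  rw [lineExt_zero hf] at h2
  exact hc (Complex.ofReal_eq_zero.1 h2)

theorem card_line_zeros_le {lam : ℕ} (hlam : 0 < lam) {a : ℤ × ℤ → ℂ} {f : E2 → ℝ}
    (hf : IsEigenfunction lam a f) {R : ℝ} (hR : 0 ≤ R) {v : E2} (hv : ‖v‖ ≤ 1) {c : E2} (hc : f c ≠ 0)
    (z : Finset ℝ) (hz : ∀ u ∈ z, |u| ≤ 1 / 2 ∧ f (c + (R / Real.sqrt lam * u) • v) = 0) :
    z.card ≤ (⌊2 * R⌋₊ + 2) * (2 * (latticePts lam).card) := by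
  classical
  set m := ⌊2 * R⌋₊ + 1 with hm
  have hm0 : (0 : ℝ) < m := by positivity
  have hmR : 2 * R < m := by rw [hm]; push_cast; exact Nat.lt_floor_add_one _
  set l : ℝ := 1 / (2 * m) with hl
  have hl0 : 0 < l := by positivity
  set t : ℕ → ℝ := fun k => -(1/2) + (2 * k + 1) / (2 * m) with ht
  set h := R / Real.sqrt lam with hh
  have hsq : 0 < Real.sqrt lam := Real.sqrt_pos.2 (by exact_mod_cast hlam)
  have hcover : z ⊆ (Finset.range (m + 1)).biUnion
      fun k => z.filter fun x => x ∈ Set.Icc (t k - l) (t k + l) := by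
    intro x hx
    have hx2 := abs_le.1 (hz x hx).1
    have hy0 : 0 ≤ (x + 1 / 2) * m := mul_nonneg (by linarith [hx2.1]) hm0.le
    have h1 := Nat.floor_le hy0
    have h2 := Nat.lt_floor_add_one ((x + 1 / 2) * m)
    set k := ⌊(x + 1 / 2) * (m : ℝ)⌋₊ with hk
    rw [Finset.mem_biUnion]
    refine ⟨k, ?_, ?_⟩
    · rw [Finset.mem_range]
      have : (x + 1 / 2) * m ≤ m := by nlinarith [hx2.2]
      have : (k : ℝ) ≤ m := h1.trans this
      have : k ≤ m := by exact_mod_cast this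
      omega
    · rw [Finset.mem_filter]
      refine ⟨hx, ?_⟩
      have e1 : t k - l = k / m - 1 / 2 := by rw [ht, hl]; field_simp; ring
      have e2 : t k + l = (k + 1) / m - 1 / 2 := by rw [ht, hl]; field_simp; ring
      rw [e1, e2]
      constructor
      · have : (k : ℝ) / m ≤ x + 1 / 2 := by rw [div_le_iff₀ hm0]; exact h1
        linarith
      · have : x + 1 / 2 ≤ ((k : ℝ) + 1) / m := by rw [le_div_iff₀ hm0]; exact h2.le
        linarith
  have hpiece : ∀ k ∈ Finset.range (m + 1),
      (z.filter fun x => x ∈ Set.Icc (t k - l) (t k + l)).card ≤ 2 * (latticePts lam).card := by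
    intro k _
    have hrep : ∀ x : ℝ, (∑ ξ ∈ latticePts lam, (a ξ * chrE ξ c) *
        cexp (I * ((2 * Real.pi * h * dirFreq v ξ) * x : ℝ))).re = f (c + (h * x) • v) := by
      intro x
      rw [← Complex.ofReal_re (f (c + (h * x) • v)), ← lineExt_ofReal hf]
      congr 1
      refine Finset.sum_congr rfl fun ξ _ => ?_
      have e : I * ((2 * Real.pi * h * dirFreq v ξ) * x : ℝ) =
          2 * Real.pi * I * x * (h * dirFreq v ξ : ℝ) := by
        push_cast
        ring
      rw [e]
      ring
    rcases card_zeros_le_of_short (latticePts lam) (fun ξ => 2 * Real.pi * h * dirFreq v ξ)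
      (t₀ := t k) (l := l) (by
        intro ξ hξ
        have h1 := abs_dirFreq_le hv hξ
        have h2 : h * |dirFreq v ξ| ≤ R := by
          calc h * |dirFreq v ξ| ≤ h * Real.sqrt lam := by gcongr
            _ = R := div_mul_cancel₀ _ hsq.ne'
        have hh0 : 0 ≤ h := by positivity
        have h3 : |2 * Real.pi * h * dirFreq v ξ| = 2 * Real.pi * (h * |dirFreq v ξ|) := by
          rw [abs_mul, abs_of_nonneg (by positivity), mul_assoc]
        have h4 : R * l < 1 / 4 := by
          rw [hl, mul_one_div, div_lt_iff₀ (by positivity)]; linarith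
        have hpi := Real.pi_pos
        calc _ = 2 * Real.pi * (h * |dirFreq v ξ|) * l := by rw [h3]
          _ ≤ 2 * Real.pi * R * l := by gcongr
          _ = 2 * Real.pi * (R * l) := by ring
          _ < 2 * Real.pi * (1 / 4) := by gcongr
          _ = _ := by ring)
      (fun ξ => a ξ * chrE ξ c) (z.filter fun x => x ∈ Set.Icc (t k - l) (t k + l)) (by
        intro x hx
        have hx' := Finset.mem_filter.1 hx
        exact ⟨hx'.2, by rw [hrep]; exact (hz x hx'.1).2⟩) with h1 | h1
    · exact h1
    · simp only [hrep] at h1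
      exact absurd h1 (lineExt_ne_zero_frequently hf h v hc hl0)
  calc z.card ≤ _ := Finset.card_le_card hcover
    _ ≤ _ := Finset.card_biUnion_le
    _ ≤ ∑ _k ∈ Finset.range (m + 1), 2 * (latticePts lam).card := Finset.sum_le_sum hpiece
    _ = _ := by rw [Finset.sum_const, Finset.card_range, smul_eq_mul]

theorem norm_cexp_dirFreq_le {lam : ℕ} (hlam : 0 < lam) {R : ℝ} (hR : 0 ≤ R) {v : E2} (hv : ‖v‖ ≤ 1)
    {ξ : ℤ × ℤ} (hξ : ξ ∈ latticePts lam) {w : ℂ} (hw : ‖w‖ ≤ 1) :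
    ‖cexp (2 * Real.pi * I * w * (R / Real.sqrt lam * dirFreq v ξ : ℝ))‖ ≤ Real.exp (2 * Real.pi * R) := by
  have hsq : 0 < Real.sqrt lam := Real.sqrt_pos.2 (by exact_mod_cast hlam)
  have h1 : |R / Real.sqrt lam * dirFreq v ξ| ≤ R := by
    rw [abs_mul, abs_of_nonneg (by positivity)]
    calc _ ≤ R / Real.sqrt lam * Real.sqrt lam := by gcongr; exact abs_dirFreq_le hv hξ
      _ = R := div_mul_cancel₀ _ hsq.ne'
  refine (Complex.norm_exp_le_exp_norm _).trans (Real.exp_le_exp.2 ?_)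
  rw [norm_mul, norm_mul, norm_mul, norm_mul, Complex.norm_real, Complex.norm_real, Complex.norm_I,
    Real.norm_eq_abs, Real.norm_eq_abs, abs_of_pos Real.pi_pos]
  have := Real.pi_pos
  calc ‖(2 : ℂ)‖ * Real.pi * 1 * ‖w‖ * |R / Real.sqrt lam * dirFreq v ξ| ≤ 2 * Real.pi * 1 * 1 * R := by
        gcongr; simp
    _ = _ := by ring

theorem continuous_lineExt_circleMap (lam : ℕ) (a : ℤ × ℤ → ℂ) (h : ℝ) (v : E2) :
    Continuous fun q : E2 × ℝ => lineExt lam a h v q.1 (circleMap 0 1 q.2) := by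
  unfold lineExt
  have h1 := continuous_circleMap 0 1
  have h2 := continuous_chrE
  fun_prop

/-- Moments of the number of zeros on short segments are dominated by a function whose averages over
balls are bounded. -/
theorem exists_line_majorant {R : ℝ} (hR : 0 ≤ R) (ε : ℝ) {p : ℕ} (hp : 1 ≤ p) :
    ∃ C : ℝ, 0 ≤ C ∧ ∀ lam, Structured ε p lam → ∀ (a : ℤ × ℤ → ℂ) (f : E2 → ℝ),
      IsEigenfunction lam a f → IsFlat lam a → ∀ v : E2, ‖v‖ ≤ 1 →
      ∃ Ψ : E2 → ℝ≥0∞, Measurable Ψ ∧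
        (∀ c, f c ≠ 0 → ∀ z : Finset ℝ,
          (∀ u ∈ z, |u| ≤ 1 / 2 ∧ f (c + (R / Real.sqrt lam * u) • v) = 0) → (z.card : ℝ≥0∞) ^ p ≤ Ψ c) ∧
        ∀ (x₀ : E2) (r : ℝ), 0 < r → (lam : ℝ) ^ (-(1/2 : ℝ) + ε) < r →
          ∫⁻ x in Metric.ball x₀ r, Ψ x ≤ ENNReal.ofReal (C * r ^ 2) := by
  set A : ℝ := 4 ^ p * p.factorial with hA
  set B : ℝ := 2 * Real.exp (2 * Real.pi * R) ^ 2 with hB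
  set K : ℝ := 24 + 4 * Real.exp 8 with hK
  set S : ℝ := K * ∑' k : ℕ, ((k : ℝ) + 1) ^ p * Real.exp (-k) with hS
  set m : ℕ := (⌊2 * R⌋₊ + 2) * 2 with hm
  have hA0 : 0 ≤ A := by positivity
  have hB0 : 0 ≤ B := by positivity
  have hK0 : 0 ≤ K := by positivity
  have hS0 : 0 ≤ S := mul_nonneg hK0 (tsum_nonneg fun k => by positivity)
  refine ⟨Real.exp Real.pi * (A * (1 + B + S) + (m : ℝ) ^ p * K), by positivity, ?_⟩
  intro lam hstr a f hf hflat v hv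
  have hlam : 0 < lam := hstr.1.1
  have hNpos := card_latticePts_pos hstr.1
  set N := (latticePts lam).card with hN
  have hN1 : (1 : ℝ) ≤ N := by exact_mod_cast hNpos
  set T : ℝ := (N : ℝ) ^ p with hT
  have hT1 : 1 ≤ T := one_le_pow₀ hN1
  set h := R / Real.sqrt lam with hh
  set J : E2 → ℝ≥0∞ := fun c => ∫⁻ θ, ‖lineExt lam a h v c (circleMap 0 1 θ)‖ₑ ^ 2 ∂angleMeasure with hJ
  set L : E2 → ℝ≥0∞ := fun c => ENNReal.ofReal (max 0 (-Real.log |f c|) ^ p) with hL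
  have hfm : Measurable f := hf.continuous.measurable
  have hcont := continuous_lineExt_circleMap lam a h v
  have hjm : Measurable fun q : E2 × ℝ => ‖lineExt lam a h v q.1 (circleMap 0 1 q.2)‖ₑ ^ 2 :=
    hcont.measurable.enorm.pow_const 2
  have hJm : Measurable J := hjm.lintegral_prod_right
  have hLm : Measurable L :=
    ((measurable_const.max (Real.measurable_log.comp hfm.abs).neg).pow_const p).ennreal_ofReal
  set E : Set E2 := {c | 1 / T ≤ |f c|} with hE
  have hEm : MeasurableSet E := measurableSet_le measurable_const hfm.abs
  set Ψ : E2 → ℝ≥0∞ := fun c => E.indicator (fun c => ENNReal.ofReal A * (1 + J c + L c)) c +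
    Eᶜ.indicator (fun _ => ((m * N : ℕ) : ℝ≥0∞) ^ p) c with hΨ
  refine ⟨Ψ, ?_, ?_, ?_⟩
  · exact ((((measurable_const.add hJm).add hLm).const_mul _).indicator hEm).add
      (measurable_const.indicator hEm.compl)
  · intro c hc z hz
    by_cases hcE : c ∈ E
    · simp only [hΨ]
      rw [Set.indicator_of_mem hcE, Set.indicator_of_notMem (by simpa using hcE), add_zero]
      exact card_line_zeros_pow_le hf h v hc z hz hp
    · simp only [hΨ]
      rw [Set.indicator_of_notMem hcE, Set.indicator_of_mem (by simpa using hcE), zero_add]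
      have := card_line_zeros_le hlam hf hR hv hc z hz
      gcongr
      rw [hm, mul_assoc]
      exact this
  · intro x₀ r hr0 hr
    have := isProbabilityMeasure_gaussAt x₀ hr0
    set μ := gaussAt x₀ r with hμ
    have hJi : ∫⁻ c, J c ∂μ ≤ ENNReal.ofReal B := by
      rw [hJ, lintegral_lintegral_swap hjm.aemeasurable]
      have h1 : ∀ θ : ℝ, ∫⁻ c, ‖lineExt lam a h v c (circleMap 0 1 θ)‖ₑ ^ 2 ∂μ ≤ ENNReal.ofReal B := by
        intro θ
        refine lintegral_enorm_sq_sum_chrE_le hp hstr hf x₀ hr0 hr (Real.exp_pos _).le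
          (b := fun ξ => a ξ * cexp (2 * Real.pi * I * circleMap 0 1 θ * (h * dirFreq v ξ : ℝ))) ?_
        intro ξ hξ
        rw [norm_mul, mul_comm]
        gcongr
        exact norm_cexp_dirFreq_le hlam hR hv hξ (by simp)
      refine (lintegral_mono h1).trans ?_
      rw [lintegral_const, measure_univ, mul_one]
    have hanti : ∀ τ : ℝ, 1 ≤ τ → τ ≤ T → μ.real {x | |f x| ≤ 1 / τ} ≤ K / τ := fun τ h1 h2 =>
      measureReal_abs_le_inv_le_div hstr hf hflat x₀ hr0 hr h1 h2
    have hLi : ∫⁻ c in E, L c ∂μ ≤ ENNReal.ofReal S :=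
      lintegral_log_pow_le μ hfm (by linarith) hK0 hanti hp
    have hm1 : Measurable fun c => 1 + J c + L c := (measurable_const.add hJm).add hLm
    have h1 : ∫⁻ c in E, ENNReal.ofReal A * (1 + J c + L c) ∂μ ≤ ENNReal.ofReal (A * (1 + B + S)) := by
      rw [lintegral_const_mul _ hm1,
        lintegral_add_right _ hLm, lintegral_add_right _ hJm, lintegral_const, one_mul,
        ENNReal.ofReal_mul hA0, ENNReal.ofReal_add (by positivity) hS0,
        ENNReal.ofReal_add zero_le_one hB0, ENNReal.ofReal_one]
      gcongr
      · rw [Measure.restrict_apply_univ]; exact prob_le_one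
      · exact (setLIntegral_le_lintegral _ _).trans hJi
    have h2 : ((m * N : ℕ) : ℝ≥0∞) ^ p * μ Eᶜ ≤ ENNReal.ofReal ((m : ℝ) ^ p * K) := by
      have h3 : μ Eᶜ ≤ ENNReal.ofReal (K / T) := by
        have hsub : Eᶜ ⊆ {x | |f x| ≤ 1 / T} := by
          intro x hx
          simp only [hE, Set.mem_compl_iff, Set.mem_ofPred_eq, not_le] at hx
          exact hx.le
        calc μ Eᶜ ≤ μ {x | |f x| ≤ 1 / T} := measure_mono hsub
          _ = ENNReal.ofReal (μ.real {x | |f x| ≤ 1 / T}) := by rw [ofReal_measureReal]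
          _ ≤ _ := ENNReal.ofReal_le_ofReal (hanti T hT1 le_rfl)
      have h4 : ((m * N : ℕ) : ℝ≥0∞) ^ p = ENNReal.ofReal (((m * N : ℕ) : ℝ) ^ p) := by
        rw [ENNReal.ofReal_pow (by positivity), ENNReal.ofReal_natCast]
      rw [h4]
      refine (mul_le_mul_right h3 _).trans (le_of_eq ?_)
      rw [← ENNReal.ofReal_mul (by positivity)]
      congr 1
      rw [hT]
      push_cast
      field_simp
      ring
    have h3 : ∫⁻ c, Ψ c ∂μ ≤ ENNReal.ofReal (A * (1 + B + S) + (m : ℝ) ^ p * K) := by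
      rw [hΨ, lintegral_add_right _ (measurable_const.indicator hEm.compl), lintegral_indicator hEm,
        lintegral_indicator_const hEm.compl, ENNReal.ofReal_add (by positivity) (by positivity)]
      exact add_le_add h1 h2
    calc _ ≤ ENNReal.ofReal (Real.exp Real.pi * r ^ 2) * ∫⁻ x, Ψ x ∂μ := setLIntegral_ball_le x₀ hr0 Ψ
      _ ≤ ENNReal.ofReal (Real.exp Real.pi * r ^ 2) *
          ENNReal.ofReal (A * (1 + B + S) + (m : ℝ) ^ p * K) := by gcongr
      _ = _ := by
        rw [← ENNReal.ofReal_mul (by positivity)]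
        congr 1
        ring

open scoped ContDiff in
theorem IsEigenfunction.contDiff {lam : ℕ} {a : ℤ × ℤ → ℂ} {f : E2 → ℝ}
    (h : IsEigenfunction lam a f) : ContDiff ℝ ω f := by
  have e : f = fun x => Complex.reCLM (∑ ξ ∈ latticePts lam, a ξ * chrE ξ x) := by
    ext x
    rw [← h.eq_sum, Complex.reCLM_apply, Complex.ofReal_re]
  rw [e]
  refine Complex.reCLM.contDiff.comp (ContDiff.sum fun ξ _ => contDiff_const.mul ?_)
  unfold chrE chr
  refine ContDiff.cexp (contDiff_const.mul (Complex.ofRealCLM.contDiff.comp ?_))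
  change ContDiff ℝ ω fun x : E2 => (ξ.1 : ℝ) * x 0 + ξ.2 * x 1
  fun_prop

theorem IsEigenfunction.exists_ne_zero {lam : ℕ} {a : ℤ × ℤ → ℂ} {f : E2 → ℝ}
    (h : IsEigenfunction lam a f) : ∃ x, f x ≠ 0 := by
  by_contra! H
  have h1 := integral_norm_trig_sq (latticePts lam) a
  rw [h.2.2.1] at h1
  have h2 : ∀ w, trig (latticePts lam) a w = 0 := by
    intro w
    have := h.eq_sum (pt w.1 w.2)
    rw [H, Complex.ofReal_zero] at this
    rw [trig, this]
    rfl
  simp [h2] at h1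

/-- `A` is a Lipschitz graph over the coordinate `k`. -/
def GraphLike (k : Fin 2) (A : Set E2) : Prop :=
  ∀ y ∈ A, ∀ z ∈ A, dist y z ≤ 3 * |y k - z k|

theorem GraphLike.mono {k : Fin 2} {A B : Set E2} (h : GraphLike k B) (hAB : A ⊆ B) : GraphLike k A :=
  fun y hy z hz => h y (hAB hy) z (hAB hz)

theorem dist_le_add_coord (y z : E2) (k : Fin 2) : dist y z ≤ |y k - z k| + |y (1 - k) - z (1 - k)| := by
  rw [EuclideanSpace.dist_eq, Fin.sum_univ_two]
  apply Real.sqrt_le_iff.2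
  refine ⟨by positivity, ?_⟩
  simp only [Real.dist_eq, sq_abs]
  fin_cases k <;> simp <;>
    nlinarith [abs_nonneg (y 0 - z 0), abs_nonneg (y 1 - z 1), sq_abs (y 0 - z 0), sq_abs (y 1 - z 1),
      mul_nonneg (abs_nonneg (y 0 - z 0)) (abs_nonneg (y 1 - z 1))]

theorem exists_graphLike_nhds {g : E2 → ℝ} {L : E2 →L[ℝ] ℝ} {z : E2} (hg : HasStrictFDerivAt g L z)
    (hL : L ≠ 0) : ∃ k : Fin 2, ∃ U ∈ 𝓝 z, GraphLike k ({y | g y = 0} ∩ U) := by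
  set l : Fin 2 → ℝ := fun i => L (EuclideanSpace.single i 1) with hl
  have hLx : ∀ y k, L y = y k * l k + y (1 - k) * l (1 - k) := by
    intro y k
    have : y = y 0 • EuclideanSpace.single 0 1 + y 1 • EuclideanSpace.single 1 1 := by
      ext i; fin_cases i <;> simp
    conv_lhs => rw [this]
    fin_cases k <;> simp [hl]
    ring
  obtain ⟨k, hk, hk0⟩ : ∃ k, |l k| ≤ |l (1 - k)| ∧ 0 < |l (1 - k)| := by
    have h0 : l 0 ≠ 0 ∨ l 1 ≠ 0 := by
      by_contra! H
      apply hL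
      ext y
      rw [hLx y 0]
      simp [H.1, H.2]
    rcases le_total |l 0| |l 1| with h | h
    · refine ⟨0, h, ?_⟩
      rcases h0 with h1 | h1
      · exact (abs_pos.2 h1).trans_le h
      · exact abs_pos.2 h1
    · refine ⟨1, h, ?_⟩
      rcases h0 with h1 | h1
      · exact abs_pos.2 h1
      · exact (abs_pos.2 h1).trans_le h
  set c := |l (1 - k)| / 3 with hc
  have h1 : ∀ᶠ q : E2 × E2 in 𝓝 (z, z), ‖g q.1 - g q.2 - L (q.1 - q.2)‖ ≤ c * ‖q.1 - q.2‖ :=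
    hg.isLittleO.def (by positivity)
  rw [nhds_prod_eq] at h1
  obtain ⟨U, hU, hUq⟩ := Filter.mem_prod_same_iff.1 h1
  refine ⟨k, U, hU, ?_⟩
  rintro y ⟨hy0, hyU⟩ w ⟨hw0, hwU⟩
  have h2 : ‖g y - g w - L (y - w)‖ ≤ c * ‖y - w‖ := hUq (Set.mk_mem_prod hyU hwU)
  simp only [Set.mem_ofPred_eq] at hy0 hw0
  rw [hy0, hw0, sub_self, zero_sub, norm_neg, Real.norm_eq_abs, hLx _ k, ← dist_eq_norm] at h2
  have h3 := dist_le_add_coord y w k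
  have h4 : |(y - w) (1 - k) * l (1 - k)| - |(y - w) k * l k| ≤
      |(y - w) k * l k + (y - w) (1 - k) * l (1 - k)| := by
    have := abs_sub_abs_le_abs_add ((y - w) (1 - k) * l (1 - k)) ((y - w) k * l k)
    rwa [add_comm] at this
  rw [abs_mul, abs_mul] at h4
  simp only [PiLp.sub_apply] at h4 h2
  set p := |y k - w k|
  set q := |y (1 - k) - w (1 - k)|
  have h5 : p * |l k| ≤ p * |l (1 - k)| := by gcongr
  have h6 : q * (3 * c) - p * (3 * c) ≤ c * (p + q) := by
    have : |l (1 - k)| = 3 * c := by rw [hc]; ring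
    rw [this] at h4 h5
    have : c * dist y w ≤ c * (p + q) := by gcongr
    linarith
  have hc0 : 0 < c := by positivity
  have h7 : q ≤ 2 * p := by nlinarith
  linarith

open scoped ContDiff in
theorem exists_graphLike_cover {F : E2 → ℝ} (hF : ContDiff ℝ ω F) (hne : ∃ x, F x ≠ 0) :
    ∃ (A : ℕ → Set E2) (k : ℕ → Fin 2), (∀ n, MeasurableSet (A n)) ∧ Pairwise (Function.onFun Disjoint A) ∧
      (∀ n, GraphLike (k n) (A n)) ∧ ⋃ n, A n = {x | F x = 0} := by
  classical
  let b := EuclideanSpace.basisFun (Fin 2) ℝ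
  let G : (Σ n : ℕ, Fin n → Fin 2) → E2 → ℝ := fun β x => iteratedFDeriv ℝ β.1 F x (fun i => b (β.2 i))
  have hG : ∀ β, ContDiff ℝ ω (G β) := by
    intro β
    have h1 : ContDiff ℝ ω (iteratedFDeriv ℝ β.1 F) := hF.iteratedFDeriv_right (by simp)
    exact (ContinuousMultilinearMap.apply ℝ _ _ _).contDiff.comp h1
  have hz : ∀ z, F z = 0 → ∃ β, G β z = 0 ∧ fderiv ℝ (G β) z ≠ 0 := by
    intro z hz
    have h1 : ∃ n, iteratedFDeriv ℝ n F z ≠ 0 := by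
      by_contra! H
      obtain ⟨x, hx⟩ := hne
      have han : AnalyticOnNhd ℝ F Set.univ := hF.analyticOnNhd
      obtain ⟨P, ρ, hP⟩ := han z (Set.mem_univ z)
      apply hx
      have h2 : F =ᶠ[𝓝 z] 0 := by
        filter_upwards [Metric.eball_mem_nhds z hP.r_pos] with y hy
        have h3 := hP.hasSum_sub hy
        have h4 : ∀ n, P n (fun _ => y - z) = 0 := by
          intro n
          have h5 := hP.factorial_smul (y - z) n
          rw [H n] at h5
          simpa [Nat.factorial_ne_zero] using h5
        simp only [h4] at h3
        exact h3.unique hasSum_zero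
      exact congrFun (han.eq_of_eventuallyEq (fun _ _ => analyticAt_const) h2) x
    obtain ⟨n, hn⟩ : ∃ n, n = Nat.find h1 := ⟨_, rfl⟩
    have hn0 : iteratedFDeriv ℝ n F z ≠ 0 := hn ▸ Nat.find_spec h1
    rcases n with _ | n
    · exact absurd (by ext; simp [hz]) hn0
    have hlt : iteratedFDeriv ℝ n F z = 0 := by
      have := Nat.find_min h1 (m := n) (by omega)
      push Not at this
      exact this
    have h2 : ∃ v : Fin (n + 1) → Fin 2, iteratedFDeriv ℝ (n + 1) F z (fun i => b (v i)) ≠ 0 := by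
      by_contra! H
      apply hn0
      apply ContinuousMultilinearMap.toMultilinearMap_injective
      refine Module.Basis.ext_multilinear (fun _ => b.toBasis) fun v => ?_
      simpa using H v
    obtain ⟨v, hv⟩ := h2
    refine ⟨⟨n, fun i => v i.succ⟩, by simp [G, hlt], ?_⟩
    intro h3
    apply hv
    rw [iteratedFDeriv_succ_apply_left]
    have h4 : DifferentiableAt ℝ (iteratedFDeriv ℝ n F) z :=
      ((hF.iteratedFDeriv_right (m := ω) (by simp)).differentiable (by simp)) z
    have h5 := ((ContinuousMultilinearMap.apply ℝ (fun _ : Fin n => E2) ℝ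
      (fun i => b (v i.succ))).hasFDerivAt.comp z h4.hasFDerivAt).fderiv
    have h6 := congrArg (fun M : E2 →L[ℝ] ℝ => M (b (v 0))) (h5.symm.trans h3)
    change fderiv ℝ (iteratedFDeriv ℝ n F) z (b (v 0)) (fun i => b (v i.succ)) = 0
    simpa using h6
  let ι := (Σ n : ℕ, Fin n → Fin 2) × Fin 2 × TopologicalSpace.countableBasis E2
  let A₀ : ι → Set E2 := fun i =>
    if GraphLike i.2.1 ({y | G i.1 y = 0} ∩ i.2.2) then {y | F y = 0} ∩ ({y | G i.1 y = 0} ∩ i.2.2) else ∅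
  have hFm : MeasurableSet {y | F y = 0} := (isClosed_eq hF.continuous continuous_const).measurableSet
  have hA₀m : ∀ i, MeasurableSet (A₀ i) := by
    intro i
    simp only [A₀]
    split_ifs
    · exact hFm.inter ((isClosed_eq (hG i.1).continuous continuous_const).measurableSet.inter
        (TopologicalSpace.isOpen_of_mem_countableBasis i.2.2.2).measurableSet)
    · exact MeasurableSet.empty
  have hA₀g : ∀ i, GraphLike i.2.1 (A₀ i) := by
    intro i
    simp only [A₀]
    split_ifs with h
    · exact h.mono Set.inter_subset_right
    · exact fun y hy => absurd hy (by simp)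
  have hA₀u : ⋃ i, A₀ i = {y | F y = 0} := by
    apply Set.Subset.antisymm
    · refine Set.iUnion_subset fun i => ?_
      simp only [A₀]
      split_ifs
      · exact Set.inter_subset_left
      · exact Set.empty_subset _
    · intro z h
      obtain ⟨β, h1, h2⟩ := hz z h
      obtain ⟨k, U, hU, hk⟩ := exists_graphLike_nhds
        ((hG β).contDiffAt.hasStrictFDerivAt (x := z) (by simp)) h2
      obtain ⟨B, hB, hzB, hBU⟩ := (TopologicalSpace.isBasis_countableBasis E2).mem_nhds_iff.1 hU
      refine Set.mem_iUnion.2 ⟨(β, k, ⟨B, hB⟩), ?_⟩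
      have h3 : GraphLike k ({y | G β y = 0} ∩ B) := hk.mono (by gcongr)
      simp only [A₀, h3, if_true]
      exact ⟨h, h1, hzB⟩
  obtain ⟨B₀, hB₀, -⟩ := (TopologicalSpace.isBasis_countableBasis E2).exists_subset_of_mem_open
    (Set.mem_univ 0) isOpen_univ
  have : Nonempty ι := ⟨(⟨0, Fin.elim0⟩, 0, ⟨B₀, hB₀⟩)⟩
  obtain ⟨e, he⟩ := exists_surjective_nat ι
  refine ⟨disjointed (A₀ ∘ e), fun n => (e n).2.1, fun n => ?_, disjoint_disjointed _, fun n => ?_, ?_⟩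
  · exact MeasurableSet.disjointed (fun n => hA₀m (e n)) n
  · exact (hA₀g (e n)).mono (disjointed_subset _ n)
  · rw [iUnion_disjointed, ← hA₀u]
    exact he.iUnion_comp A₀

theorem GraphLike.injOn {k : Fin 2} {A : Set E2} (h : GraphLike k A) : Set.InjOn (fun y : E2 => y k) A := by
  intro y hy z hz hyz
  have := h y hy z hz
  simp only at hyz
  rw [hyz, sub_self, abs_zero, mul_zero] at this
  exact dist_le_zero.1 this

theorem measurable_coord (k : Fin 2) : Measurable fun y : E2 => y k :=
  (show Continuous fun y : E2 => y k by fun_prop).measurable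

theorem GraphLike.measurableSet_image {k : Fin 2} {A : Set E2} (h : GraphLike k A) (hA : MeasurableSet A) :
    MeasurableSet ((fun y : E2 => y k) '' A) :=
  hA.image_of_continuousOn_injOn (show Continuous fun y : E2 => y k by fun_prop).continuousOn h.injOn

theorem GraphLike.hausdorffMeasure_le {k : Fin 2} {A : Set E2} (h : GraphLike k A) :
    μH[1] A ≤ 3 * volume ((fun y : E2 => y k) '' A) := by
  set π : E2 → ℝ := fun y => y k
  have h1 : LipschitzOnWith 3 (Function.invFunOn π A) (π '' A) := by
    refine LipschitzOnWith.of_dist_le_mul ?_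
    rintro _ ⟨y, hy, rfl⟩ _ ⟨z, hz, rfl⟩
    rw [h.injOn.leftInvOn_invFunOn hy, h.injOn.leftInvOn_invFunOn hz]
    exact h y hy z hz
  have h2 := h1.hausdorffMeasure_image_le (d := 1) zero_le_one
  rw [h.injOn.leftInvOn_invFunOn.image_image, hausdorffMeasure_real] at h2
  simpa using h2

theorem GraphLike.volume_eq_zero {k : Fin 2} {A : Set E2} (h : GraphLike k A) (hA : MeasurableSet A) :
    volume A = 0 := by
  have key : ∀ᵐ y : E2, y ∈ Aᶜ := by
    refine ae_mem_of_ae_add_linearMap_mem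
      (LinearMap.toSpanSingleton ℝ E2 (EuclideanSpace.single (1 - k) (1 : ℝ))) volume volume hA.compl ?_
    intro y
    have h1 : {t : ℝ | y + t • EuclideanSpace.single (1 - k) (1 : ℝ) ∈ A}.Subsingleton := by
      intro t ht u hu
      have := h.injOn ht hu (by fin_cases k <;> simp)
      have := congrArg (fun z : E2 => z (1 - k)) this
      simpa using this
    have := h1.measure_zero volume
    rw [ae_iff]
    simpa using this
  rw [ae_iff] at key
  simpa using key

open scoped ContDiff in
theorem volume_zeros_eq_zero {F : E2 → ℝ} (hF : ContDiff ℝ ω F) (hne : ∃ x, F x ≠ 0) :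
    volume {x | F x = 0} = 0 := by
  obtain ⟨A, k, hm, -, hg, hA⟩ := exists_graphLike_cover hF hne
  rw [← hA]
  exact measure_iUnion_null fun n => (hg n).volume_eq_zero (hm n)

theorem tsum_volume_image_le {k : Fin 2} {A : ℕ → Set E2} (hm : ∀ n, MeasurableSet (A n))
    (hd : Pairwise (Function.onFun Disjoint A)) (hg : ∀ n, GraphLike k (A n)) {I : Set ℝ}
    (hAI : ∀ n, ∀ y ∈ A n, y k ∈ I) {M : ℝ → ℝ≥0∞}
    (hM : ∀ᵐ s : ℝ ∂volume.restrict I, ∀ w : Finset E2, (∀ y ∈ w, y ∈ ⋃ n, A n) → (∀ y ∈ w, y k = s) →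
      (w.card : ℝ≥0∞) ≤ M s) :
    ∑' n, volume ((fun y : E2 => y k) '' A n) ≤ ∫⁻ s in I, M s := by
  classical
  set B : ℕ → Set ℝ := fun n => (fun y : E2 => y k) '' A n with hB
  have hBm : ∀ n, MeasurableSet (B n) := fun n => (hg n).measurableSet_image (hm n)
  have hBI : ∀ n, B n ⊆ I := by
    rintro n _ ⟨y, hy, rfl⟩
    exact hAI n y hy
  have h1 : ∀ n, volume (B n) = ∫⁻ s in I, (B n).indicator 1 s := by
    intro n
    rw [lintegral_indicator_one (hBm n), Measure.restrict_apply (hBm n),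
      Set.inter_eq_left.2 (hBI n)]
  change ∑' n, volume (B n) ≤ _
  simp only [h1]
  rw [← lintegral_tsum fun n => (measurable_one.indicator (hBm n)).aemeasurable]
  refine lintegral_mono_ae ?_
  filter_upwards [hM] with s hs
  rw [ENNReal.tsum_eq_iSup_sum]
  refine iSup_le fun t => ?_
  have h2 : ∑ n ∈ t, (B n).indicator (1 : ℝ → ℝ≥0∞) s = ((t.filter fun n => s ∈ B n).card : ℝ≥0∞) := by
    rw [Finset.card_filter]
    push_cast
    refine Finset.sum_congr rfl fun n _ => ?_
    simp [Set.indicator_apply]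
  rw [h2]
  have h3 : ∀ n, ∃ y : E2, s ∈ B n → y ∈ A n ∧ y k = s := by
    intro n
    by_cases h : s ∈ B n
    · obtain ⟨y, hy⟩ := h
      exact ⟨y, fun _ => hy⟩
    · exact ⟨0, fun h' => absurd h' h⟩
  choose y hy using h3
  have h4 : ((t.filter fun n => s ∈ B n).image y).card = (t.filter fun n => s ∈ B n).card := by
    apply Finset.card_image_of_injOn
    intro n hn m hm' hnm
    simp only [Finset.coe_filter, Set.mem_ofPred_eq] at hn hm'
    by_contra hne
    exact Set.disjoint_left.1 (hd hne) (hy n hn.2).1 (hnm ▸ (hy m hm'.2).1)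
  rw [← h4]
  apply hs
  · intro z hz
    obtain ⟨n, hn, rfl⟩ := Finset.mem_image.1 hz
    exact Set.mem_iUnion.2 ⟨n, (hy n (Finset.mem_filter.1 hn).2).1⟩
  · intro z hz
    obtain ⟨n, hn, rfl⟩ := Finset.mem_image.1 hz
    exact (hy n (Finset.mem_filter.1 hn).2).2

theorem measurableSet_Qdom : MeasurableSet Qdom :=
  ((measurable_coord 0) measurableSet_Icc).inter ((measurable_coord 1) measurableSet_Icc)

theorem mem_Icc_of_mem_Qdom {y : E2} (hy : y ∈ Qdom) (k : Fin 2) : y k ∈ Set.Icc (-(1 / 2) : ℝ) (1 / 2) := by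
  fin_cases k
  · exact hy.1
  · exact hy.2

open scoped ContDiff in
theorem hausdorffMeasure_zeros_le {F : E2 → ℝ} (hF : ContDiff ℝ ω F) (hne : ∃ x, F x ≠ 0)
    {M : Fin 2 → ℝ → ℝ≥0∞}
    (hM : ∀ k, ∀ᵐ s : ℝ ∂volume.restrict (Set.Icc (-(1 / 2) : ℝ) (1 / 2)), ∀ w : Finset E2,
      (∀ y ∈ w, y ∈ Qdom ∧ F y = 0) → (∀ y ∈ w, y k = s) → (w.card : ℝ≥0∞) ≤ M k s) :
    μH[1] {y | y ∈ Qdom ∧ F y = 0} ≤ 3 * ∑ k, ∫⁻ s in Set.Icc (-(1 / 2) : ℝ) (1 / 2), M k s := by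
  obtain ⟨A, κ, hm, hd, hg, hA⟩ := exists_graphLike_cover hF hne
  let B : Fin 2 → ℕ → Set E2 := fun k n => if κ n = k then A n ∩ Qdom else ∅
  have hBm : ∀ k n, MeasurableSet (B k n) := by
    intro k n
    simp only [B]
    split_ifs
    · exact (hm n).inter measurableSet_Qdom
    · exact MeasurableSet.empty
  have hBA : ∀ k n, B k n ⊆ A n ∩ Qdom := by
    intro k n
    simp only [B]
    split_ifs
    · exact subset_rfl
    · exact Set.empty_subset _
  have hBg : ∀ k n, GraphLike k (B k n) := by
    intro k n
    by_cases h : κ n = k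
    · exact h ▸ (hg n).mono ((hBA _ n).trans Set.inter_subset_left)
    · simp only [B, h, if_false]
      exact fun y hy => absurd hy (by simp)
  have hcov : {y | y ∈ Qdom ∧ F y = 0} ⊆ ⋃ n, ⋃ k, B k n := by
    rintro y ⟨hyQ, hy⟩
    have : y ∈ ⋃ n, A n := hA ▸ hy
    obtain ⟨n, hn⟩ := Set.mem_iUnion.1 this
    refine Set.mem_iUnion.2 ⟨n, Set.mem_iUnion.2 ⟨κ n, ?_⟩⟩
    simp only [B, if_true]
    exact ⟨hn, hyQ⟩
  calc μH[1] {y | y ∈ Qdom ∧ F y = 0} ≤ ∑' n, ∑ k, μH[1] (B k n) :=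
        (measure_mono hcov).trans ((measure_iUnion_le _).trans
          (ENNReal.tsum_le_tsum fun n => measure_iUnion_fintype_le _ _))
    _ ≤ ∑' n, ∑ k, 3 * volume ((fun y : E2 => y k) '' B k n) :=
        ENNReal.tsum_le_tsum fun n => Finset.sum_le_sum fun k _ => (hBg k n).hausdorffMeasure_le
    _ = 3 * ∑ k, ∑' n, volume ((fun y : E2 => y k) '' B k n) := by
        simp only [← Finset.mul_sum]
        rw [ENNReal.tsum_mul_left, Summable.tsum_finsetSum fun _ _ => ENNReal.summable]
    _ ≤ _ := by
        gcongr with k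
        refine tsum_volume_image_le (hBm k) (fun n m hnm => (hd hnm).mono
          ((hBA k n).trans Set.inter_subset_left) ((hBA k m).trans Set.inter_subset_left)) (hBg k)
          (fun n y hy => mem_Icc_of_mem_Qdom (hBA k n hy).2 k) ?_
        filter_upwards [hM k] with s hs w hw hws
        refine hs w (fun y hy => ?_) hws
        obtain ⟨n, hn⟩ := Set.mem_iUnion.1 (hw y hy)
        have h1 := hBA k n hn
        have : y ∈ ⋃ n, A n := Set.mem_iUnion.2 ⟨n, h1.1⟩
        exact ⟨h1.2, by rw [hA] at this; exact this⟩

open scoped ContDiff in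
theorem LF_le {lam : ℕ} {R : ℝ} (hh : 0 < R / Real.sqrt lam) {f : E2 → ℝ} (hf : ContDiff ℝ ω f)
    (hne : ∃ x, f x ≠ 0) {p : ℕ} (hp : 1 ≤ p) {Ψ : Fin 2 → E2 → ℝ≥0∞}
    (hΨ : ∀ k c, f c ≠ 0 → ∀ z : Finset ℝ, (∀ u ∈ z, |u| ≤ 1 / 2 ∧
      f (c + (R / Real.sqrt lam * u) • EuclideanSpace.single (1 - k) (1 : ℝ)) = 0) →
        (z.card : ℝ≥0∞) ^ p ≤ Ψ k c) {x : E2}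
    (hx : ∀ k, ∀ᵐ s : ℝ ∂volume.restrict (Set.Icc (-(1 / 2) : ℝ) (1 / 2)),
      f (x + (R / Real.sqrt lam * s) • EuclideanSpace.single k (1 : ℝ)) ≠ 0) :
    LF lam R f x ≤ 3 * ∑ k, ∫⁻ s in Set.Icc (-(1 / 2) : ℝ) (1 / 2),
      Ψ k (x + (R / Real.sqrt lam * s) • EuclideanSpace.single k (1 : ℝ)) ^ ((p : ℝ)⁻¹) := by
  classical
  set h := R / Real.sqrt lam with hhd
  have hF : ContDiff ℝ ω fun y : E2 => f (x + h • y) := hf.comp (by fun_prop)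
  refine hausdorffMeasure_zeros_le hF ?_ fun k => ?_
  · obtain ⟨w, hw⟩ := hne
    refine ⟨h⁻¹ • (w - x), ?_⟩
    rwa [smul_inv_smul₀ hh.ne', add_sub_cancel]
  · filter_upwards [hx k] with s hs w hw hws
    have hinj : Set.InjOn (fun y : E2 => y (1 - k)) w := by
      intro y hy z hz hyz
      have h1 := hws y hy
      have h2 := hws z hz
      have h3 := dist_le_add_coord y z k
      simp only at hyz
      rw [h1, h2, hyz, sub_self, sub_self, abs_zero, add_zero] at h3
      exact dist_le_zero.1 h3
    have h1 := hΨ k _ hs (w.image fun y : E2 => y (1 - k)) ?_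
    · rw [Finset.card_image_of_injOn hinj] at h1
      rw [← ENNReal.rpow_natCast] at h1
      rwa [← ENNReal.rpow_inv_le_iff (by positivity), inv_inv]
    · intro u hu
      obtain ⟨y, hy, rfl⟩ := Finset.mem_image.1 hu
      refine ⟨abs_le.2 (mem_Icc_of_mem_Qdom (hw y hy).1 _), ?_⟩
      rw [← (hw y hy).2, ← hws y hy]
      congr 1
      ext i
      fin_cases k <;> fin_cases i <;> simp

theorem ae_ae_ne_zero {f : E2 → ℝ} (hf : Continuous f) (h0 : volume {x | f x = 0} = 0) (h : ℝ) (v : E2)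
    (I : Set ℝ) : ∀ᵐ x : E2, ∀ᵐ s : ℝ ∂volume.restrict I, f (x + (h * s) • v) ≠ 0 := by
  have hm : MeasurableSet {q : E2 × ℝ | f (q.1 + (h * q.2) • v) ≠ 0} :=
    (isOpen_ne_fun (by fun_prop) continuous_const).measurableSet
  rw [Measure.ae_ae_comm hm]
  refine Eventually.of_forall fun s => ?_
  rw [ae_iff]
  simp only [ne_eq, not_not]
  have := measure_preimage_add_right (volume : Measure E2) ((h * s) • v) {x | f x = 0}
  rw [h0] at this
  exact this

theorem setLIntegral_shift_le {Ψ : E2 → ℝ≥0∞} (hΨ : Measurable Ψ) {K : ℝ≥0∞} {r : ℝ}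
    (hK : ∀ x₀, ∫⁻ x in Metric.ball x₀ r, Ψ x ≤ K) (x₀ : E2) (h : ℝ) (v : E2) :
    ∫⁻ x in Metric.ball x₀ r, ∫⁻ s in Set.Icc (-(1 / 2) : ℝ) (1 / 2), Ψ (x + (h * s) • v) ≤ K := by
  have hm : Measurable fun q : E2 × ℝ => Ψ (q.1 + (h * q.2) • v) :=
    hΨ.comp (show Continuous fun q : E2 × ℝ => q.1 + (h * q.2) • v by fun_prop).measurable
  rw [lintegral_lintegral_swap hm.aemeasurable]
  have h1 : ∀ s : ℝ, ∫⁻ x in Metric.ball x₀ r, Ψ (x + (h * s) • v) ≤ K := by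
    intro s
    refine le_trans (le_of_eq ?_) (hK (x₀ + (h * s) • v))
    rw [← (measurePreserving_add_right (volume : Measure E2)
      ((h * s) • v)).setLIntegral_comp_preimage measurableSet_ball hΨ]
    congr 2
    ext y
    simp
  refine (lintegral_mono h1).trans ?_
  rw [lintegral_const]
  simp
  norm_num

theorem sum_pow_le_two_pow (a : Fin 2 → ℝ≥0∞) (p : ℕ) : (∑ k, a k) ^ p ≤ 2 ^ p * ∑ k, a k ^ p := by
  rw [Fin.sum_univ_two, Fin.sum_univ_two]
  rcases le_total (a 0) (a 1) with h | h
  · calc (a 0 + a 1) ^ p ≤ (2 * a 1) ^ p := by gcongr; rw [two_mul]; gcongr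
      _ = 2 ^ p * a 1 ^ p := mul_pow _ _ _
      _ ≤ _ := by gcongr; exact le_add_self
  · calc (a 0 + a 1) ^ p ≤ (2 * a 0) ^ p := by gcongr; rw [two_mul]; gcongr
      _ = 2 ^ p * a 0 ^ p := mul_pow _ _ _
      _ ≤ _ := by gcongr; exact le_self_add

open scoped ContDiff in
theorem setLIntegral_LF_pow_le {lam : ℕ} {R : ℝ} (hh : 0 < R / Real.sqrt lam) {f : E2 → ℝ}
    (hf : ContDiff ℝ ω f) (hne : ∃ x, f x ≠ 0) {p : ℕ} (hp : 1 ≤ p) {Ψ : Fin 2 → E2 → ℝ≥0∞}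
    (hΨm : ∀ k, Measurable (Ψ k))
    (hΨ : ∀ k c, f c ≠ 0 → ∀ z : Finset ℝ, (∀ u ∈ z, |u| ≤ 1 / 2 ∧
      f (c + (R / Real.sqrt lam * u) • EuclideanSpace.single (1 - k) (1 : ℝ)) = 0) →
        (z.card : ℝ≥0∞) ^ p ≤ Ψ k c) {K : Fin 2 → ℝ≥0∞} {r : ℝ}
    (hK : ∀ k x₀, ∫⁻ x in Metric.ball x₀ r, Ψ k x ≤ K k) (x₀ : E2) :
    ∫⁻ x in Metric.ball x₀ r, LF lam R f x ^ p ≤ 6 ^ p * ∑ k, K k := by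
  set h := R / Real.sqrt lam with hhd
  set I := Set.Icc (-(1 / 2) : ℝ) (1 / 2) with hI
  have hprob : IsProbabilityMeasure (volume.restrict I) := ⟨by simp [hI]; norm_num⟩
  have hae : ∀ᵐ x : E2, ∀ k, ∀ᵐ s : ℝ ∂volume.restrict I,
      f (x + (h * s) • EuclideanSpace.single k (1 : ℝ)) ≠ 0 :=
    ae_all_iff.2 fun k => ae_ae_ne_zero hf.continuous (volume_zeros_eq_zero hf hne) h _ I
  have hm : ∀ k, Measurable fun q : E2 × ℝ => Ψ k (q.1 + (h * q.2) • EuclideanSpace.single k (1 : ℝ)) :=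
    fun k => (hΨm k).comp (show Continuous fun q : E2 × ℝ =>
      q.1 + (h * q.2) • EuclideanSpace.single k (1 : ℝ) by fun_prop).measurable
  have hpt : ∀ᵐ x : E2, LF lam R f x ^ p ≤
      6 ^ p * ∑ k, ∫⁻ s in I, Ψ k (x + (h * s) • EuclideanSpace.single k (1 : ℝ)) := by
    filter_upwards [hae] with x hx
    calc LF lam R f x ^ p ≤ (3 * ∑ k, ∫⁻ s in I,
          Ψ k (x + (h * s) • EuclideanSpace.single k (1 : ℝ)) ^ ((p : ℝ)⁻¹)) ^ p := by
          gcongr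
          exact LF_le hh hf hne hp hΨ hx
      _ ≤ 3 ^ p * (2 ^ p * ∑ k, (∫⁻ s in I,
          Ψ k (x + (h * s) • EuclideanSpace.single k (1 : ℝ)) ^ ((p : ℝ)⁻¹)) ^ p) := by
          rw [mul_pow]
          gcongr
          exact sum_pow_le_two_pow _ p
      _ = 6 ^ p * ∑ k, (∫⁻ s in I,
          Ψ k (x + (h * s) • EuclideanSpace.single k (1 : ℝ)) ^ ((p : ℝ)⁻¹)) ^ p := by
          rw [← mul_assoc, ← mul_pow]
          norm_num
      _ ≤ _ := by
          gcongr with k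
          have hms : Measurable fun s : ℝ => Ψ k (x + (h * s) • EuclideanSpace.single k (1 : ℝ)) :=
            (hm k).comp measurable_prodMk_left
          refine (lintegral_pow_le_of_isProbabilityMeasure (volume.restrict I)
            (hms.pow_const _).aemeasurable hp).trans (le_of_eq ?_)
          refine lintegral_congr fun s => ?_
          rw [← ENNReal.rpow_natCast, ← ENNReal.rpow_mul,
            inv_mul_cancel₀ (by positivity), ENNReal.rpow_one]
  refine (lintegral_mono_ae (ae_restrict_of_ae hpt)).trans ?_
  have hm' : ∀ k, Measurable fun x : E2 =>
      ∫⁻ s in I, Ψ k (x + (h * s) • EuclideanSpace.single k (1 : ℝ)) :=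
    fun k => (hm k).lintegral_prod_right
  rw [lintegral_const_mul _ (Finset.measurable_sum _ fun k _ => hm' k),
    lintegral_finsetSum _ fun k _ => hm' k]
  gcongr with k
  exact setLIntegral_shift_le (hΨm k) (hK k) x₀ h _

/-- Lemma: integrability of the nodal length at small scales: all
moments of `L(F_x)` averaged over any ball of radius above Planck scale are bounded,
uniformly along a density one subsequence. -/
theorem nodal_length_moments_small_scales
    (R : ℝ) (hR : 1 < R) (ε : ℝ) (hε : 0 < ε) (p : ℕ) (hp : 1 ≤ p) :
    ∃ S' : Set ℕ, DensityOne S' ∧ ∃ C : ℝ, 0 < C ∧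
      ∀ lam ∈ S', ∀ (a : ℤ × ℤ → ℂ) (f : E2 → ℝ),
        IsEigenfunction lam a f → IsFlat lam a →
        ∀ (x₀ : E2) (r : ℝ), (lam : ℝ) ^ (-(1/2 : ℝ) + ε) < r → r ≤ 1/2 →
          ∫⁻ x in Metric.ball x₀ r, (LF lam R f x) ^ p ≤
            ENNReal.ofReal C * volume (Metric.ball x₀ r) := by
  obtain ⟨C, hC0, hC⟩ := exists_line_majorant (R := R) (by linarith) ε hp
  refine ⟨{lam | Structured ε p lam}, densityOne_structured hε p, 6 ^ p * (2 * C) + 1, by positivity, ?_⟩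
  intro lam hlam a f hf hflat x₀ r hr _
  have hlam0 : 0 < lam := hlam.1.1
  have hr0 : 0 < r := (Real.rpow_nonneg (Nat.cast_nonneg lam) _).trans_lt hr
  have hh : 0 < R / Real.sqrt lam := by
    have : (0 : ℝ) < lam := by exact_mod_cast hlam0
    have : 0 < Real.sqrt lam := Real.sqrt_pos.2 this
    positivity
  have hex : ∀ k : Fin 2, ‖(EuclideanSpace.single (1 - k) (1 : ℝ) : E2)‖ ≤ 1 := fun k => by simp
  choose Ψ hΨm hΨ hΨi using fun k => hC lam hlam a f hf hflat (EuclideanSpace.single (1 - k) (1 : ℝ)) (hex k)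
  have h1 := setLIntegral_LF_pow_le hh hf.contDiff hf.exists_ne_zero hp hΨm hΨ
    (K := fun _ => ENNReal.ofReal (C * r ^ 2)) (fun k x => hΨi k x r hr0 hr) x₀
  refine h1.trans ?_
  rw [EuclideanSpace.volume_ball_fin_two]
  have h6 : (6 : ℝ≥0∞) ^ p = ENNReal.ofReal (6 ^ p) := by
    rw [ENNReal.ofReal_pow (by norm_num)]
    norm_num
  rw [Fin.sum_univ_two, h6, ← ENNReal.ofReal_add (by positivity) (by positivity),
    ← ENNReal.ofReal_mul (by positivity), ← ENNReal.ofReal_pow hr0.le]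
  rw [← ENNReal.ofReal_mul (by positivity), ← ENNReal.ofReal_mul (by positivity)]
  apply ENNReal.ofReal_le_ofReal
  have h8 : 0 ≤ 6 ^ p * (2 * C) * r ^ 2 := by positivity
  have h9 : 0 ≤ r ^ 2 * Real.pi := by positivity
  nlinarith [Real.pi_gt_three]
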